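/- There exists a group G such that: (1) the cardinality of G is ℵ₁; (2) for every uncountable subset Y ⊆ G there exists a natural number n such that G = Y^{[n]}; (3) G is simple and every subgroup of G is cyclic or simple; (4) every subgroup K of G that is not a proper subgroup of a cyclic subgroup of G is malnormal in G; (5) G is torsion-free and every strictly descending chain of non-cyclic subgroups of G is finite. -/

import Mathlib

/-- `wordSet Y n` is the set `Y^{[n]}` of all products of length at most `n`
of elements of `Y` and their inverses. -/
def wordSet {H : Type*} [Group H] (Y : Set H) (n : ℕ) : Set H :=
  {h | ∃ m : ℕ, m ≤ n ∧ ∃ g : Fin m → H,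
    (∀ i, g i ∈ Y ∨ (g i)⁻¹ ∈ Y) ∧ h = (List.ofFn g).prod}

/-- A subgroup `K` of `G` is malnormal if `K ∩ gKg⁻¹ = {1}` for all `g ∉ K`. -/
def Malnormal {G : Type*} [Group G] (K : Subgroup G) : Prop :=
  ∀ g : G, g ∉ K → ∀ y : G, y ∈ K → g⁻¹ * y * g ∈ K → y = 1

/-- A group is strongly bounded if every action by isometries on a metric
space has bounded orbits. -/
def StronglyBounded (H : Type*) [Group H] : Prop :=
  ∀ (X : Type) (_ : MetricSpace X) (_ : MulAction H X),
    (∀ h : H, Isometry (fun x : X => h • x)) →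
    ∀ x : X, Bornology.IsBounded (MulAction.orbit H x)

/-- A group is Jónsson if every proper subgroup has strictly smaller cardinality. -/
def Jonsson (H : Type*) [Group H] : Prop :=
  ∀ K : Subgroup H, K ≠ ⊤ → Cardinal.mk K < Cardinal.mk H

namespace SteepGroup

universe u w w'

section Graph

variable {V : Type*} {Γ : SimpleGraph V}

/-- `z` lies on a geodesic from `x` to `y`. -/
def Btw (Γ : SimpleGraph V) (x z y : V) : Prop := Γ.dist x z + Γ.dist z y = Γ.dist x y

/-- Geodesic triangles are `δ`-slim. -/
def Slim (Γ : SimpleGraph V) (δ : ℕ) : Prop :=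
  ∀ x y z p, Btw Γ x p y → ∃ q, (Btw Γ x q z ∨ Btw Γ z q y) ∧ Γ.dist p q ≤ δ

/-- There is a walk of length at most `n` from `x` to `y` which avoids `v`. -/
inductive Av (Γ : SimpleGraph V) (v : V) : ℕ → V → V → Prop
  | refl (n : ℕ) (x : V) : x ≠ v → Av Γ v n x x
  | cons (n : ℕ) (x y z : V) : x ≠ v → Γ.Adj x y → Av Γ v n y z → Av Γ v (n + 1) x z

/-- Initial vertices of geodesics from `v` to `x`. -/
def Lk (Γ : SimpleGraph V) (v x : V) : Set V := {e | Γ.Adj v e ∧ Γ.dist e x + 1 = Γ.dist v x}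

/-- The angle at `v` between `x` and `y` is at most `n`. -/
def Ang (Γ : SimpleGraph V) (v : V) (n : ℕ) (x y : V) : Prop :=
  ∀ e ∈ Lk Γ v x ∪ Lk Γ v y, ∀ f ∈ Lk Γ v x ∪ Lk Γ v y, Av Γ v n e f

/-- Closeness of geodesics issuing from a common point bounds angles. -/
def angleBound (δ : ℕ) : ℕ := 60 * δ + 10

theorem _root_.SimpleGraph.Connected.triangle (hc : Γ.Connected) (x y z : V) :
    Γ.dist x z ≤ Γ.dist x y + Γ.dist y z :=
  hc.dist_triangle

theorem _root_.SimpleGraph.dist_swap (Γ : SimpleGraph V) (x y : V) : Γ.dist x y = Γ.dist y x :=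
  Γ.dist_comm

theorem _root_.SimpleGraph.Adj.dist_eq_one {x y : V} (h : Γ.Adj x y) : Γ.dist x y = 1 :=
  SimpleGraph.dist_eq_one_iff_adj.2 h

namespace Av

variable {v x y z : V} {n m : ℕ}

theorem left_ne (h : Av Γ v n x y) : x ≠ v := by
  cases h <;> assumption

theorem right_ne (h : Av Γ v n x y) : y ≠ v := by
  induction h <;> assumption

theorem mono (h : Av Γ v n x y) : ∀ {m}, n ≤ m → Av Γ v m x y := by
  induction h with
  | refl n x hx => exact fun _ => .refl _ _ hx
  | cons n x y z hx ha _ ih =>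
    intro m hm
    obtain ⟨k, rfl⟩ : ∃ k, m = k + 1 := ⟨m - 1, by omega⟩
    exact .cons _ _ _ _ hx ha (ih (by omega))

theorem trans (h : Av Γ v n x y) : ∀ {m}, Av Γ v m y z → Av Γ v (n + m) x z := by
  induction h with
  | refl n x hx => exact fun h => h.mono (by omega)
  | cons n x y z hx ha _ ih =>
    intro m h
    exact (Av.cons _ _ _ _ hx ha (ih h)).mono (by omega)

theorem symm (h : Av Γ v n x y) : Av Γ v n y x := by
  induction h with
  | refl n x hx => exact .refl _ _ hx
  | cons n x y z hx ha h ih =>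
    exact ih.trans (.cons 0 _ _ _ h.left_ne ha.symm (.refl _ _ hx))

theorem dist_le (hc : Γ.Connected) (h : Av Γ v n x y) : Γ.dist x y ≤ n := by
  induction h with
  | refl => simp
  | cons n x y z hx ha h ih =>
    have := hc.triangle x y z
    have := ha.dist_eq_one
    omega

theorem split (h : Av Γ v n x y) : ∀ i ≤ n, ∃ p, Av Γ v i x p ∧ Av Γ v (n - i) p y := by
  induction h with
  | refl n x hx => exact fun i _ => ⟨x, .refl _ _ hx, .refl _ _ hx⟩
  | cons n x y z hx ha h ih =>
    intro i hi
    rcases i with _ | i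
    · exact ⟨x, .refl _ _ hx, .cons _ _ _ _ hx ha h⟩
    · obtain ⟨p, h1, h2⟩ := ih i (by omega)
      exact ⟨p, .cons _ _ _ _ hx ha h1, by simpa using h2⟩

theorem segment (hc : Γ.Connected) (h : Av Γ v (Γ.dist x y) x y) {i j : ℕ} (hij : i ≤ j)
    (hj : j ≤ Γ.dist x y) : ∃ p q, Γ.dist x p = i ∧ Btw Γ x p y ∧ Γ.dist x q = j ∧ Btw Γ x q y ∧
      Av Γ v (j - i) p q := by
  obtain ⟨q, h1, h2⟩ := h.split j hj
  obtain ⟨p, h3, h4⟩ := h1.split i hij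
  have := h2.dist_le hc
  have := h3.dist_le hc
  have := h4.dist_le hc
  have := hc.triangle x p q
  have := hc.triangle x q y
  have := hc.triangle p q y
  have := hc.triangle x p y
  grind [Btw]

end Av

variable {v x y z : V} {n m δ : ℕ}

theorem Btw.symm (h : Btw Γ x z y) : Btw Γ y z x := by
  grind [Btw, SimpleGraph.dist_swap]

theorem btw_left : Btw Γ x x y := by simp [Btw]

theorem btw_right : Btw Γ x y y := by simp [Btw]

theorem exists_next (hc : Γ.Connected) (h : x ≠ y) : ∃ e, e ∈ Lk Γ x y := by
  obtain ⟨w, hw⟩ := hc.exists_walk_length_eq_dist x y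
  cases w with
  | nil => exact absurd rfl h
  | cons ha w =>
    rename_i e
    refine ⟨e, ha, ?_⟩
    have := hc.triangle x e y
    have := ha.dist_eq_one
    have := Γ.dist_le w
    simp at hw
    omega

theorem exists_point (hc : Γ.Connected) (x y : V) {i : ℕ} (hi : i ≤ Γ.dist x y) :
    ∃ p, Btw Γ x p y ∧ Γ.dist x p = i := by
  induction i generalizing x with
  | zero => exact ⟨x, btw_left, by simp⟩
  | succ i ih =>
    have hne : x ≠ y := by rintro rfl; simp at hi
    obtain ⟨e, he, hd⟩ := exists_next hc hne
    obtain ⟨p, hp, hpe⟩ := ih e (by omega)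
    have := he.dist_eq_one
    have := hc.triangle x e p
    have := hc.triangle x p y
    grind [Btw]

theorem btw_or_av (hc : Γ.Connected) (x v y : V) : Btw Γ x v y ∨ Av Γ v (Γ.dist x y) x y := by
  generalize hn : Γ.dist x y = n
  induction n generalizing x with
  | zero =>
    obtain rfl := hc.dist_eq_zero_iff.1 hn
    by_cases h : x = v
    · subst h; exact .inl btw_left
    · exact .inr (.refl _ _ h)
  | succ n ih =>
    by_cases h : x = v
    · subst h; exact .inl btw_left
    have hne : x ≠ y := by rintro rfl; simp at hn
    obtain ⟨e, he, hd⟩ := exists_next hc hne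
    rcases ih e (by omega) with h1 | h1
    · have := he.dist_eq_one
      have := hc.triangle x e v
      have := hc.triangle x v y
      unfold Btw at *
      omega
    · exact .inr (.cons _ _ _ _ h he h1)

theorem av_of_dist_lt (hc : Γ.Connected) (h : Γ.dist x y < Γ.dist x v) :
    Av Γ v (Γ.dist x y) x y := by
  refine (btw_or_av hc x v y).resolve_left fun hb => ?_
  unfold Btw at hb; omega

/-- Two points on geodesics with common endpoints. -/
theorem Slim.fellow (hs : Slim Γ δ) (hc : Γ.Connected) {p p' : V} (hp : Btw Γ v p x)
    (hp' : Btw Γ v p' x) {k : ℕ} (h1 : Γ.dist v p ≤ Γ.dist v p' + k)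
    (h2 : Γ.dist v p' ≤ Γ.dist v p + k) : Γ.dist p p' ≤ 2 * δ + k := by
  obtain ⟨q, hq, hd⟩ := hs v x p' p hp
  have := hc.triangle p q p'
  have := hc.triangle v q p
  have := hc.triangle x q p
  grind [SimpleGraph.dist_swap, Btw]

/-- Following a geodesic from `v` for a bounded time. -/
theorem exists_along (hc : Γ.Connected) {e : V} (he : e ∈ Lk Γ v x) (T : ℕ) (hT : 1 ≤ T) :
    ∃ p, Btw Γ v p x ∧ Γ.dist v p = min T (Γ.dist v x) ∧ Av Γ v T e p := by
  obtain ⟨ha, hd⟩ := he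
  have h1 := ha.dist_eq_one
  obtain ⟨p, hp, hpe⟩ := exists_point hc e x (i := min T (Γ.dist v x) - 1) (by omega)
  have := hc.triangle v e p
  have := hc.triangle v p x
  unfold Btw at hp
  have hvp : Γ.dist v p = min T (Γ.dist v x) := by omega
  refine ⟨p, by unfold Btw; omega, hvp, ?_⟩
  refine ((btw_or_av hc e v p).resolve_left fun hb => ?_).mono (m := T) (by omega)
  unfold Btw at hb
  omega

theorem av_across (hc : Γ.Connected) (hs : Slim Γ δ) (h : Av Γ v (Γ.dist x y) x y) {p : V}
    (hp : Btw Γ v p x) (hT : Γ.dist v p = min (10 * δ + 1) (Γ.dist v x)) :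
    (∃ q, Btw Γ v q y ∧ Γ.dist p q ≤ δ ∧ 10 * δ + 1 ≤ Γ.dist v p) ∨
    ∃ i ≤ Γ.dist x y, ∀ q, Btw Γ x q y → Γ.dist x q = i → Av Γ v (3 * δ) p q ∨ q = p := by
  by_cases hT' : Γ.dist v x ≤ 10 * δ + 1
  · right
    have hpx : p = x := by
      unfold Btw at hp
      exact hc.dist_eq_zero_iff.1 (by omega)
    subst hpx
    refine ⟨0, by omega, fun q _ hq => .inr (hc.dist_eq_zero_iff.1 hq).symm⟩
  · obtain ⟨q, hq | hq, hpq⟩ := hs v x y p hp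
    · exact .inl ⟨q, hq, hpq, by omega⟩
    · right
      have hq := hq.symm
      refine ⟨Γ.dist x q, by unfold Btw at hq; omega, fun q' hq' hd => .inl ?_⟩
      have h1 := hs.fellow hc hq hq' (k := 0) (by omega) (by omega)
      have := hc.triangle p q q'
      have := Γ.dist_swap p v
      exact (av_of_dist_lt hc (by omega)).mono (by omega)

theorem lk_av (hc : Γ.Connected) (hs : Slim Γ δ) {e e' : V} (he : e ∈ Lk Γ v x)
    (he' : e' ∈ Lk Γ v x) : Av Γ v (angleBound δ) e e' := by
  obtain ⟨p, hp, hpd, hpa⟩ := exists_along hc he (10 * δ + 1) (by omega)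
  obtain ⟨p', hp', hpd', hpa'⟩ := exists_along hc he' (10 * δ + 1) (by omega)
  have h0 := hs.fellow hc hp hp' (k := 0) (by omega) (by omega)
  refine ((hpa.trans (m := 2 * δ) ?_).trans hpa'.symm).mono (by unfold angleBound; omega)
  by_cases hx : 10 * δ + 1 ≤ Γ.dist v x
  · have := Γ.dist_swap p v
    exact (av_of_dist_lt hc (by omega)).mono (by omega)
  · have h1 : p = x := by
      unfold Btw at hp; exact hc.dist_eq_zero_iff.1 (by omega)
    have h2 : p' = x := by
      unfold Btw at hp'; exact hc.dist_eq_zero_iff.1 (by omega)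
    subst h1; subst h2
    exact .refl _ _ hpa.right_ne

theorem av_cross (hc : Γ.Connected) (hs : Slim Γ δ) (h : Av Γ v (Γ.dist x y) x y) {e e' : V}
    (he : e ∈ Lk Γ v x) (he' : e' ∈ Lk Γ v y) : Av Γ v (angleBound δ) e e' := by
  have aux : ∀ {x y p p' q : V}, Btw Γ v p x → Btw Γ v p' y →
      Γ.dist v p' = min (10 * δ + 1) (Γ.dist v y) → Btw Γ v q y → Γ.dist p q ≤ δ →
      10 * δ + 1 ≤ Γ.dist v p → Γ.dist v p ≤ 10 * δ + 1 → Av Γ v (4 * δ) p p' := by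
    intro x y p p' q hp hp' hpd' hq hd h1 h2
    have t1 := hc.triangle v q p
    have t2 := hc.triangle v p q
    have e1 := Γ.dist_swap q p
    have e2 := Γ.dist_swap p v
    have : Γ.dist v q ≤ Γ.dist v y := by unfold Btw at hq; omega
    have := hs.fellow hc hq hp' (k := δ) (by omega) (by omega)
    have := hc.triangle p q p'
    exact (av_of_dist_lt hc (by omega)).mono (by omega)
  obtain ⟨p, hp, hpd, hpa⟩ := exists_along hc he (10 * δ + 1) (by omega)
  obtain ⟨p', hp', hpd', hpa'⟩ := exists_along hc he' (10 * δ + 1) (by omega)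
  have key : Av Γ v (20 * δ + 2 + 12 * δ) p p' := by
    have h' : Av Γ v (Γ.dist y x) y x := by rw [Γ.dist_comm]; exact h.symm
    rcases av_across hc hs h hp hpd with ⟨q, hq, hd, hl⟩ | ⟨i, hi, hpi⟩
    · grind [Av.mono]
    rcases av_across hc hs h' hp' hpd' with ⟨q, hq, hd, hl⟩ | ⟨j, hj, hpj⟩
    · exact (aux hp' hp hpd hq hd hl (by omega)).symm.mono (by omega)
    have conn : ∀ a b, Btw Γ x a y → Btw Γ x b y → Γ.dist x a = i →
        Γ.dist x b = Γ.dist x y - j → Γ.dist a b ≤ 20 * δ + 2 + 6 * δ := by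
      intro a b ha hb hai hbj
      have h3 : Γ.dist p a ≤ 3 * δ := by
        rcases hpi a ha hai with h | h
        · exact h.dist_le hc
        · subst h; simp
      have h4 : Γ.dist p' b ≤ 3 * δ := by
        have : Γ.dist y b = j := by
          have := hb; unfold Btw at this
          rw [Γ.dist_comm]
          rw [Γ.dist_comm (u := y)] at hj
          omega
        rcases hpj b hb.symm this with h | h
        · exact h.dist_le hc
        · subst h; simp
      have := hc.triangle a p b
      have := hc.triangle p p' b
      have := hc.triangle p v p'
      grind [SimpleGraph.dist_swap]
    have fin : ∀ a b, Btw Γ x a y → Btw Γ x b y → Γ.dist x a = i →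
        Γ.dist x b = Γ.dist x y - j → Av Γ v (20 * δ + 2 + 6 * δ) a b →
        Av Γ v (20 * δ + 2 + 12 * δ) p p' := by
      intro a b ha hb hai hbj hab
      have h3 : Av Γ v (3 * δ) p a := by
        rcases hpi a ha hai with h | h
        · exact h
        · subst h; exact .refl _ _ hpa.right_ne
      have h4 : Av Γ v (3 * δ) p' b := by
        have : Γ.dist y b = j := by
          have := hb; unfold Btw at this
          rw [Γ.dist_comm]
          rw [Γ.dist_comm (u := y)] at hj
          omega
        rcases hpj b hb.symm this with h | h
        · exact h
        · subst h; exact .refl _ _ hpa'.right_ne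
      exact ((h3.trans hab).trans h4.symm).mono (by omega)
    rcases le_total i (Γ.dist x y - j) with hij | hij
    · obtain ⟨a, b, ha, ha', hb, hb', hab⟩ := h.segment hc hij (by omega)
      refine fin a b ha' hb' ha hb (hab.mono ?_)
      have h1 := conn a b ha' hb' ha hb
      have := hc.triangle x a b
      omega
    · obtain ⟨b, a, hb, hb', ha, ha', hab⟩ := h.segment hc hij (by omega)
      refine fin a b ha' hb' ha hb (hab.symm.mono ?_)
      have h1 := conn a b ha' hb' ha hb
      have := hc.triangle x b a
      have := Γ.dist_swap b a
      omega
  refine ((hpa.trans key).trans hpa'.symm).mono ?_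
  unfold angleBound
  omega

theorem Ang.mono (h : Ang Γ v n x y) (hnm : n ≤ m) : Ang Γ v m x y :=
  fun e he e' he' => (h e he e' he').mono hnm

theorem Ang.symm (h : Ang Γ v n x y) : Ang Γ v n y x := by
  unfold Ang at *
  rwa [Set.union_comm]

theorem Ang.trans (hc : Γ.Connected) (h : Ang Γ v n x y) (h' : Ang Γ v m y z) (hy : y ≠ v) :
    Ang Γ v (n + m) x z := by
  obtain ⟨f, hf⟩ := exists_next hc hy.symm
  rintro e (he | he) e' (he' | he')
  · exact (h e (.inl he) e' (.inl he')).mono (by omega)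
  · exact (h e (.inl he) f (.inr hf)).trans (h' f (.inl hf) e' (.inr he'))
  · exact ((h e' (.inl he') f (.inr hf)).trans (h' f (.inl hf) e (.inr he))).symm
  · exact (h' e (.inr he) e' (.inr he')).mono (by omega)

theorem ang_of_av (hc : Γ.Connected) (hs : Slim Γ δ) (h : Av Γ v (Γ.dist x y) x y) :
    Ang Γ v (angleBound δ) x y := by
  rintro e (he | he) e' (he' | he')
  · exact lk_av hc hs he he'
  · exact av_cross hc hs h he he'
  · exact (av_cross hc hs h he' he).symm
  · exact lk_av hc hs he he'

theorem lk_self : Lk Γ v v = ∅ := by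
  simp [Lk]

theorem ang_self (hc : Γ.Connected) (hs : Slim Γ δ) : Ang Γ v (angleBound δ) x x := by
  rintro e he e' he'
  grind [lk_av]

theorem ang_right (hc : Γ.Connected) (hs : Slim Γ δ) : Ang Γ v (angleBound δ) x v := by
  rintro e he e' he'
  grind [lk_self, lk_av]

theorem ang_of_adj (hc : Γ.Connected) (hs : Slim Γ δ) (h : Γ.Adj x y) :
    Ang Γ v (angleBound δ) x y := by
  by_cases hx : x = v
  · subst hx; exact (ang_right hc hs).symm
  by_cases hy : y = v
  · subst hy; exact ang_right hc hs
  refine ang_of_av hc hs ?_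
  rw [h.dist_eq_one]
  exact .cons _ _ _ _ hx h (.refl _ _ hy)

theorem btw_of_not_ang (hc : Γ.Connected) (hs : Slim Γ δ) (h : ¬ Ang Γ v (angleBound δ) x y) :
    Btw Γ x v y :=
  (btw_or_av hc x v y).resolve_right fun h' => h (ang_of_av hc hs h')

theorem ne_of_not_ang (hc : Γ.Connected) (hs : Slim Γ δ) (h : ¬ Ang Γ v (angleBound δ) x y) :
    x ≠ v := by
  rintro rfl
  exact h (ang_right hc hs).symm

/-- A geodesic making a large angle at `v` is forced to pass through `v`. -/
theorem lk_eq_of_not_ang (hc : Γ.Connected) (hs : Slim Γ δ)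
    (h : ¬ Ang Γ v (angleBound δ) x y) : Lk Γ x y = Lk Γ x v := by
  have hb := btw_of_not_ang hc hs h
  have hne := ne_of_not_ang hc hs h
  have hb' := hb
  unfold Btw at hb'
  ext e
  constructor
  · rintro ⟨ha, hd⟩
    refine ⟨ha, ?_⟩
    rcases btw_or_av hc e v y with hb2 | h2
    · unfold Btw at hb2
      omega
    · refine absurd (ang_of_av hc hs ?_) h
      rw [← hd]
      exact .cons _ _ _ _ hne ha h2
  · rintro ⟨ha, hd⟩
    refine ⟨ha, ?_⟩
    have h1 := ha.dist_eq_one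
    have := hc.triangle e v y
    have := hc.triangle x e y
    omega

theorem ang_congr_right (h : Lk Γ v y = Lk Γ v z) : Ang Γ v n x y ↔ Ang Γ v n x z := by
  unfold Ang; rw [h]

theorem ang_congr_left (h : Lk Γ v y = Lk Γ v z) : Ang Γ v n y x ↔ Ang Γ v n z x := by
  unfold Ang; rw [h]

end Graph

section Action

variable {V : Type*} {Γ : SimpleGraph V} {Q : Type*} [Group Q] [MulAction Q V]

/-- The group `Q` acts on `Γ` by graph automorphisms. -/
def ActsOn (Q : Type*) [Group Q] [MulAction Q V] (Γ : SimpleGraph V) : Prop :=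
  ∀ (g : Q) (x y : V), Γ.Adj x y → Γ.Adj (g • x) (g • y)

variable {v x y z : V} {n m δ : ℕ}

theorem ActsOn.dist_smul (hQ : ActsOn Q Γ) (hc : Γ.Connected) (g : Q) (x y : V) :
    Γ.dist (g • x) (g • y) = Γ.dist x y := by
  have key : ∀ (g : Q) (x y : V), Γ.dist (g • x) (g • y) ≤ Γ.dist x y := by
    intro g x y
    obtain ⟨w, hw⟩ := hc.exists_walk_length_eq_dist x y
    have := Γ.dist_le (w.map (⟨fun x => g • x, fun h => hQ g _ _ h⟩ : Γ →g Γ))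
    simp at this
    exact this.trans hw.le
  refine le_antisymm (key g x y) ?_
  simpa using key g⁻¹ (g • x) (g • y)

theorem ActsOn.av_smul (hQ : ActsOn Q Γ) (g : Q) (h : Av Γ v n x y) :
    Av Γ (g • v) n (g • x) (g • y) := by
  induction h with
  | refl n x hx => exact .refl _ _ (by simpa using hx)
  | cons n x y z hx ha h ih => exact .cons _ _ _ _ (by simpa using hx) (hQ g _ _ ha) ih

theorem ActsOn.mem_lk_smul (hQ : ActsOn Q Γ) (hc : Γ.Connected) (g : Q) {e : V}
    (h : e ∈ Lk Γ v x) : g • e ∈ Lk Γ (g • v) (g • x) := by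
  refine ⟨hQ g _ _ h.1, ?_⟩
  rw [hQ.dist_smul hc, hQ.dist_smul hc]
  exact h.2

theorem ActsOn.btw_smul (hQ : ActsOn Q Γ) (hc : Γ.Connected) (g : Q) :
    Btw Γ (g • x) (g • z) (g • y) ↔ Btw Γ x z y := by
  simp only [Btw, hQ.dist_smul hc]

theorem ActsOn.ang_smul (hQ : ActsOn Q Γ) (hc : Γ.Connected) (g : Q) (h : Ang Γ v n x y) :
    Ang Γ (g • v) n (g • x) (g • y) := by
  have key : ∀ e, e ∈ Lk Γ (g • v) (g • x) ∪ Lk Γ (g • v) (g • y) →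
      g⁻¹ • e ∈ Lk Γ v x ∪ Lk Γ v y := by
    rintro e (he | he)
    · exact .inl (by simpa using hQ.mem_lk_smul hc g⁻¹ he)
    · exact .inr (by simpa using hQ.mem_lk_smul hc g⁻¹ he)
  intro e he e' he'
  simpa using hQ.av_smul g (h _ (key e he) _ (key e' he'))

theorem ActsOn.ang_smul_iff (hQ : ActsOn Q Γ) (hc : Γ.Connected) (g : Q) :
    Ang Γ (g • v) n (g • x) (g • y) ↔ Ang Γ v n x y :=
  ⟨fun h => by simpa using hQ.ang_smul hc g⁻¹ h, hQ.ang_smul hc g⟩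

theorem ActsOn.lk_smul_congr (hQ : ActsOn Q Γ) (hc : Γ.Connected) (g : Q)
    (h : Lk Γ v x = Lk Γ v y) : Lk Γ (g • v) (g • x) = Lk Γ (g • v) (g • y) := by
  ext e
  constructor <;> intro he
  · have := hQ.mem_lk_smul hc g⁻¹ he
    simp only [inv_smul_smul] at this
    rw [h] at this
    simpa using hQ.mem_lk_smul hc g this
  · have := hQ.mem_lk_smul hc g⁻¹ he
    simp only [inv_smul_smul] at this
    rw [← h] at this
    simpa using hQ.mem_lk_smul hc g this

end Action

section Greendlinger

variable {V : Type*} {Γ : SimpleGraph V} {Q : Type*} [Group Q] [MulAction Q V]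

/-- A very rotating family of subgroups for an action on a hyperbolic graph. -/
structure Rotating (Γ : SimpleGraph V) (δ M : ℕ) (R : V → Subgroup Q) : Prop where
  conn : Γ.Connected
  slim : Slim Γ δ
  acts : ActsOn Q Γ
  fix : ∀ v, ∀ ρ ∈ R v, ρ • v = v
  conj : ∀ (g : Q) (v : V), ∀ ρ ∈ R v, g * ρ * g⁻¹ ∈ R (g • v)
  rot : ∀ v, ∀ ρ ∈ R v, ρ ≠ 1 → ∀ e, Γ.Adj v e → ¬ Av Γ v M e (ρ • e)
  large : 6 * angleBound δ ≤ M

/-- The subgroup generated by the rotations about the vertices in `W`. -/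
def rotGroup (R : V → Subgroup Q) (W : Set V) : Subgroup Q := Subgroup.closure
    {g | ∃ v ∈ W, g ∈ R v}

/-- `ν` can be reduced to an element fixing `x` by rotations which shorten the angles
seen between `x` and `ν • x`. -/
inductive Reducible (Γ : SimpleGraph V) (δ : ℕ) (R : V → Subgroup Q) (x : V) : Q → Prop
  | base (ν : Q) : ν • x = x → Reducible Γ δ R x ν
  | step (ν ρ : Q) (v : V) : x ≠ v → ν • x ≠ v → ρ ∈ R v → ρ ≠ 1 →
      Ang Γ v (4 * angleBound δ) x (ρ • ν • x) → Reducible Γ δ R x (ρ * ν) →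
      Reducible Γ δ R x ν

/-- Points obtained from `S` by a non-degenerate sequence of rotations, the last one at `j`. -/
inductive Reach (R : V → Subgroup Q) (S J : Set V) : V → V → Prop
  | base (j z : V) (ρ : Q) : j ∈ J → z ∈ S → z ≠ j → ρ ∈ R j → ρ ≠ 1 → Reach R S J j (ρ • z)
  | step (j j' y : V) (ρ : Q) : j ∈ J → j' ≠ j → ρ ∈ R j → ρ ≠ 1 → Reach R S J j' y →
      Reach R S J j (ρ • y)

/-- Elements which are non-degenerate products of rotations about `J` and an element of `P`. -/
inductive RotExpr (R : V → Subgroup Q) (P : Subgroup Q) (J : Set V) : V → Q → Prop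
  | base (j : V) (ρ ν : Q) : j ∈ J → ν ∈ P → ρ ∈ R j → ρ ≠ 1 → RotExpr R P J j (ρ * ν)
  | step (j j' : V) (ρ g : Q) : j ∈ J → j' ≠ j → ρ ∈ R j → ρ ≠ 1 → RotExpr R P J j' g →
      RotExpr R P J j (ρ * g)

variable {δ M : ℕ} {R : V → Subgroup Q}

theorem Reach.mem {S J : Set V} {j y : V} (h : Reach R S J j y) : j ∈ J := by
  cases h <;> assumption

theorem Rotating.ang_smul_right (h : Rotating Γ δ M R) {v x y : V} {ρ : Q} {n : ℕ} (hρ : ρ ∈ R v) :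
    Ang Γ v n (ρ • x) (ρ • y) ↔ Ang Γ v n x y := by
  conv_lhs => rw [← h.fix v ρ hρ]
  exact h.acts.ang_smul_iff h.conn ρ

theorem Rotating.not_ang (h : Rotating Γ δ M R) {v x : V} {ρ : Q} (hρ : ρ ∈ R v) (h1 : ρ ≠ 1)
    (hx : x ≠ v) : ¬ Ang Γ v M x (ρ • x) := by
  obtain ⟨e, he⟩ := exists_next h.conn hx.symm
  intro ha
  refine h.rot v ρ hρ h1 e he.1 (ha e (.inl he) _ (.inr ?_))
  have := h.acts.mem_lk_smul h.conn ρ he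
  rwa [h.fix v ρ hρ] at this

theorem rotGroup_mono {V Q : Type*} [Group Q] {R : V → Subgroup Q} {W W' : Set V} (h : W ⊆ W') :
    rotGroup R W ≤ rotGroup R W' :=
  Subgroup.closure_mono fun _ ⟨v, hv, hg⟩ => ⟨v, h hv, hg⟩

theorem mem_rotGroup {V Q : Type*} [Group Q] {R : V → Subgroup Q} {W : Set V} {v : V} {ρ : Q}
    (hv : v ∈ W) (hρ : ρ ∈ R v) :
    ρ ∈ rotGroup R W := Subgroup.subset_closure ⟨v, hv, hρ⟩

theorem smul_mem_of_mem_rotGroup {S W : Set V} (h : ∀ v ∈ W, ∀ ρ ∈ R v, ∀ y ∈ S, ρ • y ∈ S) {g : Q}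
    (hg : g ∈ rotGroup R W) : ∀ y ∈ S, g • y ∈ S := by
  induction hg using Subgroup.closure_induction_left with
  | one => simp
  | mul_left x hx y _ ih =>
    grind [mul_smul]
  | inv_mul_cancel x hx y _ ih =>
    grind [mul_smul, inv_mem]

/-- The hypotheses under which a set `J` can be added to a windmill `W`. -/
structure Gluing (Γ : SimpleGraph V) (δ : ℕ) (R : V → Subgroup Q) (W J : Set V) : Prop where
  invW : ∀ g ∈ rotGroup R W, ∀ y ∈ W, g • y ∈ W
  invJ : ∀ g ∈ rotGroup R W, ∀ y ∈ J, g • y ∈ J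
  disj : ∀ j ∈ J, j ∉ W
  ang : ∀ j ∈ J, ∀ y ∈ W ∪ J, y ≠ j → ∀ z ∈ W ∪ J, z ≠ j → Ang Γ j (4 * angleBound δ) y z

/-- The set swept out by `S` under rotations about `S`. -/
def sweep (R : V → Subgroup Q) (S : Set V) : Set V := {y | ∃ g ∈ rotGroup R S, ∃ z ∈ S, y = g • z}

theorem subset_sweep (S : Set V) : S ⊆ sweep R S := fun z hz => ⟨1, one_mem _, z, hz, by simp⟩

theorem Rotating.rotGroup_sweep (h : Rotating Γ δ M R) (S : Set V) :
    rotGroup R (sweep R S) = rotGroup R S := by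
  refine le_antisymm ?_ (rotGroup_mono (subset_sweep S))
  refine (Subgroup.closure_le _).2 ?_
  rintro ρ ⟨v, ⟨g, hg, z, hz, rfl⟩, hρ⟩
  have := h.conj g⁻¹ _ ρ hρ
  rw [inv_smul_smul] at this
  have := mul_mem (mul_mem hg (mem_rotGroup hz this)) (inv_mem hg)
  have e : g * (g⁻¹ * ρ * g⁻¹⁻¹) * g⁻¹ = ρ := by group
  rwa [e] at this

theorem sweep_inv (S : Set V) : ∀ g ∈ rotGroup R S, ∀ y ∈ sweep R S, g • y ∈ sweep R S := by
  rintro g hg y ⟨g', hg', z, hz, rfl⟩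
  exact ⟨g * g', mul_mem hg hg', z, hz, (mul_smul _ _ _).symm⟩

variable {W J : Set V}

theorem Gluing.reach (hG : Gluing Γ δ R W J) (h : Rotating Γ δ M R) {j y y₀ : V}
    (hr : Reach R (W ∪ J) J j y) (h0 : y₀ ∈ W ∪ J) (hj : y₀ ≠ j) :
    y ≠ j ∧ ∀ m, m + 4 * angleBound δ ≤ M → ¬ Ang Γ j m y₀ y := by
  have hl := h.large
  have base : ∀ (j z : V) (ρ : Q) (y₀ : V), j ∈ J → z ∈ W ∪ J → z ≠ j → ρ ∈ R j → ρ ≠ 1 →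
      y₀ ∈ W ∪ J → y₀ ≠ j →
      ρ • z ≠ j ∧ ∀ m, m + 4 * angleBound δ ≤ M → ¬ Ang Γ j m y₀ (ρ • z) := by
    intro j z ρ y₀ hjJ hz hzj hρ hρ1 h0 hj
    have hne : ρ • z ≠ j := by
      intro he
      exact hzj (MulAction.injective ρ (he.trans (h.fix j ρ hρ).symm))
    refine ⟨hne, fun m hm ha => ?_⟩
    have h1 := (h.ang_smul_right (n := 4 * angleBound δ) hρ).2 (hG.ang j hjJ z hz hzj y₀ h0 hj)
    exact h.not_ang hρ hρ1 hj ((ha.trans h.conn h1 hne).mono hm)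
  induction hr generalizing y₀ with
  | base j z ρ hjJ hz hzj hρ hρ1 => exact base j z ρ y₀ hjJ hz hzj hρ hρ1 h0 hj
  | step j j' y ρ hjJ hjj' hρ hρ1 hr ih =>
    have hj' := hr.mem
    obtain ⟨hyj', ha⟩ := ih (.inr hjJ) hjj'.symm
    have ha := ha (angleBound δ) (by omega)
    have hlk := lk_eq_of_not_ang h.conn h.slim ha
    obtain ⟨hne, hm⟩ := base j j' ρ y₀ hjJ (.inr hj') hjj' hρ hρ1 h0 hj
    constructor
    · intro he
      have : y = j := MulAction.injective ρ (he.trans (h.fix j ρ hρ).symm)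
      subst this
      exact ha (ang_self h.conn h.slim)
    · intro m hm' ha'
      refine hm m hm' ?_
      have := h.acts.lk_smul_congr h.conn ρ hlk
      rw [h.fix j ρ hρ] at this
      exact (ang_congr_right this).1 ha'

theorem Gluing.reach_lk (hG : Gluing Γ δ R W J) (h : Rotating Γ δ M R) {j y v : V}
    (hr : Reach R (W ∪ J) J j y) (hv : v ∈ J) (hj : v ≠ j) : Lk Γ v y = Lk Γ v j := by
  have hl := h.large
  exact lk_eq_of_not_ang h.conn h.slim ((hG.reach h hr (.inr hv) hj).2 _ (by omega))

theorem Gluing.rotExpr_smul (hG : Gluing Γ δ R W J) (h : Rotating Γ δ M R) {j : V} {g p : Q}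
    (hp : p ∈ rotGroup R W) (hg : RotExpr R (rotGroup R W) J j g) :
    RotExpr R (rotGroup R W) J (p • j) (p * g) := by
  induction hg with
  | base j ρ ν hj hν hρ hρ1 =>
    have e : p * (ρ * ν) = (p * ρ * p⁻¹) * (p * ν) := by group
    rw [e]
    exact .base _ _ _ (hG.invJ p hp j hj) (mul_mem hp hν) (h.conj p j ρ hρ) (by simpa using hρ1)
  | step j j' ρ g hj hjj' hρ hρ1 hg ih =>
    have e : p * (ρ * g) = (p * ρ * p⁻¹) * (p * g) := by group
    rw [e]
    exact .step _ (p • j') _ _ (hG.invJ p hp j hj) (by simpa using hjj') (h.conj p j ρ hρ)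
      (by simpa using hρ1) ih

theorem Gluing.rotExpr_of_mem (hG : Gluing Γ δ R W J) (h : Rotating Γ δ M R) {g : Q}
    (hg : g ∈ rotGroup R (W ∪ J)) :
    g ∈ rotGroup R W ∨ ∃ j, RotExpr R (rotGroup R W) J j g := by
  have key : ∀ v ∈ W ∪ J, ∀ σ ∈ R v, ∀ g : Q,
      (g ∈ rotGroup R W ∨ ∃ j, RotExpr R (rotGroup R W) J j g) →
      (σ * g ∈ rotGroup R W ∨ ∃ j, RotExpr R (rotGroup R W) J j (σ * g)) := by
    rintro v hv σ hσ g hg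
    by_cases hσ1 : σ = 1
    · subst hσ1; simpa using hg
    rcases hv with hv | hv
    · have hσ' := mem_rotGroup hv hσ
      rcases hg with hg | ⟨j, hg⟩
      · exact .inl (mul_mem hσ' hg)
      · exact .inr ⟨_, hG.rotExpr_smul h hσ' hg⟩
    · rcases hg with hg | ⟨j, hg⟩
      · exact .inr ⟨v, .base _ _ _ hv hg hσ hσ1⟩
      · by_cases hjv : j = v
        · subst hjv
          cases hg with
          | base _ ρ ν hj hν hρ hρ1 =>
            by_cases hm : σ * ρ = 1
            · grind
            · right; refine ⟨j, ?_⟩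
              rw [← mul_assoc]
              exact .base _ _ _ hj hν (mul_mem hσ hρ) hm
          | step _ j' ρ g hj hjj' hρ hρ1 hg =>
            by_cases hm : σ * ρ = 1
            · grind
            · right; refine ⟨j, ?_⟩
              rw [← mul_assoc]
              exact .step _ _ _ _ hj hjj' (mul_mem hσ hρ) hm hg
        · exact .inr ⟨v, .step _ _ _ _ hv hjv hσ hσ1 hg⟩
  induction hg using Subgroup.closure_induction_left with
  | one => exact .inl (one_mem _)
  | mul_left x hx y _ ih =>
    obtain ⟨v, hv, hx⟩ := hx
    exact key v hv x hx y ih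
  | inv_mul_cancel x hx y _ ih =>
    obtain ⟨v, hv, hx⟩ := hx
    exact key v hv _ (inv_mem hx) y ih

theorem Gluing.reach_of_rotExpr (hG : Gluing Γ δ R W J) {x j : V} (hx : x ∈ W) {g : Q}
    (hg : RotExpr R (rotGroup R W) J j g) : Reach R (W ∪ J) J j (g • x) := by
  induction hg with
  | base j ρ ν hj hν hρ hρ1 =>
    rw [mul_smul]
    have := hG.invW ν hν x hx
    exact .base _ _ _ hj (.inl this) (fun he => hG.disj j hj (he ▸ this)) hρ hρ1
  | step j j' ρ g hj hjj' hρ hρ1 hg ih =>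
    rw [mul_smul]
    exact .step _ _ _ _ hj hjj' hρ hρ1 ih

theorem Gluing.reducible (hG : Gluing Γ δ R W J) (h : Rotating Γ δ M R) {x : V} (hx : x ∈ W)
    (hK : ∀ ν ∈ rotGroup R W, Reducible Γ δ R x ν) {g : Q} (hgm : g ∈ rotGroup R (W ∪ J)) :
    Reducible Γ δ R x g := by
  rcases hG.rotExpr_of_mem h hgm with hg | ⟨j, hg⟩
  · exact hK g hg
  clear hgm
  have hxj : ∀ j ∈ J, x ≠ j := fun j hj he => hG.disj j hj (he ▸ hx)
  induction hg with
  | base j ρ ν hj hν hρ hρ1 =>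
    have hW := hG.invW ν hν x hx
    have hr := (hG.reach h (hG.reach_of_rotExpr hx (.base j ρ ν hj hν hρ hρ1))
      (.inl hx) (hxj j hj)).1
    refine .step _ ρ⁻¹ j (hxj j hj) hr (inv_mem hρ) (by simpa using hρ1) ?_ ?_
    · rw [mul_smul, inv_smul_smul]
      exact hG.ang j hj x (.inl hx) (hxj j hj) _ (.inl hW) (fun he => hG.disj j hj (he ▸ hW))
    · simpa using hK ν hν
  | step j j' ρ g hj hjj' hρ hρ1 hg ih =>
    have hr' := hG.reach_of_rotExpr hx hg
    have hr := (hG.reach h (hG.reach_of_rotExpr hx (.step j j' ρ g hj hjj' hρ hρ1 hg))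
      (.inl hx) (hxj j hj)).1
    refine .step _ ρ⁻¹ j (hxj j hj) hr (inv_mem hρ) (by simpa using hρ1) ?_ ?_
    · rw [mul_smul, inv_smul_smul, ang_congr_right (hG.reach_lk h hr' hj hjj'.symm)]
      exact hG.ang j hj x (.inl hx) (hxj j hj) _ (.inr hr'.mem) hjj'
    · rw [inv_mul_cancel_left]
      exact ih

theorem Gluing.reach_smul (hG : Gluing Γ δ R W J) (h : Rotating Γ δ M R) {j y : V} {p : Q}
    (hp : p ∈ rotGroup R W) (hr : Reach R (W ∪ J) J j y) : Reach R (W ∪ J) J (p • j) (p • y) := by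
  have aux : ∀ (ρ : Q) (z : V), p • ρ • z = (p * ρ * p⁻¹) • p • z := by
    intro ρ z; simp [mul_smul]
  induction hr with
  | base j z ρ hj hz hzj hρ hρ1 =>
    rw [aux]
    refine .base _ _ _ (hG.invJ p hp j hj) ?_ (by simpa using hzj) (h.conj p j ρ hρ)
      (by simpa using hρ1)
    exact hz.imp (hG.invW p hp z) (hG.invJ p hp z)
  | step j j' y ρ hj hjj' hρ hρ1 hr ih =>
    rw [aux]
    exact .step _ _ _ _ (hG.invJ p hp j hj) (by simpa using hjj') (h.conj p j ρ hρ)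
      (by simpa using hρ1) ih

theorem Gluing.mem_sweep (hG : Gluing Γ δ R W J) (h : Rotating Γ δ M R) {y : V}
    (hy : y ∈ sweep R (W ∪ J)) : y ∈ W ∪ J ∨ ∃ j, Reach R (W ∪ J) J j y := by
  obtain ⟨g, hg, z, hz, rfl⟩ := hy
  refine smul_mem_of_mem_rotGroup (S := {y | y ∈ W ∪ J ∨ ∃ j, Reach R (W ∪ J) J j y}) ?_ hg z
    (.inl hz)
  rintro v hv σ hσ y hy
  by_cases hσ1 : σ = 1
  · subst hσ1; simpa using hy
  rcases hv with hv | hv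
  · have hσ' := mem_rotGroup hv hσ
    rcases hy with hy | ⟨j, hy⟩
    · exact .inl (hy.imp (hG.invW σ hσ' y) (hG.invJ σ hσ' y))
    · exact .inr ⟨_, hG.reach_smul h hσ' hy⟩
  · have base : ∀ σ ∈ R v, ∀ z ∈ W ∪ J, σ • z ∈ W ∪ J ∨ ∃ j, Reach R (W ∪ J) J j (σ • z) := by
      intro σ hσ z hz
      by_cases hσ1 : σ = 1
      · subst hσ1; simpa using .inl hz
      by_cases hzv : z = v
      · subst hzv; rw [h.fix z σ hσ]; exact .inl hz
      · exact .inr ⟨v, .base _ _ _ hv hz hzv hσ hσ1⟩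
    rcases hy with hy | ⟨j, hy⟩
    · exact base σ hσ y hy
    · by_cases hjv : j = v
      · subst hjv
        cases hy with
        | base _ z ρ hj hz hzj hρ hρ1 =>
          rw [← mul_smul]
          exact base _ (mul_mem hσ hρ) z hz
        | step _ j' y ρ hj hjj' hρ hρ1 hr =>
          rw [← mul_smul]
          by_cases hm : σ * ρ = 1
          · rw [hm, one_smul]; exact .inr ⟨_, hr⟩
          · exact .inr ⟨j, .step _ _ _ _ hj hjj' (mul_mem hσ hρ) hm hr⟩
      · exact .inr ⟨v, .step _ _ _ _ hv hjv hσ hσ1 hy⟩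

theorem Gluing.conv (hG : Gluing Γ δ R W J) (h : Rotating Γ δ M R) {C : ℕ}
    (hC : ∀ v, v ∉ sweep R (W ∪ J) → ∀ y ∈ W ∪ J, ∀ y' ∈ W ∪ J, Ang Γ v C y y') :
    ∀ v, v ∉ sweep R (W ∪ J) → ∀ y ∈ sweep R (W ∪ J), ∀ y' ∈ sweep R (W ∪ J), Ang Γ v C y y' := by
  have hl := h.large
  have inv : ∀ g ∈ rotGroup R (W ∪ J), ∀ v, v ∉ sweep R (W ∪ J) → g • v ∉ sweep R (W ∪ J) := by
    intro g hg v hv hgv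
    have := sweep_inv _ g⁻¹ (inv_mem hg) _ hgv
    rw [inv_smul_smul] at this
    exact hv this
  have key : ∀ j y, Reach R (W ∪ J) J j y → ∀ v, v ∉ sweep R (W ∪ J) → ∀ z ∈ W ∪ J,
      Ang Γ v C z y := by
    have red : ∀ j y, Reach R (W ∪ J) J j y →
        (∀ v, v ∉ sweep R (W ∪ J) → Ang Γ v C j y) →
        ∀ v, v ∉ sweep R (W ∪ J) → ∀ z ∈ W ∪ J, Ang Γ v C z y := by
      intro j y hr hjy v hv z hz
      by_cases hzj : z = j
      · subst hzj; exact hjy v hv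
      have hvj : v ≠ j := fun he => hv (he ▸ subset_sweep _ (.inr hr.mem))
      have h1 := (hG.reach h hr hz hzj).2 (angleBound δ + angleBound δ) (by omega)
      by_cases h2 : Ang Γ j (angleBound δ) z v
      · by_cases h3 : Ang Γ j (angleBound δ) v y
        · exact absurd (h2.trans h.conn h3 hvj) h1
        · exact (ang_congr_right (lk_eq_of_not_ang h.conn h.slim h3)).2
            (hC v hv z hz j (.inr hr.mem))
      · have := lk_eq_of_not_ang h.conn h.slim (fun ha => h2 (Ang.symm ha))
        exact (ang_congr_left this).2 (hjy v hv)
    intro j y hr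
    induction hr with
    | base j z ρ hj hz hzj hρ hρ1 =>
      refine red j _ (.base j z ρ hj hz hzj hρ hρ1) fun v hv => ?_
      have hρ' := inv_mem (mem_rotGroup (W := W ∪ J) (.inr hj) hρ)
      have := h.acts.ang_smul h.conn ρ (hC _ (inv _ hρ' v hv) j (.inr hj) z hz)
      rwa [smul_inv_smul, h.fix j ρ hρ] at this
    | step j j' y ρ hj hjj' hρ hρ1 hr ih =>
      refine red j _ (.step j j' y ρ hj hjj' hρ hρ1 hr) fun v hv => ?_
      have hρ' := inv_mem (mem_rotGroup (W := W ∪ J) (.inr hj) hρ)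
      have := h.acts.ang_smul h.conn ρ (ih _ (inv _ hρ' v hv) j (.inr hj))
      rwa [smul_inv_smul, h.fix j ρ hρ] at this
  rintro v hv y ⟨g, hg, z, hz, rfl⟩ y' hy'
  have h1 : g⁻¹ • y' ∈ sweep R (W ∪ J) := sweep_inv _ _ (inv_mem hg) _ hy'
  have hv' := inv _ (inv_mem hg) v hv
  have : Ang Γ (g⁻¹ • v) C z (g⁻¹ • y') := by
    rcases hG.mem_sweep h h1 with h1 | ⟨j, h1⟩
    · exact hC _ hv' z hz _ h1
    · exact key j _ h1 _ hv' z hz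
  simpa using h.acts.ang_smul h.conn g this

/-- A windmill: an invariant set, almost convex outside itself. -/
structure Windmill (Γ : SimpleGraph V) (δ : ℕ) (R : V → Subgroup Q) (x : V) (C : ℕ) (W : Set V) :
    Prop where
  mem : x ∈ W
  inv : ∀ g ∈ rotGroup R W, ∀ y ∈ W, g • y ∈ W
  conv : ∀ v, v ∉ W → ∀ y ∈ W, ∀ y' ∈ W, Ang Γ v C y y'
  red : ∀ ν ∈ rotGroup R W, Reducible Γ δ R x ν

theorem Gluing.windmill (hG : Gluing Γ δ R W J) (h : Rotating Γ δ M R) {x : V} (hx : x ∈ W)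
    (hK : ∀ ν ∈ rotGroup R W, Reducible Γ δ R x ν) {C : ℕ}
    (hC : ∀ v, v ∉ sweep R (W ∪ J) → ∀ y ∈ W ∪ J, ∀ y' ∈ W ∪ J, Ang Γ v C y y') :
    Windmill Γ δ R x C (sweep R (W ∪ J)) where
  mem := subset_sweep _ (.inl hx)
  inv := by rw [h.rotGroup_sweep]; exact sweep_inv _
  conv := hG.conv h hC
  red := by
    rw [h.rotGroup_sweep]
    exact fun ν hν => hG.reducible h hx hK hν

theorem Windmill.add_vertex (h : Rotating Γ δ M R) {x : V}
    (hW : Windmill Γ δ R x (2 * angleBound δ) W) {p w : V} (hw : w ∈ W) (hp : p ∉ W)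
    (ha : Γ.Adj p w) : ∃ W', W ⊆ W' ∧ p ∈ W' ∧ Windmill Γ δ R x (4 * angleBound δ) W' := by
  set J : Set V := {y | ∃ g ∈ rotGroup R W, y = g • p} with hJ
  have hadj : ∀ y ∈ W ∪ J, ∃ w ∈ W, y = w ∨ Γ.Adj y w := by
    rintro y (hy | ⟨g, hg, rfl⟩)
    · exact ⟨y, hy, .inl rfl⟩
    · exact ⟨g • w, hW.inv g hg w hw, .inr (h.acts g _ _ ha)⟩
  have hang : ∀ v, v ∉ W → ∀ y ∈ W ∪ J, ∀ y' ∈ W ∪ J,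
      Ang Γ v (4 * angleBound δ) y y' := by
    intro v hv y hy y' hy'
    have close : ∀ y w, y = w ∨ Γ.Adj y w → Ang Γ v (angleBound δ) y w := by
      rintro y w (rfl | h1)
      · exact ang_self h.conn h.slim
      · exact ang_of_adj h.conn h.slim h1
    obtain ⟨w1, hw1, h1⟩ := hadj y hy
    obtain ⟨w2, hw2, h2⟩ := hadj y' hy'
    refine (((close _ _ h1).trans h.conn (hW.conv v hv w1 hw1 w2 hw2) ?_).trans h.conn
      (close _ _ h2).symm ?_).mono (by omega)
    · rintro rfl; exact hv hw1
    · rintro rfl; exact hv hw2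
  have hdisj : ∀ j ∈ J, j ∉ W := by
    rintro _ ⟨g, hg, rfl⟩ hj
    have := hW.inv g⁻¹ (inv_mem hg) _ hj
    rw [inv_smul_smul] at this
    exact hp this
  have hG : Gluing Γ δ R W J := by
    refine ⟨hW.inv, ?_, hdisj, fun j hj y hy _ y' hy' _ => hang j (hdisj j hj) y hy y' hy'⟩
    rintro g hg _ ⟨g', hg', rfl⟩
    exact ⟨g * g', mul_mem hg hg', (mul_smul _ _ _).symm⟩
  refine ⟨sweep R (W ∪ J), fun y hy => subset_sweep _ (.inl hy),
    subset_sweep _ (.inr ⟨1, one_mem _, by simp⟩), hG.windmill h hW.mem hW.red ?_⟩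
  grind [subset_sweep]

theorem Windmill.convexify (h : Rotating Γ δ M R) {x : V}
    (hW : Windmill Γ δ R x (4 * angleBound δ) W) :
    ∃ W', W ⊆ W' ∧ Windmill Γ δ R x (2 * angleBound δ) W' := by
  set J : Set V := {v | v ∉ W ∧ ∃ y ∈ W, ∃ y' ∈ W, ¬ Ang Γ v (2 * angleBound δ) y y'} with hJ
  have hrep : ∀ v, ∀ y ∈ W ∪ J, y ≠ v → ∃ a ∈ W, Lk Γ v y = Lk Γ v a := by
    rintro v y (hy | ⟨hy, a, ha, b, hb, hab⟩) hyv
    · exact ⟨y, hy, rfl⟩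
    · by_cases h1 : Ang Γ y (angleBound δ) v a
      · by_cases h2 : Ang Γ y (angleBound δ) v b
        · exact absurd ((h1.symm.trans h.conn h2 hyv.symm).mono (by omega)) hab
        · exact ⟨b, hb, (lk_eq_of_not_ang h.conn h.slim h2).symm⟩
      · exact ⟨a, ha, (lk_eq_of_not_ang h.conn h.slim h1).symm⟩
  have hG : Gluing Γ δ R W J := by
    refine ⟨hW.inv, ?_, fun j hj => hj.1, ?_⟩
    · rintro g hg v ⟨hv, a, ha, b, hb, hab⟩
      refine ⟨fun hgv => hv ?_, g • a, hW.inv g hg a ha, g • b, hW.inv g hg b hb, ?_⟩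
      · simpa using hW.inv g⁻¹ (inv_mem hg) _ hgv
      · rwa [h.acts.ang_smul_iff h.conn]
    · intro j hj y hy hyj y' hy' hyj'
      obtain ⟨a, ha, e1⟩ := hrep j y hy hyj
      obtain ⟨b, hb, e2⟩ := hrep j y' hy' hyj'
      rw [ang_congr_left e1, ang_congr_right e2]
      exact hW.conv j hj.1 a ha b hb
  refine ⟨sweep R (W ∪ J), fun y hy => subset_sweep _ (.inl hy),
    hG.windmill h hW.mem hW.red ?_⟩
  intro v hv y hy y' hy'
  have hne : ∀ y ∈ W ∪ J, y ≠ v := fun y hy he => hv (he ▸ subset_sweep _ hy)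
  obtain ⟨a, ha, e1⟩ := hrep v y hy (hne y hy)
  obtain ⟨b, hb, e2⟩ := hrep v y' hy' (hne y' hy')
  grind [ang_congr_left, ang_congr_right]

theorem exists_boundary {V : Type*} {Γ : SimpleGraph V} (hc : Γ.Connected) {W : Set V} {x y : V}
    (hx : x ∈ W) (hy : y ∉ W) : ∃ p, p ∉ W ∧ ∃ w ∈ W, Γ.Adj p w := by
  obtain ⟨wk⟩ := hc.preconnected y x
  induction wk with
  | nil => exact absurd hx hy
  | @cons a b c ha _ ih =>
    grind

/-- Every element of the normal subgroup generated by a very rotating family reduces. -/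
theorem Rotating.reducible (h : Rotating Γ δ M R) (x : V) :
    ∀ ν ∈ rotGroup R Set.univ, Reducible Γ δ R x ν := by
  have hstart : Windmill Γ δ R x (2 * angleBound δ) {x} := by
    have hfix : ∀ g ∈ rotGroup R {x}, ∀ y ∈ ({x} : Set V), g • y ∈ ({x} : Set V) := by
      intro g hg
      refine smul_mem_of_mem_rotGroup ?_ hg
      rintro _ rfl ρ hρ _ rfl
      exact h.fix _ ρ hρ
    refine ⟨rfl, hfix, ?_, fun ν hν => .base _ (hfix ν hν x rfl)⟩
    rintro v _ _ rfl _ rfl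
    exact (ang_self h.conn h.slim).mono (by omega)
  have hch : ∀ c ⊆ {W | Windmill Γ δ R x (2 * angleBound δ) W}, IsChain (· ⊆ ·) c → c.Nonempty →
      ∃ ub ∈ {W | Windmill Γ δ R x (2 * angleBound δ) W}, ∀ s ∈ c, s ⊆ ub := by
    intro c hc hchain hcne
    have hrot : ∀ g ∈ rotGroup R (⋃₀ c), ∃ W ∈ c, g ∈ rotGroup R W := by
      intro g hg
      induction hg using Subgroup.closure_induction with
      | mem g hg =>
        grind [mem_rotGroup]
      | one => obtain ⟨W, hW⟩ := hcne; exact ⟨W, hW, one_mem _⟩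
      | mul g g' _ _ ih ih' =>
        obtain ⟨W, hW, hg⟩ := ih
        obtain ⟨W', hW', hg'⟩ := ih'
        rcases hchain.total hW hW' with hl | hl
        · exact ⟨W', hW', mul_mem (rotGroup_mono hl hg) hg'⟩
        · exact ⟨W, hW, mul_mem hg (rotGroup_mono hl hg')⟩
      | inv g _ ih =>
        grind [inv_mem]
    refine ⟨⋃₀ c, ⟨?_, ?_, ?_, ?_⟩, fun W hW => Set.subset_sUnion_of_mem hW⟩
    · obtain ⟨W, hW⟩ := hcne
      exact ⟨W, hW, (hc hW).mem⟩
    · rintro g hg y ⟨W, hW, hy⟩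
      obtain ⟨W', hW', hg⟩ := hrot g hg
      rcases hchain.total hW hW' with hl | hl
      · exact ⟨W', hW', (hc hW').inv g hg y (hl hy)⟩
      · exact ⟨W, hW, (hc hW).inv g (rotGroup_mono hl hg) y hy⟩
    · rintro v hv y ⟨W, hW, hy⟩ y' ⟨W', hW', hy'⟩
      rcases hchain.total hW hW' with hl | hl
      · exact (hc hW').conv v (fun hvW => hv ⟨W', hW', hvW⟩) y (hl hy) y' hy'
      · exact (hc hW).conv v (fun hvW => hv ⟨W, hW, hvW⟩) y hy y' (hl hy')
    · intro ν hν
      obtain ⟨W, hW, hg⟩ := hrot ν hν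
      exact (hc hW).red ν hg
  obtain ⟨W, hxW, hmax⟩ := zorn_subset_nonempty {W | Windmill Γ δ R x (2 * angleBound δ) W} hch _
    hstart
  have hW := hmax.prop
  have hall : ∀ y, y ∈ W := by
    by_contra hne
    push Not at hne
    obtain ⟨y, hy⟩ := hne
    obtain ⟨p, hp, w, hw, ha⟩ := exists_boundary h.conn hW.mem hy
    obtain ⟨W1, h1, hp1, hW1⟩ := hW.add_vertex h hw hp ha
    obtain ⟨W2, h2, hW2⟩ := hW1.convexify h
    exact hp (hmax.le_of_ge hW2 (h1.trans h2) (h2 hp1))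
  have : W = Set.univ := Set.eq_univ_of_forall hall
  subst this
  exact hW.red

end Greendlinger

section Slim

variable {V : Type*} {Γ : SimpleGraph V} {δ : ℕ}

theorem ang_of_polygon (hc : Γ.Connected) (hs : Slim Γ δ) {v : V} (q : ℕ → V) {k : ℕ}
    (hk : 1 ≤ k) (h : ∀ i < k, ¬ Btw Γ (q i) v (q (i + 1))) :
    Ang Γ v (k * angleBound δ) (q 0) (q k) := by
  have edge : ∀ i < k, Ang Γ v (angleBound δ) (q i) (q (i + 1)) := by
    grind [btw_of_not_ang]
  induction k, hk using Nat.le_induction with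
  | base => simpa using edge 0 (by omega)
  | succ k hk ih =>
    have h1 := ih (fun i hi => h i (by omega)) (fun i hi => edge i (by omega))
    refine (h1.trans hc (edge k (by omega)) ?_).mono (by rw [add_mul, one_mul])
    grind [btw_left]

theorem exists_btw_of_not_ang (hc : Γ.Connected) (hs : Slim Γ δ) {v : V} (q : ℕ → V) {k n : ℕ}
    (hk : 1 ≤ k) (hn : k * angleBound δ ≤ n) (h : ¬ Ang Γ v n (q 0) (q k)) :
    ∃ i < k, Btw Γ (q i) v (q (i + 1)) := by
  by_contra hcon
  push Not at hcon
  exact h ((ang_of_polygon hc hs q hk hcon).mono hn)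

theorem btw_or_btw_of_not_ang (hc : Γ.Connected) (hs : Slim Γ δ) {v x y : V} {n : ℕ}
    (hn : 2 * angleBound δ ≤ n) (h : ¬ Ang Γ v n x y) (z : V) : Btw Γ x v z ∨ Btw Γ z v y := by
  by_contra hcon
  push Not at hcon
  have h1 : Ang Γ v (angleBound δ) x z := by
    grind [btw_of_not_ang]
  have h2 : Ang Γ v (angleBound δ) z y := by
    grind [btw_of_not_ang]
  refine h ((h1.trans hc h2 ?_).mono (by omega))
  rintro rfl
  exact hcon.1 btw_right

/-- Displacements of points on a geodesic are controlled by displacements of the end points. -/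
theorem Slim.displacement (hs : Slim Γ δ) (hc : Γ.Connected) {Q : Type*} [Group Q] [MulAction Q V]
    (hQ : ActsOn Q Γ) {x y m : V} {g : Q} {ε : ℕ} (hm : Btw Γ x m y) (hx : Γ.dist x (g • x) ≤ ε)
    (hy : Γ.dist y (g • y) ≤ ε) : Γ.dist m (g • m) ≤ 3 * ε + 6 * δ := by
  have nearEnd : ∀ x q : V, Γ.dist x (g • x) ≤ ε → Btw Γ x q (g • x) → Γ.dist m q ≤ 2 * δ →
      Γ.dist m (g • m) ≤ 3 * ε + 6 * δ := by
    intro x q hx hq hd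
    have t1 := hc.triangle m q x
    have t2 := hc.triangle m x (g • m)
    have t3 := hc.triangle x (g • x) (g • m)
    grind [ActsOn.dist_smul, SimpleGraph.dist_swap, Btw]
  have hgm : Btw Γ (g • x) (g • m) (g • y) := (hQ.btw_smul hc g).2 hm
  have main : ∀ q, Btw Γ (g • x) q (g • y) → Γ.dist m q ≤ 2 * δ →
      Γ.dist m (g • m) ≤ 3 * ε + 6 * δ := by
    intro q hq hd
    have e1 := hQ.dist_smul hc g x m
    have t1 := hc.triangle x (g • x) q
    have t2 := hc.triangle x q m
    have t3 := hc.triangle (g • x) x q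
    have t4 := hc.triangle x m q
    have t5 := hc.triangle m q (g • m)
    have e2 := Γ.dist_swap q m
    have e3 := Γ.dist_swap x (g • x)
    have := hs.fellow hc hq hgm (k := ε + 2 * δ) (by omega) (by omega)
    omega
  obtain ⟨q, hq, hd⟩ := hs x y (g • x) m hm
  rcases hq with hq | hq
  · exact nearEnd x q hx hq (by omega)
  · obtain ⟨q', hq', hd'⟩ := hs (g • x) y (g • y) q hq
    have t := hc.triangle m q q'
    grind [Btw.symm]

end Slim

section ClosedLift

variable {V : Type*} {Γ : SimpleGraph V} {Q : Type*} [Group Q] [MulAction Q V]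
variable {δ M : ℕ} {R : V → Subgroup Q}

theorem Rotating.not_ang_of_reduce (h : Rotating Γ δ M R) {v x : V} {ν ρ : Q}
    (hx : x ≠ v) (hν : ν • x ≠ v) (hρ : ρ ∈ R v) (hρ1 : ρ ≠ 1)
    (ha : Ang Γ v (4 * angleBound δ) x (ρ • ν • x)) {m : ℕ} (hm : m + 4 * angleBound δ ≤ M) :
    ¬ Ang Γ v m x (ν • x) := fun h1 =>
  h.not_ang hρ hρ1 hν ((h1.symm.trans h.conn ha hx).mono hm)

/-- A polygon whose end points agree modulo rotations can be closed up by rotating its tails. -/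
theorem Rotating.closed_lift (h : Rotating Γ δ M R) {k : ℕ} (hk : 1 ≤ k)
    (hkM : k * angleBound δ + 4 * angleBound δ ≤ M) {x : V} {ν : Q} (hν : Reducible Γ δ R x ν)
    (q : ℕ → V) (h0 : q 0 = x) (hq : q k = ν • x) :
    ∃ q' : ℕ → V, q' 0 = x ∧ q' k = x ∧
      (∀ i, ∃ n ∈ rotGroup R Set.univ, q' i = n • q i) ∧
      ∀ i < k, Γ.dist (q' i) (q' (i + 1)) ≤ Γ.dist (q i) (q (i + 1)) := by
  induction hν generalizing q with
  | base ν hν => exact ⟨q, h0, hq.trans hν, fun i => ⟨1, one_mem _, by simp⟩, fun _ _ => le_rfl⟩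
  | step ν ρ v hx hν hρ hρ1 ha _ ih =>
    have hna := h.not_ang_of_reduce hx hν hρ hρ1 ha hkM
    rw [← hq, ← h0] at hna
    obtain ⟨i, hi, hb⟩ := exists_btw_of_not_ang h.conn h.slim q hk le_rfl hna
    obtain ⟨q', h0', hk', hN, hd⟩ := ih (fun j => if j ≤ i then q j else ρ • q j)
      (by simpa using h0) (by simp only [if_neg (not_le.2 hi), hq, mul_smul])
    refine ⟨q', h0', hk', fun j => ?_, fun j hj => (hd j hj).trans ?_⟩
    · obtain ⟨n, hn, hj⟩ := hN j
      by_cases hji : j ≤ i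
      · rw [if_pos hji] at hj; exact ⟨n, hn, hj⟩
      · rw [if_neg hji, ← mul_smul] at hj
        exact ⟨n * ρ, mul_mem hn (mem_rotGroup (Set.mem_univ v) hρ), hj⟩
    · rcases lt_trichotomy j i with hji | rfl | hji
      · rw [if_pos hji.le, if_pos (by omega)]
      · rw [if_pos le_rfl, if_neg (by omega)]
        have t := h.conn.triangle (q j) v (ρ • q (j + 1))
        have e := h.acts.dist_smul h.conn ρ v (q (j + 1))
        rw [h.fix v ρ hρ] at e
        unfold Btw at hb
        omega
      · rw [if_neg (by omega), if_neg (by omega), h.acts.dist_smul h.conn]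

theorem Rotating.not_adj_smul (h : Rotating Γ δ M R) {x : V} {ν : Q}
    (hν : Reducible Γ δ R x ν) : ¬ Γ.Adj x (ν • x) := by
  intro ha
  have hl := h.large
  cases hν with
  | base _ h1 => rw [h1] at ha; exact Γ.irrefl ha
  | step _ ρ v hx hνx hρ hρ1 ha' _ =>
    exact h.not_ang_of_reduce hx hνx hρ hρ1 ha' (m := angleBound δ) (by omega)
      (ang_of_adj h.conn h.slim ha)

/-- Lifts of a neighbour of `v` adjacent to `v` are rotations of each other. -/
theorem Rotating.smul_eq_rot (h : Rotating Γ δ M R) {v e : V} {ν : Q}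
    (hν : Reducible Γ δ R e ν) (he : Γ.Adj v e) (he' : Γ.Adj v (ν • e)) :
    ∃ ρ ∈ R v, ρ • ν • e = e := by
  have hl := h.large
  induction hν with
  | base ν hν => exact ⟨1, one_mem _, by simpa using hν⟩
  | step ν ρ u hx hνx hρ hρ1 ha _ ih =>
    have huv : u = v := by
      by_contra hne
      refine h.not_ang_of_reduce hx hνx hρ hρ1 ha (m := 2 * angleBound δ) (by omega) ?_
      exact ((ang_of_adj h.conn h.slim he.symm).trans h.conn (ang_of_adj h.conn h.slim he')
        (Ne.symm hne)).mono (by omega)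
    subst huv
    have hadj := h.acts ρ _ _ he'
    rw [h.fix u ρ hρ, ← mul_smul] at hadj
    obtain ⟨σ, hσ, hσe⟩ := ih hadj
    exact ⟨σ * ρ, mul_mem hσ hρ, by simpa [mul_smul] using hσe⟩

end ClosedLift

/-- The class of actions on hyperbolic graphs which is used in the construction. -/
structure Tame (Q : Type*) [Group Q] {V : Type*} [MulAction Q V] (Γ : SimpleGraph V) : Prop where
  conn : Γ.Connected
  acts : ActsOn Q Γ
  slim : ∃ δ, Slim Γ δ
  acyl : ∀ ε : ℕ, ∃ r n : ℕ, ∀ x y : V, r ≤ Γ.dist x y →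
    {g : Q | Γ.dist x (g • x) ≤ ε ∧ Γ.dist y (g • y) ≤ ε}.encard ≤ n
  ell : ∀ (K : Subgroup Q) (x : V) (b : ℕ), (∀ k ∈ K, Γ.dist x (k • x) ≤ b) →
    ∃ y : V, ∀ k ∈ K, k • y = y
  disj : ∀ (g : Q) (x y : V), g • x = x → g • y = y → x ≠ y → g = 1
  tf : ∀ (g : Q) (x : V), g • x = x → g ≠ 1 → ¬ IsOfFinOrder g

/-- The graph induced on a quotient of the vertex set. -/
def quotGraph {V V' : Type*} (Γ : SimpleGraph V) (π : V → V') : SimpleGraph V' where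
  Adj a b := a ≠ b ∧ ∃ x y, π x = a ∧ π y = b ∧ Γ.Adj x y
  symm := ⟨fun _ _ ⟨h, x, y, hx, hy, ha⟩ => ⟨h.symm, y, x, hy, hx, ha.symm⟩⟩
  loopless := ⟨fun _ h => h.1 rfl⟩

/-- Rotation angles of this size are large enough for quotients. -/
def bigAngle (δ : ℕ) : ℕ := (8 * angleBound δ + 100) * angleBound δ

theorem exists_points {V : Type*} {Γ : SimpleGraph V} (hc : Γ.Connected) (a b : V) :
    ∃ γ : ℕ → V, (∀ t ≤ Γ.dist a b, Btw Γ a (γ t) b) ∧ ∀ t ≤ Γ.dist a b, Γ.dist a (γ t) = t := by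
  have : ∀ t, ∃ p, t ≤ Γ.dist a b → Btw Γ a p b ∧ Γ.dist a p = t := by
    intro t
    by_cases ht : t ≤ Γ.dist a b
    · obtain ⟨p, hp⟩ := exists_point hc a b ht
      exact ⟨p, fun _ => hp⟩
    · exact ⟨a, fun h => absurd h ht⟩
  choose γ hγ using this
  exact ⟨γ, fun t ht => (hγ t ht).1, fun t ht => (hγ t ht).2⟩

/-- An almost-fixed geodesic which bends sharply at `v` is carried through `v`. -/
theorem exists_smul_eq_of_bend {V Q : Type*} [Group Q] [MulAction Q V] {Γ : SimpleGraph V} {δ : ℕ}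
    (hc : Γ.Connected) (hs : Slim Γ δ) (hacts : ActsOn Q Γ) {a b m₁ m₂ v : V} {ε : ℕ}
    (hm₁ : Btw Γ a m₁ b) (hm₂ : Btw Γ m₁ m₂ b) (h₁ : ε < Γ.dist a m₁) (h₂ : ε < Γ.dist m₂ b)
    (h : ¬ Ang Γ v (8 * angleBound δ) m₁ m₂) (γ : ℕ → V)
    (hγ : ∀ t ≤ Γ.dist a b, Btw Γ a (γ t) b) (hγd : ∀ t ≤ Γ.dist a b, Γ.dist a (γ t) = t)
    {g : Q} (hga : Γ.dist a (g • a) ≤ ε) (hgb : Γ.dist b (g • b) ≤ ε) :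
    ∃ t ≤ Γ.dist a b, Γ.dist a v ≤ t + ε ∧ t ≤ Γ.dist a v + ε ∧ g • γ t = v := by
  have hn : ¬ Ang Γ (v) (angleBound δ) m₁ m₂ := fun h' => h (h'.mono (by omega))
  have hb := btw_of_not_ang hc hs hn
  have hne1 := ne_of_not_ang hc hs hn
  have hne2 := ne_of_not_ang hc hs (fun h' => hn h'.symm)
  have p1 := hc.pos_dist_of_ne hne1
  have p2 := hc.pos_dist_of_ne hne2
  have c0 := Γ.dist_swap m₂ v
  have sab : Γ.dist a m₁ + Γ.dist m₁ (v) + Γ.dist (v) m₂ + Γ.dist m₂ b = Γ.dist a b := by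
    unfold Btw at *; omega
  have t1 := hc.triangle a m₁ v
  have t2 := hc.triangle v m₂ b
  have t3 := hc.triangle a v b
  have q1 := hc.triangle a (g • a) v
  have q2 := hc.triangle (g • a) a v
  have c1 := Γ.dist_swap a (g • a)
  have c2 := Γ.dist_swap b (g • b)
  have c3 := Γ.dist_swap v b
  have c4 := Γ.dist_swap v a
  have c5 := Γ.dist_swap a m₁
  have c7 := Γ.dist_swap b m₂
  have e := hacts.dist_smul hc g a b
  have mid : ∀ z, Btw Γ (g • a) (v) z ∨ Btw Γ z (v) (g • b) := by
    intro z
    obtain ⟨i, hi, hbi⟩ := exists_btw_of_not_ang hc hs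
      (fun i => if i = 0 then m₁ else if i = 1 then a else if i = 2 then g • a else
        if i = 3 then z else if i = 4 then g • b else if i = 5 then b else m₂)
      (k := 6) (n := 8 * angleBound δ) (by omega) (by omega) (by simpa using h)
    grind [Btw]
  have hle : Γ.dist (g • a) (v) ≤ Γ.dist a b := by
    grind
  obtain ⟨t, ht⟩ : ∃ t, t = Γ.dist (g • a) (v) := ⟨_, rfl⟩
  rw [← ht] at hle
  refine ⟨t, hle, by omega, by omega, ?_⟩
  have e1 := hacts.dist_smul hc g a (γ t)
  have e2 := hacts.dist_smul hc g (γ t) b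
  have e3 := hγd t hle
  have e4 := hγ t
  have e5 := hc.triangle (g • a) v (g • b)
  have c8 := Γ.dist_swap v (g • γ t)
  refine (hc.dist_eq_zero_iff).1 ?_
  rcases mid (g • γ t) with h1 | h1 <;> unfold Btw at h1 e4 <;> omega

theorem Av.exists_seq {V : Type*} {Γ : SimpleGraph V} {v x y : V} {n : ℕ} (h : Av Γ v n x y) :
    ∃ q : ℕ → V, q 0 = x ∧ q n = y ∧ (∀ i, q i ≠ v) ∧
      ∀ i, q i = q (i + 1) ∨ Γ.Adj (q i) (q (i + 1)) := by
  induction h with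
  | refl n x hx => exact ⟨fun _ => x, rfl, rfl, fun _ => hx, fun _ => .inl rfl⟩
  | cons n x y z hx ha _ ih =>
    obtain ⟨q, h0, hn, hv, hq⟩ := ih
    refine ⟨fun i => Nat.casesOn i x q, rfl, hn, ?_, ?_⟩
    · rintro (_ | i)
      · exact hx
      · exact hv i
    · rintro (_ | i)
      · right; simpa [h0] using ha
      · exact hq i

theorem av_of_seq {V : Type*} {Γ : SimpleGraph V} {v : V} (q : ℕ → V) {n : ℕ}
    (hv : ∀ i ≤ n, q i ≠ v) (hq : ∀ i < n, q i = q (i + 1) ∨ Γ.Adj (q i) (q (i + 1))) :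
    Av Γ v n (q 0) (q n) := by
  induction n with
  | zero => exact .refl _ _ (hv 0 le_rfl)
  | succ n ih =>
    have h1 := ih (fun i hi => hv i (by omega)) (fun i hi => hq i (by omega))
    rcases hq n (by omega) with he | ha
    · rw [← he]; exact h1.mono (by omega)
    · exact h1.trans (.cons 0 _ _ _ (hv n (by omega)) ha (.refl _ _ (hv _ le_rfl)))

/-- A quotient by the group generated by all rotations. -/
structure QuotData {V V' Q Q' : Type*} [Group Q] [Group Q'] [MulAction Q V] [MulAction Q' V']
    (Γ : SimpleGraph V) (δ M : ℕ) (R : V → Subgroup Q) (ψ : Q →* Q') (π : V → V') : Prop where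
  rot : Rotating Γ δ M R
  big : bigAngle δ ≤ M
  stab : ∀ (v : V) (g : Q), R v ≠ ⊥ → g • v = v → g ∈ R v
  nonadj : ∀ v w : V, Γ.Adj v w → R v = ⊥ ∨ R w = ⊥
  disj : ∀ (g : Q) (x y : V), g • x = x → g • y = y → x ≠ y → g = 1
  psi_surj : Function.Surjective ψ
  ker : ∀ g, ψ g = 1 ↔ g ∈ rotGroup R Set.univ
  pi_surj : Function.Surjective π
  fib : ∀ x y, π x = π y ↔ ∃ ν ∈ rotGroup R Set.univ, y = ν • x
  equiv : ∀ (g : Q) (x : V), π (g • x) = ψ g • π x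

namespace QuotData

variable {V V' Q Q' : Type*} [Group Q] [Group Q'] [MulAction Q V] [MulAction Q' V']
variable {Γ : SimpleGraph V} {δ M : ℕ} {R : V → Subgroup Q} {ψ : Q →* Q'} {π : V → V'}

theorem pi_smul (D : QuotData Γ δ M R ψ π) {ν : Q} (hν : ν ∈ rotGroup R Set.univ) (x : V) : π
    (ν • x) = π x :=
  ((D.fib _ _).2 ⟨ν, hν, rfl⟩).symm

theorem adj (D : QuotData Γ δ M R ψ π) {x y : V} (h : Γ.Adj x y) : (quotGraph Γ π).Adj (π x)
    (π y) := by
  refine ⟨fun he => ?_, x, y, rfl, rfl, h⟩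
  obtain ⟨ν, hν, rfl⟩ := (D.fib _ _).1 he
  exact D.rot.not_adj_smul (D.rot.reducible x ν hν) h

theorem exists_adj (D : QuotData Γ δ M R ψ π) {x : V} {b : V'} (h : (quotGraph Γ π).Adj (π x) b) :
    ∃ y, π y = b ∧ Γ.Adj x y := by
  obtain ⟨-, x₁, y₁, hx, rfl, ha⟩ := h
  obtain ⟨ν, hν, rfl⟩ := (D.fib _ _).1 hx
  exact ⟨ν • y₁, D.pi_smul hν _, D.rot.acts ν _ _ ha⟩

theorem conn (D : QuotData Γ δ M R ψ π) : (quotGraph Γ π).Connected := by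
  have := D.rot.conn.nonempty
  have : Nonempty V' := this.map π
  refine ⟨fun a b => ?_⟩
  obtain ⟨x, rfl⟩ := D.pi_surj a
  obtain ⟨y, rfl⟩ := D.pi_surj b
  obtain ⟨w⟩ := D.rot.conn.preconnected x y
  exact ⟨w.map ⟨π, D.adj⟩⟩

theorem dist_le (D : QuotData Γ δ M R ψ π) (x y : V) : (quotGraph Γ π).dist (π x) (π y) ≤ Γ.dist x
    y := by
  obtain ⟨w, hw⟩ := D.rot.conn.exists_walk_length_eq_dist x y
  rw [← hw, ← w.length_map ⟨π, D.adj⟩]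
  exact SimpleGraph.dist_le _

theorem lift (D : QuotData Γ δ M R ψ π) (x : V) (b : V') : ∃ y, π y = b ∧ Γ.dist x
    y = (quotGraph Γ π).dist (π x) b := by
  have key : ∀ (a b : V') (w : (quotGraph Γ π).Walk a b) (x : V), π x = a →
      ∃ y, π y = b ∧ Γ.dist x y ≤ w.length := by
    intro a b w
    induction w with
    | nil => exact fun x hx => ⟨x, hx, by simp⟩
    | cons ha w ih =>
      rintro x rfl
      obtain ⟨y, hy, hxy⟩ := D.exists_adj ha
      obtain ⟨z, hz, hd⟩ := ih y hy
      refine ⟨z, hz, ?_⟩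
      have := D.rot.conn.triangle x y z
      rw [hxy.dist_eq_one] at this
      rw [SimpleGraph.Walk.length_cons]
      omega
  obtain ⟨w, hw⟩ := D.conn.exists_walk_length_eq_dist (π x) b
  obtain ⟨y, rfl, hd⟩ := key _ _ w x rfl
  exact ⟨y, rfl, le_antisymm (hd.trans hw.le) (D.dist_le x y)⟩

theorem acts (D : QuotData Γ δ M R ψ π) : ActsOn Q' (quotGraph Γ π) := by
  rintro g a b ⟨hne, x, y, rfl, rfl, ha⟩
  obtain ⟨g, rfl⟩ := D.psi_surj g
  rw [← D.equiv, ← D.equiv]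
  exact D.adj (D.rot.acts g _ _ ha)

theorem bot_smul (D : QuotData Γ δ M R ψ π) {v : V} (h : R v = ⊥) (g : Q) : R (g • v) = ⊥ := by
  refine (Subgroup.eq_bot_iff_forall _).2 fun ρ hρ => ?_
  have := D.rot.conj g⁻¹ _ ρ hρ
  rw [inv_smul_smul, h, Subgroup.mem_bot] at this
  have e : ρ = g * (g⁻¹ * ρ * g⁻¹⁻¹) * g⁻¹ := by group
  rw [e, this]; simp

theorem mem_of_fix (D : QuotData Γ δ M R ψ π) {x : V} {ν : Q} (hν : ν ∈ rotGroup R Set.univ)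
    (h : ν • x = x) : ν ∈ R x := by
  by_cases hV : ∀ y, y = x
  · refine (Subgroup.closure_le (R x)).2 ?_ hν
    rintro ρ ⟨v, -, hρ⟩
    rwa [hV v] at hρ
  · push Not at hV
    obtain ⟨y, hy⟩ := hV
    obtain ⟨e, he, -⟩ := exists_next D.rot.conn hy.symm
    have he' := D.rot.acts ν _ _ he
    rw [h] at he'
    obtain ⟨ρ, hρ, hρe⟩ := D.rot.smul_eq_rot (D.rot.reducible e ν hν) he he'
    have h1 : ρ * ν = 1 := by
      refine D.disj _ x e ?_ ?_ he.ne
      · rw [mul_smul, h, D.rot.fix x ρ hρ]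
      · rw [mul_smul, hρe]
    rw [eq_inv_of_mul_eq_one_right h1]
    exact inv_mem hρ

theorem exists_stab (D : QuotData Γ δ M R ψ π) {x : V} {g : Q'} (h : g • π x = π x) : ∃ g₀, ψ
    g₀ = g ∧ g₀ • x = x := by
  obtain ⟨g, rfl⟩ := D.psi_surj g
  rw [← D.equiv, D.fib] at h
  obtain ⟨ν, hν, h⟩ := h
  exact ⟨ν * g, by rw [map_mul, (D.ker ν).2 hν, one_mul], by rw [mul_smul, ← h]⟩

theorem eq_one_of_apex (D : QuotData Γ δ M R ψ π) {v : V} (hv : R v ≠ ⊥) {g : Q'}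
    (h : g • π v = π v) : g = 1 := by
  obtain ⟨g, rfl, hg⟩ := D.exists_stab h
  exact (D.ker g).2 (mem_rotGroup (Set.mem_univ v) (D.stab v g hv hg))

theorem psi_ne_one (D : QuotData Γ δ M R ψ π) {x : V} (hx : R x = ⊥) {g : Q} (h : g • x = x)
    (hg : ψ g = 1) : g = 1 := by
  have := D.mem_of_fix ((D.ker g).1 hg) h
  rwa [hx, Subgroup.mem_bot] at this

theorem tf (D : QuotData Γ δ M R ψ π) (htf : ∀ (g : Q) (x : V), g • x = x → g ≠ 1 → ¬ IsOfFinOrder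
    g) (g : Q') (a : V')
    (h : g • a = a) (hg : g ≠ 1) : ¬ IsOfFinOrder g := by
  obtain ⟨x, rfl⟩ := D.pi_surj a
  by_cases hx : R x = ⊥
  · obtain ⟨g, rfl, hgx⟩ := D.exists_stab h
    intro hfin
    obtain ⟨n, hn, hgn⟩ := isOfFinOrder_iff_pow_eq_one.1 hfin
    refine htf g x hgx (fun h1 => hg (by rw [h1, map_one])) ?_
    refine isOfFinOrder_iff_pow_eq_one.2 ⟨n, hn, D.psi_ne_one hx ?_ (by rw [map_pow, hgn])⟩
    exact (MulAction.stabilizer Q x).pow_mem hgx n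
  · exact absurd (D.eq_one_of_apex hx h) hg

theorem polygon (D : QuotData Γ δ M R ψ π) {k : ℕ} (hk : 1 ≤ k)
    (hkM : k * angleBound δ + 4 * angleBound δ ≤ M)
    (p : ℕ → V') (hp : p k = p 0) {x : V} (hx : π x = p 0) :
    ∃ q : ℕ → V, q 0 = x ∧ q k = x ∧ (∀ i, π (q i) = p i) ∧
      ∀ i < k, Γ.dist (q i) (q (i + 1)) = (quotGraph Γ π).dist (p i) (p (i + 1)) := by
  choose nx hn1 hn2 using D.lift
  let q : ℕ → V := fun i => Nat.rec x (fun i y => nx y (p (i + 1))) i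
  have hq : ∀ i, π (q i) = p i := by
    rintro (_ | i)
    · exact hx
    · exact hn1 _ _
  have hd : ∀ i, Γ.dist (q i) (q (i + 1)) = (quotGraph Γ π).dist (p i) (p (i + 1)) := by
    intro i
    rw [← hq i]
    exact hn2 _ _
  obtain ⟨ν, hν, hqk⟩ := (D.fib x (q k)).1 (by rw [hq, hp, hx])
  obtain ⟨q', h0, hk', hN, hd'⟩ :=
    D.rot.closed_lift hk hkM (D.rot.reducible x ν hν) q rfl hqk
  have hπ : ∀ i, π (q' i) = p i := by
    intro i
    obtain ⟨n, hn, hi⟩ := hN i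
    rw [hi, D.pi_smul hn, hq]
  refine ⟨q', h0, hk', hπ, fun i hi => le_antisymm ((hd' i hi).trans (hd i).le) ?_⟩
  rw [← hπ, ← hπ]
  exact D.dist_le _ _

theorem slim (D : QuotData Γ δ M R ψ π) : Slim (quotGraph Γ π) δ := by
  intro x y z p hp
  have hM := D.big
  have hM' : 4 * angleBound δ + 4 * angleBound δ ≤ M := by unfold bigAngle at hM; nlinarith
  obtain ⟨x', hx'⟩ := D.pi_surj x
  obtain ⟨q, h0, h4, hπ, hd⟩ := D.polygon (k := 4) (by omega) hM'
    (fun i => if i = 1 then p else if i = 2 then y else if i = 3 then z else x) (by simp)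
    (x := x') (by simpa using hx')
  have p0 := hπ 0
  have p1 := hπ 1
  have p2 := hπ 2
  have p3 := hπ 3
  have d0 := hd 0
  have d1 := hd 1
  have d2 := hd 2
  have d3 := hd 3
  rw [h4, ← h0] at d3
  simp at p0 p1 p2 p3 d0 d1 d2 d3
  have dd := D.dist_le (q 0) (q 2)
  rw [p0, p2] at dd
  have tt := D.rot.conn.triangle (q 0) (q 1) (q 2)
  have hb : Btw Γ (q 0) (q 1) (q 2) := by
    unfold Btw at *; omega
  obtain ⟨m, hm, hmd⟩ := D.rot.slim _ _ (q 3) _ hb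
  refine ⟨π m, ?_, ?_⟩
  · have t1 := D.dist_le (q 0) m
    have t2 := D.dist_le m (q 3)
    have t3 := D.dist_le (q 3) m
    have t4 := D.dist_le m (q 2)
    rw [p0] at t1
    rw [p3] at t2 t3
    rw [p2] at t4
    have e1 := Γ.dist_swap (q 3) (q 0)
    have e2 := Γ.dist_swap (q 3) (q 2)
    have e3 := (quotGraph Γ π).dist_swap x z
    have e4 := (quotGraph Γ π).dist_swap y z
    have s1 := D.conn.triangle x (π m) z
    have s2 := D.conn.triangle z (π m) y
    grind [Btw]
  · rw [← p1]
    exact (D.dist_le _ _).trans hmd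

/-- Small angles at the image of an apex come from small angles upstairs. -/
theorem exists_av (D : QuotData Γ δ M R ψ π) {v e e' : V} (he : Γ.Adj v e) (he' : Γ.Adj v e')
    (h : Av (quotGraph Γ π) (π v) (8 * angleBound δ) (π e) (π e')) :
    ∃ ρ ∈ R v, Av Γ v (8 * angleBound δ) e (ρ • e') := by
  have hM := D.big
  obtain ⟨p, hp0, hpn, hpv, hp⟩ := h.exists_seq
  set n := 8 * angleBound δ with hn
  have hM' : (n + 2) * angleBound δ + 4 * angleBound δ ≤ M := by unfold bigAngle at hM; nlinarith
  obtain ⟨q, h0, hk, hπ, hd⟩ := D.polygon (k := n + 2) (by omega) hM'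
    (fun i => if i = 0 then π v else if i ≤ n + 1 then p (i - 1) else π v) (by simp)
    (x := v) (by simp)
  have adj_of : ∀ x y, Γ.dist x y = 1 → Γ.Adj x y := fun x y => SimpleGraph.dist_eq_one_iff_adj.1
  have hπi : ∀ i ≤ n, π (q (i + 1)) = p i := by
    grind
  have hav : Av Γ v n (q 1) (q (n + 1)) := by
    refine av_of_seq (fun i => q (i + 1)) ?_ ?_
    · grind
    · intro i hi
      have := hd (i + 1) (by omega)
      simp [show i + 1 ≤ n + 1 by omega, show i + 1 + 1 ≤ n + 1 by omega] at this
      rcases hp i with h1 | h1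
      · left
        rw [h1] at this
        simp only [SimpleGraph.dist_self] at this
        exact (D.rot.conn.dist_eq_zero_iff).1 this
      · grind [SimpleGraph.Adj.dist_eq_one]
  have h1 : Γ.Adj v (q 1) := by
    grind [QuotData.adj, SimpleGraph.Adj.dist_eq_one]
  have h2 : Γ.Adj v (q (n + 1)) := by
    have := hd (n + 1) (by omega)
    simp [hk, hpn, (D.adj he').symm.dist_eq_one] at this
    exact this.symm
  have rotate : ∀ e f, Γ.Adj v e → Γ.Adj v f → π f = π e → ∃ ρ ∈ R v, f = ρ • e := by
    intro e f he hf hef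
    obtain ⟨ν, hν, rfl⟩ := (D.fib _ _).1 hef.symm
    obtain ⟨ρ, hρ, hρe⟩ := D.rot.smul_eq_rot (D.rot.reducible e ν hν) he hf
    exact ⟨ρ⁻¹, inv_mem hρ, by rw [eq_inv_smul_iff, hρe]⟩
  obtain ⟨ρ₁, hρ₁, e1⟩ := rotate e _ he h1 (by rw [hπi 0 (by omega), hp0])
  obtain ⟨ρ₂, hρ₂, e2⟩ := rotate e' _ he' h2 (by rw [hπi n le_rfl, hpn])
  refine ⟨ρ₁⁻¹ * ρ₂, mul_mem (inv_mem hρ₁) hρ₂, ?_⟩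
  have := D.rot.acts.av_smul ρ₁⁻¹ hav
  rw [D.rot.fix v _ (inv_mem hρ₁), e1, e2, inv_smul_smul, ← mul_smul] at this
  exact this

theorem mem_lk (D : QuotData Γ δ M R ψ π) {v x e : V} (h : e ∈ Lk Γ v x)
    (hd : Γ.dist v x = (quotGraph Γ π).dist (π v) (π x)) : π e ∈ Lk (quotGraph Γ π) (π v)
      (π x) := by
  refine ⟨D.adj h.1, ?_⟩
  have h1 := h.2
  have h2 := D.dist_le e x
  have h3 := D.conn.triangle (π v) (π e) (π x)
  rw [(D.adj h.1).dist_eq_one] at h3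
  omega

theorem exists_rigid_lift (D : QuotData Γ δ M R ψ π) (n : ℕ) (x : V) (b : V')
    (hn : (quotGraph Γ π).dist (π x) b = n)
    (h : ∀ v, R v ≠ ⊥ → Ang (quotGraph Γ π) (π v) (8 * angleBound δ) (π x) b) :
    ∃ y, π y = b ∧ Γ.dist x y = n ∧ ∀ v, R v ≠ ⊥ → v ≠ x → v ≠ y →
      ∃ e ∈ Lk Γ v x, ∃ e' ∈ Lk Γ v y, Av Γ v (8 * angleBound δ) e e' := by
  have hc := D.rot.conn
  have hs := D.rot.slim
  induction n generalizing b with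
  | zero =>
    refine ⟨x, (D.conn.dist_eq_zero_iff).1 hn, by simp, fun v _ hx _ => ?_⟩
    obtain ⟨e, he⟩ := exists_next hc hx
    exact ⟨e, he, e, he, .refl _ _ he.1.ne'⟩
  | succ n ih =>
    have hne : b ≠ π x := by rintro rfl; simp at hn
    obtain ⟨a, ha, had⟩ := exists_next D.conn hne
    rw [(quotGraph Γ π).dist_comm, (quotGraph Γ π).dist_comm (u := b)] at had
    have han : (quotGraph Γ π).dist (π x) a = n := by omega
    obtain ⟨z, rfl, hz, hrig⟩ := ih a han (fun v hv => by
      by_contra hcon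
      have hcon' : ¬ Ang (quotGraph Γ π) (π v) (angleBound δ) (π x) a :=
        fun h' => hcon (h'.mono (by omega))
      have hb := btw_of_not_ang D.conn D.slim hcon'
      have hva : Btw (quotGraph Γ π) (π x) (π v) b := by
        have t1 := D.conn.triangle (π v) a b
        have t2 := D.conn.triangle (π x) (π v) b
        rw [ha.symm.dist_eq_one] at t1
        unfold Btw at *
        omega
      have hsub : ∀ e ∈ Lk (quotGraph Γ π) (π v) a, e ∈ Lk (quotGraph Γ π) (π v) b := by
        rintro e ⟨he, hed⟩
        refine ⟨he, ?_⟩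
        have t1 := D.conn.triangle (π v) e b
        have t2 := D.conn.triangle e a b
        rw [ha.symm.dist_eq_one] at t2
        rw [he.dist_eq_one] at t1
        unfold Btw at *
        omega
      refine hcon fun e he e' he' => h v hv e ?_ e' ?_
      · exact he.imp id (hsub e)
      · exact he'.imp id (hsub e'))
    obtain ⟨y₀, hy₀, hzy₀⟩ := D.exists_adj ha.symm
    obtain ⟨y, hy, hzy, hzrig⟩ : ∃ y, π y = b ∧ Γ.Adj z y ∧ (R z ≠ ⊥ → z ≠ x →
        ∃ e ∈ Lk Γ z x, Av Γ z (8 * angleBound δ) e y) := by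
      by_cases hzb : R z ≠ ⊥ ∧ z ≠ x
      · obtain ⟨e, he⟩ := exists_next hc hzb.2
        have h1 : π e ∈ Lk (quotGraph Γ π) (π z) (π x) :=
          D.mem_lk he (by rw [Γ.dist_comm, hz, (quotGraph Γ π).dist_comm, han])
        have h2 : π y₀ ∈ Lk (quotGraph Γ π) (π z) b := by
          refine ⟨D.adj hzy₀, ?_⟩
          rw [hy₀, ha.symm.dist_eq_one]; simp
        obtain ⟨ρ, hρ, hav⟩ := D.exists_av he.1 hzy₀ (h z hzb.1 _ (.inl h1) _ (.inr h2))
        have hadj := D.rot.acts ρ _ _ hzy₀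
        rw [D.rot.fix z ρ hρ] at hadj
        exact ⟨ρ • y₀, by rw [D.pi_smul (mem_rotGroup (Set.mem_univ z) hρ), hy₀], hadj,
          fun _ _ => ⟨e, he, hav⟩⟩
      · grind
    have hxy : Γ.dist x y = n + 1 := by
      have t1 := hc.triangle x z y
      rw [hzy.dist_eq_one] at t1
      have := D.dist_le x y
      rw [hy] at this
      omega
    refine ⟨y, hy, hxy, fun v hv hvx hvy => ?_⟩
    by_cases hvz : v = z
    · subst hvz
      obtain ⟨e, he, hav⟩ := hzrig hv hvx
      exact ⟨e, he, y, ⟨hzy, by simp [hzy.dist_eq_one]⟩, hav⟩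
    by_cases hb : Btw Γ x v z
    · obtain ⟨e, he, e', he', hav⟩ := hrig v hv hvx hvz
      refine ⟨e, he, e', ⟨he'.1, ?_⟩, hav⟩
      have t1 := hc.triangle v e' y
      have t2 := hc.triangle e' z y
      have t3 := hc.triangle v z y
      have t4 := hc.triangle x v y
      rw [hzy.dist_eq_one] at t2 t3
      rw [he'.1.dist_eq_one] at t1
      have := he'.2
      unfold Btw at hb
      omega
    · have h1 : Ang Γ v (angleBound δ) x z := by
        grind [btw_of_not_ang]
      have h2 := h1.trans hc (ang_of_adj hc hs hzy) (Ne.symm hvz)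
      obtain ⟨e, he⟩ := exists_next hc hvx
      obtain ⟨e', he'⟩ := exists_next hc hvy
      exact ⟨e, he, e', he', (h2 e (.inl he) e' (.inr he')).mono (by omega)⟩

/-- Either there is a large angle between two points of the quotient, or they have lifts
without large angles. -/
theorem exists_rigid (D : QuotData Γ δ M R ψ π) (x : V) (b : V')
    (h : ∀ v, R v ≠ ⊥ → Ang (quotGraph Γ π) (π v) (8 * angleBound δ) (π x) b) :
    ∃ y, π y = b ∧ Γ.dist x y = (quotGraph Γ π).dist (π x) b ∧
      ∀ v, R v ≠ ⊥ → v ≠ x → v ≠ y → Ang Γ v (10 * angleBound δ) x y := by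
  obtain ⟨y, hy, hd, hr⟩ := D.exists_rigid_lift _ x b rfl h
  refine ⟨y, hy, hd, fun v hv hx hy => ?_⟩
  obtain ⟨e, he, e', he', hav⟩ := hr v hv hx hy
  have key : ∀ f ∈ Lk Γ v x ∪ Lk Γ v y, Av Γ v (angleBound δ) f e ∨ Av Γ v (angleBound δ) f e' := by
    rintro f (hf | hf)
    · exact .inl (lk_av D.rot.conn D.rot.slim hf he)
    · exact .inr (lk_av D.rot.conn D.rot.slim hf he')
  intro f hf f' hf'
  rcases key f hf with h1 | h1 <;> rcases key f' hf' with h2 | h2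
  · exact (h1.trans h2.symm).mono (by omega)
  · exact ((h1.trans hav).trans h2.symm).mono (by omega)
  · exact ((h1.trans hav.symm).trans h2.symm).mono (by omega)
  · exact (h1.trans h2.symm).mono (by omega)

theorem exists_displacement_aux (D : QuotData Γ δ M R ψ π) {x y : V} (ε : ℕ)
    (hr : ∀ v, R v ≠ ⊥ → v ≠ x → v ≠ y → Ang Γ v (10 * angleBound δ) x y)
    {ν : Q} (hν : Reducible Γ δ R x ν) (g : Q)
    (hy : Γ.dist y (g • y) ≤ ε) (hx : Γ.dist (g • x) (ν • x) ≤ ε) :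
    ∃ n ∈ rotGroup R Set.univ,
      Γ.dist x ((n * g) • x) ≤ ε ∧ Γ.dist y ((n * g) • y) ≤ ε := by
  have hc := D.rot.conn
  have hs := D.rot.slim
  have hM : 26 * angleBound δ ≤ M := by
    have hM := D.big
    unfold bigAngle at hM; nlinarith
  induction hν generalizing g with
  | base ν hν =>
    rw [hν, Γ.dist_comm] at hx
    exact ⟨1, one_mem _, by simpa using hx, by simpa using hy⟩
  | step ν ρ v hxv hνv hρ hρ1 ha _ ih =>
    have hna := D.rot.not_ang_of_reduce hxv hνv hρ hρ1 ha (m := 22 * angleBound δ) (by omega)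
    have hv : R v ≠ ⊥ := fun hb => hρ1 (by rwa [hb, Subgroup.mem_bot] at hρ)
    have key : Btw Γ y v (g • y) ∨ Btw Γ (g • x) v (ν • x) := by
      by_contra hcon
      push Not at hcon
      have hvy : y ≠ v := by rintro rfl; exact hcon.1 btw_left
      have hvgy : g • y ≠ v := by intro he; exact hcon.1 (he ▸ btw_right)
      have hvgx : g • x ≠ v := by intro he; exact hcon.2 (he ▸ btw_left)
      have h1 := hr v hv hxv.symm hvy.symm
      have h2 : Ang Γ v (angleBound δ) y (g • y) := by
        grind [btw_of_not_ang]
      have h4 : Ang Γ v (angleBound δ) (g • x) (ν • x) := by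
        grind [btw_of_not_ang]
      have h3 : Ang Γ v (10 * angleBound δ) (g • x) (g • y) := by
        have := hr (g⁻¹ • v) (fun hb => hv (by simpa using D.bot_smul hb g))
          (fun he => hvgx (by rw [← he, smul_inv_smul]))
          (fun he => hvgy (by rw [← he, smul_inv_smul]))
        simpa using D.rot.acts.ang_smul hc g this
      exact hna ((((h1.trans hc h2 hvy).trans hc h3.symm hvgy).trans hc h4 hvgx).mono (by omega))
    rcases key with hb | hb
    · obtain ⟨n, hn, h1, h2⟩ := ih (ρ * g) (by
        have t := hc.triangle y v ((ρ * g) • y)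
        have e := D.rot.acts.dist_smul hc ρ v (g • y)
        rw [D.rot.fix v ρ hρ, ← mul_smul] at e
        unfold Btw at hb
        omega) (by rw [mul_smul, mul_smul, D.rot.acts.dist_smul hc]; exact hx)
      exact ⟨n * ρ, mul_mem hn (mem_rotGroup (Set.mem_univ v) hρ), by rwa [mul_assoc],
        by rwa [mul_assoc]⟩
    · refine ih g hy ?_
      have t := hc.triangle (g • x) v ((ρ * ν) • x)
      have e := D.rot.acts.dist_smul hc ρ v (ν • x)
      rw [D.rot.fix v ρ hρ, ← mul_smul] at e
      unfold Btw at hb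
      omega

/-- Elements with small displacement at a rigid pair lift to elements with small displacement. -/
theorem exists_displacement (D : QuotData Γ δ M R ψ π) {x y : V} (ε : ℕ)
    (hr : ∀ v, R v ≠ ⊥ → v ≠ x → v ≠ y → Ang Γ v (10 * angleBound δ) x y)
    (g : Q')
    (hx : (quotGraph Γ π).dist (π x) (g • π x) ≤ ε)
    (hy : (quotGraph Γ π).dist (π y) (g • π y) ≤ ε) :
    ∃ g₀, ψ g₀ = g ∧ Γ.dist x (g₀ • x) ≤ ε ∧ Γ.dist y (g₀ • y) ≤ ε := by
  obtain ⟨g, rfl⟩ := D.psi_surj g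
  rw [← D.equiv] at hx hy
  obtain ⟨y', hy', hd'⟩ := D.lift y (π (g • y))
  obtain ⟨n, hn, rfl⟩ := (D.fib _ _).1 hy'.symm
  have hψ : ψ (n * g) = ψ g := by rw [map_mul, (D.ker n).2 hn, one_mul]
  obtain ⟨x', hx', hdx⟩ := D.lift ((n * g) • x) (π x)
  obtain ⟨ν, hν, rfl⟩ := (D.fib _ _).1 hx'.symm
  obtain ⟨n', hn', h1, h2⟩ := D.exists_displacement_aux ε hr (D.rot.reducible x ν hν) (n * g)
    (by rw [mul_smul, hd']; exact hy)
    (by rw [hdx, D.equiv, hψ, ← D.equiv, (quotGraph Γ π).dist_comm]; exact hx)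
  exact ⟨n' * (n * g), by rw [map_mul, (D.ker n').2 hn', one_mul, hψ], h1, h2⟩

theorem disj' (D : QuotData Γ δ M R ψ π) (g : Q') (a b : V') (ha : g • a = a) (hb : g • b = b)
    (hab : a ≠ b) : g = 1 := by
  obtain ⟨x, rfl⟩ := D.pi_surj a
  by_cases h : ∀ v, R v ≠ ⊥ → Ang (quotGraph Γ π) (π v) (8 * angleBound δ) (π x) b
  · obtain ⟨y, rfl, hd, hr⟩ := D.exists_rigid x b h
    obtain ⟨g₀, rfl, h1, h2⟩ := D.exists_displacement 0 hr g (by simp [ha]) (by simp [hb])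
    rw [D.disj g₀ x y ((D.rot.conn.dist_eq_zero_iff).1 (Nat.le_zero.1 h1)).symm
      ((D.rot.conn.dist_eq_zero_iff).1 (Nat.le_zero.1 h2)).symm (fun he => hab (by rw [he])),
        map_one]
  · push Not at h
    obtain ⟨v, hv, hn⟩ := h
    refine D.eq_one_of_apex hv ?_
    have e1 := D.acts.dist_smul D.conn g (π x) (π v)
    have e2 := D.acts.dist_smul D.conn g (π v) b
    rw [ha] at e1
    rw [hb] at e2
    have c1 := (quotGraph Γ π).dist_swap (g • π v) (π v)
    refine (D.conn.dist_eq_zero_iff).1 ?_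
    rcases btw_or_btw_of_not_ang D.conn D.slim (by omega) hn (g • π v) with h1 | h1 <;>
      unfold Btw at h1 <;> omega

theorem encard_le_of_apex (D : QuotData Γ δ M R ψ π) {a b m₁ m₂ : V'} {ε : ℕ} {v : V} (hv : R v ≠ ⊥)
    (hm₁ : Btw (quotGraph Γ π) a m₁ b) (hm₂ : Btw (quotGraph Γ π) m₁ m₂ b)
    (h₁ : ε < (quotGraph Γ π).dist a m₁) (h₂ : ε < (quotGraph Γ π).dist m₂ b)
    (h : ¬ Ang (quotGraph Γ π) (π v) (8 * angleBound δ) m₁ m₂) :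
    {g : Q' | (quotGraph Γ π).dist a (g • a) ≤ ε ∧ (quotGraph Γ π).dist b (g • b) ≤ ε}.encard ≤
      (2 * ε + 1 : ℕ) := by
  set Γ' := quotGraph Γ π with hΓ'
  have hc : Γ'.Connected := D.conn
  have hs : Slim Γ' δ := D.slim
  have hacts : ActsOn Q' Γ' := D.acts
  obtain ⟨γ, hγ, hγd⟩ := exists_points hc a b
  have key : ∀ g : Q', Γ'.dist a (g • a) ≤ ε → Γ'.dist b (g • b) ≤ ε →
      ∃ t ≤ Γ'.dist a b, Γ'.dist a (π v) ≤ t + ε ∧ t ≤ Γ'.dist a (π v) + ε ∧ g • γ t = π v :=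
    fun g hga hgb => exists_smul_eq_of_bend hc hs hacts hm₁ hm₂ h₁ h₂ h γ hγ hγd hga hgb
  set s := Γ'.dist a (π v) with hsdef
  choose! τ hτ h1 h2 h3 using key
  set S := {g : Q' | Γ'.dist a (g • a) ≤ ε ∧ Γ'.dist b (g • b) ≤ ε}
  have hinj : Set.InjOn τ S := by
    intro g hg g' hg' he
    have e1 := h3 g hg.1 hg.2
    have e2 := h3 g' hg'.1 hg'.2
    rw [he] at e1
    have : (g * g'⁻¹) • π v = π v := by
      rw [← e2, mul_smul, inv_smul_smul, e1, e2]
    exact mul_inv_eq_one.1 (D.eq_one_of_apex hv this)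
  have hmaps : τ '' S ⊆ (Finset.Icc (s - ε) (s + ε) : Finset ℕ) := by
    grind
  rw [← hinj.encard_image]
  refine (Set.encard_le_encard hmaps).trans ?_
  rw [Set.encard_coe_eq_coe_finsetCard, Nat.card_Icc]
  exact_mod_cast (by omega : s + ε + 1 - (s - ε) ≤ 2 * ε + 1)

theorem acyl (D : QuotData Γ δ M R ψ π) (hacyl : ∀ ε : ℕ, ∃ r n : ℕ, ∀ x y : V, r ≤ Γ.dist x y →
      {g : Q | Γ.dist x (g • x) ≤ ε ∧ Γ.dist y (g • y) ≤ ε}.encard ≤ n) (ε : ℕ) :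
    ∃ r n : ℕ, ∀ a b : V', r ≤ (quotGraph Γ π).dist a b →
      {g : Q' | (quotGraph Γ π).dist a (g • a) ≤ ε ∧
        (quotGraph Γ π).dist b (g • b) ≤ ε}.encard ≤ n := by
  obtain ⟨r, n, hrn⟩ := hacyl (3 * ε + 6 * δ)
  refine ⟨r + 2 * ε + 2, n + (2 * ε + 1), fun a b hab => ?_⟩
  obtain ⟨m₁, hm₁, hd₁⟩ := exists_point D.conn a b (i := ε + 1) (by omega)
  obtain ⟨m₂, hm₂, hd₂⟩ := exists_point D.conn m₁ b (i := (quotGraph Γ π).dist m₁ b - (ε + 1))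
    (by omega)
  have hm₁' := hm₁
  have hm₂' := hm₂
  unfold Btw at hm₁' hm₂'
  by_cases h : ∀ v, R v ≠ ⊥ → Ang (quotGraph Γ π) (π v) (8 * angleBound δ) m₁ m₂
  · obtain ⟨x, rfl⟩ := D.pi_surj m₁
    obtain ⟨y, rfl, hd, hr⟩ := D.exists_rigid x m₂ h
    refine le_trans ?_ ((hrn x y (by omega)).trans (by exact_mod_cast (by omega)))
    refine (Set.encard_le_encard (t := ψ '' _) ?_).trans (Set.encard_image_le _ _)
    rintro g ⟨hga, hgb⟩
    have hb2 : Btw (quotGraph Γ π) a (π y) b := by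
      have t1 := D.conn.triangle a (π x) (π y)
      have t2 := D.conn.triangle a (π y) b
      unfold Btw
      omega
    obtain ⟨g₀, rfl, h1, h2⟩ := D.exists_displacement (3 * ε + 6 * δ) hr g
      (D.slim.displacement D.conn D.acts hm₁ hga hgb) (D.slim.displacement D.conn D.acts hb2 hga
        hgb)
    exact ⟨g₀, ⟨h1, h2⟩, rfl⟩
  · push Not at h
    obtain ⟨v, hv, hn⟩ := h
    refine (D.encard_le_of_apex hv hm₁ hm₂ (ε := ε) (by omega) (by omega) hn).trans ?_
    exact_mod_cast (by omega)

/-- A bounded orbit of vertices without large angles yields a lift of the group. -/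
theorem exists_fixed_of_orbit (D : QuotData Γ δ M R ψ π) (hell : ∀ (K : Subgroup Q) (x : V) (b : ℕ),
      (∀ k ∈ K, Γ.dist x (k • x) ≤ b) → ∃ y : V, ∀ k ∈ K, k • y = y)
    (K : Subgroup Q') (x : V) (hx : R x = ⊥) (b : ℕ)
    (hb : ∀ k ∈ K, (quotGraph Γ π).dist (π x) (k • π x) ≤ b)
    (h : ∀ k ∈ K, ∀ v, R v ≠ ⊥ → Ang (quotGraph Γ π) (π v) (4 * angleBound δ) (π x) (k • π x)) :
    ∃ a : V', ∀ k ∈ K, k • a = a := by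
  have hc := D.rot.conn
  have lifts : ∀ k : K, ∃ g : Q, ψ g = k ∧
      Γ.dist x (g • x) = (quotGraph Γ π).dist (π x) ((k : Q') • π x) ∧
      ∀ v, R v ≠ ⊥ → Ang Γ v (10 * angleBound δ) x (g • x) := by
    rintro ⟨k, hk⟩
    obtain ⟨y, hy, hd, hr⟩ := D.exists_rigid x (k • π x)
      (fun v hv => (h k hk v hv).mono (by omega))
    obtain ⟨g, rfl⟩ := D.psi_surj k
    rw [← D.equiv] at hy
    obtain ⟨n, hn, rfl⟩ := (D.fib _ _).1 hy.symm
    refine ⟨n * g, by rw [map_mul, (D.ker n).2 hn, one_mul], by rw [mul_smul]; exact hd, ?_⟩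
    intro v hv
    rw [mul_smul]
    refine hr v hv ?_ ?_
    · rintro rfl; exact hv hx
    · grind [QuotData.bot_smul]
  choose g hg hgd hga using lifts
  have hM : 34 * angleBound δ ≤ M := by
    have hM := D.big
    unfold bigAngle at hM; nlinarith
  have ne_apex : ∀ (v : V) (q : Q), R v ≠ ⊥ → q • x ≠ v := by
    grind [QuotData.bot_smul]
  have hmul : ∀ k l : K, g (k * l) = g k * g l := by
    intro k l
    set ν := g k * g l * (g (k * l))⁻¹ with hν
    have hνN : ν ∈ rotGroup R Set.univ := by
      rw [← D.ker, hν, map_mul, map_mul, map_inv, hg, hg, hg, Subgroup.coe_mul, mul_inv_cancel]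
    have hred := D.rot.reducible (g (k * l) • x) ν hνN
    have hνx : ν • g (k * l) • x = (g k * g l) • x := by
      rw [← mul_smul, hν, inv_mul_cancel_right]
    have hfix : ν • g (k * l) • x = g (k * l) • x := by
      cases hred with
      | base _ h1 => exact h1
      | step _ ρ v h1 h2 hρ hρ1 ha _ =>
        have hv : R v ≠ ⊥ := fun hb => hρ1 (by rwa [hb, Subgroup.mem_bot] at hρ)
        refine absurd ?_ (D.rot.not_ang_of_reduce h1 h2 hρ hρ1 ha (m := 30 * angleBound δ)
          (by omega))
        rw [hνx]
        have a1 := (hga (k * l) v hv).symm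
        have a2 := hga k v hv
        have a3 := D.rot.acts.ang_smul hc (g k) (hga l ((g k)⁻¹ • v)
          (fun hb => hv (by simpa using D.bot_smul hb (g k))))
        rw [smul_inv_smul, ← mul_smul] at a3
        have := ne_apex v 1 hv
        rw [one_smul] at this
        exact ((a1.trans hc a2 this).trans hc a3 (ne_apex v _ hv)).mono (by omega)
    grind [QuotData.mem_of_fix, Subgroup.mem_bot, mul_inv_eq_one]
  obtain ⟨y, hy⟩ := hell (MonoidHom.mk' g hmul).range x b (by
    rintro _ ⟨k, rfl⟩
    exact (hgd k).le.trans (hb k k.2))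
  refine ⟨π y, fun k hk => ?_⟩
  have := hy (g ⟨k, hk⟩) ⟨⟨k, hk⟩, rfl⟩
  conv_rhs => rw [← this, D.equiv, hg]

theorem ell (D : QuotData Γ δ M R ψ π) (hell : ∀ (K : Subgroup Q) (x : V) (b : ℕ),
      (∀ k ∈ K, Γ.dist x (k • x) ≤ b) → ∃ y : V, ∀ k ∈ K, k • y = y)
    (K : Subgroup Q') (a : V') (b : ℕ)
    (hb : ∀ k ∈ K, (quotGraph Γ π).dist a (k • a) ≤ b) : ∃ c : V', ∀ k ∈ K, k • c = c := by
  set Γ' := quotGraph Γ π with hΓ'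
  have hc : Γ'.Connected := D.conn
  have hs : Slim Γ' δ := D.slim
  have hacts : ActsOn Q' Γ' := D.acts
  have hex : ∃ r, ∃ c, ∀ k ∈ K, Γ'.dist c (k • a) ≤ r := ⟨b, a, hb⟩
  classical
  set r := Nat.find hex
  set C : Set V' := {c | ∀ k ∈ K, Γ'.dist c (k • a) ≤ r}
  have hCinv : ∀ k ∈ K, ∀ c ∈ C, k • c ∈ C := by
    intro k hk c hcC l hl
    have := hcC (k⁻¹ * l) (mul_mem (inv_mem hk) hl)
    grind [ActsOn.dist_smul, mul_smul, smul_inv_smul]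
  have bound : ∀ c : V', ∀ k ∈ K, Γ'.dist c (k • c) ≤ b + 2 * Γ'.dist a c := by
    intro c k hk
    have t1 := hc.triangle c a (k • c)
    have t2 := hc.triangle a (k • a) (k • c)
    grind [ActsOn.dist_smul, SimpleGraph.dist_swap]
  have hang : ∀ v, ∀ c₁ ∈ C, ∀ c₂ ∈ C, Ang Γ' v (2 * angleBound δ) c₁ c₂ := by
    intro v c₁ h₁ c₂ h₂
    by_contra hcon
    have hn1 := ne_of_not_ang hc hs (fun h' => hcon (h'.mono (by omega)))
    have hn2 := ne_of_not_ang hc hs (fun h' => hcon ((Ang.symm h').mono (by omega)))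
    have p1 := hc.pos_dist_of_ne hn1
    have p2 := hc.pos_dist_of_ne hn2
    have hv : ∀ k ∈ K, Γ'.dist v (k • a) + 1 ≤ r := by
      intro k hk
      have r1 := h₁ k hk
      have r2 := h₂ k hk
      have c1 := Γ'.dist_swap (k • a) v
      have c2 := Γ'.dist_swap v c₂
      have c3 := Γ'.dist_swap (k • a) c₂
      rcases btw_or_btw_of_not_ang hc hs le_rfl hcon (k • a) with h | h <;> unfold Btw at h <;>
        omega
    have := hv 1 (one_mem K)
    exact Nat.find_min hex (m := r - 1) (by omega) ⟨v, fun k hk => by have := hv k hk; omega⟩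
  obtain ⟨c, hcC⟩ : C.Nonempty := Nat.find_spec hex
  by_cases hna : ∃ c ∈ C, ∃ x, π x = c ∧ R x = ⊥
  · obtain ⟨_, hcC, x, rfl, hx⟩ := hna
    exact D.exists_fixed_of_orbit hell K x hx _ (bound (π x)) fun k hk v _ =>
      (hang _ _ hcC _ (hCinv k hk _ hcC)).mono (by omega)
  push Not at hna
  by_cases hone : ∀ c' ∈ C, c' = c
  · exact ⟨c, fun k hk => hone _ (hCinv k hk c hcC)⟩
  push Not at hone
  obtain ⟨c', hcC', hne⟩ := hone
  obtain ⟨e, he⟩ := exists_next hc hne.symm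
  obtain ⟨ĉ, rfl⟩ := D.pi_surj c
  obtain ⟨ê, rfl, hadj⟩ := D.exists_adj he.1
  have hê : R ê = ⊥ := (D.nonadj _ _ hadj).resolve_left (hna _ hcC _ rfl)
  have near : ∀ k ∈ K, ∀ v, R v ≠ ⊥ → ∃ d ∈ C, d ≠ π v ∧ Ang Γ' (π v) (angleBound δ) (k • π ê)
    d := by
    intro k hk v hv
    by_cases hcv : k • π ĉ = π v
    · refine ⟨k • c', hCinv k hk _ hcC', fun h => hne ?_, ?_⟩
      · exact MulAction.injective k (h.trans hcv.symm)
      · rw [← hcv]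
        refine D.acts.ang_smul hc k ?_
        have hsub : Lk Γ' (π ĉ) (π ê) ∪ Lk Γ' (π ĉ) c' ⊆ Lk Γ' (π ĉ) c' := by
          rintro f (⟨hf, hfd⟩ | hf)
          · rw [he.1.dist_eq_one] at hfd
            grind [SimpleGraph.Connected.dist_eq_zero_iff]
          · exact hf
        exact fun f hf f' hf' => lk_av hc hs (hsub hf) (hsub hf')
    · exact ⟨k • π ĉ, hCinv k hk _ hcC, hcv, ang_of_adj hc hs (D.acts k _ _ he.1.symm)⟩
  refine D.exists_fixed_of_orbit hell K ê hê _ (bound (π ê)) fun k hk v hv => ?_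
  obtain ⟨d₁, hd₁, hn₁, ha₁⟩ := near 1 (one_mem K) v hv
  obtain ⟨d₂, hd₂, hn₂, ha₂⟩ := near k hk v hv
  rw [one_smul] at ha₁
  exact ((ha₁.trans hc (hang _ _ hd₁ _ hd₂) hn₁).trans hc ha₂.symm hn₂).mono (by omega)

end QuotData

theorem QuotData.tame {V V' Q Q' : Type*} [Group Q] [Group Q'] [MulAction Q V] [MulAction Q' V']
    {Γ : SimpleGraph V} {δ M : ℕ} {R : V → Subgroup Q} {ψ : Q →* Q'} {π : V → V'}
    (D : QuotData Γ δ M R ψ π) (hT : Tame Q Γ) : Tame Q' (quotGraph Γ π) where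
  conn := D.conn
  acts := D.acts
  slim := ⟨δ, D.slim⟩
  acyl := D.acyl hT.acyl
  ell := D.ell hT.ell
  disj := D.disj'
  tf := D.tf hT.tf

theorem Rotating.rotGroup_normal {V Q : Type*} [Group Q] [MulAction Q V] {Γ : SimpleGraph V}
    {δ M : ℕ} {R : V → Subgroup Q} (h : Rotating Γ δ M R) : (rotGroup R Set.univ).Normal := by
  refine ⟨fun n hn g => ?_⟩
  induction hn using Subgroup.closure_induction with
  | mem x hx =>
    obtain ⟨v, -, hv⟩ := hx
    exact mem_rotGroup (Set.mem_univ _) (h.conj g v x hv)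
  | one => simp
  | mul x y _ _ hx hy =>
    have := mul_mem hx hy
    have e : g * x * g⁻¹ * (g * y * g⁻¹) = g * (x * y) * g⁻¹ := by group
    rwa [e] at this
  | inv x _ hx =>
    have := inv_mem hx
    have e : (g * x * g⁻¹)⁻¹ = g * x⁻¹ * g⁻¹ := by group
    rwa [e] at this

/-- The action of a quotient group on the quotient of a set. -/
theorem exists_quotient_action {Q : Type u} [Group Q] {V : Type w} [MulAction Q V]
    (N : Subgroup Q) [N.Normal] : ∃ (V' : Type w) (_ : MulAction (Q ⧸ N) V') (π : V → V'),
      Function.Surjective π ∧ (∀ x y, π x = π y ↔ ∃ ν ∈ N, y = ν • x) ∧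
      ∀ (g : Q) (x : V), π (g • x) = (QuotientGroup.mk' N g) • π x := by
  let s : Setoid V := MulAction.orbitRel N V
  have hs : ∀ x y : V, s x y ↔ ∃ ν ∈ N, y = ν • x := by
    intro x y
    constructor
    · rintro ⟨ν, rfl⟩
      exact ⟨(ν : Q)⁻¹, inv_mem ν.2, (inv_smul_smul (ν : Q) y).symm⟩
    · rintro ⟨ν, hν, rfl⟩
      exact ⟨⟨ν⁻¹, inv_mem hν⟩, inv_smul_smul ν x⟩
  let π : V → Quotient s := Quotient.mk s
  have hπ : ∀ x y, π x = π y ↔ ∃ ν ∈ N, y = ν • x := fun x y => by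
    rw [← hs]; exact Quotient.eq
  have hwd : ∀ (g g' : Q) (x x' : V), g⁻¹ * g' ∈ N → s x x' → π (g • x) = π (g' • x') := by
    intro g g' x x' hg hx
    obtain ⟨ν, hν, rfl⟩ := (hs _ _).1 hx
    rw [hπ]
    refine ⟨g * (g⁻¹ * g' * ν) * g⁻¹, Subgroup.Normal.conj_mem inferInstance _ (mul_mem hg hν) g,
      ?_⟩
    rw [← mul_smul, ← mul_smul]
    group
  let act : Q ⧸ N → Quotient s → Quotient s := fun q v =>
    Quotient.liftOn₂' q v (fun g x => π (g • x)) (fun g x g' x' hg hx =>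
      hwd g g' x x' (QuotientGroup.leftRel_apply.1 hg) hx)
  refine ⟨Quotient s, { smul := act, one_smul := ?_, mul_smul := ?_ }, π, Quotient.mk_surjective,
    hπ,
    fun g x => rfl⟩
  · intro a b v
    induction a using QuotientGroup.induction_on with
    | H a =>
      induction b using QuotientGroup.induction_on with
      | H b =>
        induction v using Quotient.inductionOn with
        | h x => exact congrArg π (mul_smul a b x)
  · intro v
    induction v using Quotient.inductionOn with
    | h x => exact congrArg π (one_smul Q x)

/-- The quotient of a tame action by a family of large rotations is tame. -/
theorem Tame.exists_quotient {Q : Type u} [Group Q] {V : Type w} [MulAction Q V]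
    {Γ : SimpleGraph V} (hT : Tame Q Γ) {δ M : ℕ} {R : V → Subgroup Q} (h : Rotating Γ δ M R)
    (hM : bigAngle δ ≤ M) (hstab : ∀ (v : V) (g : Q), R v ≠ ⊥ → g • v = v → g ∈ R v)
    (hnon : ∀ v w : V, Γ.Adj v w → R v = ⊥ ∨ R w = ⊥) :
    ∃ (Q' : Type u) (_ : Group Q') (V' : Type w) (_ : MulAction Q' V') (ψ : Q →* Q') (π : V → V'),
      QuotData Γ δ M R ψ π := by
  have := h.rotGroup_normal
  obtain ⟨V', _, π, hsurj, hfib, heq⟩ :=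
    exists_quotient_action (V := V) (rotGroup R Set.univ)
  exact ⟨Q ⧸ rotGroup R Set.univ, inferInstance, V', inferInstance, QuotientGroup.mk' _, π,
    { rot := h
      big := hM
      stab := hstab
      nonadj := hnon
      disj := hT.disj
      psi_surj := QuotientGroup.mk'_surjective _
      ker := fun g => QuotientGroup.eq_one_iff g
      pi_surj := hsurj
      fib := hfib
      equiv := heq }⟩

section Hyperbolic

variable {V : Type*} {Γ : SimpleGraph V} {δ : ℕ}

theorem exists_seq_of_walk (hc : Γ.Connected) (x y : V) : ∃ γ : ℕ → V, γ 0 = x ∧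
    γ (Γ.dist x y) = y ∧ ∀ i, Γ.dist (γ i) (γ (i + 1)) ≤ 1 := by
  obtain ⟨w, hw⟩ := hc.exists_walk_length_eq_dist x y
  refine ⟨w.getVert, w.getVert_zero, by rw [← hw, w.getVert_length], fun i => ?_⟩
  by_cases hi : i < w.length
  · exact (w.adj_getVert_succ hi).dist_eq_one.le
  · rw [w.getVert_of_length_le (by omega), w.getVert_of_length_le (by omega)]; simp

theorem dist_seq_le (hc : Γ.Connected) {γ : ℕ → V} (h : ∀ i, Γ.dist (γ i) (γ (i + 1)) ≤ 1)
    (i k : ℕ) :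
    Γ.dist (γ i) (γ (i + k)) ≤ k := by
  induction k with
  | zero => simp
  | succ k ih =>
    have := hc.triangle (γ i) (γ (i + k)) (γ (i + (k + 1)))
    grind

theorem dist_geod (hc : Γ.Connected) {γ : ℕ → V} (h : ∀ i, Γ.dist (γ i) (γ (i + 1)) ≤ 1) {n : ℕ}
    (hn : n ≤ Γ.dist (γ 0) (γ n)) {i j : ℕ} (hij : i ≤ j) (hj : j ≤ n) :
    Γ.dist (γ i) (γ j) = j - i := by
  have h1 := dist_seq_le hc h 0 i
  have h2 := dist_seq_le hc h i (j - i)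
  have h3 := dist_seq_le hc h j (n - j)
  rw [zero_add] at h1
  rw [Nat.add_sub_cancel' hij] at h2
  rw [Nat.add_sub_cancel' hj] at h3
  have t1 := hc.triangle (γ 0) (γ i) (γ n)
  have t2 := hc.triangle (γ i) (γ j) (γ n)
  omega

/-- The four point condition. -/
theorem four_point (hc : Γ.Connected) (hs : Slim Γ δ) (x y z w : V) :
    Γ.dist x z + Γ.dist y w ≤
      max (Γ.dist x y + Γ.dist z w) (Γ.dist x w + Γ.dist y z) + (4 * δ + 2) := by
  obtain ⟨γ, h0, hn, hγ⟩ := exists_seq_of_walk hc x z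
  set n := Γ.dist x z with hnd
  have hbt : ∀ i ≤ n, Btw Γ x (γ i) z := by
    intro i hi
    have e1 := dist_geod hc hγ (n := n) (by rw [h0, hn]) (Nat.zero_le i) hi
    have e2 := dist_geod hc hγ (n := n) (by rw [h0, hn]) hi le_rfl
    rw [h0] at e1
    rw [hn] at e2
    unfold Btw
    omega
  have near : ∀ (a b p q : V) (r : ℕ), Btw Γ a q b → Γ.dist p q ≤ r →
      Γ.dist a p + Γ.dist p b ≤ Γ.dist a b + 2 * r := by
    intro a b p q r hq hr
    have t1 := hc.triangle a q p
    have t2 := hc.triangle p q b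
    grind [SimpleGraph.dist_swap, Btw]
  have fin : ∀ p, (Γ.dist x p + Γ.dist p y ≤ Γ.dist x y + 2 * δ + 2 ∧
      Γ.dist w p + Γ.dist p z ≤ Γ.dist w z + 2 * δ) ∨
      (Γ.dist y p + Γ.dist p z ≤ Γ.dist y z + 2 * δ ∧
      Γ.dist x p + Γ.dist p w ≤ Γ.dist x w + 2 * δ + 2) → n + Γ.dist y w ≤
      max (Γ.dist x y + Γ.dist z w) (Γ.dist x w + Γ.dist y z) + (4 * δ + 2) := by
    intro p hp
    have t1 := hc.triangle x p z
    have t2 := hc.triangle y p w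
    have c1 := Γ.dist_swap p y
    have c2 := Γ.dist_swap p w
    have c3 := Γ.dist_swap z w
    omega
  by_contra hcon
  have step : ∀ i ≤ n, Γ.dist x (γ i) + Γ.dist (γ i) y ≤ Γ.dist x y + 2 * δ ∧
      Γ.dist x (γ i) + Γ.dist (γ i) w ≤ Γ.dist x w + 2 * δ := by
    intro i hi
    induction i with
    | zero => rw [h0]; simp
    | succ i ih =>
      obtain ⟨q, hq, hqd⟩ := hs x z y (γ (i + 1)) (hbt _ hi)
      obtain ⟨q', hq', hqd'⟩ := hs x z w (γ (i + 1)) (hbt _ hi)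
      have d1 := hγ i
      have t1 := hc.triangle x (γ i) (γ (i + 1))
      have t2 := hc.triangle (γ (i + 1)) (γ i) y
      have c1 := Γ.dist_swap (γ (i + 1)) (γ i)
      rcases hq with hq | hq <;> rcases hq' with hq' | hq' <;>
        have n1 := near _ _ _ _ _ hq hqd <;> have n2 := near _ _ _ _ _ hq' hqd'
      · exact ⟨n1, n2⟩
      · grind
      · grind
      · grind
  grind

/-- Points which are nearly between `x` and `y` are nearly determined by their positions. -/
theorem dist_le_of_near (hc : Γ.Connected) (hs : Slim Γ δ) {x η y y' : V} {b : ℕ}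
    (h : Γ.dist x y + Γ.dist y η ≤ Γ.dist x η + b)
    (h' : Γ.dist x y' + Γ.dist y' η ≤ Γ.dist x η + b)
    (hle : Γ.dist x y ≤ Γ.dist x y') :
    Γ.dist y y' + Γ.dist x y ≤ Γ.dist x y' + b + (4 * δ + 2) := by
  have := four_point hc hs x y η y'
  have c1 := Γ.dist_swap η y'
  omega

end Hyperbolic

section Lox

variable {V : Type*} {Γ : SimpleGraph V} {δ : ℕ} {Q : Type*} [Group Q] [MulAction Q V]

/-- The orbit of `x` under powers of `g` is a quasi-geodesic. -/
def IsLox (Γ : SimpleGraph V) (g : Q) (x : V) (C : ℕ) : Prop :=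
  ∀ m n : ℕ, Γ.dist x (g ^ m • x) + Γ.dist x (g ^ n • x) ≤ Γ.dist x (g ^ (m + n) • x) + C ∧
    n ≤ Γ.dist x (g ^ n • x)

theorem dist_pow (hc : Γ.Connected) (hQ : ActsOn Q Γ) (g : Q) (x : V) (m n : ℕ) :
    Γ.dist (g ^ m • x) (g ^ (m + n) • x) = Γ.dist x (g ^ n • x) := by
  rw [pow_add, mul_smul, hQ.dist_smul hc]

theorem isLox_of_dist_sq (hc : Γ.Connected) (hs : Slim Γ δ) (hQ : ActsOn Q Γ) {g : Q} {x : V}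
    (h : Γ.dist x (g • x) + 2 * (4 * δ + 2) + 1 ≤ Γ.dist x (g ^ 2 • x)) :
    ∃ C, IsLox Γ g x C := by
  set L := Γ.dist x (g • x) with hL
  set k := 4 * δ + 2 with hk
  have fp : ∀ a b c e : ℕ, _ := fun a b c e => four_point hc hs (g ^ a • x) (g ^ b • x)
    (g ^ c • x) (g ^ e • x)
  have dp : ∀ m n : ℕ, _ := dist_pow hc hQ g x
  set d : ℕ → ℕ := fun n => Γ.dist x (g ^ n • x) with hd
  have hd0 : d 0 = 0 := by simp [hd]
  have hd1 : d 1 = L := by simp [hd, hL]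
  have dp' : ∀ i j, i ≤ j → Γ.dist (g ^ i • x) (g ^ j • x) = d (j - i) := by
    grind [Nat.add_sub_cancel']
  have hd2 : L + 2 * k + 1 ≤ d 2 := h
  have grow : ∀ n, d n + (d 2 - L - k) ≤ d (n + 1) := by
    intro n
    induction n with
    | zero =>
      have t := hc.triangle x (g • x) (g ^ 2 • x)
      grind [pow_one]
    | succ n ih =>
      have f := fp 0 n (n + 1) (n + 2)
      grind
  have hlin : ∀ n, n ≤ d n := by
    intro n
    induction n with
    | zero => omega
    | succ n ih => have := grow n; omega
  refine ⟨L + k, fun m n => ⟨?_, hlin n⟩⟩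
  change d m + d n ≤ d (m + n) + (L + k)
  rcases n with _ | n
  · rw [hd0]; simp
  have f := fp 0 m (m + 1) (m + (n + 1))
  rw [dp' _ _ (by omega), dp' _ _ (by omega), dp' _ _ (by omega), dp' _ _ (by omega),
    dp' _ _ (by omega), dp' _ _ (by omega)] at f
  simp only [Nat.sub_zero, show m + (n + 1) - m = n + 1 by omega,
    show m + (n + 1) - (m + 1) = n by omega, show m + 1 - m = 1 by omega] at f
  have g1 := grow m
  have g2 := grow n
  omega

theorem near_of_btw (hc : Γ.Connected) (hs : Slim Γ δ) {x x' η η' y : V} {b : ℕ}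
    (hx : Γ.dist x x' ≤ b) (hη : Γ.dist η η' ≤ b) (hy : Btw Γ x' y η')
    (h1 : b + δ < Γ.dist x' y) (h2 : b + 2 * δ < Γ.dist y η') :
    Γ.dist x y + Γ.dist y η ≤ Γ.dist x η + 4 * δ := by
  obtain ⟨q, hq, hqd⟩ := hs x' η' x y hy
  have t1 := hc.triangle x' q y
  have c1 := Γ.dist_swap y q
  have c2 := Γ.dist_swap x x'
  rcases hq with hq | hq
  · unfold Btw at hq
    omega
  obtain ⟨p, hp, hpd⟩ := hs x η' η q hq
  have t2 := hc.triangle y q p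
  have t3 := hc.triangle y p η'
  have t4 := hc.triangle x p y
  have t5 := hc.triangle y p η
  grind [SimpleGraph.dist_swap, Btw]

theorem dist_smul_le_of_shift (hc : Γ.Connected) (hs : Slim Γ δ) (hQ : ActsOn Q Γ) {g : Q}
    {x η p z : V} {B : ℕ} (hx : Γ.dist x (g • x) ≤ B) (hη : Γ.dist η (g • η) ≤ B)
    (hp : Btw Γ x p η) (hz : Btw Γ x z η) (hzp : Γ.dist x z + Γ.dist z p = Γ.dist x p)
    (h1 : 4 * B + 4 * δ < Γ.dist x z) (h2 : 4 * B + 4 * δ < Γ.dist z p)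
    (h3 : 4 * B + 4 * δ < Γ.dist p η)
    (hA : Γ.dist p (g ^ 2 • p) ≤ Γ.dist p (g • p) + 2 * (4 * δ + 2)) :
    Γ.dist p (g • p) ≤ 40 * δ + 12 := by
  have e := fun a b : V => hQ.dist_smul hc g a b
  have hxx : Γ.dist x (g ^ 2 • x) ≤ 2 * B := by
    have := hc.triangle x (g • x) (g ^ 2 • x)
    grind [mul_smul, pow_two]
  have hηη : Γ.dist η (g ^ 2 • η) ≤ 2 * B := by
    have := hc.triangle η (g • η) (g ^ 2 • η)
    grind [mul_smul, pow_two]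
  have e2 := fun a b : V => hQ.dist_smul hc (g ^ 2) a b
  have hpη : Γ.dist z η = Γ.dist z p + Γ.dist p η := by unfold Btw at hp hz; omega
  have nz := near_of_btw hc hs hx hη ((hQ.btw_smul hc g).2 hz) (by rw [e]; omega) (by rw [e]; omega)
  have np := near_of_btw hc hs hx hη ((hQ.btw_smul hc g).2 hp) (by rw [e]; omega) (by rw [e]; omega)
  have np2 := near_of_btw hc hs hxx hηη ((hQ.btw_smul hc (g ^ 2)).2 hp) (by rw [e2]; omega)
    (by rw [e2]; omega)
  have z0 : Γ.dist x z + Γ.dist z η ≤ Γ.dist x η + 4 * δ := by unfold Btw at hz; omega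
  have p0 : Γ.dist x p + Γ.dist p η ≤ Γ.dist x η + 4 * δ := by unfold Btw at hp; omega
  have e1 := e z p
  have e3 := e z (g • p)
  rw [← mul_smul, ← pow_two] at e3
  have b1 := hc.triangle x (g • x) (g • z)
  have b3 := hc.triangle x (g • x) (g • p)
  have b4 := hc.triangle (g • x) x (g • p)
  have b6 := hc.triangle (g ^ 2 • x) x (g ^ 2 • p)
  have c2 := Γ.dist_swap x (g • x)
  have c3 := Γ.dist_swap x (g ^ 2 • x)
  rw [e] at b1 b3 b4
  rw [e2] at b6
  have d1 := dist_le_of_near hc hs nz np (by omega)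
  have d2 := dist_le_of_near hc hs z0 np (by omega)
  have d3 := dist_le_of_near hc hs nz np2 (by omega)
  have d5 := hc.triangle x (g • z) (g • p)
  have d6 := hc.triangle x z (g • p)
  have d7 := hc.triangle x (g • z) (g ^ 2 • p)
  have c1 := Γ.dist_swap p (g ^ 2 • p)
  rcases le_total (Γ.dist x p) (Γ.dist x (g • p)) with h | h
  · have d4 := dist_le_of_near hc hs p0 np h
    have d8 := hc.triangle x p (g ^ 2 • p)
    omega
  · have d4 := dist_le_of_near hc hs np p0 h
    have d9 := hc.triangle x (g ^ 2 • p) p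
    have c4 := Γ.dist_swap p (g • p)
    omega

theorem dist_smul_le_of_gromov (hc : Γ.Connected) (hs : Slim Γ δ) (hQ : ActsOn Q Γ) {g k : Q}
    {x η : V} {G : ℕ} (hA : ∀ l ∈ Subgroup.closure {g, k},
      Γ.dist x (l ^ 2 • x) ≤ Γ.dist x (l • x) + 2 * (4 * δ + 2))
    (hG : Γ.dist x (g • x) ≤ G) (hη : Btw Γ x η (k • x))
    (hT : 2 * Γ.dist x η + G + 4 * (4 * δ + 2) ≤ Γ.dist x (k • x)) :
    Γ.dist η (g • η) ≤ 3 * G + 2 * (4 * δ + 2) := by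
  have gm : g ∈ Subgroup.closure {g, k} := Subgroup.subset_closure (by simp)
  have km : k ∈ Subgroup.closure {g, k} := Subgroup.subset_closure (by simp)
  have sq : ∀ l ∈ Subgroup.closure {g, k},
      Γ.dist (l⁻¹ • x) (l • x) ≤ Γ.dist x (l • x) + 2 * (4 * δ + 2) := by
    grind [ActsOn.dist_smul, smul_inv_smul, mul_smul, pow_two]
  have inv : ∀ l : Q, Γ.dist x (l⁻¹ • x) = Γ.dist x (l • x) := by
    intro l
    rw [← hQ.dist_smul hc l, smul_inv_smul, SimpleGraph.dist_comm]
  have s1 := sq k km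
  have s2 := sq (g * k) (mul_mem gm km)
  have i1 := inv k
  have i2 := inv (g * k)
  have i3 : Γ.dist (k⁻¹ • x) ((g * k)⁻¹ • x) = Γ.dist x (g • x) := by
    grind [ActsOn.dist_smul, mul_smul, mul_inv_rev]
  have i4 : Γ.dist (g • x) ((g * k) • x) = Γ.dist x (k • x) := by
    rw [mul_smul, hQ.dist_smul hc]
  have i5 : Γ.dist (g • x) (g • η) = Γ.dist x η := hQ.dist_smul hc _ _ _
  have i6 : Γ.dist (g • η) ((g * k) • x) = Γ.dist η (k • x) := by
    rw [mul_smul, hQ.dist_smul hc]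
  have f1 := four_point hc hs x (k • x) (k⁻¹ • x) ((g * k)⁻¹ • x)
  have f2 := four_point hc hs x (k • x) ((g * k)⁻¹ • x) ((g * k) • x)
  have f3 := four_point hc hs x η (k • x) ((g * k) • x)
  have f4 := four_point hc hs x η ((g * k) • x) (g • η)
  have c1 := Γ.dist_swap (k • x) (k⁻¹ • x)
  have c4 := Γ.dist_swap ((g * k) • x) (g • η)
  have c5 := Γ.dist_swap x (g • x)
  have t2 := hc.triangle (g • x) x ((g * k) • x)
  have t3 := hc.triangle x (g • x) (g • η)
  unfold Btw at hη
  omega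

/-- A group which acts acylindrically with unbounded orbits contains a loxodromic element. -/
theorem exists_dist_sq (hc : Γ.Connected) (hs : Slim Γ δ) (hQ : ActsOn Q Γ)
    (hacyl : ∀ ε, ∃ R n : ℕ, ∀ x y : V, R ≤ Γ.dist x y →
      {g : Q | Γ.dist x (g • x) ≤ ε ∧ Γ.dist y (g • y) ≤ ε}.encard ≤ n)
    {K : Subgroup Q} {x : V} (hK : ∀ B, ∃ k ∈ K, B < Γ.dist x (k • x)) :
    ∃ g ∈ K, ∃ y, Γ.dist y (g • y) + 2 * (4 * δ + 2) + 1 ≤ Γ.dist y (g ^ 2 • y) := by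
  by_contra hcon
  push Not at hcon
  have hA : ∀ g ∈ K, ∀ y, Γ.dist y (g ^ 2 • y) ≤ Γ.dist y (g • y) + 2 * (4 * δ + 2) := by
    intro g hg y
    have := hcon g hg y
    omega
  obtain ⟨R, n, hRn⟩ := hacyl (40 * δ + 12)
  have hinf : (K : Set Q).Infinite := by
    intro hfin
    obtain ⟨B, hB⟩ := (hfin.image fun k => Γ.dist x (k • x)).bddAbove
    obtain ⟨k, hk, hkB⟩ := hK B
    exact absurd (hB ⟨k, hk, rfl⟩) (by simpa using hkB)
  obtain ⟨s, hsK, hcard⟩ := hinf.exists_subset_card_eq (n + 1)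
  obtain ⟨G, hG⟩ : ∃ G, ∀ g ∈ s, Γ.dist x (g • x) ≤ G :=
    ⟨s.sup fun g => Γ.dist x (g • x), fun g hg => Finset.le_sup (f := fun g => Γ.dist x (g • x)) hg⟩
  obtain ⟨B, hB⟩ : ∃ B, B = 3 * G + 2 * (4 * δ + 2) := ⟨_, rfl⟩
  obtain ⟨w, hw⟩ : ∃ w, w = 4 * B + 4 * δ + 1 := ⟨_, rfl⟩
  obtain ⟨k, hkK, hk⟩ := hK (2 * (3 * w + R) + G + 4 * (4 * δ + 2))
  obtain ⟨γ, h0, hn, hγ⟩ := exists_seq_of_walk hc x (k • x)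
  obtain ⟨L, hL⟩ : ∃ L, L = Γ.dist x (k • x) := ⟨_, rfl⟩
  rw [← hL] at hn
  have geo : ∀ {i j : ℕ}, i ≤ j → j ≤ L → Γ.dist (γ i) (γ j) = j - i := fun h h' =>
    dist_geod hc hγ (by rw [h0, hn, hL]) h h'
  have hd : ∀ i, i ≤ L → Γ.dist x (γ i) = i := fun i hi => by
    grind
  have hη : Btw Γ x (γ (3 * w + R)) (k • x) := by
    have := geo (i := 3 * w + R) (j := L) (by omega) le_rfl
    have := hd (3 * w + R) (by omega)
    rw [hn] at *
    unfold Btw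
    omega
  have hbt : ∀ i, i ≤ 3 * w + R → Btw Γ x (γ i) (γ (3 * w + R)) := by
    intro i hi
    have := geo hi (by omega)
    have := hd i (by omega)
    have := hd (3 * w + R) (by omega)
    unfold Btw
    omega
  have hmv : ∀ i, 2 * w ≤ i → i ≤ 2 * w + R → ∀ g ∈ s, Γ.dist (γ i) (g • γ i) ≤ 40 * δ + 12 := by
    intro i hi hi' g hg
    have hgK : g ∈ K := hsK hg
    have hle : Subgroup.closure {g, k} ≤ K := by
      rw [Subgroup.closure_le]
      rintro a (rfl | rfl)
      · exact hgK
      · exact hkK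
    have h1 := dist_smul_le_of_gromov hc hs hQ (fun l hl => hA l (hle hl) x) (hG g hg) hη
      (by rw [hd _ (by omega)]; omega)
    have e1 := hd w (by omega)
    have e2 := hd i (by omega)
    have e3 := geo (i := w) (j := i) (by omega) (by omega)
    have e4 := geo (i := i) (j := 3 * w + R) (by omega) (by omega)
    exact dist_smul_le_of_shift hc hs hQ (B := B) ((hG g hg).trans (by omega)) (h1.trans (by omega))
      (hbt i (by omega)) (hbt w (by omega)) (by omega) (by omega) (by omega) (by omega) (hA g hgK _)
  have hfar := geo (i := 2 * w) (j := 2 * w + R) (by omega) (by omega)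
  have := hRn (γ (2 * w)) (γ (2 * w + R)) (by omega)
  have hsub : (s : Set Q) ⊆ {g : Q | Γ.dist (γ (2 * w)) (g • γ (2 * w)) ≤ 40 * δ + 12 ∧
      Γ.dist (γ (2 * w + R)) (g • γ (2 * w + R)) ≤ 40 * δ + 12} := fun g hg =>
    ⟨hmv _ le_rfl (by omega) g hg, hmv _ (by omega) le_rfl g hg⟩
  have h2 := (Set.encard_le_encard hsub).trans this
  rw [Set.encard_coe_eq_coe_finsetCard, hcard] at h2
  have h3 : n + 1 ≤ n := by exact_mod_cast h2
  omega

end Lox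

section Polygon

variable {V : Type*} {Γ : SimpleGraph V} {δ : ℕ}

theorem Slim.polygon (hc : Γ.Connected) (hs : Slim Γ δ) {m : ℕ} : ∀ {n : ℕ} (q : ℕ → V) {p : V},
    1 ≤ n → n ≤ 2 ^ m → Btw Γ (q 0) p (q n) →
    ∃ k < n, ∃ u, Btw Γ (q k) u (q (k + 1)) ∧ Γ.dist p u ≤ m * δ := by
  induction m with
  | zero =>
    grind
  | succ m ih =>
    intro n q p h1 hn hp
    by_cases hle : n ≤ 2 ^ m
    · obtain ⟨k, hk, u, hu, hd⟩ := ih q h1 hle hp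
      grind
    obtain ⟨w, hw, hwd⟩ := hs _ _ (q (2 ^ m)) p hp
    rcases hw with hw | hw
    · obtain ⟨k, hk, u, hu, hd⟩ := ih q Nat.one_le_two_pow le_rfl hw
      refine ⟨k, by omega, u, hu, ?_⟩
      have := hc.triangle p w u
      rw [add_mul]; omega
    · obtain ⟨k, hk, u, hu, hd⟩ := ih (n := n - 2 ^ m) (fun i => q (2 ^ m + i)) (by omega)
        (by omega)
        (by simpa [Nat.add_sub_cancel' (show 2 ^ m ≤ n by omega)] using hw)
      refine ⟨2 ^ m + k, by omega, u, hu, ?_⟩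
      have := hc.triangle p w u
      rw [add_mul]; omega

/-- A walk of length at most `n` whose vertices satisfy `P`. -/
inductive Pth (Γ : SimpleGraph V) (P : V → Prop) : ℕ → V → V → Prop
  | refl (n : ℕ) (x : V) : P x → Pth Γ P n x x
  | cons (n : ℕ) (x y z : V) : P x → Γ.Adj x y → Pth Γ P n y z → Pth Γ P (n + 1) x z

namespace Pth

variable {P P' : V → Prop} {x y z : V} {n : ℕ}

theorem mono (h : Pth Γ P n x y) : ∀ {m}, n ≤ m → Pth Γ P m x y := by
  induction h with
  | refl n x hx => exact fun _ => .refl _ _ hx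
  | cons n x y z hx ha _ ih =>
    intro m hm
    obtain ⟨k, rfl⟩ : ∃ k, m = k + 1 := ⟨m - 1, by omega⟩
    exact .cons _ _ _ _ hx ha (ih (by omega))

theorem trans (h : Pth Γ P n x y) : ∀ {m}, Pth Γ P m y z → Pth Γ P (n + m) x z := by
  induction h with
  | refl n x hx => exact fun h => h.mono (by omega)
  | cons n x y z hx ha _ ih =>
    intro m h
    exact (Pth.cons _ _ _ _ hx ha (ih h)).mono (by omega)

theorem left (h : Pth Γ P n x y) : P x := by
  cases h <;> assumption

theorem exists_seq (h : Pth Γ P n x y) : ∃ γ : ℕ → V, γ 0 = x ∧ γ n = y ∧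
    (∀ i < n, γ i = γ (i + 1) ∨ Γ.Adj (γ i) (γ (i + 1))) ∧ ∀ i ≤ n, P (γ i) := by
  induction h with
  | refl n x hx => exact ⟨fun _ => x, rfl, rfl, fun _ _ => .inl rfl, fun _ _ => hx⟩
  | cons n x y z hx ha _ ih =>
    obtain ⟨γ, h0, hn, h1, h2⟩ := ih
    refine ⟨fun i => Nat.casesOn i x γ, rfl, hn, ?_, ?_⟩
    · rintro (_ | i) hi
      · right; simpa [h0] using ha
      · exact h1 i (by omega)
    · rintro (_ | i) hi
      · exact hx
      · exact h2 i (by omega)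

theorem of_seq (hc : Γ.Connected) {γ : ℕ → V} (hγ : ∀ i, Γ.dist (γ i) (γ (i + 1)) ≤ 1) {k : ℕ}
    {a : ℕ} (hP : ∀ i ≤ k, P (γ (a + i))) : Pth Γ P k (γ a) (γ (a + k)) := by
  induction k with
  | zero => exact .refl _ _ (hP 0 le_rfl)
  | succ k ih =>
    refine (ih fun i hi => hP i (by omega)).trans (m := 1) ?_
    have h1 := hP k (by omega)
    have h2 := hP (k + 1) le_rfl
    rcases Nat.lt_or_ge 0 (Γ.dist (γ (a + k)) (γ (a + k + 1))) with h | h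
    · exact .cons 0 _ _ _ h1 (SimpleGraph.dist_eq_one_iff_adj.1 (le_antisymm (hγ _) h))
        (.refl _ _ h2)
    · have := hc.dist_eq_zero_iff.1 (Nat.le_zero.1 h)
      have e : γ (a + (k + 1)) = γ (a + k) := this.symm
      rw [e]
      exact .refl _ _ h1

theorem of_dist (hc : Γ.Connected) (hP : ∀ p, Btw Γ x p y → P p) : Pth Γ P (Γ.dist x y) x y := by
  obtain ⟨γ, h0, hn, hγ⟩ := exists_seq_of_walk hc x y
  have h := of_seq (P := P) hc hγ (k := Γ.dist x y) (a := 0) fun i hi => hP _ (by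
    have e1 := dist_geod hc hγ (n := Γ.dist x y) (by rw [h0, hn]) (Nat.zero_le i) hi
    have e2 := dist_geod hc hγ (n := Γ.dist x y) (by rw [h0, hn]) hi le_rfl
    rw [h0] at e1
    rw [hn] at e2
    rw [zero_add]
    unfold Btw
    omega)
  rwa [zero_add, h0, hn] at h

theorem symm (h : Pth Γ P n x y) : Pth Γ P n y x := by
  induction h with
  | refl n x hx => exact .refl _ _ hx
  | cons n x y z hx ha h ih => exact ih.trans (.cons 0 _ _ _ h.left ha.symm (.refl _ _ hx))

end Pth

theorem exists_pow_bound (a b : ℕ) : ∃ m₁, ∀ m, m₁ ≤ m → a * m + b ≤ 2 ^ m := by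
  have sq : ∀ m, 4 ≤ m → m * m ≤ 2 ^ m := by
    intro m hm
    induction m, hm using Nat.le_induction with
    | base => norm_num
    | succ m hm ih => rw [pow_succ]; nlinarith
  refine ⟨a + b + 4, fun m hm => le_trans ?_ (sq m (by omega))⟩
  nlinarith

/-- A sequence which changes by at most one attains intermediate values. -/
theorem exists_first {f : ℕ → ℕ} {n c : ℕ} (h0 : f 0 ≤ c) (hn : c ≤ f n)
    (hf : ∀ i, f (i + 1) ≤ f i + 1) : ∃ i ≤ n, f i = c := by
  induction n with
  | zero => exact ⟨0, le_rfl, by omega⟩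
  | succ n ih =>
    grind

end Polygon

section Cone

variable {V ι : Type*} {Γ : SimpleGraph V} {S : ι → Set V} {δ σ : ℕ}

/-- The graph obtained by adding a vertex joined to all of `S i`, for every `i`. -/
def coneGraph (Γ : SimpleGraph V) (S : ι → Set V) : SimpleGraph (V ⊕ ι) where
  Adj
    | .inl x, .inl y => Γ.Adj x y
    | .inl x, .inr i => x ∈ S i
    | .inr i, .inl x => x ∈ S i
    | .inr _, .inr _ => False
  symm := ⟨by rintro (x | i) (y | j) h; exacts [h.symm, h, h, h]⟩
  loopless := ⟨by rintro (x | i) h; exacts [Γ.loopless.irrefl _ h, h]⟩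

/-- Uniform quasiconvexity of a family of sets of vertices. -/
def QConv (Γ : SimpleGraph V) (S : ι → Set V) (σ : ℕ) : Prop :=
  ∀ i, ∀ s ∈ S i, ∀ t ∈ S i, ∀ p, Btw Γ s p t → ∃ u ∈ S i, Γ.dist p u ≤ σ

local notation "cdist" => SimpleGraph.dist (coneGraph Γ S)

theorem cone_adj_inl {x y : V} : (coneGraph Γ S).Adj (.inl x) (.inl y) ↔ Γ.Adj x y := Iff.rfl

theorem cone_adj_inr {i : ι} {x : V} : (coneGraph Γ S).Adj (.inr i) (.inl x) ↔ x ∈ S i := Iff.rfl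

theorem cone_adj_inr_right {i : ι} {x : V} : (coneGraph Γ S).Adj (.inl x) (.inr i) ↔ x ∈ S
    i := Iff.rfl

theorem cone_conn (hc : Γ.Connected) (hne : ∀ i, (S i).Nonempty) : (coneGraph Γ S).Connected := by
  have hl : ∀ x y : V, (coneGraph Γ S).Reachable (.inl x) (.inl y) := fun x y =>
    (hc.preconnected x y).map (⟨Sum.inl, fun h => h⟩ : Γ →g coneGraph Γ S)
  have hr : ∀ a : V ⊕ ι, ∃ y : V, (coneGraph Γ S).Reachable a (.inl y) := by
    rintro (x | i)
    · exact ⟨x, .refl _⟩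
    · obtain ⟨s, hs⟩ := hne i
      exact ⟨s, SimpleGraph.Adj.reachable (cone_adj_inr.2 hs)⟩
  have := hc.nonempty
  refine { preconnected := fun a b => ?_, nonempty := inferInstance }
  obtain ⟨y, hy⟩ := hr a
  obtain ⟨z, hz⟩ := hr b
  exact (hy.trans (hl y z)).trans hz.symm

theorem cone_dist_le (hc : Γ.Connected) (x y : V) :
    cdist (.inl x) (.inl y) ≤ Γ.dist x y := by
  obtain ⟨w, hw⟩ := hc.exists_walk_length_eq_dist x y
  have := (coneGraph Γ S).dist_le (w.map (⟨Sum.inl, fun h => h⟩ : Γ →g coneGraph Γ S))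
  rw [SimpleGraph.Walk.length_map, hw] at this
  exact this

theorem exists_inl_near (hne : ∀ i, (S i).Nonempty) (a : V ⊕ ι) :
    ∃ x : V, cdist (.inl x) a ≤ 1 := by
  rcases a with x | i
  · exact ⟨x, by simp⟩
  · obtain ⟨s, hs⟩ := hne i
    exact ⟨s, (cone_adj_inr_right.2 hs).dist_eq_one.le⟩

/-- A walk in the cone-off is shadowed by a sequence of vertices of the base. -/
theorem exists_base_seq {α : ℕ → V ⊕ ι} {n : ℕ} {x y : V} (h0 : α 0 = .inl x) (hn : α n = .inl y)
    (hα : ∀ i < n, α i = α (i + 1) ∨ (coneGraph Γ S).Adj (α i) (α (i + 1))) :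
    ∃ q : ℕ → V, q 0 = x ∧ q n = y ∧ ∀ k < n,
      (α k = .inl (q k) ∧ Γ.dist (q k) (q (k + 1)) ≤ 1) ∨
      ∃ i, α k = .inr i ∧ q k ∈ S i ∧ q (k + 1) ∈ S i := by
  let q : ℕ → V := fun k => Nat.rec x (fun k r => Sum.elim id (fun _ => r) (α (k + 1))) k
  have qs : ∀ k, q (k + 1) = Sum.elim id (fun _ => q k) (α (k + 1)) := fun _ => rfl
  have ql : ∀ k v, α k = .inl v → q k = v := by
    rintro (_ | k) v hv
    · rw [h0] at hv; exact Sum.inl_injective hv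
    · rw [qs, hv]; rfl
  have qr : ∀ k ≤ n, ∀ i, α k = .inr i → q k ∈ S i := by
    intro k
    induction k with
    | zero => intro _ i hi; rw [h0] at hi; cases hi
    | succ k ih =>
      intro hk i hi
      rw [qs, hi]
      rcases hα k (by omega) with e | e
      · exact ih (by omega) i (e.trans hi)
      · rw [hi] at e
        rcases hak : α k with v | j
        · rw [hak] at e
          rw [ql k v hak]
          exact e
        · rw [hak] at e
          exact e.elim
  refine ⟨q, rfl, ql n y hn, fun k hk => ?_⟩
  rcases hk0 : α k with v | i
  · have e := ql _ _ hk0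
    refine .inl ⟨by rw [e], ?_⟩
    rcases hk1 : α (k + 1) with v' | i'
    · rw [e, ql _ _ hk1]
      rcases hα k hk with h | h
      · grind
      · rw [hk0, hk1] at h; exact (cone_adj_inl.1 h).dist_eq_one.le
    · grind
  · have h1 := qr k (by omega) i hk0
    refine .inr ⟨i, rfl, h1, ?_⟩
    rcases hα k hk with h | h
    · grind
    · rcases hk1 : α (k + 1) with v' | i'
      · rw [hk0, hk1] at h
        rw [ql _ _ hk1]
        exact h
      · rw [hk0, hk1] at h
        exact h.elim

theorem cone_near_path (hc : Γ.Connected) (hs : Slim Γ δ) (hne : ∀ i, (S i).Nonempty)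
    (hq : QConv Γ S σ) {P : V ⊕ ι → Prop} {n m : ℕ} {x y u : V}
    (hP : Pth (coneGraph Γ S) P n (.inl x) (.inl y)) (hn : n ≤ 2 ^ m) (hu : Btw Γ x u y) :
    ∃ a, P a ∧ cdist (.inl u) a ≤ m * δ + σ + 1 := by
  have hc' := cone_conn hc hne
  obtain ⟨α, h0, hn', hα, hαP⟩ := hP.exists_seq
  rcases Nat.eq_zero_or_pos n with rfl | hpos
  · rw [h0] at hn'
    obtain rfl : x = y := Sum.inl_injective hn'
    refine ⟨.inl x, hP.left, ?_⟩
    have : u = x := by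
      unfold Btw at hu
      simp only [SimpleGraph.dist_self] at hu
      exact (hc.dist_eq_zero_iff.1 (by omega : Γ.dist x u = 0)).symm
    subst this
    simp
  obtain ⟨q, q0, qn, hqs⟩ := exists_base_seq h0 hn' hα
  obtain ⟨k, hk, w, hw, hd⟩ := hs.polygon hc q hpos hn (by rw [q0, qn]; exact hu)
  have key : cdist (.inl w) (α k) ≤ σ + 1 := by
    rcases hqs k hk with ⟨e, h1⟩ | ⟨i, e, h1, h2⟩
    · rw [e]
      refine (cone_dist_le hc _ _).trans ?_
      grind [SimpleGraph.dist_swap, Btw]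
    · obtain ⟨b, hb, hbd⟩ := hq i _ h1 _ h2 _ hw
      rw [e]
      have t := hc'.triangle (.inl w) (.inl b) (.inr i)
      grind [cone_dist_le, cone_adj_inr_right, SimpleGraph.Adj.dist_eq_one]
  refine ⟨α k, hαP k hk.le, ?_⟩
  have t := hc'.triangle (.inl u) (.inl w) (α k)
  grind [cone_dist_le]

/-- Geodesics stay this close to geodesics of the cone-off. -/
noncomputable def coneBound (δ σ : ℕ) : ℕ :=
  (exists_pow_bound (16 * δ) (16 * (σ + 2))).choose * δ + σ + 2

theorem le_coneBound {h : ℕ} (H : ∀ m, 8 * h ≤ 2 ^ m → h ≤ m * δ + σ + 2) : h ≤ coneBound δ σ := by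
  have h1 := (exists_pow_bound (16 * δ) (16 * (σ + 2))).choose_spec
  unfold coneBound
  set m₁ := (exists_pow_bound (16 * δ) (16 * (σ + 2))).choose
  have hex : ∃ m, 8 * h ≤ 2 ^ m := ⟨8 * h, Nat.lt_two_pow_self.le⟩
  obtain ⟨m, hm, hmin⟩ : ∃ m, 8 * h ≤ 2 ^ m ∧ ∀ k < m, ¬ 8 * h ≤ 2 ^ k :=
    ⟨Nat.find hex, Nat.find_spec hex, fun k hk => Nat.find_min hex hk⟩
  have hh := H m hm
  by_contra hcon
  have hlt : m₁ ≤ m := by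
    by_contra hlt
    have : m * δ ≤ m₁ * δ := Nat.mul_le_mul_right _ (by omega)
    omega
  have h2 := h1 m hlt
  rcases m with _ | m
  · simp at hm; omega
  · grind

theorem cone_near_geod (hc : Γ.Connected) (hs : Slim Γ δ) (hne : ∀ i, (S i).Nonempty)
    (hq : QConv Γ S σ) {a b : V ⊕ ι} {x y u : V} (hx : cdist (.inl x) a ≤ 1)
    (hy : cdist (.inl y) b ≤ 1) {α : ℕ → V ⊕ ι} {L : ℕ} (h0 : α 0 = a) (hL : α L = b)
    (hα : ∀ i, cdist (α i) (α (i + 1)) ≤ 1) (hLd : L ≤ cdist a b)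
    (hu : Btw Γ x u y) : ∃ k ≤ L, cdist (.inl u) (α k) ≤ coneBound δ σ := by
  have hc' := cone_conn hc hne
  set Δ := coneGraph Γ S with hΔ
  have hle : ∀ v w : V, Δ.dist (.inl v) (.inl w) ≤ Γ.dist v w := fun v w => cone_dist_le hc v w
  have hex : ∃ h, ∀ u, Btw Γ x u y → ∃ k ≤ L, Δ.dist (.inl u) (α k) ≤ h := by
    refine ⟨Γ.dist x y + 1, fun u hu => ⟨0, by omega, ?_⟩⟩
    have t := hc'.triangle (.inl u) (.inl x) a
    grind [SimpleGraph.dist_swap, Btw]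
  obtain ⟨h, hh, hmin⟩ : ∃ h, (∀ u, Btw Γ x u y → ∃ k ≤ L, Δ.dist (.inl u) (α k) ≤ h) ∧
      ∀ h' < h, ¬ ∀ u, Btw Γ x u y → ∃ k ≤ L, Δ.dist (.inl u) (α k) ≤ h' := by
    classical
    exact ⟨Nat.find hex, Nat.find_spec hex, fun k hk => Nat.find_min hex hk⟩
  suffices hb : h ≤ coneBound δ σ by
    grind
  clear hu u
  rcases Nat.eq_zero_or_pos h with rfl | hpos
  · exact Nat.zero_le _
  have hbad := hmin (h - 1) (by omega)
  push Not at hbad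
  obtain ⟨u, hu, hfar⟩ := hbad
  have geo : ∀ {i j : ℕ}, i ≤ j → j ≤ L → Δ.dist (α i) (α j) = j - i := fun h h' =>
    dist_geod hc' hα (by rw [h0, hL]; exact hLd) h h'
  have side : ∀ (z : V) (c : V ⊕ ι) (t : ℕ), t ≤ L → α t = c → Δ.dist (.inl z) c ≤ 1 →
      (∀ p, Btw Γ z p u → Btw Γ x p y) → ∃ p k, k ≤ L ∧ Btw Γ z p u ∧ Δ.dist (.inl u)
        (.inl p) ≤ 2 * h ∧
        Δ.dist (.inl p) (α k) ≤ h ∧ Pth Δ (fun b => h - 1 ≤ Δ.dist (.inl u) b) h (.inl p)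
          (α k) := by
    intro z c t ht hct hzc hz
    by_cases hdz : Δ.dist (.inl u) (.inl z) ≤ 2 * h
    · have h1 : Δ.dist (.inl z) (α t) ≤ 1 := by rw [hct]; exact hzc
      refine ⟨z, t, ht, btw_left, hdz, by omega, (Pth.of_dist hc' ?_).mono (n := _) (by omega)⟩
      intro p hp
      have := hfar t ht
      have t1 := hc'.triangle (.inl u) p (α t)
      unfold Btw at hp
      omega
    · obtain ⟨γ, g0, gn, hγ⟩ := exists_seq_of_walk hc u z
      have hstep : ∀ i, Δ.dist (.inl u) (.inl (γ (i + 1))) ≤ Δ.dist (.inl u) (.inl (γ i)) + 1 := by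
        intro i
        have := hc'.triangle (.inl u) (.inl (γ i)) (.inl (γ (i + 1)))
        grind
      obtain ⟨i, hi, hd⟩ := exists_first (f := fun i => Δ.dist (.inl u) (.inl (γ i)))
        (n := Γ.dist u z) (c := 2 * h) (by simp [g0]) (by simp only [gn]; omega) hstep
      have hb : Btw Γ z (γ i) u := by
        have e1 := dist_geod hc hγ (n := Γ.dist u z) (by rw [g0, gn]) (Nat.zero_le i) hi
        have e2 := dist_geod hc hγ (n := Γ.dist u z) (by rw [g0, gn]) hi le_rfl
        grind [Btw, Btw.symm]
      obtain ⟨k, hk, hkd⟩ := hh (γ i) (hz _ hb)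
      refine ⟨γ i, k, hk, hb, hd.le, hkd, (Pth.of_dist hc' ?_).mono (n := _) hkd⟩
      intro p hp
      have t1 := hc'.triangle (.inl u) p (.inl (γ i))
      grind [SimpleGraph.dist_swap, Btw]
  have hsub : ∀ {z w p : V}, Btw Γ z u w → Btw Γ z p u → Btw Γ z p w ∧ Btw Γ p u w := by
    intro z w p h1 h2
    have t1 := hc.triangle z p w
    have t2 := hc.triangle p u w
    unfold Btw at *
    omega
  obtain ⟨p, k, hk, hp, hpu, hpk, P1⟩ := side x a 0 (Nat.zero_le _) h0 hx fun p hp => (hsub hu hp).1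
  obtain ⟨p', k', hk', hp', hpu', hpk', P2⟩ := side y b L le_rfl hL hy
    fun p hp => (hsub hu.symm hp).1.symm
  have hpp : Btw Γ p u p' := ((hsub (hsub hu hp).2.symm hp').2).symm
  have hkk : ∀ i j, i ≤ j → j ≤ L → Δ.dist (α i) (α j) ≤ 6 * h →
      Pth Δ (fun b => h - 1 ≤ Δ.dist (.inl u) b) (6 * h) (α i) (α j) := by
    intro i j hij hj hd
    have := Pth.of_seq (P := fun b => h - 1 ≤ Δ.dist (.inl u) b) hc' hα (k := j - i) (a := i)
      fun l hl => by have := hfar (i + l) (by omega); omega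
    rw [Nat.add_sub_cancel' hij] at this
    grind [Pth.mono]
  have hd6 : Δ.dist (α k) (α k') ≤ 6 * h := by
    have t1 := hc'.triangle (α k) (.inl p) (α k')
    have t2 := hc'.triangle (.inl p) (.inl u) (α k')
    have t3 := hc'.triangle (.inl u) (.inl p') (α k')
    grind [SimpleGraph.dist_swap]
  have P3 : Pth Δ (fun b => h - 1 ≤ Δ.dist (.inl u) b) (6 * h) (α k) (α k') := by
    rcases le_total k k' with hle | hle
    · exact hkk k k' hle hk' hd6
    · grind [SimpleGraph.dist_comm, Pth.symm]
  refine le_coneBound fun m hm => ?_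
  obtain ⟨b, hb, hbd⟩ := cone_near_path hc hs hne hq (((P1.trans P3).trans P2.symm).mono
    (show h + 6 * h + h ≤ 8 * h by omega)) hm hpp
  grind

theorem cone_near_base (hc : Γ.Connected) (hs : Slim Γ δ) (hne : ∀ i, (S i).Nonempty)
    (hq : QConv Γ S σ) {a b c : V ⊕ ι} {x y : V} (hx : cdist (.inl x) a ≤ 1)
    (hy : cdist (.inl y) b ≤ 1) (hp : Btw (coneGraph Γ S) a c b) :
    ∃ u, Btw Γ x u y ∧ cdist c (.inl u) ≤ 3 * coneBound δ σ + 1 := by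
  have hc' := cone_conn hc hne
  set Δ := coneGraph Γ S with hΔ
  set H := coneBound δ σ with hH
  have hH1 : 1 ≤ H := by rw [hH]; unfold coneBound; omega
  obtain ⟨α₁, a0, an, hα₁⟩ := exists_seq_of_walk hc' a c
  obtain ⟨α₂, b0, bn, hα₂⟩ := exists_seq_of_walk hc' c b
  obtain ⟨t, ht⟩ : ∃ t, t = Δ.dist a c := ⟨_, rfl⟩
  obtain ⟨L, hLe⟩ : ∃ L, L = Δ.dist a b := ⟨_, rfl⟩
  have htL : t ≤ L := by unfold Btw at hp; omega
  have hsum : Δ.dist c b = L - t := by unfold Btw at hp; omega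
  rw [← ht] at an
  rw [hsum] at bn
  obtain ⟨α, hα0, hαt, hαL, hα⟩ : ∃ α : ℕ → V ⊕ ι, α 0 = a ∧ α t = c ∧ α L = b ∧
      ∀ i, Δ.dist (α i) (α (i + 1)) ≤ 1 := by
    refine ⟨fun i => if i ≤ t then α₁ i else α₂ (i - t), by simp [a0], by simp [an], ?_, fun i =>
      ?_⟩
    · grind
    · grind
  have geo : ∀ {i j : ℕ}, i ≤ j → j ≤ L → Δ.dist (α i) (α j) = j - i := fun h h' =>
    dist_geod hc' hα (by rw [hα0, hαL, hLe]) h h'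
  have near : ∀ u, Btw Γ x u y → ∃ k ≤ L, Δ.dist (.inl u) (α k) ≤ H := fun u hu => cone_near_geod
    hc hs hne hq hx hy hα0 hαL hα hLe.le hu
  obtain ⟨β, β0, βn, hβ⟩ := exists_seq_of_walk hc x y
  have hbt : ∀ i ≤ Γ.dist x y, Btw Γ x (β i) y := by
    intro i hi
    have e1 := dist_geod hc hβ (n := Γ.dist x y) (by rw [β0, βn]) (Nat.zero_le i) hi
    have e2 := dist_geod hc hβ (n := Γ.dist x y) (by rw [β0, βn]) hi le_rfl
    grind [Btw]
  have hfin : ∃ k, t ≤ k ∧ k ≤ L ∧ Δ.dist (.inl (β (Γ.dist x y))) (α k) ≤ H :=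
    ⟨L, htL, le_rfl, by rw [βn, hαL]; omega⟩
  have hex : ∃ j, j ≤ Γ.dist x y ∧ ∃ k, t ≤ k ∧ k ≤ L ∧ Δ.dist (.inl (β j)) (α k) ≤ H :=
    ⟨_, le_rfl, hfin⟩
  obtain ⟨j, ⟨hj, k, hk, hkL, hkd⟩, hmin⟩ : ∃ j, (j ≤ Γ.dist x y ∧ ∃ k, t ≤ k ∧ k ≤ L ∧
      Δ.dist (.inl (β j)) (α k) ≤ H) ∧ ∀ j' < j, ¬ (j' ≤ Γ.dist x y ∧ ∃ k, t ≤ k ∧ k ≤ L ∧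
      Δ.dist (.inl (β j')) (α k) ≤ H) := by
    classical
    exact ⟨Nat.find hex, Nat.find_spec hex, fun k hk => Nat.find_min hex hk⟩
  refine ⟨β j, hbt j hj, ?_⟩
  obtain ⟨k', hk', hkd'⟩ : ∃ k' ≤ t, Δ.dist (.inl (β j)) (α k') ≤ H + 1 := by
    rcases j with _ | j
    · grind
    · obtain ⟨k', hk', hd'⟩ := near (β j) (hbt j (by omega))
      refine ⟨k', ?_, ?_⟩
      · grind
      · have t1 := hc'.triangle (.inl (β (j + 1))) (.inl (β j)) (α k')
        grind [cone_dist_le, SimpleGraph.dist_comm]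
  have e1 := geo hk' htL
  have e2 := geo hk hkL
  have e3 := geo (hk'.trans hk) hkL
  have t1 := hc'.triangle (α k') (.inl (β j)) (α k)
  have c1 := Δ.dist_swap (.inl (β j)) (α k')
  have t2 := hc'.triangle (α t) (α k) (.inl (β j))
  grind [SimpleGraph.dist_swap]

/-- The slimness constant of cone-offs. -/
noncomputable def coneSlim (δ σ : ℕ) : ℕ := 4 * coneBound δ σ + 1 + δ

theorem cone_slim (hc : Γ.Connected) (hs : Slim Γ δ) (hne : ∀ i, (S i).Nonempty)
    (hq : QConv Γ S σ) : Slim (coneGraph Γ S) (coneSlim δ σ) := by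
  have hc' := cone_conn hc hne
  intro a b c p hp
  obtain ⟨x, hx⟩ := exists_inl_near (Γ := Γ) hne a
  obtain ⟨y, hy⟩ := exists_inl_near (Γ := Γ) hne b
  obtain ⟨z, hz⟩ := exists_inl_near (Γ := Γ) hne c
  obtain ⟨u, hu, hpu⟩ := cone_near_base hc hs hne hq hx hy hp
  obtain ⟨w, hw, huw⟩ := hs x y z u hu
  have key : ∀ {x y : V} {a b : V ⊕ ι}, cdist (.inl x) a ≤ 1 →
      cdist (.inl y) b ≤ 1 → Btw Γ x w y →
      ∃ q, Btw (coneGraph Γ S) a q b ∧ cdist p q ≤ coneSlim δ σ := by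
    intro x y a b hx hy hw
    obtain ⟨α, h0, hn, hα⟩ := exists_seq_of_walk hc' a b
    obtain ⟨k, hk, hd⟩ := cone_near_geod hc hs hne hq hx hy h0 hn hα le_rfl hw
    refine ⟨α k, ?_, ?_⟩
    · have e1 := dist_geod hc' hα (n := cdist a b) (by rw [h0, hn]) (Nat.zero_le k) hk
      have e2 := dist_geod hc' hα (n := cdist a b) (by rw [h0, hn]) hk le_rfl
      rw [h0] at e1
      rw [hn] at e2
      unfold Btw
      omega
    · have t1 := hc'.triangle p (.inl u) (α k)
      have t2 := hc'.triangle (.inl u) (.inl w) (α k)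
      grind [cone_dist_le, coneSlim]
  grind

/-- Distinct members of the family are close only along bounded segments. -/
def Ovl (Γ : SimpleGraph V) (S : ι → Set V) (C D : ℕ) : Prop :=
  ∀ i j, ∀ s₁ ∈ S i, ∀ s₂ ∈ S i, ∀ t₁ ∈ S j, ∀ t₂ ∈ S j,
    Γ.dist s₁ t₁ ≤ C → Γ.dist s₂ t₂ ≤ C → D ≤ Γ.dist s₁ s₂ → i = j

theorem Av.pth {v x y : V} {n : ℕ} (h : Av Γ v n x y) : Pth Γ (· ≠ v) n x y := by
  induction h with
  | refl n x hx => exact .refl _ _ hx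
  | cons n x y z hx ha _ ih => exact .cons _ _ _ _ hx ha ih

theorem dist_le_of_cone_av (hc : Γ.Connected) (hs : Slim Γ δ) (hq : QConv Γ S σ) {n D : ℕ}
    (hO : Ovl Γ S (n * δ + 2 * σ) D) {i : ι} {s s' : V} (hsi : s ∈ S i) (hsi' : s' ∈ S i)
    (h : Av (coneGraph Γ S) (.inr i) n (.inl s) (.inl s')) :
    Γ.dist s s' ≤ n * (D + 2 * σ + 2 * (n * δ) + 3) := by
  obtain ⟨α, h0, hn, hα, hαP⟩ := h.pth.exists_seq
  rcases Nat.eq_zero_or_pos n with rfl | hpos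
  · grind
  obtain ⟨q, q0, qn, hqs⟩ := exists_base_seq h0 hn hα
  obtain ⟨L, hL⟩ : ∃ L, L = D + 2 * σ + 2 * (n * δ) + 3 := ⟨_, rfl⟩
  rw [← hL]
  by_contra hcon
  obtain ⟨β, β0, βn, hβ⟩ := exists_seq_of_walk hc s s'
  have geo : ∀ {i j : ℕ}, i ≤ j → j ≤ Γ.dist s s' → Γ.dist (β i) (β j) = j - i := fun h h' =>
    dist_geod hc hβ (by rw [β0, βn]) h h'
  have hbt : ∀ k ≤ n, Btw Γ s (β (k * L)) s' := by
    intro k hk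
    have hk' : k * L ≤ n * L := Nat.mul_le_mul_right _ hk
    grind [Btw]
  have hpt : ∀ k ≤ n, ∃ l < n, ∃ u, Btw Γ (q l) u (q (l + 1)) ∧ Γ.dist (β (k * L)) u ≤ n * δ :=
    fun k hk => hs.polygon hc q hpos Nat.lt_two_pow_self.le (by rw [q0, qn]; exact hbt k hk)
  have hpt' : ∀ k : Fin (n + 1), ∃ l : Fin n, ∃ u, Btw Γ (q l) u (q (l + 1)) ∧
      Γ.dist (β (k * L)) u ≤ n * δ := fun k => by
    obtain ⟨l, hl, u, hu⟩ := hpt k (by omega)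
    exact ⟨⟨l, hl⟩, u, hu⟩
  choose f u hu hud using hpt'
  obtain ⟨a, b, hab, hf⟩ : ∃ a b : Fin (n + 1), a < b ∧ f a = f b := by
    obtain ⟨a, b, hne, e⟩ := Fintype.exists_ne_map_eq_of_card_lt f (by simp)
    grind
  have hdab : L ≤ Γ.dist (β (a * L)) (β (b * L)) := by
    have h1 : (a + 1 : ℕ) * L ≤ b * L := Nat.mul_le_mul_right _ (Fin.lt_def.1 hab)
    have h2 : (b : ℕ) * L ≤ n * L := Nat.mul_le_mul_right _ (by omega)
    rw [add_mul] at h1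
    rw [geo (by omega) (by omega)]
    omega
  have ub := hu b
  have ua := hu a
  rw [← hf] at ub
  have d1 := hud a
  have d2 := hud b
  have t1 := hc.triangle (β (a * L)) (u a) (β (b * L))
  have t2 := hc.triangle (u a) (u b) (β (b * L))
  have c1 := Γ.dist_swap (u b) (β (b * L))
  rcases hqs (f a) (f a).2 with ⟨-, h1⟩ | ⟨j, e, h1, h2⟩
  · have t3 := hc.triangle (u a) (q (f a)) (u b)
    grind [SimpleGraph.dist_swap, Btw]
  · obtain ⟨ta, hta, dta⟩ := hq j _ h1 _ h2 _ ua
    obtain ⟨tb, htb, dtb⟩ := hq j _ h1 _ h2 _ ub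
    obtain ⟨sa, hsa, dsa⟩ := hq i _ hsi _ hsi' _ (hbt a (by omega))
    obtain ⟨sb, hsb, dsb⟩ := hq i _ hsi _ hsi' _ (hbt b (by omega))
    have key : ∀ {x y z w : V}, Γ.dist y z ≤ n * δ → Γ.dist y x ≤ σ → Γ.dist z w ≤ σ →
        Γ.dist x w ≤ n * δ + 2 * σ := by
      intro x y z w h1 h2 h3
      have t1 := hc.triangle x y w
      have t2 := hc.triangle y z w
      have c := Γ.dist_swap x y
      omega
    have t3 := hc.triangle (β (a * L)) sa (β (b * L))
    have t4 := hc.triangle sa sb (β (b * L))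
    have c3 := Γ.dist_swap sb (β (b * L))
    have := hO i j sa hsa sb hsb ta hta tb htb (key d1 dsa dta) (key d2 dsb dtb) (by omega)
    grind

end Cone

section General

variable {V : Type*} {Γ : SimpleGraph V} {δ : ℕ}

theorem Ang.of_btw (hc : Γ.Connected) (hs : Slim Γ δ) {v x y z : V} {n : ℕ} (hn : angleBound δ ≤ n)
    (h : Ang Γ v n x z) (hb : Btw Γ x y z) : Ang Γ v n x y := by
  by_cases h' : Ang Γ v (angleBound δ) x y
  · exact h'.mono hn
  have hv := btw_of_not_ang hc hs h'
  have key : Lk Γ v y ⊆ Lk Γ v z := by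
    rintro e ⟨he, hd⟩
    refine ⟨he, ?_⟩
    have t1 := hc.triangle e y z
    have t2 := hc.triangle x v z
    have t3 := hc.triangle v e z
    have t5 := he.dist_eq_one
    unfold Btw at *
    omega
  exact fun e he e' he' => h e (he.imp_right (key ·)) e' (he'.imp_right (key ·))

/-- A point which is nearly between `x` and `w` is close to a geodesic. -/
theorem exists_btw_near (hc : Γ.Connected) (hs : Slim Γ δ) {x z w : V} {b : ℕ}
    (h : Γ.dist x z + Γ.dist z w ≤ Γ.dist x w + b) :
    ∃ u, Btw Γ x u w ∧ Γ.dist z u ≤ b + (4 * δ + 2) := by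
  by_cases hle : Γ.dist x z ≤ Γ.dist x w
  · obtain ⟨u, hu, hd⟩ := exists_point hc x w hle
    have := dist_le_of_near hc hs h (y' := u) (by unfold Btw at hu; omega) (by omega)
    exact ⟨u, hu, by omega⟩
  · exact ⟨w, btw_right, by omega⟩

theorem encard_le_of_fibres {α : Type*} {A : Set α} {τ : α → ℕ} (T : Finset ℕ) {n : ℕ}
    (hA : ∀ a ∈ A, τ a ∈ T) (h : ∀ t ∈ T, {a | a ∈ A ∧ τ a = t}.encard ≤ n) :
    A.encard ≤ (T.card * n : ℕ) := by
  classical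
  induction T using Finset.induction_on generalizing A with
  | empty =>
    have : A = ∅ := Set.eq_empty_of_forall_notMem fun a ha => by simpa using hA a ha
    simp [this]
  | insert t T ht ih =>
    have h1 := h t (Finset.mem_insert_self _ _)
    have h2 := ih (A := {a | a ∈ A ∧ τ a ≠ t})
      (fun a ha => (Finset.mem_insert.1 (hA a ha.1)).resolve_left ha.2)
      (fun s hs => (Set.encard_le_encard (t := {a | a ∈ A ∧ τ a = s})
        fun a ha => ⟨ha.1.1, ha.2⟩).trans (h s (Finset.mem_insert_of_mem hs)))
    have h3 : A = {a | a ∈ A ∧ τ a = t} ∪ {a | a ∈ A ∧ τ a ≠ t} := by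
      ext a; simp only [Set.mem_union, Set.mem_ofPred_eq]; tauto
    rw [h3, Finset.card_insert_of_notMem ht, add_mul, one_mul, add_comm]
    refine (Set.encard_union_le _ _).trans ?_
    push_cast at h2 ⊢
    exact add_le_add h1 h2

end General

section Cone

variable {V ι Q : Type*} [Group Q] [MulAction Q V] [MulAction Q ι]
variable {Γ : SimpleGraph V} {S : ι → Set V} {δ σ : ℕ}

local notation "cdist" => SimpleGraph.dist (coneGraph Γ S)

/-- An invariant family of subsets whose cone-off is again a tame graph. -/
structure ConeFam (Q : Type*) [Group Q] {V ι : Type*} [MulAction Q V] [MulAction Q ι]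
    (Γ : SimpleGraph V) (S : ι → Set V) (σ : ℕ) : Prop where
  ne : ∀ i, (S i).Nonempty
  qconv : QConv Γ S σ
  equiv : ∀ (g : Q) (i : ι), ∀ s ∈ S i, g • s ∈ S (g • i)
  ovl : ∀ C, ∃ D, Ovl Γ S C D
  fin : ∀ C : ℕ, ∃ n : ℕ, ∀ i, ∀ s ∈ S i, {g : Q | g • i = i ∧ Γ.dist s (g • s) ≤ C}.encard ≤ n
  unb : ∀ i, ∀ s ∈ S i, ∀ g : Q, g • i = i → g ≠ 1 → ∀ C, ∃ k : ℕ, C < Γ.dist s (g ^ k • s)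

namespace ConeFam

theorem acts (hF : ConeFam Q Γ S σ) (hQ : ActsOn Q Γ) : ActsOn Q (coneGraph Γ S) := by
  rintro g (x | i) (y | j) h
  · exact hQ g _ _ h
  · exact hF.equiv g j x h
  · exact hF.equiv g i y h
  · exact h

theorem exists_bound (hF : ConeFam Q Γ S σ) (hc : Γ.Connected) (hs : Slim Γ δ) (n : ℕ) :
    ∃ B, ∀ i, ∀ s ∈ S i, ∀ s' ∈ S i, Av (coneGraph Γ S) (.inr i) n (.inl s) (.inl s') →
      Γ.dist s s' ≤ B := by
  obtain ⟨D, hD⟩ := hF.ovl (n * δ + 2 * σ)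
  exact ⟨_, fun i s hsi s' hsi' h => dist_le_of_cone_av hc hs hF.qconv hD hsi hsi' h⟩

end ConeFam

theorem dist_le_of_cone_ang {δ' : ℕ} (hc : Γ.Connected) (hne : ∀ i, (S i).Nonempty)
    (hs : Slim (coneGraph Γ S) δ')
    {N B : ℕ} (hN : angleBound δ' ≤ N) (hB : ∀ i, ∀ s ∈ S i, ∀ s' ∈ S i,
      Av (coneGraph Γ S) (.inr i) N (.inl s) (.inl s') → Γ.dist s s' ≤ B) (n : ℕ) :
    ∀ p p' : V, cdist (.inl p) (.inl p') = n →
      (∀ i, Ang (coneGraph Γ S) (.inr i) N (.inl p) (.inl p')) → Γ.dist p p' ≤ n * (1 + B) := by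
  have hc' : (coneGraph Γ S).Connected := cone_conn hc hne
  induction n using Nat.strong_induction_on with
  | _ n ih =>
  intro p p' hd hang
  rcases Nat.eq_zero_or_pos n with rfl | hpos
  · obtain rfl : p = p' := Sum.inl_injective (hc'.dist_eq_zero_iff.1 hd)
    simp
  obtain ⟨e, he, hed⟩ := exists_next hc' (x := .inl p) (y := .inl p')
    (by rintro h; simp [h] at hd; omega)
  have hd1 := he.dist_eq_one
  rcases e with q | i
  · have := ih (n - 1) (by omega) q p' (by omega) (fun l =>
      (Ang.of_btw hc' hs hN (hang l).symm (by
        have h1 := (coneGraph Γ S).dist_swap (.inl p) (.inl p')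
        have h2 := (coneGraph Γ S).dist_swap (.inl q) (.inl p')
        have h3 := (coneGraph Γ S).dist_swap (.inl q) (.inl p)
        unfold Btw; omega)).symm)
    have t := hc.triangle p q p'
    have e1 := (cone_adj_inl.1 he).dist_eq_one
    grind [add_mul]
  · obtain ⟨f, hf, hfd⟩ := exists_next hc' (x := .inr i) (y := .inl p') (by simp)
    rcases f with q | j
    swap
    · exact absurd hf id
    have hd2 := hf.dist_eq_one
    have := ih (n - 2) (by omega) q p' (by omega) (fun l =>
      (Ang.of_btw hc' hs hN (hang l).symm (by
        have h1 := (coneGraph Γ S).dist_swap (.inl p) (.inl p')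
        have h2 := (coneGraph Γ S).dist_swap (.inl q) (.inl p')
        have h3 := (coneGraph Γ S).dist_swap (.inl q) (.inl p)
        have h4 := hc'.triangle (.inl p) (.inr i) (.inl q)
        have h5 := hc'.triangle (.inl p) (.inl q) (.inl p')
        have h6 := hc'.triangle (.inl p) (.inr i) (.inl p')
        unfold Btw
        omega)).symm)
    have t := hc.triangle p q p'
    have e1 := hB i p he q hf (hang i _ (.inl ⟨SimpleGraph.Adj.symm he, by
      rw [SimpleGraph.dist_self, SimpleGraph.dist_comm, hd1]⟩) _ (.inr ⟨hf, hfd⟩))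
    grind [add_mul]

theorem exists_inl_btw {a b : V ⊕ ι} (hc : (coneGraph Γ S).Connected) {i : ℕ}
    (hi : i + 1 ≤ cdist a b) :
    ∃ p : V, Btw (coneGraph Γ S) a (.inl p) b ∧ i ≤ cdist a (.inl p) ∧
      cdist a (.inl p) ≤ i + 1 := by
  obtain ⟨m, hm, hd⟩ := exists_point hc a b (i := i) (by omega)
  rcases m with p | j
  · exact ⟨p, hm, by omega, by omega⟩
  have hne : (.inr j : V ⊕ ι) ≠ b := by rintro rfl; omega
  obtain ⟨f, hf, hfd⟩ := exists_next hc hne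
  rcases f with q | k
  · have t1 := hc.triangle a (.inr j) (.inl q)
    have t2 := hc.triangle a (.inl q) b
    grind [SimpleGraph.Adj.dist_eq_one, Btw]
  · exact absurd hf id

namespace ConeFam

theorem encard_le_of_bend (hF : ConeFam Q Γ S σ) (hc : Γ.Connected) (hQ : ActsOn Q Γ)
    {Δ : SimpleGraph (V ⊕ ι)} {δ' : ℕ} (hΔ : Δ = coneGraph Γ S) (hs : Slim Δ δ')
    {B n ε : ℕ} (hB : ∀ i, ∀ s ∈ S i, ∀ s' ∈ S i,
      Av Δ (.inr i) (angleBound δ' + angleBound δ') (.inl s) (.inl s') → Γ.dist s s' ≤ B)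
    (hn : ∀ i, ∀ s ∈ S i, {g : Q | g • i = i ∧ Γ.dist s (g • s) ≤ B}.encard ≤ n)
    {a b m₁ m₂ : V ⊕ ι} {i : ι} (hm₁ : Btw Δ a m₁ b) (hm₂ : Btw Δ m₁ m₂ b)
    (h₁ : ε < Δ.dist a m₁) (h₂ : ε < Δ.dist m₂ b)
    (h : ¬ Ang Δ (.inr i) (8 * angleBound δ') m₁ m₂) :
    {g : Q | Δ.dist a (g • a) ≤ ε ∧ Δ.dist b (g • b) ≤ ε}.encard ≤ ((2 * ε + 1) * n : ℕ) := by
  have hc' : Δ.Connected := hΔ ▸ cone_conn hc hF.ne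
  have hacts : ActsOn Q Δ := hΔ ▸ hF.acts hQ
  obtain ⟨γ, hγ, hγd⟩ := exists_points hc' a b
  have key : ∀ g : Q, Δ.dist a (g • a) ≤ ε → Δ.dist b (g • b) ≤ ε →
      ∃ t ≤ Δ.dist a b, Δ.dist a (.inr i) ≤ t + ε ∧ t ≤ Δ.dist a (.inr i) + ε ∧ g • γ t = .inr i :=
    fun g hga hgb => exists_smul_eq_of_bend hc' hs hacts hm₁ hm₂ h₁ h₂ h γ hγ hγd hga hgb
  have hb := btw_of_not_ang hc' hs (fun h' => h (h'.mono (by omega)))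
  have hav : ε < Δ.dist a (.inr i) := by
    have t1 := hc'.triangle a (.inr i) m₂
    have t2 := hc'.triangle a m₂ b
    unfold Btw at *
    omega
  choose! τ hτ h1 h2 h3 using key
  have hcard : (Finset.Icc (Δ.dist a (.inr i) - ε) (Δ.dist a (.inr i) + ε)).card = 2 * ε + 1 := by
    rw [Nat.card_Icc]; omega
  rw [← hcard]
  refine encard_le_of_fibres (τ := τ) _ ?_ ?_
  · grind
  intro t _
  rcases Set.eq_empty_or_nonempty {g | g ∈ {g : Q | Δ.dist a (g • a) ≤ ε ∧ Δ.dist b (g • b) ≤ ε} ∧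
    τ g = t} with he | ⟨g₀, ⟨hg₀a, hg₀b⟩, rfl⟩
  · rw [he]; simp
  have e₀ := h3 g₀ hg₀a hg₀b
  have angle : ∀ g : Q, Δ.dist a (g • a) ≤ ε → Ang Δ (.inr i) (angleBound δ') a (g • a) :=
    fun g hg => ang_of_av hc' hs (av_of_dist_lt hc' (by omega))
  have hγa : γ (τ g₀) ≠ a := by
    grind
  obtain ⟨f, hf⟩ := exists_next hc' hγa
  have hfS : ∀ g : Q, g • γ (τ g₀) = .inr i → Δ.Adj (.inr i) (g • f) := fun g hg => by
    have := hacts g _ _ hf.1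
    rwa [hg] at this
  subst hΔ
  rcases f with f | j
  swap
  · exact absurd (hfS g₀ e₀) id
  refine le_trans ?_ (hn i (g₀ • f) (hfS g₀ e₀))
  have hinj : Function.Injective fun g : Q => g * g₀⁻¹ := mul_left_injective _
  rw [← hinj.encard_image]
  refine Set.encard_le_encard ?_
  rintro _ ⟨g, ⟨⟨hga, hgb⟩, hgt⟩, rfl⟩
  have e₁ := h3 g hga hgb
  rw [hgt] at e₁
  constructor
  · have : (g * g₀⁻¹) • (.inr i : V ⊕ ι) = .inr i := by
      grind [mul_smul, inv_smul_smul]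
    exact Sum.inr_injective this
  · rw [mul_smul, inv_smul_smul]
    refine hB i _ (hfS g₀ e₀) _ (hfS g e₁) ?_
    have hne : a ≠ .inr i := by rintro rfl; simp at hav
    refine ((angle g₀ hg₀a).symm.trans hc' (angle g hga) hne) _ (.inl ?_) _ (.inr ?_)
    · rw [← e₀]; exact hacts.mem_lk_smul hc' g₀ hf
    · rw [← e₁]; exact hacts.mem_lk_smul hc' g hf

theorem acyl (hF : ConeFam Q Γ S σ) (hT : Tame Q Γ) (ε : ℕ) :
    ∃ r n : ℕ, ∀ a b : V ⊕ ι, r ≤ cdist a b →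
      {g : Q | cdist a (g • a) ≤ ε ∧
        cdist b (g • b) ≤ ε}.encard ≤ n := by
  have hc := hT.conn
  obtain ⟨δ, hδ⟩ := hT.slim
  obtain ⟨Δ, hΔ⟩ : ∃ Δ, Δ = coneGraph Γ S := ⟨_, rfl⟩
  have hs : Slim Δ (coneSlim δ σ) := hΔ ▸ cone_slim hc hδ hF.ne hF.qconv
  have hc' : Δ.Connected := hΔ ▸ cone_conn hc hF.ne
  have hacts : ActsOn Q Δ := hΔ ▸ hF.acts hT.acts
  generalize coneSlim δ σ = δ' at hs
  obtain ⟨θ, hθ⟩ : ∃ θ, θ = angleBound δ' := ⟨_, rfl⟩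
  obtain ⟨B, hB⟩ := hF.exists_bound hc hδ (θ + θ)
  obtain ⟨n₂, hn₂⟩ := hF.fin B
  obtain ⟨B', hB'⟩ := hF.exists_bound hc hδ (8 * θ + (θ + 8 * θ))
  obtain ⟨ε₁, hε₁⟩ : ∃ ε₁, ε₁ = 3 * ε + 6 * δ' := ⟨_, rfl⟩
  obtain ⟨r, n, hrn⟩ := hT.acyl (ε₁ * (1 + B'))
  refine ⟨r + 2 * ε + 2 * ε₁ + 10, n + (2 * ε + 1) * n₂, fun a b hab => ?_⟩
  rw [← hΔ] at hB hB' hab ⊢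
  obtain ⟨m₁, hm₁, hd₁⟩ := exists_point hc' a b (i := ε + 1) (by omega)
  obtain ⟨m₂, hm₂, hd₂⟩ := exists_point hc' m₁ b (i := Δ.dist m₁ b - (ε + 1)) (by omega)
  have hm₁' := hm₁
  have hm₂' := hm₂
  unfold Btw at hm₁' hm₂'
  by_cases h : ∀ i, Ang Δ (.inr i) (8 * θ) m₁ m₂
  swap
  · push Not at h
    obtain ⟨i, hi⟩ := h
    rw [hθ] at hi hB
    refine (hF.encard_le_of_bend hc hT.acts hΔ hs hB hn₂ hm₁ hm₂ (by omega) (by omega) hi).trans ?_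
    exact_mod_cast (by omega)
  have move : ∀ p : V, Btw Δ m₁ (.inl p) m₂ → 2 * ε₁ < Δ.dist m₁ (.inl p) → ∀ g : Q,
      Δ.dist a (g • a) ≤ ε → Δ.dist b (g • b) ≤ ε → Γ.dist p (g • p) ≤ ε₁ * (1 + B') := by
    intro p hp hpd g hga hgb
    have t1 := hc'.triangle a m₁ (.inl p)
    have t2 := hc'.triangle a (.inl p) b
    have t3 := hc'.triangle (.inl p) m₂ b
    have hpb : Btw Δ a (.inl p) b := by unfold Btw at *; omega
    have hpm : Δ.dist (.inl p) (.inl (g • p)) ≤ 3 * ε + 6 * δ' :=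
      hs.displacement hc' hacts hpb hga hgb
    have hmm := hs.displacement hc' hacts hm₁ hga hgb
    refine le_trans (dist_le_of_cone_ang hc hF.ne (δ' := δ') (hΔ ▸ hs) (N := 8 * θ + (θ + 8 * θ))
      (by omega) (hΔ ▸ hB') _ p (g • p) rfl ?_) (Nat.mul_le_mul_right _ (by rw [← hΔ]; omega))
    intro i
    rw [← hΔ]
    by_cases hfar : Δ.dist (.inl p) (.inl (g • p)) < Δ.dist (.inl p) (.inr i)
    · exact (ang_of_av hc' hs (av_of_dist_lt hc' hfar)).mono (by omega)
    have t4 := hc'.triangle m₁ (.inr i) (.inl p)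
    have c1 := Δ.dist_swap (.inl p) (.inr i)
    have hav := av_of_dist_lt (v := .inr i) hc' (show Δ.dist m₁ (g • m₁) < _ by omega)
    have a1 : ∀ j, Ang Δ (.inr j) (8 * θ) m₁ (.inl p) := fun j =>
      Ang.of_btw hc' hs (by omega) (h j) hp
    have a2 : Ang Δ (.inr i) (8 * θ) (g • m₁) (.inl (g • p)) := by
      have := hacts.ang_smul hc' g (a1 (g⁻¹ • i))
      rwa [Sum.smul_inr, smul_inv_smul, Sum.smul_inl] at this
    exact (a1 i).symm.trans hc' ((hθ ▸ ang_of_av hc' hs hav).trans hc' a2 hav.right_ne) hav.left_ne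
  have hm12 : 2 * ε₁ + r + 5 ≤ Δ.dist m₁ m₂ := by omega
  rw [hΔ] at hm12
  obtain ⟨p, hp, hp1, hp2⟩ := exists_inl_btw (hΔ ▸ hc') (a := m₁) (b := m₂) (i := 2 * ε₁ + 1)
    (by omega)
  obtain ⟨p', hp', hp1', hp2'⟩ := exists_inl_btw (hΔ ▸ hc') (a := m₁) (b := m₂)
    (i := cdist m₁ m₂ - 1) (by omega)
  have t1 := (hΔ ▸ hc' : (coneGraph Γ S).Connected).triangle m₁ (.inl p) (.inl p')
  have t2 : cdist _ _ ≤ _ := cone_dist_le (S := S) hc p p'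
  rw [← hΔ] at *
  refine (Set.encard_le_encard ?_).trans ((hrn p p' (by omega)).trans
    (by exact_mod_cast (by omega)))
  grind

/-- A loxodromic element of the base which has bounded orbits in the cone-off stabilises a member
of the family. -/
theorem exists_fixed_of_lox (hF : ConeFam Q Γ S σ) (hc : Γ.Connected) (hs : Slim Γ δ)
    (hQ : ActsOn Q Γ) {g : Q} {y : V} {C b : ℕ} (hlox : IsLox Γ g y C)
    (hb : ∀ n : ℕ, cdist (.inl y) (.inl (g ^ n • y)) ≤ b) : ∃ j : ι, g • j = j := by
  obtain ⟨C₂, hC₂⟩ : ∃ C₂, C₂ = C + (4 * δ + 2) + b * δ + σ := ⟨_, rfl⟩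
  obtain ⟨D, hD⟩ := hF.ovl (2 * C₂ + Γ.dist y (g • y))
  obtain ⟨T, hT⟩ : ∃ T, T = 2 * C₂ + D + 3 := ⟨_, rfl⟩
  have hc' : (coneGraph Γ S).Connected := cone_conn hc hF.ne
  obtain ⟨α, α0, αn, hα⟩ := exists_seq_of_walk hc' (.inl y) (.inl (g ^ (T * (b + 1)) • y))
  have hlen := hb (T * (b + 1))
  generalize cdist (.inl y) (.inl (g ^ (T * (b + 1)) • y)) = ℓ at αn hlen
  obtain ⟨q, q0, qn, hq⟩ := exists_base_seq α0 αn (fun i _ => by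
    rcases Nat.le_one_iff_eq_zero_or_eq_one.1 (hα i) with h | h
    · exact .inl (hc'.dist_eq_zero_iff.1 h)
    · exact .inr (SimpleGraph.dist_eq_one_iff_adj.1 h))
  have hℓ : 1 ≤ ℓ := by
    by_contra hcon
    obtain rfl : ℓ = 0 := by omega
    have h1 := (hlox 0 (T * (b + 1))).2
    grind
  have near : ∀ l ≤ T * (b + 1), ∃ k < ℓ, ∃ u, Btw Γ (q k) u (q (k + 1)) ∧
      Γ.dist (g ^ l • y) u ≤ C + (4 * δ + 2) + b * δ := by
    intro l hl
    obtain ⟨m, hm⟩ := Nat.exists_eq_add_of_le hl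
    have h1 := (hlox l m).1
    rw [← dist_pow hc hQ g y l m, ← hm] at h1
    obtain ⟨p, hp, hpd⟩ := exists_btw_near hc hs h1
    rw [← qn, ← q0] at hp
    obtain ⟨k, hk, u, hu, hud⟩ := hs.polygon hc q hℓ (hlen.trans
      (Nat.lt_two_pow_self (n := b)).le) hp
    have := hc.triangle (g ^ l • y) p u
    exact ⟨k, hk, u, hu, by omega⟩
  have : Nonempty V := ⟨y⟩
  choose! κ hκ u hu hud using near
  obtain ⟨a, ha, a', ha', hne, he⟩ := Finset.exists_ne_map_eq_of_card_lt_of_maps_to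
    (s := Finset.range (b + 1)) (t := Finset.range b) (by simp) (f := fun a => κ (T * a)) (by
      intro a ha
      have ha : a < b + 1 := by simpa using ha
      have := hκ (T * a) (Nat.mul_le_mul_left _ (by omega))
      simp only [Finset.coe_range, Set.mem_Iio]
      omega)
  wlog hlt : a < a' generalizing a a'
  · exact this a' ha' a ha hne.symm he.symm (by omega)
  simp only [Finset.mem_range] at ha ha'
  have hla : T * a ≤ T * (b + 1) := Nat.mul_le_mul_left _ (by omega)
  have hla' : T * a' ≤ T * (b + 1) := Nat.mul_le_mul_left _ (by omega)
  have hgap : T * a + T ≤ T * a' := by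
    calc T * a + T = T * (a + 1) := by ring
      _ ≤ T * a' := Nat.mul_le_mul_left _ (by omega)
  generalize T * a = l at *
  generalize T * a' = l' at *
  have hdist : T ≤ Γ.dist (g ^ l • y) (g ^ l' • y) := by
    obtain ⟨m, rfl⟩ := Nat.exists_eq_add_of_le (show l ≤ l' by omega)
    rw [dist_pow hc hQ]
    have := (hlox 0 m).2
    omega
  have hu1 := hu l hla
  have hu2 := hu l' hla'
  have hd1 := hud l hla
  have hd2 := hud l' hla'
  rw [← he] at hu2
  rcases hq (κ l) (hκ l hla) with ⟨_, hshort⟩ | ⟨j, _, hj1, hj2⟩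
  · have t1 := hc.triangle (g ^ l • y) (u l) (g ^ l' • y)
    have t2 := hc.triangle (u l) (u l') (g ^ l' • y)
    have t3 := hc.triangle (u l) (q (κ l)) (u l')
    grind [SimpleGraph.dist_swap, Btw]
  obtain ⟨s, hs1, hsd⟩ := hF.qconv j _ hj1 _ hj2 _ hu1
  obtain ⟨s', hs1', hsd'⟩ := hF.qconv j _ hj1 _ hj2 _ hu2
  have near2 : ∀ l : ℕ, ∀ s u : V, Γ.dist (g ^ l • y) u ≤ C + (4 * δ + 2) + b * δ →
      Γ.dist u s ≤ σ → Γ.dist (g ^ l • y) s ≤ C₂ ∧ Γ.dist s (g • s) ≤ 2 * C₂ + Γ.dist y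
        (g • y) := by
    intro l s u h1 h2
    have t1 := hc.triangle (g ^ l • y) u s
    have t2 := hc.triangle s (g ^ l • y) (g • s)
    have t3 := hc.triangle (g ^ l • y) (g • g ^ l • y) (g • s)
    have e1 := hQ.dist_smul hc g (g ^ l • y) s
    have e2 : Γ.dist (g ^ l • y) (g • g ^ l • y) = Γ.dist y (g • y) := by
      rw [← mul_smul, ← pow_succ', pow_succ, mul_smul, hQ.dist_smul hc]
    grind [SimpleGraph.dist_swap]
  obtain ⟨n1, n2⟩ := near2 l s _ hd1 hsd
  obtain ⟨n1', n2'⟩ := near2 l' s' _ hd2 hsd'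
  refine ⟨j, (hD j (g • j) s hs1 s' hs1' _ (hF.equiv g j s hs1) _ (hF.equiv g j s' hs1') n2 n2'
    ?_).symm⟩
  have t1 := hc.triangle (g ^ l • y) s (g ^ l' • y)
  have t2 := hc.triangle s s' (g ^ l' • y)
  grind [SimpleGraph.dist_swap]

theorem not_ang_pow (hF : ConeFam Q Γ S σ) (hT : Tame Q Γ) {i : ι} {g : Q} (hg : g • i = i)
    (h1 : g ≠ 1) {y : V ⊕ ι} (hy : y ≠ .inr i) (n : ℕ) :
    ∃ k : ℕ, ¬ Ang (coneGraph Γ S) (.inr i) n y (g ^ k • y) := by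
  obtain ⟨δ, hδ⟩ := hT.slim
  have hc' : (coneGraph Γ S).Connected := cone_conn hT.conn hF.ne
  obtain ⟨B, hB⟩ := hF.exists_bound hT.conn hδ n
  obtain ⟨e, he⟩ := exists_next hc' hy.symm
  rcases e with s | j
  swap
  · exact absurd he.1 id
  obtain ⟨k, hk⟩ := hF.unb i s he.1 g hg h1 B
  have hgk : g ^ k • i = i := by
    have : g ∈ MulAction.stabilizer Q i := hg
    exact pow_mem this k
  refine ⟨k, fun h => ?_⟩
  have h2 := (hF.acts hT.acts).mem_lk_smul hc' (g ^ k) he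
  rw [Sum.smul_inr, hgk, Sum.smul_inl] at h2
  have := hB i s he.1 _ h2.1 (h _ (.inl he) _ (.inr h2))
  omega

theorem ell (hF : ConeFam Q Γ S σ) (hT : Tame Q Γ) (K : Subgroup Q) (x : V ⊕ ι) (b : ℕ)
    (hb : ∀ k ∈ K, cdist x (k • x) ≤ b) : ∃ y : V ⊕ ι, ∀ k ∈ K, k • y = y := by
  obtain ⟨δ, hδ⟩ := hT.slim
  have hc := hT.conn
  have hc' : (coneGraph Γ S).Connected := cone_conn hc hF.ne
  have hacts := hF.acts hT.acts
  have hs : Slim (coneGraph Γ S) (coneSlim δ σ) := cone_slim hc hδ hF.ne hF.qconv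
  have move : ∀ z : V ⊕ ι, ∀ k ∈ K,
      cdist z (k • z) ≤ b + 2 * cdist x z := by
    intro z k hk
    have t1 := hc'.triangle z x (k • z)
    have t2 := hc'.triangle x (k • x) (k • z)
    grind [ActsOn.dist_smul, SimpleGraph.dist_swap]
  obtain ⟨x₀, -⟩ := exists_inl_near (Γ := Γ) hF.ne x
  by_cases hbd : ∃ B, ∀ k ∈ K, Γ.dist x₀ (k • x₀) ≤ B
  · obtain ⟨B, hB⟩ := hbd
    obtain ⟨y, hy⟩ := hT.ell K x₀ B hB
    exact ⟨.inl y, fun k hk => by rw [Sum.smul_inl, hy k hk]⟩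
  push Not at hbd
  obtain ⟨g, hgK, y, hgy⟩ := exists_dist_sq hc hδ hT.acts hT.acyl hbd
  obtain ⟨C, hlox⟩ := isLox_of_dist_sq hc hδ hT.acts hgy
  obtain ⟨j, hj⟩ := hF.exists_fixed_of_lox hc hδ hT.acts hlox
    (fun n => move (.inl y) (g ^ n) (pow_mem hgK n))
  have hg1 : g ≠ 1 := by
    rintro rfl
    simp at hgy
  refine ⟨.inr j, ?_⟩
  obtain ⟨k₀, hk₀, hmax⟩ : ∃ k₀ ∈ K, ∀ k ∈ K, cdist (.inr j) (k • .inr j) ≤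
      cdist (.inr j) (k₀ • .inr j) := by
    have hfin : ((fun k : Q => cdist (.inr j) (k • .inr j)) '' (K : Set Q)).Finite :=
      (Set.finite_Iic _).subset (by rintro _ ⟨k, hk, rfl⟩; exact move _ k hk)
    obtain ⟨_, ⟨⟨k₀, hk₀, rfl⟩, hmax⟩⟩ := hfin.exists_maximal ⟨_, 1, K.one_mem, rfl⟩
    refine ⟨k₀, hk₀, fun k hk => ?_⟩
    by_contra hlt
    exact hlt (hmax ⟨k, hk, rfl⟩ (by simp only; omega))
  by_cases h0 : k₀ • (.inr j : V ⊕ ι) = .inr j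
  · intro k hk
    have := hmax k hk
    rw [h0, SimpleGraph.dist_self] at this
    exact (hc'.dist_eq_zero_iff.1 (by omega)).symm
  obtain ⟨n, hn⟩ := hF.not_ang_pow hT hj hg1 h0 (angleBound (coneSlim δ σ))
  have hb1 := btw_of_not_ang hc' hs hn
  have hgn : g ^ n • (.inr j : V ⊕ ι) = .inr j := by
    have : g ∈ MulAction.stabilizer Q (.inr j : V ⊕ ι) := congrArg Sum.inr hj
    exact pow_mem this n
  have e1 := hacts.dist_smul hc' (g ^ n) (.inr j) (k₀ • .inr j)
  rw [hgn] at e1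
  have e2 := hacts.dist_smul hc' k₀ (.inr j) (k₀⁻¹ • g ^ n • k₀ • .inr j)
  rw [smul_inv_smul] at e2
  have e3 := hmax (k₀⁻¹ * g ^ n * k₀) (K.mul_mem (K.mul_mem (K.inv_mem hk₀) (K.pow_mem hgK n)) hk₀)
  rw [mul_smul, mul_smul] at e3
  have p := hc'.pos_dist_of_ne h0
  unfold Btw at hb1
  omega

theorem eq_one_of_fixed (hF : ConeFam Q Γ S σ) (hT : Tame Q Γ) {i : ι} {g : Q} {y : V ⊕ ι}
    (hg : g • i = i) (hy : g • y = y) (hne : y ≠ .inr i) : g = 1 := by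
  by_contra h1
  obtain ⟨δ, hδ⟩ := hT.slim
  have hs : Slim (coneGraph Γ S) (coneSlim δ σ) := cone_slim hT.conn hδ hF.ne hF.qconv
  have hc' : (coneGraph Γ S).Connected := cone_conn hT.conn hF.ne
  obtain ⟨k, hk⟩ := hF.not_ang_pow hT hg h1 hne (angleBound (coneSlim δ σ))
  have hgk : g ^ k • y = y := by
    have : g ∈ MulAction.stabilizer Q y := hy
    exact pow_mem this k
  rw [hgk] at hk
  exact hk (ang_self hc' hs)

theorem not_isOfFinOrder (hF : ConeFam Q Γ S σ) {i : ι} {g : Q} (hg : g • i = i) (h1 : g ≠ 1) :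
    ¬ IsOfFinOrder g := by
  intro h
  obtain ⟨s, hs⟩ := hF.ne i
  obtain ⟨k, hk⟩ := hF.unb i s hs g hg h1 ((Finset.range (orderOf g)).sup fun k => Γ.dist s
    (g ^ k • s))
  exact absurd (Finset.le_sup (f := fun k => Γ.dist s (g ^ k • s))
    (Finset.mem_range.2 (Nat.mod_lt k h.orderOf_pos))) (by simpa using hk)

theorem tame (hF : ConeFam Q Γ S σ) (hT : Tame Q Γ) : Tame Q (coneGraph Γ S) where
  conn := cone_conn hT.conn hF.ne
  acts := hF.acts hT.acts
  slim := let ⟨_, hδ⟩ := hT.slim; ⟨_, cone_slim hT.conn hδ hF.ne hF.qconv⟩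
  acyl := hF.acyl hT
  ell := hF.ell hT
  disj := by
    rintro g (x | i) (y | j) hx hy hne
    · exact hT.disj g x y (Sum.inl_injective hx) (Sum.inl_injective hy) (fun h => hne (by rw [h]))
    · exact hF.eq_one_of_fixed hT (Sum.inr_injective hy) hx hne
    · exact hF.eq_one_of_fixed hT (Sum.inr_injective hx) hy hne.symm
    · exact hF.eq_one_of_fixed hT (Sum.inr_injective hx) hy hne.symm
  tf := by
    rintro g (x | i) hx h1
    · exact hT.tf g x (Sum.inl_injective hx) h1
    · exact hF.not_isOfFinOrder (Sum.inr_injective hx) h1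

end ConeFam

end Cone

section Cyclic

variable {G : Type*} [Group G]

theorem eq_one_of_zpow_eq_one (htf : ∀ g : G, g ≠ 1 → ¬ IsOfFinOrder g) {g : G} {n : ℤ} (hn : n ≠ 0)
    (h : g ^ n = 1) : g = 1 := by
  by_contra h1
  exact htf g h1 (isOfFinOrder_iff_zpow_eq_one.2 ⟨n, hn, h⟩)

/-- A torsion-free group with a cyclic subgroup of finite index is cyclic. -/
theorem isCyclic_of_finiteIndex (htf : ∀ g : G, g ≠ 1 → ¬ IsOfFinOrder g) (z : G)
    [(Subgroup.zpowers z).FiniteIndex] : IsCyclic G := by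
  set N := (Subgroup.zpowers z).normalCore with hN
  have : IsCyclic N := Subgroup.isCyclic_of_le (Subgroup.zpowers z).normalCore_le
  obtain ⟨⟨w, hwN⟩, hw⟩ := IsCyclic.exists_generator (α := N)
  have hw' : ∀ x ∈ N, ∃ k : ℤ, w ^ k = x := fun x hx => by
    obtain ⟨k, hk⟩ := Subgroup.mem_zpowers_iff.1 (hw ⟨x, hx⟩)
    exact ⟨k, by simpa using congrArg Subtype.val hk⟩
  have hcomm : ∀ g : G, g * w = w * g := by
    intro g
    have hNn : N.Normal := Subgroup.normalCore_normal _
    obtain ⟨a, ha⟩ := hw' _ (hNn.conj_mem w hwN g)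
    obtain ⟨k, hk, -, hgk⟩ := Subgroup.exists_pow_mem_of_index_ne_zero
      (Subgroup.FiniteIndex.index_ne_zero (H := N)) g
    obtain ⟨j, hj⟩ := hw' _ hgk
    by_cases hj0 : j = 0
    · rw [hj0, zpow_zero] at hj
      have := eq_one_of_zpow_eq_one htf (g := g) (n := k) (by omega) (by rw [zpow_natCast, ← hj])
      simp [this]
    have h1 : w ^ (a * j) = w ^ j := by
      rw [zpow_mul, ha, conj_zpow, hj]
      group
    have h2 : w ^ ((a - 1) * j) = 1 := by
      rw [sub_mul, one_mul, zpow_sub, h1, mul_inv_cancel]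
    by_cases ha1 : a = 1
    · rw [ha1, zpow_one] at ha
      nth_rewrite 2 [ha]
      group
    · have := eq_one_of_zpow_eq_one htf (mul_ne_zero (sub_ne_zero.2 ha1) hj0) h2
      simp [this]
  have hNc : N ≤ Subgroup.center G := by
    intro x hx
    obtain ⟨k, rfl⟩ := hw' x hx
    refine zpow_mem ?_ k
    exact Subgroup.mem_center_iff.2 hcomm
  have : (Subgroup.center G).FiniteIndex := Subgroup.finiteIndex_of_le hNc
  have hinj : Function.Injective (MonoidHom.transferCenterPow G) := by
    refine (injective_iff_map_eq_one _).2 fun g hg => ?_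
    have hg := congrArg Subtype.val hg
    exact eq_one_of_zpow_eq_one htf (n := (Subgroup.center G).index)
      (by exact_mod_cast Subgroup.FiniteIndex.index_ne_zero) (by rw [zpow_natCast]; exact hg)
  have hab : ∀ a b : G, a * b = b * a := fun a b => hinj (by
    rw [map_mul, map_mul]
    exact Subtype.ext (Subgroup.mem_center_iff.1 (MonoidHom.transferCenterPow G b).2 _))
  let f : G →* N :=
    { toFun := fun g => ⟨g ^ N.index, by
        exact N.pow_index_mem g⟩
      map_one' := by simp
      map_mul' := fun a b => Subtype.ext ((show Commute a b from hab a b).mul_pow _) }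
  refine isCyclic_of_injective f ((injective_iff_map_eq_one _).2 fun g hg => ?_)
  have hg : g ^ N.index = 1 := congrArg Subtype.val hg
  exact eq_one_of_zpow_eq_one htf (n := N.index)
    (by exact_mod_cast Subgroup.FiniteIndex.index_ne_zero) (by rw [zpow_natCast]; exact hg)

end Cyclic

section Axis

variable {V Q : Type*} [Group Q] [MulAction Q V] {Γ : SimpleGraph V} {δ : ℕ}

/-- The orbit of `y` under the powers of `c` is a properly embedded quasi-axis. -/
structure QAx (Γ : SimpleGraph V) (c : Q) (y : V) (C : ℕ) : Prop where
  add : ∀ m n : ℕ, Γ.dist y (c ^ m • y) + Γ.dist y (c ^ n • y) ≤ Γ.dist y (c ^ (m + n) • y) + C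
  proper : ∀ B, ∃ N : ℕ, ∀ n ≥ N, B < Γ.dist y (c ^ n • y)

theorem IsLox.qax {g : Q} {y : V} {C : ℕ} (h : IsLox Γ g y C) : QAx Γ g y C :=
  ⟨fun m n => (h m n).1, fun B => ⟨B + 1, fun n hn => lt_of_lt_of_le hn (h 0 n).2⟩⟩

theorem Tame.torsionFree (hT : Tame Q Γ) (g : Q) (hg : g ≠ 1) : ¬ IsOfFinOrder g := by
  intro hfin
  obtain ⟨x⟩ := hT.conn.nonempty
  obtain ⟨y, hy⟩ := hT.ell (Subgroup.zpowers g) x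
    ((Finset.range (orderOf g)).sup fun k => Γ.dist x (g ^ k • x)) (by
      intro k hk
      obtain ⟨n, rfl⟩ := hfin.mem_powers_iff_mem_zpowers.2 hk
      simp only
      rw [← pow_mod_orderOf]
      exact Finset.le_sup (f := fun k => Γ.dist x (g ^ k • x))
        (Finset.mem_range.2 (Nat.mod_lt n hfin.orderOf_pos)))
  exact hT.tf g y (hy g (Subgroup.mem_zpowers g)) hg hfin

theorem dist_zpow (hc : Γ.Connected) (hQ : ActsOn Q Γ) (c : Q) (y : V) (k l : ℤ) :
    Γ.dist (c ^ k • y) (c ^ l • y) = Γ.dist y (c ^ (l - k).natAbs • y) := by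
  have key : ∀ (k : ℤ) (n : ℕ), Γ.dist (c ^ k • y) (c ^ (k + n) • y) = Γ.dist y (c ^ n • y) := by
    intro k n
    rw [zpow_add, mul_smul, hQ.dist_smul hc, zpow_natCast]
  rcases le_total k l with h | h
  · rw [← key k, show k + ((l - k).natAbs : ℤ) = l by omega]
  · rw [← key l, show l + ((l - k).natAbs : ℤ) = k by omega, SimpleGraph.dist_comm]

namespace QAx

variable {c : Q} {y : V} {C : ℕ}

theorem ne_one (h : QAx Γ c y C) : c ≠ 1 := by
  rintro rfl
  obtain ⟨N, hN⟩ := h.proper 0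
  simpa using hN N le_rfl

/-- Geodesics between points of the axis stay close to the axis. -/
theorem near_axis (h : QAx Γ c y C) (hc : Γ.Connected) (hs : Slim Γ δ) (hQ : ActsOn Q Γ) {k l : ℤ}
    {p : V} (hp : Btw Γ (c ^ k • y) p (c ^ l • y)) :
    ∃ j : ℤ, Γ.dist p (c ^ j • y) ≤ Γ.dist y (c • y) + C + (4 * δ + 2) := by
  wlog hkl : k ≤ l generalizing k l
  · exact this hp.symm (by omega)
  obtain ⟨n, rfl⟩ : ∃ n : ℕ, l = k + n := ⟨(l - k).toNat, by omega⟩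
  have hp' : Btw Γ y (c ^ (-k) • p) (c ^ n • y) := by
    have := (hQ.btw_smul hc (c ^ (-k))).2 hp
    rwa [← mul_smul, ← mul_smul, ← zpow_add, ← zpow_add, neg_add_cancel, neg_add_cancel_left,
      zpow_zero, one_smul, zpow_natCast] at this
  generalize hp0 : c ^ (-k) • p = p' at hp'
  have hn : Γ.dist y p' ≤ Γ.dist y (c ^ n • y) := by unfold Btw at hp'; omega
  classical
  have hex : ∃ j, Γ.dist y p' ≤ Γ.dist y (c ^ j • y) := ⟨n, hn⟩
  obtain ⟨j, hj⟩ : ∃ j, j = Nat.find hex := ⟨_, rfl⟩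
  have hj1 := Nat.find_spec hex
  have hj2 := Nat.find_min' hex hn
  have hj3 : Γ.dist y (c ^ j • y) ≤ Γ.dist y p' + Γ.dist y (c • y) := by
    rcases Nat.eq_zero_or_pos j with h0 | hpos
    · simp [h0]
    · have := Nat.find_min hex (m := j - 1) (by omega)
      obtain ⟨i, rfl⟩ : ∃ i, j = i + 1 := ⟨j - 1, by omega⟩
      have t := hc.triangle y (c ^ i • y) (c ^ (i + 1) • y)
      grind [dist_pow, pow_one]
  rw [← hj] at hj1 hj2
  obtain ⟨m, rfl⟩ := Nat.exists_eq_add_of_le hj2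
  have ha := h.add j m
  have e := dist_pow hc hQ c y j m
  have := dist_le_of_near hc hs (x := y) (η := c ^ (j + m) • y) (y := p') (y' := c ^ j • y) (b := C)
    (by unfold Btw at hp'; omega) (by omega) hj1
  refine ⟨k + j, ?_⟩
  rw [zpow_add, mul_smul, zpow_natCast, ← hQ.dist_smul hc (c ^ (-k)), hp0, ← mul_smul, ← zpow_add,
    neg_add_cancel, zpow_zero, one_smul]
  omega

/-- A point of the axis is close to a geodesic with end points near the axis, or near its ends. -/
theorem near_geod (h : QAx Γ c y C) (hc : Γ.Connected) (hs : Slim Γ δ) (hQ : ActsOn Q Γ) {l n B : ℕ}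
    {t₁ t₂ : V} (hl : l ≤ n) (h₁ : Γ.dist y t₁ ≤ B) (h₂ : Γ.dist (c ^ n • y) t₂ ≤ B) :
    ∃ p, Btw Γ t₁ p t₂ ∧ (Γ.dist (c ^ l • y) p ≤ C + (6 * δ + 2) ∨
      (Γ.dist (c ^ l • y) p ≤ B + C + (6 * δ + 2) ∧
        (Γ.dist y (c ^ l • y) ≤ B + C + (6 * δ + 2) ∨
          Γ.dist (c ^ l • y) (c ^ n • y) ≤ B + C + (6 * δ + 2)))) := by
  obtain ⟨m, rfl⟩ := Nat.exists_eq_add_of_le hl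
  have ha := h.add l m
  rw [← dist_pow hc hQ c y l m] at ha
  obtain ⟨u, hu, hud⟩ := exists_btw_near hc hs ha
  generalize c ^ (l + m) • y = w at *
  generalize c ^ l • y = z at *
  obtain ⟨q, hq, hqd⟩ := hs y w t₁ u hu
  have s1 := hc.triangle z u q
  rcases hq with hq | hq
  · refine ⟨t₁, btw_left, .inr ?_⟩
    have s2 := hc.triangle z q t₁
    have s3 := hc.triangle y q z
    grind [SimpleGraph.dist_swap, Btw]
  obtain ⟨p, hp, hpd⟩ := hs t₁ w t₂ q hq
  have s2 := hc.triangle z q p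
  rcases hp with hp | hp
  · exact ⟨p, hp, .inl (by omega)⟩
  · refine ⟨t₂, btw_right, .inr ?_⟩
    have s4 := hc.triangle z p t₂
    have s5 := hc.triangle z p w
    grind [SimpleGraph.dist_swap, Btw]

/-- Only boundedly many elements carry a long initial part of the axis into itself. -/
theorem encard_le (h : QAx Γ c y C) (hT : Tame Q Γ) (B : ℕ) :
    ∃ R M : ℕ, {w : Q | Γ.dist y (w • y) ≤ B ∧
      ∃ r : ℤ, Γ.dist (c ^ R • y) (w • c ^ r • y) ≤ B}.encard ≤ M := by
  have hc := hT.conn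
  obtain ⟨d, n, hdn⟩ := hT.acyl (2 * B)
  obtain ⟨R, hR⟩ := h.proper d
  obtain ⟨N, hN⟩ := h.proper (2 * B + Γ.dist y (c ^ R • y))
  refine ⟨R, (Finset.range (2 * N)).card * n, ?_⟩
  have hr : ∀ w : Q, ∃ r : ℤ, (Γ.dist y (w • y) ≤ B ∧
      ∃ r : ℤ, Γ.dist (c ^ R • y) (w • c ^ r • y) ≤ B) → Γ.dist (c ^ R • y)
        (w • c ^ r • y) ≤ B := by
    intro w
    by_cases hw : Γ.dist y (w • y) ≤ B ∧ ∃ r : ℤ, Γ.dist (c ^ R • y) (w • c ^ r • y) ≤ B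
    · grind
    · exact ⟨0, fun h => absurd h hw⟩
  choose ρ hρ using hr
  have hsmall : ∀ w : Q, (Γ.dist y (w • y) ≤ B ∧
      ∃ r : ℤ, Γ.dist (c ^ R • y) (w • c ^ r • y) ≤ B) → (ρ w).natAbs < N := by
    intro w hw
    by_contra hcon
    have h1 := hN _ (not_lt.1 hcon)
    have h2 := hρ w hw
    have e := dist_zpow hc hT.acts c y 0 (ρ w)
    rw [sub_zero, zpow_zero, one_smul] at e
    have e2 := hT.acts.dist_smul hc w y (c ^ ρ w • y)
    have t1 := hc.triangle (w • y) y (w • c ^ ρ w • y)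
    have t2 := hc.triangle y (c ^ R • y) (w • c ^ ρ w • y)
    have c1 := Γ.dist_swap y (w • y)
    omega
  refine encard_le_of_fibres (τ := fun w => (ρ w + N).toNat) _ ?_ ?_
  · grind
  intro t _
  rcases Set.eq_empty_or_nonempty {w | w ∈ {w : Q | Γ.dist y (w • y) ≤ B ∧
    ∃ r : ℤ, Γ.dist (c ^ R • y) (w • c ^ r • y) ≤ B} ∧ (ρ w + N).toNat = t} with he | ⟨w₀, hw₀, ht⟩
  · rw [he]; simp
  refine le_trans ?_ (hdn y (c ^ R • y) (hR R le_rfl).le)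
  have hinj : Function.Injective fun g : Q => g * w₀⁻¹ := mul_left_injective _
  rw [← hinj.encard_image]
  refine Set.encard_le_encard ?_
  rintro _ ⟨w, ⟨hw, hwt⟩, rfl⟩
  have hρρ : ρ w = ρ w₀ := by
    have := hsmall w₀ hw₀
    omega
  have key : ∀ a b : V, Γ.dist a (w • b) ≤ B → Γ.dist a (w₀ • b) ≤ B →
      Γ.dist a ((w * w₀⁻¹) • a) ≤ 2 * B := by
    intro a b h1 h2
    have t := hc.triangle a (w • b) ((w * w₀⁻¹) • a)
    have e := hT.acts.dist_smul hc (w * w₀⁻¹) (w₀ • b) a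
    grind [mul_smul, inv_smul_smul, SimpleGraph.dist_swap]
  grind

end QAx

end Axis

/-- The commensurator of a cyclic subgroup. -/
def comm {Q : Type*} [Group Q] (q : Q) : Subgroup Q where
  carrier := {g | ∃ m n : ℤ, m ≠ 0 ∧ n ≠ 0 ∧ g * q ^ m * g⁻¹ = q ^ n}
  one_mem' := ⟨1, 1, one_ne_zero, one_ne_zero, by simp⟩
  mul_mem' := by
    rintro a b ⟨m, n, hm, hn, h⟩ ⟨m', n', hm', hn', h'⟩
    refine ⟨m' * m, n * n', mul_ne_zero hm' hm, mul_ne_zero hn hn', ?_⟩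
    calc a * b * q ^ (m' * m) * (a * b)⁻¹ = a * (b * q ^ m' * b⁻¹) ^ m * a⁻¹ := by
          rw [conj_zpow, zpow_mul]; group
      _ = (a * q ^ m * a⁻¹) ^ n' := by rw [h', conj_zpow, ← zpow_mul, ← zpow_mul, mul_comm]
      _ = q ^ (n * n') := by rw [h, zpow_mul]
  inv_mem' := by
    rintro a ⟨m, n, hm, hn, h⟩
    refine ⟨n, m, hn, hm, ?_⟩
    rw [← h]; group

section

variable {V Q : Type*} [Group Q] [MulAction Q V] {Γ : SimpleGraph V} {δ : ℕ}
variable {c : Q} {y : V} {C : ℕ}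

theorem QAx.exists_mem (h : QAx Γ c y C) (hT : Tame Q Γ) (hs : Slim Γ δ) {B : ℕ}
    (hB : Γ.dist y (c • y) + 2 * C + (10 * δ + 4) ≤ B) (R : ℕ) {g : Q} (hg : g ∈ comm c) :
    ∃ l k : ℤ, Γ.dist y ((c ^ l * g * c ^ k) • y) ≤ B ∧
      ∃ r : ℤ, Γ.dist (c ^ R • y) ((c ^ l * g * c ^ k) • c ^ r • y) ≤ B := by
  have hc := hT.conn
  obtain ⟨m, n, hm, hn, hgmn⟩ := hg
  wlog hpos : 0 < n generalizing m n
  · refine this (-m) (-n) (by omega) (by omega) ?_ (by omega)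
    rw [zpow_neg, zpow_neg, ← hgmn]; group
  set b := Γ.dist y (g • y) with hb
  obtain ⟨L, hL⟩ := h.proper (b + C + (6 * δ + 2))
  obtain ⟨n, rfl⟩ : ∃ n' : ℕ, n = n' := ⟨n.toNat, by omega⟩
  have hlong : L + R + L ≤ n * (L + R + L) := Nat.le_mul_of_pos_left _ (by omega)
  have hend : Γ.dist (c ^ (n * (L + R + L)) • y) (g • c ^ (m * (L + R + L : ℕ)) • y) ≤ b := by
    have : g * c ^ (m * (L + R + L : ℕ)) = c ^ (n * (L + R + L)) * g := by
      rw [← mul_inv_eq_iff_eq_mul, zpow_mul, ← conj_zpow, hgmn, ← zpow_natCast c, ← zpow_mul]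
      push_cast; rfl
    rw [← mul_smul, this, mul_smul, hT.acts.dist_smul hc]
  have near : ∀ l : ℕ, L ≤ l → l ≤ L + R → ∃ j : ℤ, Γ.dist (c ^ l • y) (g • c ^ j • y) ≤ B := by
    intro l h1 h2
    obtain ⟨p, hp, hpd⟩ := h.near_geod hc hs hT.acts (l := l) (n := n * (L + R + L))
      (t₁ := g • y) (by omega) le_rfl hend
    have f1 := hL l h1
    have f2 := hL (n * (L + R + L) - l) (by omega)
    have e := dist_pow hc hT.acts c y l (n * (L + R + L) - l)
    rw [Nat.add_sub_cancel' (by omega)] at e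
    have hp' : Btw Γ (c ^ (0 : ℤ) • y) (g⁻¹ • p) (c ^ (m * (L + R + L : ℕ)) • y) := by
      rw [← hT.acts.btw_smul hc g, smul_inv_smul, zpow_zero, one_smul]; exact hp
    obtain ⟨j, hj⟩ := h.near_axis hc hs hT.acts hp'
    rw [← hT.acts.dist_smul hc g, smul_inv_smul] at hj
    have t := hc.triangle (c ^ l • y) p (g • c ^ j • y)
    exact ⟨j, by omega⟩
  obtain ⟨k, hk⟩ := near L le_rfl (by omega)
  obtain ⟨k', hk'⟩ := near (L + R) (by omega) le_rfl
  refine ⟨-L, k, ?_, k' - k, ?_⟩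
  · rw [← hT.acts.dist_smul hc (c ^ L), ← mul_smul]
    rwa [show c ^ L * (c ^ (-(L : ℤ)) * g * c ^ k) = g * c ^ k by
      rw [zpow_neg, zpow_natCast]; group, mul_smul]
  · rw [← hT.acts.dist_smul hc (c ^ L), ← mul_smul, ← mul_smul, ← mul_smul, ← pow_add]
    rwa [show c ^ L * (c ^ (-(L : ℤ)) * g * c ^ k) * c ^ (k' - k) = g * c ^ k' by
      rw [zpow_neg, zpow_natCast]; group, mul_smul]

theorem QAx.finite_cosets (h : QAx Γ c y C) (hT : Tame Q Γ) :
    (Set.range fun e : comm c => (QuotientGroup.mk (e : Q) : Q ⧸ Subgroup.zpowers c)).Finite := by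
  obtain ⟨δ, hs⟩ := hT.slim
  obtain ⟨R, M, hM⟩ := h.encard_le hT (Γ.dist y (c • y) + 2 * C + (10 * δ + 4))
  set W := {w : Q | Γ.dist y (w • y) ≤ Γ.dist y (c • y) + 2 * C + (10 * δ + 4) ∧
    ∃ r : ℤ, Γ.dist (c ^ R • y) (w • c ^ r • y) ≤ Γ.dist y (c • y) + 2 * C + (10 * δ + 4)} with hW
  have hWfin : W.Finite := Set.finite_of_encard_le_coe hM
  have hrep : ∀ w : Q, ∃ n : ℤ, w ∈ comm c → n ≠ 0 ∧ ∃ m : ℤ, w * c ^ m * w⁻¹ = c ^ n := by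
    intro w
    by_cases hw : w ∈ comm c
    · obtain ⟨m, n, hm, hn, h⟩ := hw
      exact ⟨n, fun _ => ⟨hn, m, h⟩⟩
    · exact ⟨0, fun h => absurd h hw⟩
  choose ν hν using hrep
  refine Set.Finite.subset (s := ⋃ w ∈ W, (fun r : ℤ => (QuotientGroup.mk (c ^ r * w) :
    Q ⧸ Subgroup.zpowers c)) '' Set.Ico (0 : ℤ) |ν w|) (hWfin.biUnion fun w _ =>
      (Set.finite_Ico _ _).image _) ?_
  rintro _ ⟨⟨g, hg⟩, rfl⟩
  obtain ⟨l, k, hw⟩ := h.exists_mem hT hs le_rfl R hg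
  set w := c ^ l * g * c ^ k with hwdef
  have hcc : ∀ k : ℤ, c ^ k ∈ comm c := fun k => ⟨1, 1, one_ne_zero, one_ne_zero, by group⟩
  have hwE : w ∈ comm c := mul_mem (mul_mem (hcc l) hg) (hcc k)
  obtain ⟨hn, m, hm⟩ := hν w hwE
  refine Set.mem_biUnion (show w ∈ W from hw) ⟨(-l) % ν w,
    ⟨Int.emod_nonneg _ hn, Int.emod_lt_abs _ hn⟩, ?_⟩
  simp only
  rw [QuotientGroup.eq]
  refine Subgroup.mem_zpowers_iff.2 ⟨m * ((-l) / ν w) - k, ?_⟩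
  have h2 : g = c ^ (-l) * w * c ^ (-k) := by rw [hwdef]; group
  have h3 : c ^ (ν w * (-l / ν w)) * w = w * c ^ (m * (-l / ν w)) := by
    rw [zpow_mul, ← hm, conj_zpow, zpow_mul]; group
  have h4 : c ^ (-l) = c ^ (-l % ν w) * c ^ (ν w * (-l / ν w)) := by
    rw [← zpow_add, Int.emod_add_mul_ediv]
  rw [h2, h4, mul_assoc (c ^ (-l % ν w)), h3, zpow_sub, zpow_neg]
  group

theorem QAx.isCyclic (h : QAx Γ c y C) (hT : Tame Q Γ) : IsCyclic (comm c) := by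
  have hcE : c ∈ comm c := ⟨1, 1, one_ne_zero, one_ne_zero, by group⟩
  have hfin := h.finite_cosets hT
  have : Finite (comm c ⧸ Subgroup.zpowers (⟨c, hcE⟩ : comm c)) := by
    have : Finite (Set.range fun e : comm c =>
      (QuotientGroup.mk (e : Q) : Q ⧸ Subgroup.zpowers c)) := hfin
    refine Finite.of_surjective (α := Set.range fun e : comm c =>
      (QuotientGroup.mk (e : Q) : Q ⧸ Subgroup.zpowers c))
      (fun t => QuotientGroup.mk t.2.choose) ?_
    intro t
    obtain ⟨e, rfl⟩ := QuotientGroup.mk_surjective t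
    refine ⟨⟨_, e, rfl⟩, ?_⟩
    have hex : ∃ e' : comm c, (QuotientGroup.mk (e' : Q) : Q ⧸ Subgroup.zpowers c) =
      QuotientGroup.mk (e : Q) := ⟨e, rfl⟩
    have h1 := hex.choose_spec
    rw [QuotientGroup.eq] at h1
    refine QuotientGroup.eq.2 ?_
    obtain ⟨k, hk⟩ := Subgroup.mem_zpowers_iff.1 h1
    exact Subgroup.mem_zpowers_iff.2 ⟨k, Subtype.ext (by simpa using hk)⟩
  have : (Subgroup.zpowers (⟨c, hcE⟩ : comm c)).FiniteIndex :=
    Subgroup.finiteIndex_of_finite_quotient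
  refine isCyclic_of_finiteIndex (fun g hg hfin => ?_) (⟨c, hcE⟩ : comm c)
  exact hT.torsionFree (g : Q) (by simpa using hg) (by
    obtain ⟨n, hn, h⟩ := isOfFinOrder_iff_pow_eq_one.1 hfin
    exact isOfFinOrder_iff_pow_eq_one.2 ⟨n, hn, by simpa using congrArg Subtype.val h⟩)

/-- A quasi-axis whose cyclic group is its own commensurator. -/
structure Axis (Γ : SimpleGraph V) (c : Q) (y : V) (C : ℕ) : Prop extends QAx Γ c y C where
  closed : ∀ (g : Q) (m n : ℤ), m ≠ 0 → g * c ^ m * g⁻¹ = c ^ n → g ∈ Subgroup.zpowers c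

theorem QAx.exists_axis {q : Q} (h : QAx Γ q y C) (hT : Tame Q Γ) :
    ∃ c C', q ∈ Subgroup.zpowers c ∧ Axis Γ c y C' := by
  have hc := hT.conn
  have := h.isCyclic hT
  obtain ⟨⟨c, hcE⟩, hgen⟩ := IsCyclic.exists_generator (α := comm q)
  have hE : ∀ x ∈ comm q, x ∈ Subgroup.zpowers c := fun x hx => by
    obtain ⟨k, hk⟩ := Subgroup.mem_zpowers_iff.1 (hgen ⟨x, hx⟩)
    exact Subgroup.mem_zpowers_iff.2 ⟨k, by simpa using congrArg Subtype.val hk⟩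
  obtain ⟨j, hj⟩ := Subgroup.mem_zpowers_iff.1
    (hE q ⟨1, 1, one_ne_zero, one_ne_zero, by group⟩)
  wlog hj0 : 0 ≤ j generalizing c j
  · refine this c⁻¹ (inv_mem hcE) ?_ ?_ (-j) (by rw [← hj]; group) (by omega)
    · intro x
      have e : (⟨c⁻¹, inv_mem hcE⟩ : comm q) = (⟨c, hcE⟩ : comm q)⁻¹ := rfl
      rw [e, Subgroup.zpowers_inv]; exact hgen x
    · intro x hx; rw [Subgroup.zpowers_inv]; exact hE x hx
  obtain ⟨j, rfl⟩ : ∃ i : ℕ, j = i := ⟨j.toNat, by omega⟩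
  rw [zpow_natCast] at hj
  have hjpos : 0 < j := by
    rcases Nat.eq_zero_or_pos j with h0 | h0
    · rw [h0, pow_zero] at hj; exact absurd hj.symm h.ne_one
    · exact h0
  set e := (Finset.range j).sup fun r => Γ.dist y (c ^ r • y) with he
  have hdiv : ∀ m : ℕ, Γ.dist (c ^ m • y) (q ^ (m / j) • y) ≤ e := by
    intro m
    rw [← hj, ← pow_mul, SimpleGraph.dist_comm]
    conv_lhs => rw [← Nat.div_add_mod m j]
    rw [show (j * (m / j) + m % j) / j = m / j by rw [Nat.div_add_mod], dist_pow hc hT.acts]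
    exact Finset.le_sup (f := fun r => Γ.dist y (c ^ r • y))
      (Finset.mem_range.2 (Nat.mod_lt _ hjpos))
  have hq1 : ∀ a b : ℕ, a ≤ b + 1 → b ≤ a + 1 →
      Γ.dist y (q ^ a • y) ≤ Γ.dist y (q ^ b • y) + Γ.dist y (q • y) := by
    intro a b h1 h2
    have t := hc.triangle y (q ^ b • y) (q ^ a • y)
    rcases lt_trichotomy a b with hab | rfl | hab
    · obtain rfl : b = a + 1 := by omega
      have := dist_pow hc hT.acts q y a 1
      rw [pow_one, SimpleGraph.dist_comm] at this
      omega
    · omega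
    · obtain rfl : a = b + 1 := by omega
      have := dist_pow hc hT.acts q y b 1
      rw [pow_one] at this
      omega
  have hcomp : ∀ m : ℕ, Γ.dist y (c ^ m • y) ≤ Γ.dist y (q ^ (m / j) • y) + e ∧
      Γ.dist y (q ^ (m / j) • y) ≤ Γ.dist y (c ^ m • y) + e := by
    intro m
    have t1 := hc.triangle y (c ^ m • y) (q ^ (m / j) • y)
    have t2 := hc.triangle y (q ^ (m / j) • y) (c ^ m • y)
    have c1 := Γ.dist_swap (c ^ m • y) (q ^ (m / j) • y)
    have := hdiv m
    omega
  refine ⟨c, C + 3 * e + Γ.dist y (q • y), Subgroup.mem_zpowers_iff.2 ⟨j, by simpa using hj⟩,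
    ⟨⟨fun m n => ?_, fun B => ?_⟩, fun g m n hm hg => hE g ?_⟩⟩
  · have h1 := hcomp m
    have h2 := hcomp n
    have h3 := hcomp (m + n)
    have h4 := h.add (m / j) (n / j)
    have h5 := hq1 (m / j + n / j) ((m + n) / j) (by
      have := Nat.div_add_div_le_add_div (x := m) (y := n) (z := j); omega) (by
      rw [Nat.add_div hjpos]; split_ifs <;> omega)
    omega
  · obtain ⟨N, hN⟩ := h.proper (B + e)
    refine ⟨j * N, fun n hn => ?_⟩
    have h1 := hN (n / j) ((Nat.le_div_iff_mul_le hjpos).2 (by rw [mul_comm]; exact hn))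
    have := hcomp n
    omega
  · have hn : n ≠ 0 := by
      rintro rfl
      rw [zpow_zero, mul_inv_eq_one, mul_eq_left] at hg
      have : c ≠ 1 := by rintro rfl; rw [one_pow] at hj; exact h.ne_one hj.symm
      exact this (eq_one_of_zpow_eq_one hT.torsionFree hm hg)
    refine ⟨m, n, hm, hn, ?_⟩
    rw [← hj, ← zpow_natCast, ← zpow_mul, ← zpow_mul, mul_comm (j : ℤ), mul_comm (j : ℤ), zpow_mul,
      ← conj_zpow, hg, zpow_mul]

/-- The translates of the orbit of an axis. -/
def axisFam (c : Q) (y : V) (i : Q ⧸ Subgroup.zpowers c) : Set V :=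
  {x | ∃ g : Q, (QuotientGroup.mk g : Q ⧸ Subgroup.zpowers c) = i ∧ x = g • y}

theorem mem_axisFam {g : Q} {x : V} :
    x ∈ axisFam c y (QuotientGroup.mk g) ↔ ∃ k : ℤ, x = g • c ^ k • y := by
  constructor
  · rintro ⟨g', hg', rfl⟩
    rw [eq_comm, QuotientGroup.eq] at hg'
    obtain ⟨k, hk⟩ := Subgroup.mem_zpowers_iff.1 hg'
    exact ⟨k, by rw [hk, ← mul_smul, mul_inv_cancel_left]⟩
  · rintro ⟨k, rfl⟩
    refine ⟨g * c ^ k, ?_, by rw [mul_smul]⟩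
    rw [eq_comm, QuotientGroup.eq]
    exact Subgroup.mem_zpowers_iff.2 ⟨k, by group⟩

theorem Axis.ovl (h : Axis Γ c y C) (hT : Tame Q Γ) (B : ℕ) : ∃ D, Ovl Γ (axisFam c y) B D := by
  have hc := hT.conn
  obtain ⟨δ, hs⟩ := hT.slim
  obtain ⟨B', hB'⟩ : ∃ B', B' = B + 2 * C + (10 * δ + 4) + Γ.dist y (c • y) := ⟨_, rfl⟩
  obtain ⟨R, M, hM⟩ := h.encard_le hT B'
  obtain ⟨D, hD⟩ : ∃ D, D = (Finset.range (M + R + 1)).sup fun k => Γ.dist y (c ^ k • y) := ⟨_, rfl⟩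
  refine ⟨D + 1, fun i j s₁ hs₁ s₂ hs₂ t₁ ht₁ t₂ ht₂ h₁ h₂ hd => ?_⟩
  obtain ⟨g, rfl⟩ := QuotientGroup.mk_surjective i
  obtain ⟨g', rfl⟩ := QuotientGroup.mk_surjective j
  obtain ⟨a, rfl⟩ := mem_axisFam.1 hs₁
  obtain ⟨b, rfl⟩ := mem_axisFam.1 hs₂
  obtain ⟨a', rfl⟩ := mem_axisFam.1 ht₁
  obtain ⟨b', rfl⟩ := mem_axisFam.1 ht₂
  wlog hab : a ≤ b generalizing a b a' b'
  · grind [SimpleGraph.dist_comm]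
  obtain ⟨n, rfl⟩ : ∃ n : ℕ, b = a + n := ⟨(b - a).toNat, by omega⟩
  rw [hT.acts.dist_smul hc, dist_zpow hc hT.acts, show (a + n - a : ℤ).natAbs = n by omega] at hd
  have hn : M + R + 1 ≤ n := by
    by_contra hcon
    have := Finset.le_sup (f := fun k => Γ.dist y (c ^ k • y)) (Finset.mem_range.2 (not_le.1 hcon))
    omega
  obtain ⟨f, hf⟩ : ∃ f, f = (g * c ^ a)⁻¹ * g' := ⟨_, rfl⟩
  have e1 : ∀ (l : ℕ) (k : ℤ),
      Γ.dist (g • c ^ (a + l) • y) (g' • c ^ k • y) = Γ.dist (c ^ l • y) (f • c ^ k • y) := by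
    intro l k
    rw [← hT.acts.dist_smul hc (g * c ^ a) (c ^ l • y), hf, ← mul_smul _ _ (c ^ k • y),
      mul_inv_cancel_left, mul_smul, ← mul_smul (c ^ a), zpow_add, zpow_natCast]
  have h₁' := e1 0 a'
  rw [Nat.cast_zero, add_zero, pow_zero, one_smul] at h₁'
  rw [h₁'] at h₁
  rw [e1] at h₂
  have near : ∀ l : ℕ, ∃ k : ℤ, l ≤ M + R → Γ.dist (c ^ l • y) (f • c ^ k • y) ≤ B' := by
    intro l
    by_cases hl : l ≤ M + R
    swap
    · exact ⟨0, fun h => absurd h hl⟩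
    obtain ⟨p, hp, hpd⟩ := h.near_geod hc hs hT.acts (by omega : l ≤ n) h₁ h₂
    have hp' : Btw Γ (c ^ a' • y) (f⁻¹ • p) (c ^ b' • y) := by
      rw [← hT.acts.btw_smul hc f, smul_inv_smul]; exact hp
    obtain ⟨k, hk⟩ := h.near_axis hc hs hT.acts hp'
    rw [← hT.acts.dist_smul hc f, smul_inv_smul] at hk
    have t := hc.triangle (c ^ l • y) p (f • c ^ k • y)
    exact ⟨k, fun _ => by omega⟩
  choose ν hν using near
  obtain ⟨l, hl, l', hl', hne, he⟩ : ∃ l ≤ M, ∃ l' ≤ M, l ≠ l' ∧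
      c ^ (-(l : ℤ)) * f * c ^ ν l = c ^ (-(l' : ℤ)) * f * c ^ ν l' := by
    by_contra hcon
    push Not at hcon
    have hinj : Set.InjOn (fun l : ℕ => c ^ (-(l : ℤ)) * f * c ^ ν l) (Set.Iic M) := by
      intro l hl l' hl' he
      by_contra hne
      exact hcon l hl l' hl' hne he
    have h1 : ((fun l : ℕ => c ^ (-(l : ℤ)) * f * c ^ ν l) '' (Set.Iic M)).encard ≤ M := by
      refine (Set.encard_le_encard ?_).trans hM
      rintro _ ⟨l, hl, rfl⟩
      have hl : l ≤ M := hl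
      refine ⟨?_, ν (l + R) - ν l, ?_⟩
      · rw [← hT.acts.dist_smul hc (c ^ l), ← mul_smul]
        have := hν l (by omega)
        rwa [← mul_smul, show f * c ^ ν l = c ^ l * (c ^ (-(l : ℤ)) * f * c ^ ν l) by
          rw [zpow_neg, zpow_natCast]; group] at this
      · rw [← hT.acts.dist_smul hc (c ^ l), ← mul_smul, ← mul_smul, ← mul_smul, ← pow_add]
        have := hν (l + R) (by omega)
        rwa [← mul_smul, show f * c ^ ν (l + R) =
          c ^ l * (c ^ (-(l : ℤ)) * f * c ^ ν l) * c ^ (ν (l + R) - ν l) by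
            rw [zpow_neg, zpow_natCast]; group] at this
    rw [hinj.encard_image, ← Finset.coe_Iic, Set.encard_coe_eq_coe_finsetCard, Nat.card_Iic] at h1
    exact absurd h1 (by exact_mod_cast (by omega))
  have hclosed := h.closed f⁻¹ (l - l') (ν l - ν l') (by omega) (by
    have h2 : f * c ^ ν l = c ^ ((l : ℤ) - l') * f * c ^ ν l' := by
      rw [sub_eq_add_neg, zpow_add, mul_assoc, mul_assoc, ← mul_assoc (c ^ (-(l' : ℤ))), ← he,
        zpow_neg]; group
    rw [zpow_sub c (ν l), inv_inv, mul_assoc, eq_mul_inv_iff_mul_eq.2 h2.symm]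
    group)
  rw [QuotientGroup.eq]
  obtain ⟨k, hk⟩ := Subgroup.mem_zpowers_iff.1 hclosed
  refine Subgroup.mem_zpowers_iff.2 ⟨a - k, ?_⟩
  rw [zpow_sub, hk, hf]; group

theorem Axis.coneFam (h : Axis Γ c y C) (hT : Tame Q Γ) : ∃ σ, ConeFam Q Γ (axisFam c y) σ := by
  have hc := hT.conn
  obtain ⟨δ, hs⟩ := hT.slim
  have hstab : ∀ (g₀ g : Q), g • (QuotientGroup.mk g₀ : Q ⧸ Subgroup.zpowers c) = QuotientGroup.mk
    g₀ →
      ∃ l : ℤ, g = g₀ * c ^ l * g₀⁻¹ := by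
    intro g₀ g hg
    have hg : (QuotientGroup.mk (g * g₀) : Q ⧸ Subgroup.zpowers c) = QuotientGroup.mk g₀ := hg
    rw [eq_comm, QuotientGroup.eq] at hg
    obtain ⟨l, hl⟩ := Subgroup.mem_zpowers_iff.1 hg
    exact ⟨l, by rw [hl]; group⟩
  have hdist : ∀ (g₀ : Q) (k l : ℤ), Γ.dist (g₀ • c ^ k • y)
    ((g₀ * c ^ l * g₀⁻¹) • g₀ • c ^ k • y) =
      Γ.dist y (c ^ l.natAbs • y) := by
    intro g₀ k l
    rw [← mul_smul _ g₀, inv_mul_cancel_right, mul_smul, hT.acts.dist_smul hc, ← mul_smul, ←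
      zpow_add,
      dist_zpow hc hT.acts]
    congr 4; ring
  refine ⟨Γ.dist y (c • y) + C + (4 * δ + 2), ?_, ?_, ?_, h.ovl hT, ?_, ?_⟩
  · intro i
    obtain ⟨g, rfl⟩ := QuotientGroup.mk_surjective i
    exact ⟨g • y, g, rfl, rfl⟩
  · intro i s hsi t hti p hp
    obtain ⟨g, rfl⟩ := QuotientGroup.mk_surjective i
    obtain ⟨a, rfl⟩ := mem_axisFam.1 hsi
    obtain ⟨b, rfl⟩ := mem_axisFam.1 hti
    have hp' : Btw Γ (c ^ a • y) (g⁻¹ • p) (c ^ b • y) := by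
      rw [← hT.acts.btw_smul hc g, smul_inv_smul]; exact hp
    obtain ⟨k, hk⟩ := h.near_axis hc hs hT.acts hp'
    rw [← hT.acts.dist_smul hc g, smul_inv_smul] at hk
    exact ⟨_, mem_axisFam.2 ⟨k, rfl⟩, hk⟩
  · rintro g i _ ⟨g', rfl, rfl⟩
    exact ⟨g * g', rfl, (mul_smul _ _ _).symm⟩
  · intro B
    obtain ⟨N, hN⟩ := h.proper B
    refine ⟨(Finset.Icc (-(N : ℤ)) N).card, ?_⟩
    intro i s hsi
    obtain ⟨g₀, rfl⟩ := QuotientGroup.mk_surjective i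
    obtain ⟨k, rfl⟩ := mem_axisFam.1 hsi
    rw [← Set.encard_coe_eq_coe_finsetCard]
    refine (Set.encard_le_encard ?_).trans (Set.encard_image_le (fun l : ℤ => g₀ * c ^ l * g₀⁻¹) _)
    rintro g ⟨hg, hd⟩
    obtain ⟨l, rfl⟩ := hstab g₀ g hg
    refine ⟨l, ?_, rfl⟩
    rw [hdist] at hd
    have : l.natAbs < N := by
      by_contra hcon
      have := hN _ (not_lt.1 hcon)
      omega
    simp only [Finset.coe_Icc, Set.mem_Icc]; omega
  · intro i s hsi g hg h1 B
    obtain ⟨g₀, rfl⟩ := QuotientGroup.mk_surjective i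
    obtain ⟨k, rfl⟩ := mem_axisFam.1 hsi
    obtain ⟨l, rfl⟩ := hstab g₀ g hg
    have hl : l ≠ 0 := by rintro rfl; simp at h1
    obtain ⟨N, hN⟩ := h.proper B
    refine ⟨N, ?_⟩
    rw [conj_pow, ← zpow_natCast, ← zpow_mul, hdist]
    refine hN _ ?_
    rw [Int.natAbs_mul]
    have : 1 ≤ l.natAbs := by omega
    simpa using Nat.mul_le_mul_right N this

end

section

variable {V : Type*} {Γ : SimpleGraph V} {δ A d : ℕ} {Z : Set V} {z z' : ℤ → V}

/-- A bi-infinite broken geodesic with large angles at its corners. -/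
structure Broken (Γ : SimpleGraph V) (δ A d : ℕ) (Z : Set V) (z : ℤ → V) : Prop where
  mem : ∀ i, z i ∈ Z
  bend : ∀ i, ¬ Ang Γ (z i) (A + 4 * angleBound δ) (z (i - 1)) (z (i + 1))
  dist_le : ∀ i, Γ.dist (z i) (z (i + 1)) ≤ d
  inner : ∀ i, ∀ w ∈ Z, Btw Γ (z i) w (z (i + 1)) →
    w = z i ∨ w = z (i + 1) ∨ Ang Γ w A (z i) (z (i + 1))

namespace Broken

theorem reverse (h : Broken Γ δ A d Z z) : Broken Γ δ A d Z (fun i => z (-i)) where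
  mem i := h.mem _
  bend i ha := h.bend (-i) (by
    have := ha.symm
    rwa [show -(i + 1) = -i - 1 by ring, show -(i - 1) = -i + 1 by ring] at this)
  dist_le i := by
    have := h.dist_le (-(i + 1))
    rwa [show -(i + 1) + 1 = -i by ring, SimpleGraph.dist_comm] at this
  inner i w hw hb := by
    have := h.inner (-(i + 1)) w hw
    rw [show -(i + 1) + 1 = -i by ring] at this
    rcases this hb.symm with h1 | h1 | h1
    · exact .inr (.inl h1)
    · exact .inl h1
    · exact .inr (.inr h1.symm)

theorem smul {Q : Type*} [Group Q] [MulAction Q V] (h : Broken Γ δ A d Z z) (hc : Γ.Connected)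
    (hQ : ActsOn Q Γ) (hZ : ∀ (g : Q), ∀ w ∈ Z, g • w ∈ Z) (g : Q) :
    Broken Γ δ A d Z (fun i => g • z i) where
  mem i := hZ _ _ (h.mem _)
  bend i := by rw [hQ.ang_smul_iff hc]; exact h.bend i
  dist_le i := by rw [hQ.dist_smul hc]; exact h.dist_le i
  inner i w hw hb := by
    have := h.inner i (g⁻¹ • w) (hZ _ _ hw) (by rw [← hQ.btw_smul hc g, smul_inv_smul]; exact hb)
    rwa [inv_smul_eq_iff, inv_smul_eq_iff, ← hQ.ang_smul_iff hc g, smul_inv_smul] at this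

theorem ne_succ (h : Broken Γ δ A d Z z) (hc : Γ.Connected) (hs : Slim Γ δ) (i : ℤ) :
    z i ≠ z (i + 1) := by
  have := h.bend (i + 1)
  rw [add_sub_cancel_right] at this
  exact ne_of_not_ang hc hs fun h' => this (h'.mono (by omega))

theorem lk_right (h : Broken Γ δ A d Z z) (hc : Γ.Connected) (hs : Slim Γ δ) (n : ℕ) (i : ℤ) :
    Lk Γ (z i) (z (i + n + 1)) = Lk Γ (z i) (z (i + 1)) := by
  induction n generalizing i with
  | zero => simp
  | succ n ih =>
    refine lk_eq_of_not_ang hc hs fun ha => h.bend (i + 1) ?_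
    rw [add_sub_cancel_right, ← ang_congr_right (ih (i + 1))]
    grind [Ang.mono]

theorem lk_eq (h : Broken Γ δ A d Z z) (hc : Γ.Connected) (hs : Slim Γ δ) {i j : ℤ} (hij : i < j) :
    Lk Γ (z i) (z j) = Lk Γ (z i) (z (i + 1)) := by
  rw [← h.lk_right hc hs (j - i - 1).toNat i]
  congr 2; omega

theorem lk_eq_left (h : Broken Γ δ A d Z z) (hc : Γ.Connected) (hs : Slim Γ δ) {i j : ℤ}
    (hij : i < j) : Lk Γ (z j) (z i) = Lk Γ (z j) (z (j - 1)) := by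
  have := h.reverse.lk_eq hc hs (i := -j) (j := -i) (by omega)
  simpa [← sub_eq_neg_add] using this

theorem not_ang (h : Broken Γ δ A d Z z) (hc : Γ.Connected) (hs : Slim Γ δ) {i j k : ℤ}
    (hij : i < j) (hjk : j < k) : ¬ Ang Γ (z j) (A + 4 * angleBound δ) (z i) (z k) := by
  rw [ang_congr_left (h.lk_eq_left hc hs hij), ang_congr_right (h.lk_eq hc hs hjk)]
  exact h.bend j

theorem btw (h : Broken Γ δ A d Z z) (hc : Γ.Connected) (hs : Slim Γ δ) {i j k : ℤ}
    (hij : i ≤ j) (hjk : j ≤ k) : Btw Γ (z i) (z j) (z k) := by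
  rcases hij.eq_or_lt with rfl | hij
  · exact btw_left
  rcases hjk.eq_or_lt with rfl | hjk
  · exact btw_right
  exact btw_of_not_ang hc hs fun ha => h.not_ang hc hs hij hjk (ha.mono (by omega))

theorem le_dist (h : Broken Γ δ A d Z z) (hc : Γ.Connected) (hs : Slim Γ δ) (n : ℕ) (i : ℤ) :
    n ≤ Γ.dist (z i) (z (i + n)) := by
  induction n with
  | zero => simp
  | succ n ih =>
    have h1 := h.btw hc hs (i := i) (j := i + n) (k := i + n + 1) (by omega) (by omega)
    have h2 := hc.pos_dist_of_ne (h.ne_succ hc hs (i + n))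
    grind [Btw]

theorem dist_le_mul (h : Broken Γ δ A d Z z) (hc : Γ.Connected) (n : ℕ) (i : ℤ) :
    Γ.dist (z i) (z (i + n)) ≤ n * d := by
  induction n with
  | zero => simp
  | succ n ih =>
    have h1 := hc.triangle (z i) (z (i + n)) (z (i + n + 1))
    have h2 := h.dist_le (i + n)
    grind

theorem le_dist_of_lt (h : Broken Γ δ A d Z z) (hc : Γ.Connected) (hs : Slim Γ δ) {i j : ℤ} {n : ℕ}
    (hij : i + n ≤ j) : n ≤ Γ.dist (z i) (z j) := by
  have := h.le_dist hc hs (j - i).toNat i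
  grind

theorem injective (h : Broken Γ δ A d Z z) (hc : Γ.Connected) (hs : Slim Γ δ) :
    Function.Injective z := by
  intro i j hij
  by_contra hne
  rcases lt_or_gt_of_ne hne with hlt | hlt
  · have := h.le_dist_of_lt hc hs (i := i) (j := j) (n := 1) (by omega)
    grind
  · have := h.le_dist_of_lt hc hs (i := j) (j := i) (n := 1) (by omega)
    grind

theorem locate (h : Broken Γ δ A d Z z) (hc : Γ.Connected) (hs : Slim Γ δ) {w : V} (n : ℕ) (i : ℤ)
    (hw : Btw Γ (z i) w (z (i + n + 1))) :
    ∃ j, i ≤ j ∧ j ≤ i + n ∧ Btw Γ (z j) w (z (j + 1)) := by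
  induction n with
  | zero => exact ⟨i, le_rfl, by omega, by simpa using hw⟩
  | succ n ih =>
    have hna := h.not_ang hc hs (i := i) (j := i + n + 1) (k := i + (n + 1 : ℕ) + 1) (by omega)
      (by push_cast; omega)
    have hb := btw_of_not_ang hc hs fun ha => hna (ha.mono (by omega))
    rcases btw_or_btw_of_not_ang hc hs (by omega) hna w with h1 | h1
    · grind [Btw]
    · grind [Btw]

theorem locate_of_lt (h : Broken Γ δ A d Z z) (hc : Γ.Connected) (hs : Slim Γ δ) {w : V} {i k : ℤ}
    (hik : i < k) (hw : Btw Γ (z i) w (z k)) :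
    ∃ j, i ≤ j ∧ j < k ∧ Btw Γ (z j) w (z (j + 1)) := by
  have := h.locate hc hs (w := w) (k - i - 1).toNat i
  grind

theorem lk_inner (h : Broken Γ δ A d Z z) (hc : Γ.Connected) (hs : Slim Γ δ) {w : V} {j k : ℤ}
    (hb : Btw Γ (z j) w (z (j + 1))) (hw : w ≠ z (j + 1)) (hk : j < k) :
    Lk Γ w (z k) = Lk Γ w (z (j + 1)) := by
  rcases (show j + 1 ≤ k by omega).eq_or_lt with rfl | hk
  · rfl
  refine lk_eq_of_not_ang hc hs fun ha => h.not_ang hc hs (i := j) (by omega) hk ?_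
  have h1 : Ang Γ (z (j + 1)) (angleBound δ) (z j) w :=
    (ang_right hc hs).of_btw hc hs le_rfl hb
  exact (h1.trans hc ha hw).mono (by omega)

theorem mem_of_btw (h : Broken Γ δ A d Z z) (hc : Γ.Connected) (hs : Slim Γ δ) {w : V} {i k : ℤ}
    (hw : w ∈ Z) (hik : i < k) (hb : Btw Γ (z i) w (z k)) (ha : ¬ Ang Γ w A (z i) (z k)) :
    ∃ j, i ≤ j ∧ j ≤ k ∧ w = z j := by
  obtain ⟨j, h1, h2, h3⟩ := h.locate_of_lt hc hs hik hb
  rcases h.inner j w hw h3 with h4 | h4 | h4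
  · exact ⟨j, h1, h2.le, h4⟩
  · exact ⟨j + 1, by omega, by omega, h4⟩
  by_cases h5 : w = z j
  · exact ⟨j, h1, h2.le, h5⟩
  by_cases h6 : w = z (j + 1)
  · exact ⟨j + 1, by omega, by omega, h6⟩
  refine absurd ?_ ha
  rw [ang_congr_right (h.lk_inner hc hs h3 h6 h2)]
  have := h.reverse.lk_inner hc hs (w := w) (j := -(j + 1)) (k := -i)
    (by simpa using h3.symm) (by simpa using h5) (by omega)
  grind [ang_congr_left]

theorem exists_run (h : Broken Γ δ A d Z z) (h' : Broken Γ δ A d Z z') (hc : Γ.Connected)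
    (hs : Slim Γ δ) {C : ℕ} {i₁ i₂ k₁ k₂ : ℤ} (hk : k₁ < k₂) (h₁ : Γ.dist (z i₁) (z' k₁) ≤ C)
    (h₂ : Γ.dist (z i₂) (z' k₂) ≤ C) : ∃ e : ℤ, ∀ j, i₁ + C < j → j < i₂ - C → z j = z'
      (j + e) := by
  have a₁ : ∀ j, i₁ + C < j → Ang Γ (z j) (angleBound δ) (z i₁) (z' k₁) ∧ z' k₁ ≠ z j := by
    intro j hj
    have := h.le_dist_of_lt hc hs (i := i₁) (j := j) (n := C + 1) (by push_cast; omega)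
    grind [av_of_dist_lt, ang_of_av]
  have a₂ : ∀ j, j < i₂ - C → Ang Γ (z j) (angleBound δ) (z i₂) (z' k₂) ∧ z' k₂ ≠ z j := by
    intro j hj
    have := h.le_dist_of_lt hc hs (i := j) (j := i₂) (n := C + 1) (by push_cast; omega)
    grind [SimpleGraph.dist_comm, av_of_dist_lt, ang_of_av]
  have hex : ∀ j, ∃ k, i₁ + C < j → j < i₂ - C → k₁ ≤ k ∧ k ≤ k₂ ∧ z j = z' k := by
    intro j
    by_cases hj : i₁ + C < j ∧ j < i₂ - C
    swap
    · grind
    have hna : ¬ Ang Γ (z j) (A + 2 * angleBound δ) (z' k₁) (z' k₂) := by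
      intro ha
      refine h.not_ang hc hs (i := i₁) (j := j) (k := i₂) (by omega) (by omega) ?_
      exact (((a₁ j hj.1).1.trans hc ha (a₁ j hj.1).2).trans hc (a₂ j hj.2).1.symm
        (a₂ j hj.2).2).mono (by omega)
    obtain ⟨k, hk⟩ := h'.mem_of_btw hc hs (h.mem j) hk
      (btw_of_not_ang hc hs fun ha => hna (ha.mono (by omega))) fun ha => hna (ha.mono (by omega))
    exact ⟨k, fun _ _ => hk⟩
  choose κ hκ using hex
  have hstep : ∀ j, i₁ + C < j → j + 1 < i₂ - C → κ (j + 1) = κ j + 1 := by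
    intro j hj1 hj2
    obtain ⟨b1, b2, b3⟩ := hκ j hj1 (by omega)
    obtain ⟨c1, c2, c3⟩ := hκ (j + 1) (by omega) hj2
    have hlt : κ j < κ (j + 1) := by
      by_contra hcon
      have hb : Btw Γ (z' k₁) (z j) (z (j + 1)) := btw_of_not_ang hc hs fun ha =>
        h.not_ang hc hs (i := i₁) (j := j) (k := j + 1) (by omega) (by omega)
          (((a₁ j hj1).1.trans hc ha (a₁ j hj1).2).mono (by omega))
      have h2 := h'.btw hc hs c1 (not_lt.1 hcon)
      have h3 := hc.pos_dist_of_ne (h.ne_succ hc hs j)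
      grind [Btw]
    by_contra hne
    have hb := h'.btw hc hs (i := κ j) (j := κ j + 1) (k := κ (j + 1)) (by omega) (by omega)
    have hna := h'.not_ang hc hs (i := κ j) (j := κ j + 1) (k := κ (j + 1)) (by omega) (by omega)
    rw [← b3, ← c3] at hb hna
    rcases h.inner j _ (h'.mem _) hb with h4 | h4 | h4
    · rw [b3] at h4
      have := h'.injective hc hs h4
      omega
    · rw [c3] at h4
      have := h'.injective hc hs h4
      omega
    · exact hna (h4.mono (by omega))
  have hall : ∀ n : ℕ, i₁ + C + 1 + n < i₂ - C → κ (i₁ + C + 1 + n) = κ (i₁ + C + 1) + n := by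
    intro n
    induction n with
    | zero => simp
    | succ n ih =>
      grind
  refine ⟨κ (i₁ + C + 1) - (i₁ + C + 1), fun j hj1 hj2 => ?_⟩
  have h4 := hall (j - (i₁ + C + 1)).toNat (by omega)
  grind

end Broken

end

/-- The product of the letters `f 0, …, f (i - 1)`, extended to negative `i`. -/
def pos {Q : Type*} [Group Q] (f : ℤ → Q) : ℤ → Q
  | (n : ℕ) => Nat.rec 1 (fun i g => g * f i) n
  | .negSucc n => Nat.rec (f (-1))⁻¹ (fun i g => g * (f (-(i + 2)))⁻¹) n

section

variable {Q : Type*} [Group Q] {f : ℤ → Q}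

theorem pos_zero : pos f 0 = 1 := rfl

theorem pos_succ (i : ℤ) : pos f (i + 1) = pos f i * f i := by
  obtain n | n := i
  · rfl
  · obtain _ | n := n
    · exact (inv_mul_cancel _).symm
    · have h1 : (Int.negSucc (n + 1) + 1) = Int.negSucc n := rfl
      have h2 : pos f (Int.negSucc (n + 1)) = pos f (Int.negSucc n) * (f (-(n + 2)))⁻¹ := rfl
      grind [inv_mul_cancel_right]

theorem pos_pred (i : ℤ) : pos f (i - 1) = pos f i * (f (i - 1))⁻¹ := by
  have := pos_succ (f := f) (i - 1)
  grind [mul_inv_cancel_right]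

theorem pos_add {L : ℤ} (hf : ∀ i, f (i + L) = f i) (i : ℤ) : pos f (i + L) = pos f L * pos f
    i := by
  induction i using Int.induction_on with
  | zero => rw [zero_add, pos_zero, mul_one]
  | succ i ih => rw [pos_succ, add_right_comm, pos_succ, ih, hf, mul_assoc]
  | pred i ih =>
    grind [pos_pred]

theorem pos_add_mul {L : ℤ} (hf : ∀ i, f (i + L) = f i) (n i : ℤ) :
    pos f (i + n * L) = pos f L ^ n * pos f i := by
  induction n using Int.induction_on with
  | zero => simp
  | succ n ih =>
    rw [add_mul, one_mul, ← add_assoc, pos_add hf, ih, zpow_add, zpow_one, ← mul_assoc]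
    congr 1
    exact (Commute.self_zpow _ _).eq
  | pred n ih =>
    have := pos_add hf (i + (-n - 1) * L)
    rw [show i + (-n - 1) * L + L = i + -n * L by ring, ih] at this
    rw [sub_eq_neg_add, zpow_add, zpow_neg_one, mul_assoc, this, inv_mul_cancel_left]
    congr 2; ring

end

/-- The equivariant maps between actions which arise from coning off and killing relators. -/
structure Step {V V' Q Q' : Type*} [Group Q] [Group Q'] [MulAction Q V] [MulAction Q' V']
    (Γ : SimpleGraph V) (Γ' : SimpleGraph V') (ψ : Q →* Q') (π : V → V') : Prop where
  surj : Function.Surjective ψ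
  equiv : ∀ (g : Q) (x : V), π (g • x) = ψ g • π x
  stab : ∀ (x : V) (g : Q'), g • π x = π x → ∃ g₀, ψ g₀ = g ∧ g₀ • x = x
  inj : ∀ (x : V) (g : Q), g • x = x → ψ g = 1 → g = 1
  adj : ∀ x y : V, Γ.Adj x y → Γ'.Adj (π x) (π y)
  rest : ∀ v : V', (∃ x, π x = v) ∨ IsCyclic (MulAction.stabilizer Q' v)

theorem Step.trans {V V' V'' Q Q' Q'' : Type*} [Group Q] [Group Q'] [Group Q''] [MulAction Q V]
    [MulAction Q' V'] [MulAction Q'' V''] {Γ : SimpleGraph V} {Γ' : SimpleGraph V'}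
    {Γ'' : SimpleGraph V''} {ψ : Q →* Q'} {π : V → V'} {ψ' : Q' →* Q''} {π' : V' → V''}
    (h : Step Γ Γ' ψ π) (h' : Step Γ' Γ'' ψ' π') : Step Γ Γ'' (ψ'.comp ψ) (π' ∘ π) where
  surj := h'.surj.comp h.surj
  equiv g x := by simp [h.equiv, h'.equiv]
  stab x g hg := by
    obtain ⟨g₁, rfl, h1⟩ := h'.stab _ _ hg
    obtain ⟨g₀, rfl, h0⟩ := h.stab _ _ h1
    exact ⟨g₀, rfl, h0⟩
  inj x g hg h1 := h.inj x g hg (h'.inj (π x) (ψ g) (by rw [← h.equiv, hg]) h1)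
  adj x y hxy := h'.adj _ _ (h.adj _ _ hxy)
  rest v := by
    rcases h'.rest v with ⟨x, rfl⟩ | hv
    swap
    · exact .inr hv
    rcases h.rest x with ⟨y, rfl⟩ | hx
    · exact .inl ⟨y, rfl⟩
    right
    let φ : MulAction.stabilizer Q' x →* MulAction.stabilizer Q'' (π' x) :=
      (ψ'.comp (MulAction.stabilizer Q' x).subtype).codRestrict _ fun g => by
        rw [MulAction.mem_stabilizer_iff]
        change ψ' g • π' x = π' x
        rw [← h'.equiv, g.2]
    refine isCyclic_of_surjective φ fun g => ?_
    obtain ⟨g₁, h1, h2⟩ := h'.stab x g g.2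
    exact ⟨⟨g₁, h2⟩, Subtype.ext h1⟩

section

variable {V Q : Type*} [Group Q] [MulAction Q V] {Γ : SimpleGraph V} {δ A d L ℓ : ℕ} {ι : Type*}
variable {x₀ : V} {p : Q} {a : ι → Q} {lab : ι → ℤ → Q}

/-- The connector between consecutive labels of a relator; once per period it carries an
extra factor. -/
def link (L : ℕ) (p : Q) (a : ι → Q) (α : ι) (i : ℤ) : Q := if (L : ℤ) ∣ i + 1 then p * a α else p

/-- The letters of the relator with index `α`. -/
def letter (L : ℕ) (p : Q) (a : ι → Q) (lab : ι → ℤ → Q) (α : ι) (i : ℤ) : Q :=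
  lab α i * link L p a α i

/-- A system of relators of period `L`, whose labels fix `x₀`, such that the orbit of `x₀` along
each relator is a broken geodesic and windows of length `ℓ` determine the position
in the relator. -/
structure RelSys (Γ : SimpleGraph V) (δ A d : ℕ) (x₀ : V) (p : Q) (L ℓ : ℕ) (a : ι → Q)
    (lab : ι → ℤ → Q) : Prop where
  lab_fix : ∀ α i, lab α i • x₀ = x₀
  lab_per : ∀ α i, lab α (i + L) = lab α i
  bend : ∀ α i, ¬ Ang Γ x₀ (A + 4 * angleBound δ) ((link L p a α (i - 1))⁻¹ • x₀)
    (letter L p a lab α i • x₀)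
  dist_le : ∀ α i, Γ.dist x₀ (link L p a α i • x₀) ≤ d
  inner : ∀ α i (g : Q), Btw Γ x₀ (g • x₀) (link L p a α i • x₀) → g • x₀ = x₀ ∨
    g • x₀ = link L p a α i • x₀ ∨ Ang Γ (g • x₀) A x₀ (link L p a α i • x₀)
  pin : ∀ α β (j k : ℤ), (∀ i : ℕ, i < ℓ → ¬ (L : ℤ) ∣ j + i + 1 ∧ ¬ (L : ℤ) ∣ k + i + 1 ∧
    lab α (j + i) = lab β (k + i)) → α = β ∧ (L : ℤ) ∣ j - k
  rev : ∀ α β (j k : ℤ) (τ μ : Q), τ • x₀ = x₀ → μ • x₀ = x₀ → p⁻¹ * τ * p⁻¹ = μ →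
    ¬ ∀ i : ℕ, i < ℓ → ¬ (L : ℤ) ∣ j + i + 1 ∧ ¬ (L : ℤ) ∣ k - i + 1 ∧
      lab α (j + i + 1) * τ = μ * (lab β (k - i))⁻¹

/-- Of three consecutive blocks one avoids two predicates which hold at most once. -/
theorem exists_block {m : ℕ} {P P' : ℕ → Prop} (hP : ∀ i j, i < 3 * m → j < 3 * m → P i → P j →
    i = j)
    (hP' : ∀ i j, i < 3 * m → j < 3 * m → P' i → P' j → i = j) :
    ∃ b < 3, ∀ i < m, ¬ P (b * m + i) ∧ ¬ P' (b * m + i) := by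
  by_contra hcon
  push Not at hcon
  obtain ⟨i, hi, h1⟩ := hcon 0 (by omega)
  obtain ⟨j, hj, h2⟩ := hcon 1 (by omega)
  obtain ⟨k, hk, h3⟩ := hcon 2 (by omega)
  have key : ∀ i j k, i < m → j < m → k < m → ∀ P : ℕ → Prop,
      (∀ i j, i < 3 * m → j < 3 * m → P i → P j → i = j) →
      ¬ (P (0 * m + i) ∧ P (1 * m + j)) ∧ ¬ (P (0 * m + i) ∧ P (2 * m + k)) ∧
        ¬ (P (1 * m + j) ∧ P (2 * m + k)) := by
    grind
  have k1 := key i j k hi hj hk P hP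
  have k2 := key i j k hi hj hk P' hP'
  tauto

theorem letter_per (h : RelSys Γ δ A d x₀ p L ℓ a lab) (α : ι) (i : ℤ) :
    letter L p a lab α (i + L) = letter L p a lab α i := by
  have : (L : ℤ) ∣ i + L + 1 ↔ (L : ℤ) ∣ i + 1 := by
    rw [show i + L + 1 = i + 1 + L by ring, dvd_add_self_right]
  simp only [letter, link, h.lab_per, this]

namespace RelSys

/-- The relator with index `α`. -/
def rel (L : ℕ) (p : Q) (a : ι → Q) (lab : ι → ℤ → Q) (α : ι) : Q := pos (letter L p a lab α) L

/-- The corners of the axis of the relator with index `α`. -/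
def corner (x₀ : V) (L : ℕ) (p : Q) (a : ι → Q) (lab : ι → ℤ → Q) (α : ι) (i : ℤ) : V :=
  pos (letter L p a lab α) i • x₀

theorem corner_add (h : RelSys Γ δ A d x₀ p L ℓ a lab) (α : ι) (n i : ℤ) :
    rel L p a lab α ^ n • corner x₀ L p a lab α i = corner x₀ L p a lab α (i + n * L) := by
  rw [corner, corner, pos_add_mul (letter_per h α), mul_smul]
  rfl

theorem broken (h : RelSys Γ δ A d x₀ p L ℓ a lab) (hc : Γ.Connected) (hQ : ActsOn Q Γ) (α : ι) :
    Broken Γ δ A d (Set.range fun g : Q => g • x₀) (corner x₀ L p a lab α) := by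
  have hsucc : ∀ i, corner x₀ L p a lab α (i + 1) =
      (pos (letter L p a lab α) i * lab α i) • link L p a α i • x₀ := by
    grind [RelSys.corner, pos_succ, letter, mul_smul]
  have hself : ∀ i, corner x₀ L p a lab α i = (pos (letter L p a lab α) i * lab α i) • x₀ := by
    intro i
    rw [corner, mul_smul, h.lab_fix]
  have hpred : ∀ i, corner x₀ L p a lab α (i - 1) =
      pos (letter L p a lab α) i • (link L p a α (i - 1))⁻¹ • x₀ := by
    intro i
    rw [corner, pos_pred, letter, mul_smul, mul_inv_rev, mul_smul,
      inv_smul_eq_iff.2 (h.lab_fix α (i - 1)).symm]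
  refine ⟨fun i => ⟨_, rfl⟩, fun i => ?_, fun i => ?_, ?_⟩
  · rw [hpred, hsucc, mul_smul, ← mul_smul (lab α i), corner, hQ.ang_smul_iff hc]
    exact h.bend α i
  · rw [hself, hsucc, hQ.dist_smul hc]
    exact h.dist_le α i
  · rintro i _ ⟨g, rfl⟩ hb
    obtain ⟨f, hf⟩ : ∃ f, f = pos (letter L p a lab α) i * lab α i := ⟨_, rfl⟩
    rw [hself, hsucc, ← hf] at hb ⊢
    have := h.inner α i (f⁻¹ * g)
      (by rw [← hQ.btw_smul hc f, mul_smul f⁻¹, smul_inv_smul]; exact hb)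
    grind [mul_smul, ActsOn.ang_smul_iff, smul_inv_smul]

end RelSys

theorem letter_of_not_dvd {α : ι} {i : ℤ} (h : ¬ (L : ℤ) ∣ i + 1) :
    letter L p a lab α i = lab α i * p := by
  rw [letter, link, if_neg h]

theorem at_most_one {L : ℕ} {m : ℕ} (hm : m ≤ L) (j : ℤ) {s t : ℕ} (hs : s < m) (ht : t < m)
    (h1 : (L : ℤ) ∣ j + s) (h2 : (L : ℤ) ∣ j + t) : s = t := by
  have h3 : (L : ℤ) ∣ (s : ℤ) - t := by
    have := dvd_sub h1 h2
    rwa [add_sub_add_left_eq_sub] at this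
  have := Int.eq_zero_of_abs_lt_dvd h3 (by rw [abs_lt]; constructor <;> omega)
  omega

namespace RelSys

theorem link_smul_ne (h : RelSys Γ δ A d x₀ p L ℓ a lab) (hc : Γ.Connected) (hs : Slim Γ δ)
    (hL : 2 ≤ L) (α : ι) : p⁻¹ • x₀ ≠ x₀ := by
  have h1 := ne_of_not_ang hc hs fun ha => h.bend α 1 (ha.mono (by omega))
  rwa [link, if_neg] at h1
  intro h2
  have := Int.le_of_dvd (by omega) h2
  omega

theorem pin_of_run (h : RelSys Γ δ A d x₀ p L ℓ a lab) (hT : Tame Q Γ) (hs : Slim Γ δ)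
    (hL : 3 * (ℓ + 2) ≤ L) {α β : ι} {f : Q} {j e : ℤ}
    (hrun : ∀ i : ℕ, i < 3 * (ℓ + 2) →
      corner x₀ L p a lab α (j + i) = f • corner x₀ L p a lab β (j + i + e)) :
    α = β ∧ f ∈ Subgroup.zpowers (rel L p a lab α) := by
  have hc := hT.conn
  obtain ⟨b, hb, hblock⟩ := exists_block (m := ℓ + 2) (P := fun i => (L : ℤ) ∣ j + 1 + i)
    (P' := fun i => (L : ℤ) ∣ j + e + 1 + i) (fun s t hs ht => at_most_one hL _ hs ht)
    (fun s t hs ht => at_most_one hL _ hs ht)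
  obtain ⟨k, hk⟩ : ∃ k : ℤ, k = j + (b * (ℓ + 2) : ℕ) := ⟨_, rfl⟩
  have hbl : b * (ℓ + 2) ≤ 2 * (ℓ + 2) := Nat.mul_le_mul_right _ (by omega)
  have hsp : ∀ i : ℕ, i < ℓ + 2 → ¬ (L : ℤ) ∣ k + i + 1 ∧ ¬ (L : ℤ) ∣ k + e + i + 1 := by
    intro i hi
    have := hblock i hi
    grind
  obtain ⟨η, hη⟩ : ∃ η : ℤ → Q, ∀ i, η i =
      (pos (letter L p a lab α) i)⁻¹ * f * pos (letter L p a lab β) (i + e) := ⟨_, fun _ => rfl⟩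
  have hfix : ∀ i : ℕ, i < ℓ + 2 → η (k + i) • x₀ = x₀ := by
    intro i hi
    have := hrun (b * (ℓ + 2) + i) (by omega)
    grind [RelSys.corner, mul_smul, inv_smul_smul]
  have hstep : ∀ i : ℕ, i < ℓ + 2 →
      η (k + i + 1) = p⁻¹ * ((lab α (k + i))⁻¹ * η (k + i) * lab β (k + i + e)) * p := by
    intro i hi
    obtain ⟨h1, h2⟩ := hsp i hi
    rw [hη, hη, pos_succ, add_right_comm, pos_succ, letter_of_not_dvd h1,
      letter_of_not_dvd (by rwa [add_right_comm k])]
    group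
  have hone : ∀ i : ℕ, i < ℓ + 1 → (lab α (k + i))⁻¹ * η (k + i) * lab β (k + i + e) = 1 := by
    intro i hi
    refine hT.disj _ x₀ (p • x₀) ?_ ?_ ?_
    · rw [mul_smul, mul_smul, h.lab_fix, hfix i (by omega), inv_smul_eq_iff, h.lab_fix]
    · have := hfix (i + 1) (by omega)
      grind [mul_smul, inv_smul_eq_iff]
    · intro h0
      exact h.link_smul_ne hc hs (by omega) α (by rw [inv_smul_eq_iff]; exact h0)
  have hη1 : ∀ i : ℕ, i < ℓ + 1 → η (k + i + 1) = 1 := by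
    intro i hi
    rw [hstep i (by omega), hone i hi]; group
  have hpin := h.pin α β (k + 1) (k + e + 1) fun i hi => by
    obtain ⟨h1, h2⟩ := hsp (i + 1) (by omega)
    grind [inv_mul_eq_one]
  obtain ⟨rfl, n, hn⟩ := hpin
  refine ⟨rfl, Subgroup.mem_zpowers_iff.2 ⟨n, ?_⟩⟩
  have h5 := hη1 0 (by omega)
  rw [Nat.cast_zero, add_zero, hη] at h5
  have h6 := pos_add_mul (letter_per h α) n (k + 1 + e)
  rw [show k + 1 + e + n * L = k + 1 by linear_combination -hn] at h6
  rw [h6, mul_inv_rev] at h5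
  have h7 : f = rel L p a lab α ^ n * (pos (letter L p a lab α) (k + 1 + e) *
      ((pos (letter L p a lab α) (k + 1 + e))⁻¹ * (pos (letter L p a lab α) L ^ n)⁻¹ * f *
      pos (letter L p a lab α) (k + 1 + e)) * (pos (letter L p a lab α) (k + 1 + e))⁻¹) := by
    rw [rel]; group
  rw [h5] at h7
  rw [h7]; group

theorem false_of_run (h : RelSys Γ δ A d x₀ p L ℓ a lab) (hT : Tame Q Γ) (hs : Slim Γ δ)
    (hL : 3 * (ℓ + 2) ≤ L) {α β : ι} {f : Q} {j e : ℤ}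
    (hrun : ∀ i : ℕ, i < 3 * (ℓ + 2) →
      corner x₀ L p a lab α (j + i) = f • corner x₀ L p a lab β (-(j + i + e))) : False := by
  have hc := hT.conn
  obtain ⟨b, hb, hblock⟩ := exists_block (m := ℓ + 2) (P := fun i => (L : ℤ) ∣ j + 1 + i)
    (P' := fun i => (L : ℤ) ∣ j + e + i) (fun s t hs ht => at_most_one hL _ hs ht)
    (fun s t hs ht => at_most_one hL _ hs ht)
  obtain ⟨k, hk⟩ : ∃ k : ℤ, k = j + (b * (ℓ + 2) : ℕ) := ⟨_, rfl⟩
  have hbl : b * (ℓ + 2) ≤ 2 * (ℓ + 2) := Nat.mul_le_mul_right _ (by omega)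
  have hsp : ∀ i : ℕ, i < ℓ + 2 → ¬ (L : ℤ) ∣ k + i + 1 ∧ ¬ (L : ℤ) ∣ -(k + i + e) - 1 + 1 := by
    intro i hi
    have := hblock i hi
    rw [sub_add_cancel, dvd_neg]
    grind
  obtain ⟨η, hη⟩ : ∃ η : ℤ → Q, ∀ i, η i =
      (pos (letter L p a lab α) i)⁻¹ * f * pos (letter L p a lab β) (-(i + e)) := ⟨_, fun _ => rfl⟩
  have hfix : ∀ i : ℕ, i < ℓ + 2 → η (k + i) • x₀ = x₀ := by
    intro i hi
    have := hrun (b * (ℓ + 2) + i) (by omega)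
    grind [RelSys.corner, mul_smul, inv_smul_smul]
  have hstep : ∀ i : ℕ, i < ℓ + 2 → η (k + i + 1) * lab β (-(k + i + e) - 1) =
      p⁻¹ * ((lab α (k + i))⁻¹ * η (k + i)) * p⁻¹ := by
    intro i hi
    obtain ⟨h1, h2⟩ := hsp i hi
    rw [hη, hη, pos_succ, show -(k + i + 1 + e) = -(k + i + e) - 1 by ring, pos_pred,
      letter_of_not_dvd h1, letter_of_not_dvd h2]
    group
  have hτfix : ∀ i : ℕ, i < ℓ + 2 → ((lab α (k + i))⁻¹ * η (k + i)) • x₀ = x₀ := by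
    intro i hi
    rw [mul_smul, hfix i hi, inv_smul_eq_iff, h.lab_fix]
  have hμfix : ∀ i : ℕ, i < ℓ + 1 → (η (k + i + 1) * lab β (-(k + i + e) - 1)) • x₀ = x₀ := by
    intro i hi
    have := hfix (i + 1) (by omega)
    rw [Nat.cast_add, Nat.cast_one, ← add_assoc] at this
    rw [mul_smul, h.lab_fix, this]
  have hτ : ∀ i : ℕ, i < ℓ + 1 → (lab α (k + i))⁻¹ * η (k + i) = (lab α k)⁻¹ * η k := by
    intro i hi
    have key : ∀ i : ℕ, i < ℓ + 1 → ((lab α (k + i))⁻¹ * η (k + i)) • p⁻¹ • x₀ = p • x₀ := by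
      grind [mul_smul, inv_smul_eq_iff]
    have h0 := key 0 (by omega)
    have h0' := hτfix 0 (by omega)
    rw [Nat.cast_zero, add_zero] at h0 h0'
    have : ((lab α k)⁻¹ * η k)⁻¹ * ((lab α (k + i))⁻¹ * η (k + i)) = 1 := by
      refine hT.disj _ _ _ ?_ ?_ (h.link_smul_ne hc hs (by omega) α)
      · rw [mul_smul, key i hi, inv_smul_eq_iff, h0]
      · grind [mul_smul, inv_smul_eq_iff]
    exact (inv_mul_eq_one.1 this).symm
  have h6 := hstep 0 (by omega)
  have h7 := hτfix 0 (by omega)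
  have h8 := hμfix 0 (by omega)
  simp only [Nat.cast_zero, add_zero] at h6 h7 h8
  refine h.rev α β k (-(k + e) - 1) _ _ h7 h8 h6.symm fun i hi => ?_
  grind [mul_inv_cancel_left, mul_inv_cancel_right]

end RelSys

end

theorem ConeFam.exists_quotient {Q : Type u} [Group Q] {V : Type w} {ι : Type w'} [MulAction Q V]
    [MulAction Q ι] {Γ : SimpleGraph V} {S : ι → Set V} {σ δ : ℕ} (hF : ConeFam Q Γ S σ)
    (hT : Tame Q Γ) (hs : Slim Γ δ) (hrot : ∀ i, ∀ s ∈ S i, ∀ ρ : Q, ρ • i = i → ρ ≠ 1 →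
      ¬ Av (coneGraph Γ S) (.inr i) (bigAngle (coneSlim δ σ)) (.inl s) (.inl (ρ • s))) :
    ∃ (Q' : Type u) (_ : Group Q') (V' : Type (max w w')) (_ : MulAction Q' V')
      (Γ' : SimpleGraph V') (ψ : Q →* Q') (π : V → V'), Tame Q' Γ' ∧ Step Γ Γ' ψ π ∧
      ∀ (i : ι) (g : Q), g • i = i → ψ g = 1 := by
  have hT' := hF.tame hT
  have hrotating : Rotating (coneGraph Γ S) (coneSlim δ σ) (bigAngle (coneSlim δ σ))
      (Sum.elim (fun _ => ⊥) fun i => MulAction.stabilizer Q i) := by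
    refine ⟨hT'.conn, cone_slim hT.conn hs hF.ne hF.qconv, hT'.acts, ?_, ?_, ?_, ?_⟩
    · rintro (v | i) ρ hρ
      · rw [hρ, one_smul]
      · exact congrArg Sum.inr hρ
    · rintro g (v | i) ρ hρ
      · rw [hρ, mul_one, mul_inv_cancel]
        exact one_mem _
      · change g * ρ * g⁻¹ ∈ MulAction.stabilizer Q (g • i)
        rw [MulAction.mem_stabilizer_iff, mul_smul, inv_smul_smul, mul_smul, hρ]
    · rintro (v | i) ρ hρ h1 (e | j) he
      · exact absurd hρ h1
      · exact absurd hρ h1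
      · exact hrot i e he ρ hρ h1
      · exact absurd he id
    · exact Nat.mul_le_mul_right _ (by omega)
  obtain ⟨Q', _, V', _, ψ, π, D⟩ := hT'.exists_quotient hrotating le_rfl
    (by
      rintro (v | i) g h hg
      · exact absurd rfl h
      · exact Sum.inr_injective hg)
    (by
      rintro (v | i) (w | j) h
      · exact .inl rfl
      · exact .inl rfl
      · exact .inr rfl
      · exact absurd h id)
  have hker : ∀ (i : ι) (g : Q), g • i = i → ψ g = 1 := fun i g hg =>
    (D.ker g).2 (mem_rotGroup (Set.mem_univ (Sum.inr i : V ⊕ ι)) hg)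
  refine ⟨Q', _, V', _, quotGraph (coneGraph Γ S) π, ψ, fun x => π (.inl x), D.tame hT',
    ⟨D.psi_surj, fun g x => D.equiv g (.inl x), fun x g hg => ?_, fun x g hg h1 => ?_,
      fun x y h => D.adj h, fun v => ?_⟩, hker⟩
  · obtain ⟨g₀, h1, h2⟩ := D.exists_stab hg
    exact ⟨g₀, h1, Sum.inl_injective h2⟩
  · exact D.psi_ne_one (x := .inl x) rfl (congrArg Sum.inl hg) h1
  · obtain ⟨x | i, rfl⟩ := D.pi_surj v
    · exact .inl ⟨x, rfl⟩
    · right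
      have : Subsingleton (MulAction.stabilizer Q' (π (.inr i))) := by
        refine ⟨fun a b => Subtype.ext ?_⟩
        have key : ∀ a : MulAction.stabilizer Q' (π (.inr i)), (a : Q') = 1 := by
          rintro ⟨a, ha⟩
          obtain ⟨g₀, rfl, h2⟩ := D.exists_stab ha
          exact hker i g₀ (Sum.inr_injective h2)
        rw [key a, key b]
      infer_instance

section

variable {V Q : Type*} [Group Q] [MulAction Q V] {Γ : SimpleGraph V} {δ A d L ℓ : ℕ} {ι : Type*}
variable {x₀ : V} {p : Q} {a : ι → Q} {lab : ι → ℤ → Q}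

namespace RelSys

/-- The axes of the conjugates of the relators. -/
def fam (x₀ : V) (L : ℕ) (p : Q) (a : ι → Q) (lab : ι → ℤ → Q)
    (i : Σ α : ι, Q ⧸ Subgroup.zpowers (rel L p a lab α)) : Set V :=
  {x | ∃ g : Q, (QuotientGroup.mk g : Q ⧸ Subgroup.zpowers (rel L p a lab i.1)) = i.2 ∧
    ∃ j : ℤ, x = g • corner x₀ L p a lab i.1 j}

theorem mem_fam (h : RelSys Γ δ A d x₀ p L ℓ a lab) {α : ι} {g : Q} {x : V} :
    x ∈ fam x₀ L p a lab ⟨α, QuotientGroup.mk g⟩ ↔ ∃ j : ℤ, x = g • corner x₀ L p a lab α j := by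
  constructor
  · rintro ⟨g', hg', j, rfl⟩
    rw [eq_comm, QuotientGroup.eq] at hg'
    obtain ⟨k, hk⟩ := Subgroup.mem_zpowers_iff.1 hg'
    refine ⟨j + k * L, ?_⟩
    rw [← h.corner_add α k j, hk, ← mul_smul, mul_inv_cancel_left]
  · rintro ⟨j, rfl⟩
    exact ⟨g, rfl, j, rfl⟩

theorem ovl (h : RelSys Γ δ A d x₀ p L ℓ a lab) (hT : Tame Q Γ) (hs : Slim Γ δ)
    (hL : 3 * (ℓ + 2) ≤ L) (C : ℕ) : Ovl Γ (fam x₀ L p a lab) C ((2 * C + 3 * ℓ + 9) * d + 1) := by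
  have hc := hT.conn
  rintro ⟨α, gα⟩ ⟨β, gβ⟩ s₁ hs₁ s₂ hs₂ t₁ ht₁ t₂ ht₂ h₁ h₂ hd
  obtain ⟨g, rfl⟩ := QuotientGroup.mk_surjective gα
  obtain ⟨g', rfl⟩ := QuotientGroup.mk_surjective gβ
  obtain ⟨i₁, rfl⟩ := h.mem_fam.1 hs₁
  obtain ⟨i₂, rfl⟩ := h.mem_fam.1 hs₂
  obtain ⟨k₁, rfl⟩ := h.mem_fam.1 ht₁
  obtain ⟨k₂, rfl⟩ := h.mem_fam.1 ht₂
  clear hs₁ hs₂ ht₁ ht₂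
  wlog hi : i₁ ≤ i₂ generalizing i₁ i₂ k₁ k₂
  · grind [SimpleGraph.dist_comm]
  obtain ⟨n, rfl⟩ : ∃ n : ℕ, i₂ = i₁ + n := ⟨(i₂ - i₁).toNat, by omega⟩
  rw [hT.acts.dist_smul hc] at hd
  have hb := h.broken hc hT.acts α
  have hn : 2 * C + 3 * ℓ + 9 < n := by
    have := hb.dist_le_mul hc n i₁
    by_contra hcon
    have := Nat.mul_le_mul_right d (not_lt.1 hcon)
    omega
  obtain ⟨f, hf⟩ : ∃ f, f = g⁻¹ * g' := ⟨_, rfl⟩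
  have hmove : ∀ i k, Γ.dist (g • corner x₀ L p a lab α i) (g' • corner x₀ L p a lab β k) =
      Γ.dist (corner x₀ L p a lab α i) (f • corner x₀ L p a lab β k) := by
    intro i k
    rw [← hT.acts.dist_smul hc g _ (f • _), ← mul_smul, hf, mul_inv_cancel_left]
  rw [hmove] at h₁ h₂
  have hb' := (h.broken hc hT.acts β).smul hc hT.acts
    (by rintro g _ ⟨g', rfl⟩; exact ⟨g * g', mul_smul _ _ _⟩) f
  rcases lt_trichotomy k₁ k₂ with hk | rfl | hk
  · obtain ⟨e, he⟩ := hb.exists_run hb' hc hs hk h₁ h₂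
    obtain ⟨rfl, hr⟩ := h.pin_of_run hT hs hL (f := f) (j := i₁ + C + 1) (e := e) fun i hi =>
      he _ (by omega) (by omega)
    grind [QuotientGroup.eq]
  · have h3 := hb.le_dist hc hs n i₁
    have h4 := hc.triangle (corner x₀ L p a lab α i₁) (f • corner x₀ L p a lab β k₁)
      (corner x₀ L p a lab α (i₁ + n))
    rw [SimpleGraph.dist_comm] at h₂
    omega
  · obtain ⟨e, he⟩ := hb.exists_run hb'.reverse hc hs (k₁ := -k₁) (k₂ := -k₂) (by omega)
      (by simpa using h₁) (by simpa using h₂)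
    exact (h.false_of_run hT hs hL (f := f) (j := i₁ + C + 1) (e := e) fun i hi =>
      he _ (by omega) (by omega)).elim

theorem exists_eq_conj {α : ι} {g₀ g : Q}
    (hg : g • (⟨α, QuotientGroup.mk g₀⟩ : Σ α : ι, Q ⧸ Subgroup.zpowers (rel L p a lab α)) =
      ⟨α, QuotientGroup.mk g₀⟩) : ∃ l : ℤ, g = g₀ * rel L p a lab α ^ l * g₀⁻¹ := by
  have hg : (QuotientGroup.mk (g * g₀) : Q ⧸ Subgroup.zpowers (rel L p a lab α)) =
      QuotientGroup.mk g₀ := eq_of_heq (Sigma.mk.inj hg).2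
  rw [eq_comm, QuotientGroup.eq] at hg
  obtain ⟨l, hl⟩ := Subgroup.mem_zpowers_iff.1 hg
  exact ⟨l, by rw [hl]; group⟩

theorem le_dist_conj (h : RelSys Γ δ A d x₀ p L ℓ a lab) (hT : Tame Q Γ) (hs : Slim Γ δ) (α : ι)
    (g₀ : Q) (j l : ℤ) : l.natAbs * L ≤ Γ.dist (g₀ • corner x₀ L p a lab α j)
      ((g₀ * rel L p a lab α ^ l * g₀⁻¹) • g₀ • corner x₀ L p a lab α j) := by
  have hc := hT.conn
  have hb := h.broken hc hT.acts α
  rw [mul_smul, inv_smul_smul, mul_smul, hT.acts.dist_smul hc, h.corner_add]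
  rcases le_total 0 l with hl | hl
  · refine hb.le_dist_of_lt hc hs ?_
    push_cast
    rw [abs_of_nonneg hl]
  · rw [SimpleGraph.dist_comm]
    refine hb.le_dist_of_lt hc hs ?_
    push_cast
    rw [abs_of_nonpos hl]
    linarith

theorem coneFam (h : RelSys Γ δ A d x₀ p L ℓ a lab) (hT : Tame Q Γ) (hs : Slim Γ δ)
    (hL : 3 * (ℓ + 2) ≤ L) : ConeFam Q Γ (fam x₀ L p a lab) d := by
  have hc := hT.conn
  have hLpos : 1 ≤ L := by omega
  refine ⟨?_, ?_, ?_, fun C => ⟨_, h.ovl hT hs hL C⟩, ?_, ?_⟩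
  · rintro ⟨α, g⟩
    obtain ⟨g, rfl⟩ := QuotientGroup.mk_surjective g
    exact ⟨_, h.mem_fam.2 ⟨0, rfl⟩⟩
  · rintro ⟨α, g⟩ s hsi t hti q hq
    obtain ⟨g, rfl⟩ := QuotientGroup.mk_surjective g
    obtain ⟨i, rfl⟩ := h.mem_fam.1 hsi
    obtain ⟨k, rfl⟩ := h.mem_fam.1 hti
    clear hsi hti
    have hb := (h.broken hc hT.acts α).smul hc hT.acts
      (by rintro g _ ⟨g', rfl⟩; exact ⟨g * g', mul_smul _ _ _⟩) g
    wlog hik : i ≤ k generalizing i k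
    · exact this k i hq.symm (by omega)
    rcases hik.eq_or_lt with rfl | hik
    · refine ⟨_, h.mem_fam.2 ⟨i, rfl⟩, ?_⟩
      grind [Btw]
    · obtain ⟨j, -, -, h3⟩ := hb.locate_of_lt hc hs hik hq
      refine ⟨_, h.mem_fam.2 ⟨j, rfl⟩, ?_⟩
      have := hb.dist_le j
      grind [Btw, SimpleGraph.dist_comm]
  · rintro g i _ ⟨g', hg', j, rfl⟩
    refine ⟨g * g', ?_, j, (mul_smul _ _ _).symm⟩
    change _ = g • i.2
    rw [← hg']
    rfl
  · intro C
    refine ⟨(Finset.Icc (-(C : ℤ)) C).card, ?_⟩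
    rintro ⟨α, g₀⟩ s hsi
    obtain ⟨g₀, rfl⟩ := QuotientGroup.mk_surjective g₀
    obtain ⟨j, rfl⟩ := h.mem_fam.1 hsi
    rw [← Set.encard_coe_eq_coe_finsetCard]
    refine (Set.encard_le_encard ?_).trans
      (Set.encard_image_le (fun l : ℤ => g₀ * rel L p a lab α ^ l * g₀⁻¹) _)
    rintro g ⟨hg, hd⟩
    obtain ⟨l, rfl⟩ := exists_eq_conj hg
    refine ⟨l, ?_, rfl⟩
    have := h.le_dist_conj hT hs α g₀ j l
    have := Nat.le_mul_of_pos_right l.natAbs hLpos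
    grind
  · rintro ⟨α, g₀⟩ s hsi g hg h1 C
    obtain ⟨g₀, rfl⟩ := QuotientGroup.mk_surjective g₀
    obtain ⟨j, rfl⟩ := h.mem_fam.1 hsi
    obtain ⟨l, rfl⟩ := exists_eq_conj hg
    have hl : l ≠ 0 := by rintro rfl; simp at h1
    refine ⟨C + 1, ?_⟩
    rw [conj_pow, ← zpow_natCast, ← zpow_mul]
    have := h.le_dist_conj hT hs α g₀ j (l * (C + 1 : ℕ))
    rw [Int.natAbs_mul, Int.natAbs_natCast] at this
    have h2 : 1 * (C + 1) * 1 ≤ l.natAbs * (C + 1) * L :=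
      Nat.mul_le_mul (Nat.mul_le_mul_right _ (by omega)) hLpos
    omega

end RelSys

end

/-- Relators of at least this period can be killed. -/
noncomputable def relLen (δ d ℓ : ℕ) : ℕ :=
  let M := bigAngle (coneSlim δ d)
  M * ((2 * (M * δ + 2 * d) + 3 * ℓ + 9) * d + 1 + 2 * d + 2 * (M * δ) + 3) + 3 * ℓ + 7

theorem RelSys.exists_quotient {Q : Type u} [Group Q] {V : Type w} [MulAction Q V]
    {Γ : SimpleGraph V} {δ A d L ℓ : ℕ} {ι : Type w'} {x₀ : V} {p : Q} {a : ι → Q} {lab : ι → ℤ → Q}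
    (h : RelSys Γ δ A d x₀ p L ℓ a lab) (hT : Tame Q Γ) (hs : Slim Γ δ) (hL : relLen δ d ℓ ≤ L) :
    ∃ (Q' : Type u) (_ : Group Q') (V' : Type (max w u w')) (_ : MulAction Q' V')
      (Γ' : SimpleGraph V') (ψ : Q →* Q') (π : V → V'), Tame Q' Γ' ∧ Step Γ Γ' ψ π ∧
      ∀ α, ψ (rel L p a lab α) = 1 := by
  unfold relLen at hL
  obtain ⟨M, hM⟩ : ∃ M, M = bigAngle (coneSlim δ d) := ⟨_, rfl⟩
  simp only [← hM] at hL
  have hF := h.coneFam hT hs (by omega)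
  obtain ⟨Q', i1, V', i2, Γ', ψ, π, hT', hS, hk⟩ := hF.exists_quotient hT hs (by
    rintro ⟨α, g₀⟩ s hsi ρ hρ h1 hav
    have h3 := dist_le_of_cone_av hT.conn hs hF.qconv (h.ovl hT hs (by omega) _) hsi
      (by simpa [hρ] using hF.equiv ρ _ s hsi) hav
    obtain ⟨g₀, rfl⟩ := QuotientGroup.mk_surjective g₀
    obtain ⟨j, rfl⟩ := h.mem_fam.1 hsi
    obtain ⟨l, rfl⟩ := exists_eq_conj hρ
    have hl : l ≠ 0 := by rintro rfl; simp at h1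
    have h4 := h.le_dist_conj hT hs α g₀ j l
    have h5 : 1 * L ≤ l.natAbs * L := Nat.mul_le_mul_right _ (by omega)
    rw [← hM] at h3
    omega)
  refine ⟨Q', i1, V', i2, Γ', ψ, π, hT', hS, fun α => hk ⟨α, QuotientGroup.mk 1⟩ _ ?_⟩
  change (⟨α, QuotientGroup.mk (_ * 1)⟩ : Σ α : ι, Q ⧸ Subgroup.zpowers (rel L p a lab α)) = _
  congr 1
  rw [eq_comm, QuotientGroup.eq]
  simp

section

variable {V Q : Type*} [Group Q] [MulAction Q V] {Γ : SimpleGraph V} {δ σ : ℕ} {ι : Type*}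
variable [MulAction Q ι] {S : ι → Set V}

theorem av_inr (Γ : SimpleGraph V) (S : ι → Set V) (i : ι) {x y : V} (w : Γ.Walk x y) :
    Av (coneGraph Γ S) (.inr i) w.length (.inl x) (.inl y) := by
  induction w with
  | nil => exact .refl _ _ (by simp)
  | @cons a b _ h w ih =>
    exact .cons _ _ _ _ (by simp) (show (coneGraph Γ S).Adj (.inl a) (.inl b) from h) ih

/-- For two given points all angles at cone points are bounded. -/
theorem ConeFam.exists_ang (hF : ConeFam Q Γ S σ) (hT : Tame Q Γ) (x z : V ⊕ ι) :
    ∃ A, ∀ i, Ang (coneGraph Γ S) (.inr i) A x z := by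
  obtain ⟨δ, hδ⟩ := hT.slim
  have hc' := cone_conn hT.conn hF.ne
  have hs := cone_slim hT.conn hδ hF.ne hF.qconv
  obtain ⟨θ, hθ⟩ : ∃ θ, θ = angleBound (coneSlim δ σ) := ⟨_, rfl⟩
  have hone : ∀ i, ∃ n, Ang (coneGraph Γ S) (.inr i) n x z := by
    intro i
    by_cases hx : x = .inr i
    · rw [hx]; exact ⟨_, (ang_right hc' hs).symm⟩
    by_cases hz : z = .inr i
    · rw [hz]; exact ⟨_, ang_right hc' hs⟩
    obtain ⟨s | j, he⟩ := exists_next hc' (Ne.symm hx)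
    swap
    · exact absurd he.1 id
    obtain ⟨s' | j, hf⟩ := exists_next hc' (Ne.symm hz)
    swap
    · exact absurd hf.1 id
    obtain ⟨w⟩ := hT.conn.preconnected s s'
    have hw := av_inr Γ S i w
    refine ⟨θ + w.length + θ, ?_⟩
    subst hθ
    rintro e₁ (h1 | h1) e₂ (h2 | h2)
    · exact (lk_av hc' hs h1 h2).mono (by omega)
    · exact ((lk_av hc' hs h1 he).trans hw).trans (lk_av hc' hs hf h2)
    · exact ((lk_av hc' hs h2 he).trans hw).trans (lk_av hc' hs hf h1) |>.symm
    · exact (lk_av hc' hs h1 h2).mono (by omega)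
  obtain ⟨γ, hγ, hd⟩ := exists_points hc' x z
  have hb : ∀ t, ∃ n, ∀ i, γ t = .inr i → Ang (coneGraph Γ S) (.inr i) n x z := by
    intro t
    rcases ht : γ t with s | i
    · exact ⟨0, fun i h => by simp at h⟩
    · obtain ⟨n, hn⟩ := hone i
      exact ⟨n, fun j h => by obtain rfl := Sum.inr_injective h; exact hn⟩
  choose n hn using hb
  refine ⟨2 * θ + (Finset.range ((coneGraph Γ S).dist x z + 1)).sup n, fun i => ?_⟩
  by_contra hcon
  have hxy : Btw (coneGraph Γ S) x (.inr i) z := btw_of_not_ang hc' hs fun h =>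
    hcon (h.mono (by omega))
  obtain ⟨t, ht⟩ : ∃ t, t = (coneGraph Γ S).dist x (.inr i) := ⟨_, rfl⟩
  have htd : t ≤ (coneGraph Γ S).dist x z := by unfold Btw at hxy; omega
  have h1 := hγ t htd
  have h2 := hd t htd
  have hti : γ t = .inr i := by
    rw [← hc'.dist_eq_zero_iff]
    have c1 := (coneGraph Γ S).dist_swap (γ t) (Sum.inr i)
    rcases btw_or_btw_of_not_ang hc' hs (n := 2 * θ) (by omega)
      (fun h => hcon (h.mono (by omega))) (γ t) with h | h <;> unfold Btw at h h1 hxy <;> omega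
  refine hcon ((hn t i hti).mono ?_)
  have := Finset.le_sup (f := n) (Finset.mem_range.2 (show t < (coneGraph Γ S).dist x z + 1 by
    omega))
  omega

theorem step_cone (Γ : SimpleGraph V) (S : ι → Set V) (hcyc : ∀ i : ι, IsCyclic
    (MulAction.stabilizer Q i)) :
    Step Γ (coneGraph Γ S) (MonoidHom.id Q) (Sum.inl : V → V ⊕ ι) where
  surj := Function.surjective_id
  equiv g x := rfl
  stab x g hg := ⟨g, rfl, Sum.inl_injective hg⟩
  inj x g _ h := h
  adj x y h := h
  rest v := by
    rcases v with x | i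
    · exact .inl ⟨x, rfl⟩
    · right
      have : MulAction.stabilizer Q (Sum.inr i : V ⊕ ι) = MulAction.stabilizer Q i := by
        ext g
        exact ⟨fun h => Sum.inr_injective h, fun h => congrArg Sum.inr h⟩
      rw [this]
      exact hcyc i

theorem isCyclic_stabilizer_quotient (c : Q) (i : Q ⧸ Subgroup.zpowers c) :
    IsCyclic (MulAction.stabilizer Q i) := by
  obtain ⟨g, rfl⟩ := QuotientGroup.mk_surjective i
  refine Subgroup.isCyclic_of_le (H' := Subgroup.zpowers (g * c * g⁻¹)) fun x hx => ?_
  have hx : (QuotientGroup.mk (x * g) : Q ⧸ Subgroup.zpowers c) = QuotientGroup.mk g := hx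
  rw [eq_comm, QuotientGroup.eq] at hx
  obtain ⟨k, hk⟩ := Subgroup.mem_zpowers_iff.1 hx
  refine Subgroup.mem_zpowers_iff.2 ⟨k, ?_⟩
  rw [conj_zpow, hk]
  group

theorem Tame.exists_qax (hT : Tame Q Γ) (K : Subgroup Q) (hK : ¬ ∃ x : V, ∀ k ∈ K, k • x = x) :
    ∃ q ∈ K, ∃ y C, QAx Γ q y C := by
  obtain ⟨δ, hs⟩ := hT.slim
  obtain ⟨x⟩ := hT.conn.nonempty
  obtain ⟨q, hq, y, hy⟩ := exists_dist_sq hT.conn hs hT.acts hT.acyl (K := K) (x := x) (by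
    by_contra hcon
    push Not at hcon
    obtain ⟨B, hB⟩ := hcon
    exact hK (hT.ell K x B hB))
  obtain ⟨C, hC⟩ := isLox_of_dist_sq hT.conn hs hT.acts hy
  exact ⟨q, hq, y, C, hC.qax⟩

end

section

variable {V Q : Type*} [Group Q] [MulAction Q V] {Γ : SimpleGraph V} {c : Q} {y : V} {C σ : ℕ}

theorem smul_base_iff (c g : Q) :
    g • (Sum.inr (QuotientGroup.mk 1) : V ⊕ (Q ⧸ Subgroup.zpowers c)) = .inr (QuotientGroup.mk 1) ↔
      g ∈ Subgroup.zpowers c := by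
  constructor
  · intro h
    have h : (QuotientGroup.mk (g * 1) : Q ⧸ Subgroup.zpowers c) = QuotientGroup.mk 1 :=
      Sum.inr_injective h
    rw [eq_comm, QuotientGroup.eq] at h
    simpa using h
  · intro h
    refine congrArg Sum.inr ?_
    change (QuotientGroup.mk (g * 1) : Q ⧸ Subgroup.zpowers c) = QuotientGroup.mk 1
    rw [eq_comm, QuotientGroup.eq]
    simpa using h

/-- Large powers of the generator of an axis rotate by a large angle. -/
theorem Axis.exists_not_ang (h : Axis Γ c y C) (hT : Tame Q Γ) (hF : ConeFam Q Γ (axisFam c y) σ)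
    (A : ℕ) {x z : V ⊕ (Q ⧸ Subgroup.zpowers c)} (hx : x ≠ .inr (QuotientGroup.mk 1))
    (hz : z ≠ .inr (QuotientGroup.mk 1)) :
    ∃ N : ℕ, ∀ n : ℤ, N ≤ n.natAbs →
      ¬ Ang (coneGraph Γ (axisFam c y)) (.inr (QuotientGroup.mk 1)) A x (c ^ n • z) := by
  obtain ⟨δ, hs⟩ := hT.slim
  have hc' := cone_conn hT.conn hF.ne
  obtain ⟨B, hB⟩ := hF.exists_bound hT.conn hs A
  obtain ⟨N, hN⟩ := h.proper B
  obtain ⟨s | j, he⟩ := exists_next hc' (Ne.symm hx)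
  swap
  · exact absurd he.1 id
  obtain ⟨s' | j, hf⟩ := exists_next hc' (Ne.symm hz)
  swap
  · exact absurd hf.1 id
  obtain ⟨a, ha⟩ := mem_axisFam.1 (show s ∈ axisFam c y (QuotientGroup.mk 1) from he.1)
  obtain ⟨b, hb⟩ := mem_axisFam.1 (show s' ∈ axisFam c y (QuotientGroup.mk 1) from hf.1)
  rw [one_smul] at ha hb
  refine ⟨N + a.natAbs + b.natAbs, fun n hn hang => ?_⟩
  have hf' := (hF.acts hT.acts).mem_lk_smul hc' (c ^ n) hf
  rw [(smul_base_iff c (c ^ n)).2 (zpow_mem (Subgroup.mem_zpowers c) n)] at hf'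
  have hav := hang _ (.inl he) _ (.inr hf')
  have := hB (QuotientGroup.mk 1) s he.1 (c ^ n • s') hf'.1 hav
  rw [ha, hb, ← mul_smul, ← zpow_add, dist_zpow hT.conn hT.acts] at this
  grind

end

section

variable {V Q : Type*} [Group Q] [MulAction Q V] {Γ : SimpleGraph V}

/-- Residues of consecutive integers are consecutive unless they wrap around. -/
theorem emod_succ {L i : ℤ} (hL : 0 < L) (h : ¬ L ∣ i + 1) : (i + 1) % L = i % L + 1 := by
  have h1 := Int.emod_nonneg i hL.ne'
  have h2 := Int.emod_lt_of_pos i hL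
  have e : i + 1 = i % L + 1 + L * (i / L) := by linarith [Int.emod_add_mul_ediv i L]
  have h4 : i % L + 1 ≠ L := fun h4 => h ⟨i / L + 1, by rw [e, h4]; ring⟩
  rw [e, Int.add_mul_emod_self_left, Int.emod_eq_of_lt (by omega) (by omega)]

/-- The exponents of the labels: distinct and convex along a period. -/
def expo (N L : ℕ) (i : ℤ) : ℕ := N * 2 ^ (i % L).toNat

theorem expo_inj {N L : ℕ} (hN : 0 < N) (hL : 0 < L) {i j : ℤ} (h : expo N L i = expo N L j) :
    (L : ℤ) ∣ i - j := by
  have h := Nat.pow_right_injective le_rfl (Nat.eq_of_mul_eq_mul_left hN h)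
  have h1 := Int.emod_nonneg i (b := L) (by omega)
  have h2 := Int.emod_nonneg j (b := L) (by omega)
  exact Int.ModEq.dvd (show j % L = i % L by omega)

theorem expo_rev {N L : ℕ} (hN : 0 < N) (hL : 0 < L) {j k : ℤ}
    (h : ∀ i : ℕ, i < 3 → ¬ (L : ℤ) ∣ j + i + 1 ∧ ¬ (L : ℤ) ∣ k - i + 1)
    (h01 : expo N L (j + 1) + expo N L k = expo N L (j + 2) + expo N L (k - 1))
    (h02 : expo N L (j + 1) + expo N L k = expo N L (j + 3) + expo N L (k - 2)) : False := by
  have hL' : (0 : ℤ) < L := by omega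
  have a1 := emod_succ hL' (i := j + 1) (by simpa [add_right_comm] using (h 1 (by omega)).1)
  have a2 := emod_succ hL' (i := j + 2) (by simpa [add_right_comm] using (h 2 (by omega)).1)
  have b1 := emod_succ hL' (i := k - 1) (by simpa using (h 1 (by omega)).2)
  have b2 := emod_succ hL' (i := k - 2) (by simpa using (h 2 (by omega)).2)
  rw [show j + 1 + 1 = j + 2 by ring] at a1
  rw [show j + 2 + 1 = j + 3 by ring] at a2
  rw [sub_add_cancel] at b1
  rw [show k - 2 + 1 = k - 1 by ring] at b2
  have p1 := Int.emod_nonneg (j + 1) hL'.ne'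
  have p2 := Int.emod_nonneg (k - 2) hL'.ne'
  obtain ⟨r, hr⟩ := Int.eq_ofNat_of_zero_le p1
  obtain ⟨s, hs⟩ := Int.eq_ofNat_of_zero_le p2
  simp only [expo, a2, a1, b1, b2, hr, hs] at h01 h02
  have t : ∀ n : ℕ, ((n : ℤ) + 1).toNat = n + 1 := fun n => by omega
  have t2 : ∀ n : ℕ, ((n : ℤ) + 1 + 1).toNat = n + 2 := fun n => by omega
  simp only [t, t2, Int.toNat_natCast, pow_succ, ← mul_add] at h01 h02
  grind [Nat.eq_of_mul_eq_mul_left]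

end

theorem Step.refl {V Q : Type*} [Group Q] [MulAction Q V] (Γ : SimpleGraph V) :
    Step Γ Γ (MonoidHom.id Q) id :=
  ⟨Function.surjective_id, fun _ _ => rfl, fun _ g h => ⟨g, rfl, h⟩, fun _ _ _ h => h,
    fun _ _ h => h, fun v => .inl ⟨v, rfl⟩⟩

/-- Some quotient forces `a` into the subgroup `K` or gives `K` a fixed vertex. -/
theorem Tame.exists_step {Q V : Type} [Group Q] [MulAction Q V] {Γ : SimpleGraph V}
    (hT : Tame Q Γ) (K : Subgroup Q) (a : Q) :
    ∃ (Q' : Type) (_ : Group Q') (V' : Type) (_ : MulAction Q' V')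
      (Γ' : SimpleGraph V') (ψ : Q →* Q') (π : V → V'), Tame Q' Γ' ∧ Step Γ Γ' ψ π ∧
      ((∃ x : V', ∀ k ∈ K, ψ k • x = x) ∨ ψ a ∈ K.map ψ) := by
  by_cases hK : ∃ x : V, ∀ k ∈ K, k • x = x
  · obtain ⟨x, hx⟩ := hK
    exact ⟨Q, _, V, _, Γ, _, _, hT, Step.refl Γ, .inl ⟨x, hx⟩⟩
  obtain ⟨q, hq, y, C, hax⟩ := hT.exists_qax K hK
  obtain ⟨c, C', hqc, hAx⟩ := hax.exists_axis hT
  obtain ⟨σ, hF⟩ := hAx.coneFam hT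
  have hT₁ := hF.tame hT
  have hS₁ := step_cone Γ (axisFam c y) (isCyclic_stabilizer_quotient c)
  obtain ⟨x₀, hx₀⟩ : ∃ x₀ : V ⊕ (Q ⧸ Subgroup.zpowers c), x₀ = .inr (QuotientGroup.mk 1) := ⟨_, rfl⟩
  have hst : ∀ g : Q, g • x₀ = x₀ ↔ g ∈ Subgroup.zpowers c := fun g => by
    rw [hx₀]; exact smul_base_iff c g
  by_cases hK₁ : ∀ k ∈ K, k • x₀ = x₀
  · exact ⟨Q, _, _, _, _, _, _, hT₁, hS₁, .inl ⟨x₀, hK₁⟩⟩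
  have hq0 := (hst q).2 hqc
  have hq1 : q ≠ 1 := hax.ne_one
  obtain ⟨p, hp, hp1, hp2⟩ : ∃ p ∈ K, p • x₀ ≠ x₀ ∧ (p * a) • x₀ ≠ x₀ := by
    push Not at hK₁
    obtain ⟨p, hp, hp1⟩ := hK₁
    by_cases h : (p * a) • x₀ = x₀
    swap
    · exact ⟨p, hp, hp1, h⟩
    refine ⟨p * q, mul_mem hp hq, by rwa [mul_smul, hq0], fun h' => ?_⟩
    rw [mul_smul, ← eq_inv_smul_iff] at h h'
    rw [mul_inv_rev, mul_smul, ← h, eq_inv_smul_iff] at h'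
    refine hq1 (hT₁.disj q _ _ h' hq0 fun e => ?_)
    grind [inv_smul_eq_iff]
  obtain ⟨δ₁, hs₁⟩ := hT₁.slim
  obtain ⟨jj, hjj⟩ := Subgroup.mem_zpowers_iff.1 hqc
  have hjj0 : jj ≠ 0 := by rintro rfl; exact hq1 (by rw [← hjj, zpow_zero])
  have hc1 : c ≠ 1 := by rintro rfl; exact hq1 (by rw [← hjj, one_zpow])
  have hinj : ∀ m n : ℤ, c ^ m = c ^ n → m = n := by
    intro m n h
    by_contra hmn
    refine hc1 (eq_one_of_zpow_eq_one hT.torsionFree (sub_ne_zero.2 hmn) ?_)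
    rw [zpow_sub, h, mul_inv_cancel]
  obtain ⟨A₁, hA₁⟩ := hF.exists_ang hT x₀ (p • x₀)
  obtain ⟨A₂, hA₂⟩ := hF.exists_ang hT x₀ ((p * a) • x₀)
  obtain ⟨A, hA⟩ : ∃ A, A = A₁ + A₂ := ⟨_, rfl⟩
  have hbend : ∀ l l' : Q, l • x₀ ≠ x₀ → l' • x₀ ≠ x₀ → ∃ N : ℕ, ∀ n : ℤ, N ≤ n.natAbs →
      ¬ Ang (coneGraph Γ (axisFam c y)) x₀ (A + 4 * angleBound δ₁) (l⁻¹ • x₀)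
        (c ^ n • l' • x₀) := by
    intro l l' h h'
    rw [hx₀]
    refine hAx.exists_not_ang hT hF _ ?_ ?_ <;> rw [← hx₀]
    · rwa [Ne, inv_smul_eq_iff, eq_comm]
    · exact h'
  obtain ⟨N₁, hN₁⟩ := hbend p p hp1 hp1
  obtain ⟨N₂, hN₂⟩ := hbend p (p * a) hp1 hp2
  obtain ⟨N₃, hN₃⟩ := hbend (p * a) p hp2 hp1
  obtain ⟨N₄, hN₄⟩ := hbend (p * a) (p * a) hp2 hp2
  obtain ⟨N, hN⟩ : ∃ N, N = N₁ + N₂ + N₃ + N₄ + 1 := ⟨_, rfl⟩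
  obtain ⟨d, hd⟩ : ∃ d, d = (coneGraph Γ (axisFam c y)).dist x₀ (p • x₀) +
    (coneGraph Γ (axisFam c y)).dist x₀ ((p * a) • x₀) := ⟨_, rfl⟩
  obtain ⟨L, hL⟩ : ∃ L, L = relLen δ₁ d 3 + 1 := ⟨_, rfl⟩
  have hlink : ∀ (α : Unit) i, link L p (fun _ => a) α i = p ∨ link L p (fun _ => a) α
    i = p * a := by
    intro α i
    unfold link
    split_ifs <;> simp
  have hexpo : ∀ i, N ≤ (jj * expo N L i).natAbs := by
    intro i
    rw [Int.natAbs_mul, Int.natAbs_natCast]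
    have h1 : 1 ≤ jj.natAbs := Int.natAbs_pos.2 hjj0
    have h2 : 0 < 2 ^ (i % (L : ℤ)).toNat := by positivity
    have h3 : N ≤ expo N L i := Nat.le_mul_of_pos_right _ h2
    nlinarith
  have hqpow : ∀ n : ℕ, q ^ n = c ^ (jj * n) := fun n => by
    rw [zpow_mul, hjj, zpow_natCast]
  have hsys : RelSys (coneGraph Γ (axisFam c y)) δ₁ A d x₀ p L 3 (fun _ : Unit => a)
      (fun _ i => q ^ expo N L i) := by
    refine ⟨fun _ i => ?_, fun _ i => ?_, fun α i => ?_, fun α i => ?_, fun α i g _ => ?_,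
      fun α β j k h => ?_, fun α β j k τ μ hτ hμ _ h => ?_⟩
    · exact pow_mem (show q ∈ MulAction.stabilizer Q x₀ from hq0) _
    · simp [expo]
    · rw [letter, hqpow, mul_smul]
      have := hexpo i
      rcases hlink α (i - 1) with h | h <;> rcases hlink α i with h' | h' <;> rw [h, h']
      · exact hN₁ _ (by omega)
      · exact hN₂ _ (by omega)
      · exact hN₃ _ (by omega)
      · exact hN₄ _ (by omega)
    · rcases hlink α i with h' | h' <;> rw [h'] <;> omega
    · right; right
      have hg : g • x₀ = .inr (g • QuotientGroup.mk 1) := by rw [hx₀]; rfl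
      rcases hlink α i with h' | h' <;> rw [h', hg]
      · exact (hA₁ _).mono (by omega)
      · exact (hA₂ _).mono (by omega)
    · refine ⟨rfl, ?_⟩
      have := (h 0 (by omega)).2.2
      simp only [Nat.cast_zero, add_zero] at this
      rw [hqpow, hqpow] at this
      have := mul_left_cancel₀ hjj0 (hinj _ _ this)
      exact expo_inj (N := N) (by omega) (by omega) (by exact_mod_cast this)
    · obtain ⟨s, rfl⟩ := Subgroup.mem_zpowers_iff.1 ((hst τ).1 hτ)
      obtain ⟨t, rfl⟩ := Subgroup.mem_zpowers_iff.1 ((hst μ).1 hμ)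
      have key : ∀ i : ℕ, i < 3 →
          jj * ((expo N L (j + i + 1) : ℤ) + expo N L (k - i)) = t - s := by
        intro i hi
        have := (h i hi).2.2
        rw [hqpow, hqpow, ← zpow_neg, ← zpow_add, ← zpow_add] at this
        have := hinj _ _ this
        linarith
      have h0 := key 0 (by omega)
      have h1 := key 1 (by omega)
      have h2 := key 2 (by omega)
      have h01 := mul_left_cancel₀ hjj0 (h0.trans h1.symm)
      have h02 := mul_left_cancel₀ hjj0 (h0.trans h2.symm)
      push_cast at h01 h02
      rw [show j + 1 + 1 = j + 2 by ring, add_zero, sub_zero] at h01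
      rw [show j + 2 + 1 = j + 3 by ring, add_zero, sub_zero] at h02
      exact expo_rev (N := N) (L := L) (j := j) (k := k) (by omega) (by omega)
        (fun i hi => ⟨(h i hi).1, (h i hi).2.1⟩) (by exact_mod_cast h01) (by exact_mod_cast h02)
  obtain ⟨Q', _, V', _, Γ', ψ, π, hT', hS', hrel⟩ := hsys.exists_quotient hT₁ hs₁ (by omega)
  refine ⟨Q', _, V', _, Γ', _, _, hT', hS₁.trans hS', .inr ?_⟩
  have hpos : ∀ n : ℕ, n < L → pos (letter L p (fun _ : Unit => a) (fun _ i => q ^ expo N L i) ())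
    n ∈ K := by
    intro n
    induction n with
    | zero => intro _; rw [Nat.cast_zero, pos_zero]; exact one_mem _
    | succ n ih =>
      intro hn
      refine mul_mem (ih (by omega)) (mul_mem (pow_mem hq _) ?_)
      rw [link, if_neg]
      · exact hp
      · intro hdvd
        have := Int.le_of_dvd (by omega) hdvd
        omega
  have hr := hrel ()
  rw [RelSys.rel, show (L : ℤ) = ((L - 1 : ℕ) : ℤ) + 1 by omega, pos_succ, letter, link, if_pos (by
    rw [show ((L - 1 : ℕ) : ℤ) + 1 = L by omega]), ← mul_assoc, ← mul_assoc, map_mul,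
      mul_eq_one_iff_inv_eq] at hr
  change ψ a ∈ _
  rw [← hr]
  exact inv_mem ⟨_, mul_mem (mul_mem (hpos (L - 1) (by omega)) (pow_mem hq _)) hp, rfl⟩

theorem Tame.exists_elliptic {Q V : Type} [Group Q] [MulAction Q V] {Γ : SimpleGraph V}
    (hT : Tame Q Γ) (u : Q) :
    ∃ (V' : Type) (_ : MulAction Q V') (Γ' : SimpleGraph V') (π : V → V'), Tame Q Γ' ∧
      Step Γ Γ' (MonoidHom.id Q) π ∧ ∃ x : V', u • x = x := by
  by_cases hK : ∃ x : V, ∀ k ∈ Subgroup.zpowers u, k • x = x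
  · obtain ⟨x, hx⟩ := hK
    exact ⟨V, _, Γ, _, hT, Step.refl Γ, x, hx u (Subgroup.mem_zpowers u)⟩
  obtain ⟨q, hq, y, C, hax⟩ := hT.exists_qax _ hK
  obtain ⟨c, C', hqc, hAx⟩ := hax.exists_axis hT
  obtain ⟨σ, hF⟩ := hAx.coneFam hT
  refine ⟨_, _, _, _, hF.tame hT, step_cone Γ (axisFam c y) (isCyclic_stabilizer_quotient c),
    .inr (QuotientGroup.mk 1), (smul_base_iff c u).2 ?_⟩
  obtain ⟨j, rfl⟩ := Subgroup.mem_zpowers_iff.1 hqc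
  obtain ⟨k, hk⟩ := Subgroup.mem_zpowers_iff.1 hq
  refine hAx.closed u j j ?_ ?_
  · rintro rfl
    exact hax.ne_one (zpow_zero c)
  · rw [← hk, mul_inv_eq_iff_eq_mul]
    exact (Commute.self_zpow u k).eq

/-- One step of the construction: `u` becomes elliptic, and then either `u` and `v` have a common
fixed vertex or they generate a subgroup containing `a`. -/
theorem Tame.exists_next_stage {Q V : Type} [Group Q] [MulAction Q V] {Γ : SimpleGraph V}
    (hT : Tame Q Γ) (u v a : Q) :
    ∃ (Q' : Type) (_ : Group Q') (V' : Type) (_ : MulAction Q' V')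
      (Γ' : SimpleGraph V') (ψ : Q →* Q') (π : V → V'), Tame Q' Γ' ∧ Step Γ Γ' ψ π ∧
      (∃ x : V', ψ u • x = x) ∧
      ((∃ x : V', ψ u • x = x ∧ ψ v • x = x) ∨ ψ a ∈ Subgroup.closure {ψ u, ψ v}) := by
  obtain ⟨V₁, _, Γ₁, π₁, hT₁, hS₁, x, hx⟩ := hT.exists_elliptic u
  obtain ⟨Q', _, V', _, Γ', ψ, π, hT', hS', h⟩ := hT₁.exists_step (Subgroup.closure {u, v}) a
  refine ⟨Q', _, V', _, Γ', _, _, hT', hS₁.trans hS', ⟨π x, ?_⟩, ?_⟩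
  · change ψ u • π x = π x
    rw [← hS'.equiv, hx]
  · rcases h with ⟨x, hx⟩ | h
    · exact .inl ⟨x, hx u (Subgroup.subset_closure (by simp)),
        hx v (Subgroup.subset_closure (by simp))⟩
    · rw [MonoidHom.map_closure, Set.image_pair] at h
      exact .inr h

section

variable {V Q : Type*} [Group Q] [MulAction Q V] {Γ : SimpleGraph V}

/-- Distinct neighbours of a vertex are separated by it. -/
def Arboreal (Γ : SimpleGraph V) : Prop :=
  ∀ (v e e' : V) (n : ℕ), Γ.Adj v e → Γ.Adj v e' → Av Γ v n e e' → e = e'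

theorem Arboreal.slim (h : Arboreal Γ) (hc : Γ.Connected) : Slim Γ 0 := by
  intro x y z p hp
  refine ⟨p, ?_, by simp⟩
  by_contra hcon
  push Not at hcon
  have hx : x ≠ p := by rintro rfl; exact hcon.1 btw_left
  have hy : y ≠ p := by rintro rfl; exact hcon.2 btw_right
  obtain ⟨e, he⟩ := exists_next hc hx.symm
  obtain ⟨e', he'⟩ := exists_next hc hy.symm
  have key : ∀ {w f : V}, f ∈ Lk Γ p w → Av Γ p (Γ.dist f w) f w := by
    intro w f hf
    refine (btw_or_av hc f p w).resolve_left fun hb => ?_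
    have := hf.2
    unfold Btw at hb
    omega
  have hav := (((key he).trans ((btw_or_av hc x p z).resolve_left hcon.1)).trans
    ((btw_or_av hc z p y).resolve_left hcon.2)).trans (key he').symm
  obtain rfl := h p e e' _ he.1 he'.1 hav
  have h1 := he.2
  have h2 := he'.2
  have h3 := hc.triangle x e y
  grind [SimpleGraph.dist_swap, Btw]

theorem Arboreal.tame (h : Arboreal Γ) (hc : Γ.Connected) (hQ : ActsOn Q Γ)
    (hfree : ∀ (g : Q) (x y : V), Γ.Adj x y → g • x = x → g • y = y → g = 1)
    (hrank : ∃ (D : Q → ℤ) (d : V → ℤ), (∀ g x, d (g • x) = D g + d x) ∧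
      ∀ x y, Γ.Adj x y → d y - d x = 1 ∨ d y - d x = -1)
    (htf : ∀ (g : Q) (x : V), g • x = x → g ≠ 1 → ¬ IsOfFinOrder g) : Tame Q Γ := by
  have hs := h.slim hc
  have huniq : ∀ {x y p q : V}, Btw Γ x p y → Btw Γ x q y → Γ.dist x p = Γ.dist x q → p = q := by
    intro x y p q hp hq hpq
    have := hs.fellow hc hp hq (k := 0) (by omega) (by omega)
    exact hc.dist_eq_zero_iff.1 (by omega)
  have hdisj : ∀ (g : Q) (x y : V), g • x = x → g • y = y → x ≠ y → g = 1 := by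
    intro g x y hx hy hne
    obtain ⟨e, he⟩ := exists_next hc hne
    have he' := hQ.mem_lk_smul hc g he
    rw [hx, hy] at he'
    exact hfree g x e he.1 hx (h x _ _ _ he'.1 he.1 (lk_av hc hs he' he))
  have hthree : ∀ {x y z p : V}, Btw Γ x p y → Btw Γ x p z ∨ Btw Γ z p y := by
    intro x y z p hp
    obtain ⟨q, hq, hd⟩ := hs x y z p hp
    obtain rfl := hc.dist_eq_zero_iff.1 (Nat.le_zero.1 hd)
    exact hq
  refine ⟨hc, hQ, ⟨0, hs⟩, fun ε => ⟨2 * ε + 3, (2 * ε + 3) * (2 * ε + 3), fun x y hr => ?_⟩,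
    fun K x b hb => ?_, hdisj, htf⟩
  · obtain ⟨p, hp, hpd⟩ := exists_point hc x y (i := ε + 1) (by omega)
    obtain ⟨p', hp', hpd'⟩ := exists_point hc x y (i := ε + 2) (by omega)
    have hne : p ≠ p' := by rintro rfl; omega
    have hmid : ∀ {r : V}, Btw Γ x r y → ε < Γ.dist x r → ε < Γ.dist r y → ∀ {g : Q},
        Γ.dist x (g • x) ≤ ε → Γ.dist y (g • y) ≤ ε →
        Btw Γ x (g • r) y ∧ Γ.dist x (g • r) ≤ Γ.dist x r + ε := by
      intro r hr h1 h2 g hgx hgy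
      have e1 := hQ.dist_smul hc g x r
      have e2 := hQ.dist_smul hc g r y
      have c1 := Γ.dist_swap (g • x) x
      have t1 := hc.triangle x (g • x) (g • r)
      refine ⟨?_, by omega⟩
      rcases hthree (z := x) ((hQ.btw_smul hc g).2 hr) with h | h
      · unfold Btw at h; omega
      rcases hthree (z := y) h with h | h
      · exact h
      · unfold Btw at h; omega
    have hinj : Set.InjOn (fun g : Q => (Γ.dist x (g • p), Γ.dist x (g • p')))
        {g : Q | Γ.dist x (g • x) ≤ ε ∧ Γ.dist y (g • y) ≤ ε} := by
      intro g hg g' hg' he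
      simp only [Prod.mk.injEq] at he
      have d1 : ε < Γ.dist p y := by unfold Btw at hp; omega
      have d2 : ε < Γ.dist p' y := by unfold Btw at hp'; omega
      have h1 := huniq (hmid hp (by omega) d1 hg.1 hg.2).1 (hmid hp (by omega) d1 hg'.1 hg'.2).1
        he.1
      have h2 := huniq (hmid hp' (by omega) d2 hg.1 hg.2).1
        (hmid hp' (by omega) d2 hg'.1 hg'.2).1 he.2
      have := hdisj (g'⁻¹ * g) p p' (by rw [mul_smul, h1, inv_smul_smul])
        (by rw [mul_smul, h2, inv_smul_smul]) hne
      exact (inv_mul_eq_one.1 this).symm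
    have hmaps : Set.MapsTo (fun g : Q => (Γ.dist x (g • p), Γ.dist x (g • p')))
        {g : Q | Γ.dist x (g • x) ≤ ε ∧ Γ.dist y (g • y) ≤ ε}
        ((Finset.range (2 * ε + 3) ×ˢ Finset.range (2 * ε + 3) : Finset (ℕ × ℕ)) : Set
          (ℕ × ℕ)) := by
      intro g hg
      have d1 : ε < Γ.dist p y := by unfold Btw at hp; omega
      have d2 : ε < Γ.dist p' y := by unfold Btw at hp'; omega
      have h1 := (hmid hp (by omega) d1 hg.1 hg.2).2
      have h2 := (hmid hp' (by omega) d2 hg.1 hg.2).2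
      simp only [Finset.coe_product, Set.mem_prod, Finset.coe_range, Set.mem_Iio]
      omega
    have := Set.encard_le_encard_of_injOn hmaps hinj
    rwa [Set.encard_coe_eq_coe_finsetCard, Finset.card_product, Finset.card_range] at this
  · obtain ⟨D, d, hd, hadj⟩ := hrank
    have hex : ∃ r, ∃ z : V, ∀ k ∈ K, Γ.dist z (k • x) ≤ r := ⟨b, x, hb⟩
    classical
    obtain ⟨z, hz⟩ := Nat.find_spec hex
    have hmin : ∀ r, (∃ z : V, ∀ k ∈ K, Γ.dist z (k • x) ≤ r) → Nat.find hex ≤ r := fun r hr =>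
      Nat.find_min' hex hr
    obtain ⟨r, hr⟩ : ∃ r, r = Nat.find hex := ⟨_, rfl⟩
    rw [← hr] at hz hmin
    have hcen : ∀ k ∈ K, ∀ l ∈ K, Γ.dist (k • z) (l • x) ≤ r := by
      intro k hk l hl
      have := hz (k⁻¹ * l) (mul_mem (inv_mem hk) hl)
      rwa [← hQ.dist_smul hc k, ← mul_smul, mul_inv_cancel_left] at this
    have hclose : ∀ k ∈ K, Γ.dist z (k • z) ≤ 1 := by
      intro k hk
      by_contra hcon
      obtain ⟨p, hp, hpd⟩ := exists_point hc z (k • z) (i := 1) (by omega)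
      have hp2 : 1 ≤ Γ.dist p (k • z) := by unfold Btw at hp; omega
      have hr1 : 1 ≤ r := by
        by_contra h0
        have h1 := hz 1 (one_mem K)
        have h2 := hcen k hk 1 (one_mem K)
        have := hc.triangle z ((1 : Q) • x) (k • z)
        have := Γ.dist_swap (k • z) ((1 : Q) • x)
        omega
      have := hmin (r - 1) ⟨p, fun l hl => ?_⟩
      · omega
      have h1 := hz l hl
      have h2 := hcen k hk l hl
      have c1 := Γ.dist_swap (k • z) (l • x)
      have c2 := Γ.dist_swap p (l • x)
      rcases hthree (z := l • x) hp with h | h <;> unfold Btw at h <;> omega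
    refine ⟨z, fun k hk => ?_⟩
    by_contra hne
    have hone : ∀ w : V, Γ.dist z w ≤ 1 → w = z ∨ d w - d z = 1 ∨ d w - d z = -1 := by
      intro w hw
      rcases Nat.le_one_iff_eq_zero_or_eq_one.1 hw with h | h
      · exact .inl (hc.dist_eq_zero_iff.1 h).symm
      · exact .inr (hadj _ _ (SimpleGraph.dist_eq_one_iff_adj.1 h))
    have e1 := hd k z
    have e2 := hd k (k • z)
    rw [← mul_smul] at e2
    have h1 := (hone _ (hclose k hk)).resolve_left hne
    rcases hone _ (hclose (k * k) (mul_mem hk hk)) with h2 | h2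
    · rw [h2] at e2; omega
    · omega

end

/-- The free product of `H` with an infinite cyclic group. -/
abbrev FreeExt (H : Type*) [Group H] : Type _ := HNNExtension H ⊥ ⊥ (MulEquiv.refl (⊥ : Subgroup H))

namespace FreeExt

open HNNExtension

variable {H : Type*} [Group H]

/-- The embedded copy of `H`. -/
abbrev base (H : Type*) [Group H] : Subgroup (FreeExt H) := (of : H →* FreeExt H).range

/-- A homomorphism out of `FreeExt H`. -/
def lift' {G : Type*} [Group G] (f : H →* G) (x : G) : FreeExt H →* G :=
  lift f x fun a => by
    have : (a : H) = 1 := Subgroup.mem_bot.1 a.2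
    simp [this]

/-- The exponent sum of the stable letter. -/
def deg : FreeExt H →* Multiplicative ℤ := lift' 1 (Multiplicative.ofAdd 1)

theorem deg_of (h : H) : deg (of h : FreeExt H) = 1 := by simp [deg, lift']

theorem deg_t : deg (t : FreeExt H) = Multiplicative.ofAdd 1 := by simp [deg, lift']

theorem deg_base {g : FreeExt H} (hg : g ∈ base H) : deg g = 1 := by
  obtain ⟨h, rfl⟩ := hg
  exact deg_of h

open Classical in
/-- The affine action on functions on the edges whose translation part is the Fox derivative. -/
noncomputable def fox : FreeExt H →* Equiv.Perm (FreeExt H → ℤ) :=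
  lift'
    { toFun := fun h => (Equiv.mulLeft (of h : FreeExt H)).arrowCongr (Equiv.refl ℤ)
      map_one' := by
        ext F k
        change F ((of (1 : H))⁻¹ * k) = F k
        simp
      map_mul' := fun a b => by
        ext F k
        change F ((of (a * b))⁻¹ * k) = F ((of b)⁻¹ * ((of a)⁻¹ * k))
        simp [mul_assoc] }
    (((Equiv.mulLeft (t : FreeExt H)).arrowCongr (Equiv.refl ℤ)).trans
      (Equiv.addRight (Pi.single 1 1)))

theorem fox_of (h : H) (F : FreeExt H → ℤ) (k : FreeExt H) :
    fox (of h) F k = F ((of h)⁻¹ * k) := by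
  simp [fox, lift']

open Classical in
theorem fox_t (F : FreeExt H → ℤ) (k : FreeExt H) :
    fox (t : FreeExt H) F k = F (t⁻¹ * k) + (Pi.single 1 1 : FreeExt H → ℤ) k := by
  simp [fox, lift']

theorem fox_sub (g : FreeExt H) : ∀ (F F' : FreeExt H → ℤ) (k : FreeExt H),
    fox g F k - fox g F' k = F (g⁻¹ * k) - F' (g⁻¹ * k) := by
  induction g using HNNExtension.induction_on with
  | of h => intro F F' k; rw [fox_of, fox_of]
  | t => intro F F' k; rw [fox_t, fox_t]; ring
  | mul x y hx hy =>
    intro F F' k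
    rw [map_mul, Equiv.Perm.mul_apply, Equiv.Perm.mul_apply, hx, hy, mul_inv_rev, mul_assoc]
  | inv x hx =>
    intro F F' k
    have := hx (fox x⁻¹ F) (fox x⁻¹ F') (x * k)
    rw [← Equiv.Perm.mul_apply, ← Equiv.Perm.mul_apply, ← map_mul, mul_inv_cancel, map_one,
      inv_mul_cancel_left] at this
    rw [inv_inv]
    exact this.symm

/-- The signed count of the edges on a path from the base vertex. -/
noncomputable def cross (g : FreeExt H) : FreeExt H → ℤ := fox g 0

theorem cross_mul_of (g : FreeExt H) {b : FreeExt H} (hb : b ∈ base H) : cross (g * b) = cross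
    g := by
  obtain ⟨h, rfl⟩ := hb
  unfold cross
  rw [map_mul, Equiv.Perm.mul_apply]
  congr 1

theorem cross_base {b : FreeExt H} (hb : b ∈ base H) : cross b = 0 := by
  have := cross_mul_of 1 hb
  rw [one_mul] at this
  rw [this, cross, map_one]
  rfl

open Classical in
theorem cross_mul_t (g k : FreeExt H) : cross (g * t) k = cross g k + if k = g then 1 else 0 := by
  unfold cross
  rw [map_mul, Equiv.Perm.mul_apply]
  have := fox_sub g (fox t 0) 0 k
  rw [fox_t] at this
  have e : (Pi.single 1 1 : FreeExt H → ℤ) (g⁻¹ * k) = if k = g then 1 else 0 := by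
    rw [Pi.single_apply]
    congr 1
    rw [inv_mul_eq_one]
    exact propext eq_comm
  simp only [Pi.zero_apply] at this
  linarith

/-- The Bass–Serre tree of `FreeExt H`. -/
def tree (H : Type*) [Group H] : SimpleGraph (FreeExt H ⧸ base H) where
  Adj x y := ∃ g : FreeExt H, (x = QuotientGroup.mk g ∧ y = QuotientGroup.mk (g * t)) ∨
    (y = QuotientGroup.mk g ∧ x = QuotientGroup.mk (g * t))
  symm := ⟨fun x y ⟨g, hg⟩ => ⟨g, hg.symm⟩⟩
  loopless := ⟨by
    rintro x ⟨g, hg⟩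
    have : (QuotientGroup.mk g : FreeExt H ⧸ base H) = QuotientGroup.mk (g * t) := by
      rcases hg with ⟨h1, h2⟩ | ⟨h1, h2⟩ <;> exact h1.symm.trans h2
    rw [QuotientGroup.eq, inv_mul_cancel_left] at this
    have := deg_base this
    rw [deg_t] at this
    exact one_ne_zero (Multiplicative.ofAdd.injective this)⟩

local notation "coset" => (QuotientGroup.mk : FreeExt H → FreeExt H ⧸ base H)

theorem tree_acts : ActsOn (FreeExt H) (tree H) := by
  rintro g x y ⟨g', h | h⟩
  · exact ⟨g * g', .inl ⟨by rw [h.1]; rfl, by rw [h.2, mul_assoc]; rfl⟩⟩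
  · exact ⟨g * g', .inr ⟨by rw [h.1]; rfl, by rw [h.2, mul_assoc]; rfl⟩⟩

theorem tree_conn : (tree H).Connected := by
  have key : ∀ g g' : FreeExt H, (tree H).Reachable (coset g') (coset (g' * g)) := by
    intro g
    induction g using HNNExtension.induction_on with
    | of h =>
      intro g'
      have : coset (g' * of h) = coset g' := by
        rw [eq_comm, QuotientGroup.eq, inv_mul_cancel_left]
        exact ⟨h, rfl⟩
      rw [this]
    | t => exact fun g' => SimpleGraph.Adj.reachable ⟨g', .inl ⟨rfl, rfl⟩⟩
    | mul x y hx hy =>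
      intro g'
      rw [← mul_assoc]
      exact (hx g').trans (hy _)
    | inv x hx =>
      intro g'
      have := hx (g' * x⁻¹)
      rw [inv_mul_cancel_right] at this
      exact this.symm
  refine ⟨fun x y => ?_⟩
  obtain ⟨g, rfl⟩ := QuotientGroup.mk_surjective x
  obtain ⟨g', rfl⟩ := QuotientGroup.mk_surjective y
  have := key (g⁻¹ * g') g
  rwa [mul_inv_cancel_left] at this

theorem mk_eq_base {g : FreeExt H} :
    coset g = coset 1 ↔ g ∈ base H := by
  rw [eq_comm, QuotientGroup.eq, inv_one, one_mul]

theorem smul_base {g : FreeExt H} :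
    g • coset 1 = coset 1 ↔ g ∈ base H := by
  rw [← mk_eq_base]
  change coset (g * 1) = _ ↔ _
  rw [mul_one]

/-- `cross` as a function on vertices. -/
noncomputable def vcross (x : FreeExt H ⧸ base H) : FreeExt H → ℤ := cross x.out

theorem vcross_mk (g : FreeExt H) : vcross (coset g) = cross g := by
  obtain ⟨h, hh⟩ := QuotientGroup.mk_out_eq_mul (base H) g
  rw [vcross, hh, cross_mul_of g h.2]

theorem vcross_of_av {x y : FreeExt H ⧸ base H} {n : ℕ} (h : Av (tree H) (coset 1) n x y)
    {k : FreeExt H} (hk : k ∈ base H ∨ k * t ∈ base H) : vcross x k = vcross y k := by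
  induction h with
  | refl => rfl
  | cons n x y z hx ha h ih =>
    rw [← ih]
    have key : ∀ g : FreeExt H, coset g ≠ coset 1 →
        coset (g * t) ≠ coset 1 →
        cross (g * t) k = cross g k := by
      grind [FreeExt.mk_eq_base, FreeExt.cross_mul_t]
    obtain ⟨g, ⟨rfl, rfl⟩ | ⟨rfl, rfl⟩⟩ := ha
    · rw [vcross_mk, vcross_mk, key g hx h.left_ne]
    · rw [vcross_mk, vcross_mk, key g h.left_ne hx]

theorem exists_of_adj_base {e : FreeExt H ⧸ base H} (h : (tree H).Adj (coset 1) e) :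
    ∃ g : FreeExt H, (g ∈ base H ∧ e = coset (g * t)) ∨ (g * t ∈ base H ∧ e = coset g) := by
  obtain ⟨g, ⟨h1, h2⟩ | ⟨h1, h2⟩⟩ := h
  · exact ⟨g, .inl ⟨mk_eq_base.1 h1.symm, h2⟩⟩
  · exact ⟨g, .inr ⟨mk_eq_base.1 h2.symm, h1⟩⟩

theorem tree_arboreal : Arboreal (tree H) := by
  classical
  intro v e e' n he he' hav
  obtain ⟨g, rfl⟩ := QuotientGroup.mk_surjective v
  have hg : coset g = g • coset 1 := by
    change _ = coset (g * 1)
    rw [mul_one]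
  rw [hg] at he he' hav
  have he := tree_acts g⁻¹ _ _ he
  have he' := tree_acts g⁻¹ _ _ he'
  have hav := tree_acts.av_smul g⁻¹ hav
  rw [inv_smul_smul] at he he' hav
  refine MulAction.injective g⁻¹ ?_
  simp only
  generalize g⁻¹ • e = e at *
  generalize g⁻¹ • e' = e' at *
  have hneg : ∀ g : FreeExt H, g * t ∈ base H → ∀ k, cross g k = - if k = g then 1 else 0 := by
    intro g hg k
    have := cross_mul_t g k
    rw [cross_base hg, Pi.zero_apply] at this
    linarith
  have hpos : ∀ g : FreeExt H, g ∈ base H → ∀ k, cross (g * t) k = if k = g then 1 else 0 := by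
    intro g hg k
    rw [cross_mul_t, cross_base hg, Pi.zero_apply, zero_add]
  obtain ⟨a, ⟨ha, rfl⟩ | ⟨ha, rfl⟩⟩ := exists_of_adj_base he <;>
  obtain ⟨b, ⟨hb, rfl⟩ | ⟨hb, rfl⟩⟩ := exists_of_adj_base he'
  · have := vcross_of_av hav (.inl ha)
    rw [vcross_mk, vcross_mk, hpos a ha, hpos b hb, if_pos rfl] at this
    grind
  · have := vcross_of_av hav (.inl ha)
    rw [vcross_mk, vcross_mk, hpos a ha, hneg b hb, if_pos rfl] at this
    split_ifs at this
    all_goals omega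
  · have := vcross_of_av hav (.inr ha)
    rw [vcross_mk, vcross_mk, hneg a ha, hpos b hb, if_pos rfl] at this
    split_ifs at this
  · have := vcross_of_av hav (.inr ha)
    rw [vcross_mk, vcross_mk, hneg a ha, hneg b hb, if_pos rfl] at this
    split_ifs at this with hab
    rw [hab]

end FreeExt

/-- A fixed positive word in `t` and `x`, whose syllables `x` are placed at the squares. -/
def bigWord {G : Type*} [Monoid G] (n : ℕ) (t x : G) : G :=
  ((List.range n).map fun i => (if IsSquare i then x else 1) * t).prod

theorem map_bigWord {G K : Type*} [Monoid G] [Monoid K] (φ : G →* K) (n : ℕ) (t x : G) :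
    φ (bigWord n t x) = bigWord n (φ t) (φ x) := by
  simp only [bigWord, map_list_prod, List.map_map]
  congr 2
  grind

theorem bigWord_succ {G : Type*} [Monoid G] (n : ℕ) (t x : G) :
    bigWord (n + 1) t x = bigWord n t x * ((if IsSquare n then x else 1) * t) := by
  simp [bigWord, List.range_succ]

/-- The number of syllables in the relators which control the colouring. -/
noncomputable def baseWidth : ℕ := 50 * (bigAngle (coneSlim 0 1) + 1)

/-- A window of length `4 * m + 4` inside `[0, m ^ 2)` is determined by the squares it contains. -/
theorem eq_of_square_window {m r s : ℕ} (hr : r < m ^ 2)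
    (h : ∀ i < 4 * m + 4, (IsSquare (r + i) ↔ IsSquare (s + i))) : r = s := by
  classical
  have hex : ∃ k, r ≤ k * k := ⟨r, Nat.le_mul_self r⟩
  obtain ⟨k, hk, hmin⟩ : ∃ k, r ≤ k * k ∧ ∀ j < k, j * j < r :=
    ⟨Nat.find hex, Nat.find_spec hex, fun j hj => not_le.1 (Nat.find_min hex hj)⟩
  have hkm : k ≤ m := by
    grind
  have hk1 : k * k ≤ r + 2 * m := by
    rcases Nat.eq_zero_or_pos k with rfl | hpos
    · omega
    · obtain ⟨j, rfl⟩ : ∃ j, k = j + 1 := ⟨k - 1, by omega⟩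
      have := hmin j (by omega)
      nlinarith
  obtain ⟨i, hi⟩ : ∃ i, r + i = k * k := ⟨k * k - r, by omega⟩
  have e1 : r + (i + (2 * k + 1)) = (k + 1) * (k + 1) := by linarith
  obtain ⟨u, hu⟩ := (h i (by omega)).1 ⟨k, hi⟩
  obtain ⟨w, hw⟩ := (h (i + (2 * k + 1)) (by omega)).1 ⟨k + 1, e1⟩
  have huw : u < w := by
    by_contra hcon
    have : w * w ≤ u * u := Nat.mul_self_le_mul_self (by omega)
    omega
  have hw1 : w = u + 1 := by
    by_contra hcon
    have h1 : (u + 1) * (u + 1) < w * w := Nat.mul_self_lt_mul_self (by omega)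
    have h2 : (u + 1) * (u + 1) = u * u + (2 * u + 1) := by ring
    obtain ⟨c, hc⟩ := (h (i + (2 * u + 1)) (by omega)).2 ⟨u + 1, by omega⟩
    have h3 : k < c := by
      by_contra hcon
      have : c * c ≤ k * k := Nat.mul_self_le_mul_self (by omega)
      omega
    have h4 : c < k + 1 := by
      by_contra hcon
      have : (k + 1) * (k + 1) ≤ c * c := Nat.mul_self_le_mul_self (by omega)
      omega
    omega
  grind

theorem emod_window {L j : ℤ} (hL : 0 < L) : ∀ {n : ℕ}, (∀ i : ℕ, i < n → ¬ L ∣ j + i + 1) →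
    (j + n) % L = j % L + n
  | 0, _ => by simp
  | n + 1, h => by
    have ih := emod_window hL fun i hi => h i (Nat.lt_succ_of_lt hi)
    have := emod_succ hL (h n (Nat.lt_succ_self n))
    push_cast
    rw [← add_assoc, this, ih, add_assoc]

namespace FreeExt

open HNNExtension

variable {H : Type*} [Group H]

local notation "coset" => (QuotientGroup.mk : FreeExt H → FreeExt H ⧸ base H)

theorem exists_smul_base (x : FreeExt H ⧸ base H) : ∃ g : FreeExt H, x = g • coset 1 := by
  obtain ⟨g, rfl⟩ := QuotientGroup.mk_surjective x
  refine ⟨g, ?_⟩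
  change _ = coset (g * 1)
  rw [mul_one]

theorem smul_base_eq (g : FreeExt H) :
    g • coset 1 = coset g := by
  change coset (g * 1) = _
  rw [mul_one]

/-- The height function on the tree. -/
noncomputable def height (x : FreeExt H ⧸ base H) : ℤ := (deg x.out).toAdd

theorem height_mk (g : FreeExt H) :
    height (coset g) = (deg g).toAdd := by
  obtain ⟨h, hh⟩ := QuotientGroup.mk_out_eq_mul (base H) g
  rw [height, hh, map_mul, deg_base h.2, mul_one]

theorem of_inj : Function.Injective (of : H →* FreeExt H) := of_injective _

theorem adj_base_t : (tree H).Adj (coset 1) ((t : FreeExt H) • coset 1) :=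
  ⟨1, .inl ⟨rfl, by rw [smul_base_eq, one_mul]⟩⟩

theorem tame (htf : ∀ h : H, h ≠ 1 → ¬ IsOfFinOrder h) : Tame (FreeExt H) (tree H) := by
  refine tree_arboreal.tame tree_conn tree_acts ?_ ⟨fun g => (deg g).toAdd, height, ?_, ?_⟩ ?_
  · classical
    have key : ∀ g k : FreeExt H, g • coset k = coset k →
        g • coset (k * t) = coset (k * t) → g = 1 := by
      intro g k h1 h2
      have h1 : coset (g * k) = coset k := h1
      have h2 : coset (g * (k * t)) = coset (k * t) := h2
      have e1 := congrArg (fun x => vcross x k) h1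
      have e2 := congrArg (fun x => vcross x k) h2
      simp only [vcross_mk] at e1 e2
      rw [← mul_assoc, cross_mul_t, cross_mul_t, e1, if_pos rfl] at e2
      split_ifs at e2 with hk
      · exact mul_eq_right.1 hk.symm
      · omega
    rintro g x y ⟨k, ⟨rfl, rfl⟩ | ⟨rfl, rfl⟩⟩ hx hy
    · exact key g k hx hy
    · exact key g k hy hx
  · intro g x
    obtain ⟨k, rfl⟩ := QuotientGroup.mk_surjective x
    change height (coset (g * k)) = _
    rw [height_mk, height_mk, map_mul]
    rfl
  · rintro x y ⟨k, ⟨rfl, rfl⟩ | ⟨rfl, rfl⟩⟩ <;>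
    · rw [height_mk, height_mk, map_mul, deg_t, toAdd_mul, toAdd_ofAdd]
      omega
  · intro g x hx h1 hfin
    obtain ⟨k, rfl⟩ := exists_smul_base x
    have hb : k⁻¹ * g * k ∈ base H := by
      rw [← smul_base, mul_smul, mul_smul, hx, inv_smul_smul]
    obtain ⟨h, hh⟩ := hb
    have hh1 : h ≠ 1 := by
      rintro rfl
      rw [map_one] at hh
      apply h1
      have : g = k * (k⁻¹ * g * k) * k⁻¹ := by group
      rw [this, ← hh]
      group
    refine htf h hh1 ?_
    rw [← of_inj.isOfFinOrder_iff (f := (of : H →* FreeExt H)), hh]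
    obtain ⟨n, hn, hgn⟩ := isOfFinOrder_iff_pow_eq_one.1 hfin
    refine isOfFinOrder_iff_pow_eq_one.2 ⟨n, hn, ?_⟩
    have := conj_pow (a := k⁻¹) (b := g) (i := n)
    rw [inv_inv] at this
    rw [this, hgn]
    group

theorem ang_base {x y : FreeExt H ⧸ base H} {n : ℕ}
    (hx : (tree H).Adj (coset 1) x) (hy : (tree H).Adj (coset 1) y)
    (h : Ang (tree H) (coset 1) n x y) : x = y := by
  have key : ∀ {z : FreeExt H ⧸ base H}, (tree H).Adj (coset 1) z →
      z ∈ Lk (tree H) (coset 1) z := by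
    intro z hz
    refine ⟨hz, ?_⟩
    rw [SimpleGraph.dist_self, hz.dist_eq_one]
  exact tree_arboreal _ _ _ n hx hy (h x (.inl (key hx)) y (.inr (key hy)))

theorem relSys (f : H → H) : RelSys (tree H) 0 0 1 (coset 1) (t : FreeExt H)
    (baseWidth ^ 2) (4 * baseWidth + 4) (fun h : {h : H // h ≠ 1} => of (f h)⁻¹)
    (fun h i => if IsSquare (i % (baseWidth ^ 2 : ℕ)).toNat then of h.1 else 1) := by
  have hm : 0 < baseWidth := by unfold baseWidth; positivity
  have hL : (0 : ℤ) < (baseWidth ^ 2 : ℕ) := by positivity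
  generalize baseWidth = m at *
  have hlink : ∀ (h : {h : H // h ≠ 1}) (i : ℤ),
      ∃ b ∈ base H, link (m ^ 2) (t : FreeExt H) (fun h : {h : H // h ≠ 1} => of (f h)⁻¹) h
        i = t * b := by
    intro h i
    unfold link
    split_ifs
    · exact ⟨_, ⟨_, rfl⟩, rfl⟩
    · exact ⟨1, one_mem _, (mul_one _).symm⟩
  have hlab : ∀ (h : {h : H // h ≠ 1}) (i : ℤ),
      (if IsSquare (i % (m ^ 2 : ℕ)).toNat then of h.1 else 1 : FreeExt H) ∈ base H := by
    intro h i
    split_ifs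
    exacts [⟨_, rfl⟩, one_mem _]
  have hlinks : ∀ (h : {h : H // h ≠ 1}) (i : ℤ),
      link (m ^ 2) (t : FreeExt H) (fun h : {h : H // h ≠ 1} => of (f h)⁻¹) h i •
        coset 1 = (t : FreeExt H) • coset 1 := by
    intro h i
    obtain ⟨b, hb, e⟩ := hlink h i
    rw [e, mul_smul, smul_base.2 hb]
  refine ⟨?_, ?_, ?_, ?_, ?_, ?_, ?_⟩
  · exact fun h i => smul_base.2 (hlab h i)
  · intro h i
    simp only [Int.add_emod_right]
  · intro h i hang
    obtain ⟨b, hb, e⟩ := hlink h (i - 1)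
    have h1 : (tree H).Adj (coset 1)
        ((link (m ^ 2) (t : FreeExt H) (fun h : {h : H // h ≠ 1} => of (f h)⁻¹) h (i - 1))⁻¹ •
          (coset 1)) := by
      have := tree_acts (link (m ^ 2) (t : FreeExt H)
        (fun h : {h : H // h ≠ 1} => of (f h)⁻¹) h (i - 1))⁻¹ _ _ (adj_base_t (H := H))
      rw [← hlinks h (i - 1), inv_smul_smul] at this
      exact this.symm
    have h2 : (tree H).Adj (coset 1)
        (letter (m ^ 2) (t : FreeExt H) (fun h : {h : H // h ≠ 1} => of (f h)⁻¹)
          (fun h i => if IsSquare (i % (m ^ 2 : ℕ)).toNat then of h.1 else 1) h i •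
          (coset 1)) := by
      have := tree_acts (if IsSquare (i % (m ^ 2 : ℕ)).toNat then of h.1 else 1 : FreeExt H) _ _
        (adj_base_t (H := H))
      rwa [smul_base.2 (hlab h i), ← hlinks h i, ← mul_smul] at this
    have := congrArg height (ang_base h1 h2 hang)
    rw [letter, mul_smul, hlinks, ← mul_smul, e, smul_base_eq, smul_base_eq, height_mk, height_mk,
      map_mul, map_inv, map_mul, deg_base hb, deg_base (hlab h i), deg_t, toAdd_mul, toAdd_inv,
      toAdd_mul, toAdd_one, toAdd_ofAdd] at this
    omega
  · intro h i
    rw [hlinks, adj_base_t.dist_eq_one]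
  · intro h i g hb
    rw [hlinks] at hb ⊢
    rw [Btw, adj_base_t.dist_eq_one] at hb
    have hc := tree_conn (H := H)
    rcases Nat.eq_zero_or_pos ((tree H).dist (coset 1) (g • coset 1)) with h0 | h0
    · exact .inl (hc.dist_eq_zero_iff.1 h0).symm
    · exact .inr (.inl (hc.dist_eq_zero_iff.1 (by omega)))
  · intro h h' j k hw
    have hj := fun n (hn : n ≤ 4 * m + 4) =>
      emod_window (n := n) hL (fun i hi => (hw i (by omega)).1)
    have hk := fun n (hn : n ≤ 4 * m + 4) =>
      emod_window (n := n) hL (fun i hi => (hw i (by omega)).2.1)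
    have j0 := Int.emod_nonneg j hL.ne'
    have k0 := Int.emod_nonneg k hL.ne'
    obtain ⟨r, hr⟩ := Int.eq_ofNat_of_zero_le j0
    obtain ⟨s, hs⟩ := Int.eq_ofNat_of_zero_le k0
    have hsq : ∀ i < 4 * m + 4, (if IsSquare (r + i) then of h.1 else 1 : FreeExt H) =
        if IsSquare (s + i) then of h'.1 else 1 := by
      intro i hi
      have := (hw i hi).2.2
      rw [hj i hi.le, hk i hi.le, hr, hs] at this
      exact_mod_cast this
    have hne : ∀ h : {h : H // h ≠ 1}, (of h.1 : FreeExt H) ≠ 1 := fun h e =>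
      h.2 (of_inj (e.trans (map_one _).symm))
    have hiff : ∀ i < 4 * m + 4, (IsSquare (r + i) ↔ IsSquare (s + i)) := by
      intro i hi
      have := hsq i hi
      split_ifs at this with h1 h2 h2
      · exact iff_of_true h1 h2
      · exact absurd this (hne h)
      · exact absurd this.symm (hne h')
      · exact iff_of_false h1 h2
    have hrm : r < m ^ 2 := by
      have := Int.emod_lt_of_pos j hL
      rw [hr] at this
      exact_mod_cast this
    have hrs := eq_of_square_window hrm hiff
    subst hrs
    refine ⟨?_, Int.ModEq.dvd (n := (m ^ 2 : ℕ)) (a := k) (b := j) (hs.trans hr.symm)⟩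
    have hex : ∃ i < 4 * m + 4, IsSquare (r + i) := by
      have h2 := Nat.sqrt_le r
      have h3 := Nat.lt_succ_sqrt r
      have h4 : r.sqrt < m := by rw [Nat.sqrt_lt']; exact hrm
      refine ⟨(r.sqrt + 1) * (r.sqrt + 1) - r, ?_, r.sqrt + 1, ?_⟩
      · grind
      · simp only [Nat.succ_eq_add_one] at h3
        omega
    obtain ⟨i, hi, hq⟩ := hex
    grind [FreeExt.of_inj]
  · intro h h' j k τ μ hτ hμ e _
    have := congrArg deg e
    rw [map_mul, map_mul, map_inv, deg_base (smul_base.1 hτ), deg_base (smul_base.1 hμ),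
      deg_t] at this
    have := congrArg Multiplicative.toAdd this
    simp at this

theorem rel_eq (f : H → H) (h : {h : H // h ≠ 1}) :
    RelSys.rel (baseWidth ^ 2) (t : FreeExt H) (fun h : {h : H // h ≠ 1} => of (f h)⁻¹)
      (fun h i => if IsSquare (i % (baseWidth ^ 2 : ℕ)).toNat then of h.1 else 1) h =
    bigWord (baseWidth ^ 2) t (of h.1) * (of (f h))⁻¹ := by
  have hm : 0 < baseWidth := by unfold baseWidth; positivity
  obtain ⟨n, hn⟩ : ∃ n, baseWidth ^ 2 = n + 1 :=
    ⟨baseWidth ^ 2 - 1, (Nat.succ_pred_eq_of_pos (by positivity)).symm⟩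
  rw [hn]
  have hlab : ∀ i : ℕ, i ≤ n → ((i : ℤ) % (n + 1 : ℕ)).toNat = i := by
    intro i hi
    rw [← Int.natCast_mod, Int.toNat_natCast, Nat.mod_eq_of_lt (by omega)]
  have key : ∀ i : ℕ, i ≤ n → pos (letter (n + 1) (t : FreeExt H)
      (fun h : {h : H // h ≠ 1} => of (f h)⁻¹)
      (fun h i => if IsSquare (i % (n + 1 : ℕ)).toNat then of h.1 else 1) h) i =
      bigWord i t (of h.1) := by
    intro i
    induction i with
    | zero => intro _; simp [pos_zero, bigWord]
    | succ i ih =>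
      intro hi
      have hd : ¬ ((n + 1 : ℕ) : ℤ) ∣ (i : ℤ) + 1 := fun hd => by
        have := Int.le_of_dvd (by positivity) hd
        omega
      grind [pos_succ, bigWord_succ, letter, link]
  have hd : ((n + 1 : ℕ) : ℤ) ∣ (n : ℤ) + 1 := dvd_refl _
  have hpos := fun F : ℤ → FreeExt H => pos_succ (f := F) n
  refine (hpos _).trans ?_
  grind [bigWord_succ, letter, link]

end FreeExt

theorem exists_base_stage (H : Type) [Group H] (htf : ∀ h : H, h ≠ 1 → ¬ IsOfFinOrder h)
    (f : H → H) :
    ∃ (Q : Type) (_ : Group Q) (V : Type) (_ : MulAction Q V) (Γ : SimpleGraph V) (φ : H →* Q)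
      (t : Q) (x₀ : V), Tame Q Γ ∧ Function.Injective φ ∧ (∀ g : Q, g • x₀ = x₀ ↔ g ∈ φ.range) ∧
      Γ.Adj x₀ (t • x₀) ∧
      (∀ v : V, (∃ g : Q, v = g • x₀) ∨ IsCyclic (MulAction.stabilizer Q v)) ∧
      Subgroup.closure (insert t (Set.range φ)) = ⊤ ∧
      ∀ h : H, h ≠ 1 → bigWord (baseWidth ^ 2) t (φ h) = φ (f h) := by
  have hT := FreeExt.tame htf
  obtain ⟨Q', _, V', _, Γ', ψ, π, hT', hS, hrel⟩ := (FreeExt.relSys f).exists_quotient hT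
    (FreeExt.tree_arboreal.slim FreeExt.tree_conn) (by
      unfold relLen baseWidth
      nlinarith)
  refine ⟨Q', _, V', _, Γ', ψ.comp HNNExtension.of, ψ HNNExtension.t, π (QuotientGroup.mk 1), hT',
    ?_, ?_,
    ?_, ?_, ?_, ?_⟩
  · rw [injective_iff_map_eq_one]
    intro h hh
    have := hS.inj (QuotientGroup.mk 1) (HNNExtension.of h) (FreeExt.smul_base.2 ⟨h, rfl⟩) hh
    exact FreeExt.of_inj (this.trans (map_one _).symm)
  · intro g
    constructor
    · intro hg
      obtain ⟨g₀, rfl, h0⟩ := hS.stab _ _ hg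
      obtain ⟨h, rfl⟩ := FreeExt.smul_base.1 h0
      exact ⟨h, rfl⟩
    · rintro ⟨h, rfl⟩
      rw [MonoidHom.comp_apply, ← hS.equiv, FreeExt.smul_base.2 ⟨h, rfl⟩]
  · rw [← hS.equiv]
    exact hS.adj _ _ FreeExt.adj_base_t
  · intro v
    rcases hS.rest v with ⟨x, rfl⟩ | h
    · obtain ⟨g, rfl⟩ := FreeExt.exists_smul_base x
      exact .inl ⟨ψ g, hS.equiv _ _⟩
    · exact .inr h
  · rw [eq_top_iff]
    intro g _
    obtain ⟨g, rfl⟩ := hS.surj g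
    induction g using HNNExtension.induction_on with
    | of h => exact Subgroup.subset_closure (.inr ⟨h, rfl⟩)
    | t => exact Subgroup.subset_closure (.inl rfl)
    | mul x y hx hy => rw [map_mul]; exact mul_mem (hx trivial) (hy trivial)
    | inv x hx => rw [map_inv]; exact inv_mem (hx trivial)
  · intro h hh
    have := hrel ⟨h, hh⟩
    rw [FreeExt.rel_eq, map_mul, map_inv, mul_inv_eq_one, map_bigWord] at this
    exact this

section

variable {F : Type} [Group F]

/-- A normal subgroup `N` with a family `𝓟` of subgroups above it which are malnormal and pairwise
disjoint modulo `N`, and which are cyclic modulo `N` or conjugate to `P₀ ⊔ N`. -/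
structure Peripheral (P₀ : Subgroup F) (t : F) (N : Subgroup F) (𝓟 : Set (Subgroup F)) : Prop where
  normal : N.Normal
  le : ∀ P ∈ 𝓟, N ≤ P
  disj : ∀ P ∈ 𝓟, ∀ P' ∈ 𝓟, P ≠ P' → P ⊓ P' ≤ N
  mal : ∀ P ∈ 𝓟, ∀ g ∉ P, ∀ y ∈ P, g⁻¹ * y * g ∈ P → y ∈ N
  tf : ∀ P ∈ 𝓟, ∀ g ∈ P, ∀ n : ℕ, 0 < n → g ^ n ∈ N → g ∈ N
  base : P₀ ⊔ N ∈ 𝓟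
  letter : t ∉ P₀ ⊔ N
  type : ∀ P ∈ 𝓟, (∃ g : F, ∀ y, y ∈ P ↔ g⁻¹ * y * g ∈ P₀ ⊔ N) ∨
    ∃ c : F, P = Subgroup.zpowers c ⊔ N

/-- Compatibility of peripheral structures. -/
structure PLink (N : Subgroup F) (𝓟 : Set (Subgroup F)) (N' : Subgroup F) (𝓟' : Set (Subgroup F)) :
    Prop where
  le : N ≤ N'
  mem : ∀ P ∈ 𝓟, P ⊔ N' ∈ 𝓟'
  inf : ∀ P ∈ 𝓟, P ⊓ N' ≤ N

theorem PLink.trans {N N' N'' : Subgroup F} {𝓟 𝓟' 𝓟'' : Set (Subgroup F)} (h : PLink N 𝓟 N' 𝓟')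
    (h' : PLink N' 𝓟' N'' 𝓟'') : PLink N 𝓟 N'' 𝓟'' := by
  refine ⟨h.le.trans h'.le, fun P hP => ?_, fun P hP y hy => ?_⟩
  · have := h'.mem _ (h.mem P hP)
    rwa [sup_assoc, sup_eq_right.2 h'.le] at this
  · exact h.inf P hP ⟨hy.1, h'.inf _ (h.mem P hP) ⟨Subgroup.mem_sup_left hy.1, hy.2⟩⟩

theorem PLink.refl {N : Subgroup F} {𝓟 : Set (Subgroup F)} (h : ∀ P ∈ 𝓟, N ≤ P) : PLink N 𝓟 N 𝓟 :=
  ⟨le_rfl, fun P hP => by rwa [sup_eq_left.2 (h P hP)], fun _ _ => inf_le_right⟩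

/-- The peripheral structure comes from a tame action. -/
def Realized (P₀ : Subgroup F) (t : F) (N : Subgroup F) (𝓟 : Set (Subgroup F)) : Prop :=
  ∃ (Q : Type) (_ : Group Q) (V : Type) (_ : MulAction Q V) (Γ : SimpleGraph V) (ψ : F →* Q)
    (x₀ : V),
    Tame Q Γ ∧ Function.Surjective ψ ∧ ψ.ker = N ∧
    𝓟 = Set.range (fun x : V => (MulAction.stabilizer Q x).comap ψ) ∧
    (MulAction.stabilizer Q x₀).comap ψ = P₀ ⊔ N ∧ Γ.Adj x₀ (ψ t • x₀) ∧
    ∀ v : V, (∃ g : Q, v = g • x₀) ∨ IsCyclic (MulAction.stabilizer Q v)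

theorem Realized.peripheral {P₀ N : Subgroup F} {t : F} {𝓟 : Set (Subgroup F)}
    (h : Realized P₀ t N 𝓟) : Peripheral P₀ t N 𝓟 := by
  obtain ⟨Q, _, V, _, Γ, ψ, x₀, hT, hψ, rfl, rfl, hbase, hadj, hcyc⟩ := h
  refine ⟨inferInstance, ?_, ?_, ?_, ?_, ⟨x₀, hbase⟩, ?_, ?_⟩
  · rintro _ ⟨x, rfl⟩ g hg
    rw [MonoidHom.mem_ker] at hg
    simp [hg]
  · rintro _ ⟨x, rfl⟩ _ ⟨y, rfl⟩ hne g hg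
    refine hT.disj (ψ g) x y hg.1 hg.2 ?_
    rintro rfl
    exact hne rfl
  · rintro _ ⟨x, rfl⟩ g hg y hy hgy
    simp only [Subgroup.mem_comap, MulAction.mem_stabilizer_iff] at hg hy hgy
    refine hT.disj (ψ y) x (ψ g • x) hy ?_ fun h => hg h.symm
    grind [mul_smul, inv_smul_eq_iff]
  · rintro _ ⟨x, rfl⟩ g hg n hn hgn
    by_contra h1
    refine hT.tf (ψ g) x hg h1 (isOfFinOrder_iff_pow_eq_one.2 ⟨n, hn, ?_⟩)
    rwa [← map_pow]
  · rw [← hbase]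
    exact fun h => hadj.ne (Eq.symm h)
  · rintro _ ⟨x, rfl⟩
    rcases hcyc x with ⟨g, rfl⟩ | hx
    · obtain ⟨g, rfl⟩ := hψ g
      refine .inl ⟨g, fun y => ?_⟩
      grind [Subgroup.mem_comap, MulAction.mem_stabilizer_iff, mul_smul, inv_smul_eq_iff]
    · right
      obtain ⟨⟨c, hc⟩, hgen⟩ := hx.exists_generator
      obtain ⟨c, rfl⟩ := hψ c
      refine ⟨c, le_antisymm ?_ (sup_le ?_ ?_)⟩
      · intro g hg
        obtain ⟨k, hk⟩ := hgen ⟨ψ g, hg⟩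
        have hk : ψ c ^ k = ψ g := congrArg Subtype.val hk
        have : g = c ^ k * ((c ^ k)⁻¹ * g) := by group
        rw [this]
        refine Subgroup.mul_mem_sup ⟨k, rfl⟩ ?_
        grind [MonoidHom.mem_ker, inv_mul_cancel]
      · rw [Subgroup.zpowers_le]
        exact hc
      · intro g hg
        rw [MonoidHom.mem_ker] at hg
        simp [hg]

theorem Realized.exists_next {P₀ N : Subgroup F} {t : F} {𝓟 : Set (Subgroup F)}
    (h : Realized P₀ t N 𝓟) (u v a : F) : ∃ N' 𝓟', Realized P₀ t N' 𝓟' ∧ PLink N 𝓟 N' 𝓟' ∧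
      (∃ P ∈ 𝓟', u ∈ P) ∧ ((∃ P ∈ 𝓟', u ∈ P ∧ v ∈ P) ∨ a ∈ Subgroup.closure {u, v} ⊔ N') := by
  obtain ⟨Q, _, V, _, Γ, ψ, x₀, hT, hψ, rfl, rfl, hbase, hadj, hcyc⟩ := h
  obtain ⟨Q', _, V', _, Γ', χ, π, hT', hS, ⟨x, hx⟩, hgen⟩ := hT.exists_next_stage (ψ u) (ψ v) (ψ a)
  have hker : ψ.ker ≤ (χ.comp ψ).ker := by
    intro g hg
    grind [MonoidHom.mem_ker, MonoidHom.comp_apply]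
  have hstab : ∀ x : V, (MulAction.stabilizer Q' (π x)).comap (χ.comp ψ) =
      (MulAction.stabilizer Q x).comap ψ ⊔ (χ.comp ψ).ker := by
    intro x
    refine le_antisymm ?_ (sup_le ?_ ?_)
    · intro g hg
      obtain ⟨g₀, h0, h1⟩ := hS.stab x _ hg
      obtain ⟨g₀, rfl⟩ := hψ g₀
      have : g = g₀ * (g₀⁻¹ * g) := by group
      rw [this]
      refine Subgroup.mul_mem_sup h1 ?_
      grind [MonoidHom.mem_ker, MonoidHom.comp_apply, inv_mul_cancel]
    · intro g hg
      change χ (ψ g) • π x = π x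
      rw [← hS.equiv, hg]
    · intro g hg
      rw [MonoidHom.mem_ker] at hg
      simp [hg]
  refine ⟨(χ.comp ψ).ker, Set.range fun x : V' => (MulAction.stabilizer Q' x).comap (χ.comp ψ),
    ⟨Q', _, V', _, Γ', χ.comp ψ, π x₀, hT', hS.surj.comp hψ, rfl, rfl, ?_, ?_, ?_⟩, ⟨hker, ?_, ?_⟩,
    ⟨_, ⟨x, rfl⟩, hx⟩, ?_⟩
  · rw [hstab, hbase, sup_assoc, sup_eq_right.2 hker]
  · rw [MonoidHom.comp_apply, ← hS.equiv]
    exact hS.adj _ _ hadj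
  · intro v
    rcases hS.rest v with ⟨x, rfl⟩ | hv
    · rcases hcyc x with ⟨g, rfl⟩ | hx
      · exact .inl ⟨χ g, hS.equiv _ _⟩
      · right
        have : MulAction.stabilizer Q' (π x) = (MulAction.stabilizer Q x).map χ := by
          ext g
          constructor
          · intro hg
            obtain ⟨g₀, h0, h1⟩ := hS.stab x _ hg
            exact ⟨g₀, h1, h0⟩
          · rintro ⟨g₀, h1, rfl⟩
            change χ g₀ • π x = π x
            rw [← hS.equiv, h1]
        rw [this]
        exact isCyclic_of_surjective _ (χ.subgroupMap_surjective _)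
    · exact .inr hv
  · grind
  · rintro _ ⟨x, rfl⟩ g ⟨h1, h2⟩
    exact hS.inj x (ψ g) h1 h2
  · rcases hgen with ⟨y, h1, h2⟩ | h1
    · exact .inl ⟨_, ⟨y, rfl⟩, h1, h2⟩
    · right
      have : Subgroup.closure {χ (ψ u), χ (ψ v)} = (Subgroup.closure {u, v}).map (χ.comp ψ) := by
        rw [MonoidHom.map_closure, Set.image_pair]
        rfl
      rw [this] at h1
      obtain ⟨b, hb, hba⟩ := h1
      have e : a = b * (b⁻¹ * a) := by group
      rw [e]
      refine Subgroup.mul_mem_sup hb ?_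
      grind [MonoidHom.mem_ker, MonoidHom.comp_apply, inv_mul_cancel]

theorem mem_iSup_nat {N : ℕ → Subgroup F} (hN : Monotone N) {g : F} :
    g ∈ ⨆ n, N n ↔ ∃ n, g ∈ N n := Subgroup.mem_iSup_of_directed hN.directed_le

theorem Peripheral.limit {P₀ : Subgroup F} {t : F} {N : ℕ → Subgroup F} {𝓟 : ℕ → Set (Subgroup F)}
    (h : ∀ n, Peripheral P₀ t (N n) (𝓟 n)) (hl : ∀ n, PLink (N n) (𝓟 n) (N (n + 1)) (𝓟 (n + 1))) :
    Peripheral P₀ t (⨆ n, N n) {P | ∃ n, ∃ P' ∈ 𝓟 n, P = P' ⊔ ⨆ n, N n} ∧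
      ∀ n, PLink (N n) (𝓟 n) (⨆ n, N n) {P | ∃ n, ∃ P' ∈ 𝓟 n, P = P' ⊔ ⨆ n, N n} := by
  have hmono : Monotone N := monotone_nat_of_le_succ fun n => (hl n).le
  have hll : ∀ {n m}, n ≤ m → PLink (N n) (𝓟 n) (N m) (𝓟 m) := by
    intro n m hnm
    induction hnm with
    | refl => exact PLink.refl (h n).le
    | step _ ih => exact ih.trans (hl _)
  have hmem : ∀ (P : Subgroup F) (g : F), g ∈ P ⊔ ⨆ n, N n → ∃ n, ∀ m, n ≤ m → g ∈ P ⊔ N m := by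
    intro P g hg
    have hnor : (⨆ n, N n).Normal := by
      refine ⟨fun x hx g => ?_⟩
      rw [mem_iSup_nat hmono] at hx ⊢
      obtain ⟨n, hx⟩ := hx
      exact ⟨n, (h n).normal.conj_mem x hx g⟩
    obtain ⟨p, hp, y, hy, rfl⟩ := Subgroup.mem_sup_of_normal_right.1 hg
    obtain ⟨n, hn⟩ := (mem_iSup_nat hmono).1 hy
    exact ⟨n, fun m hm => Subgroup.mul_mem_sup hp (hmono hm hn)⟩
  have hle : ∀ (P : Subgroup F) n, P ⊔ N n ≤ P ⊔ ⨆ n, N n := fun P n =>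
    sup_le_sup_left (le_iSup N n) P
  refine ⟨⟨?_, ?_, ?_, ?_, ?_, ?_, ?_, ?_⟩, fun n => ⟨le_iSup N n, fun P hP => ⟨n, P, hP, rfl⟩, ?_⟩⟩
  · refine ⟨fun x hx g => ?_⟩
    rw [mem_iSup_nat hmono] at hx ⊢
    obtain ⟨n, hx⟩ := hx
    exact ⟨n, (h n).normal.conj_mem x hx g⟩
  · rintro _ ⟨n, P, hP, rfl⟩
    exact le_sup_right
  · rintro _ ⟨n, P, hP, rfl⟩ _ ⟨n', P', hP', rfl⟩ hne g ⟨h1, h2⟩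
    obtain ⟨k, hk⟩ := hmem _ _ h1
    obtain ⟨k', hk'⟩ := hmem _ _ h2
    obtain ⟨m, hm1, hm2, hm3, hm4⟩ : ∃ m, n ≤ m ∧ n' ≤ m ∧ k ≤ m ∧ k' ≤ m :=
      ⟨n + n' + k + k', by omega, by omega, by omega, by omega⟩
    have e : P ⊔ N m ≠ P' ⊔ N m := by
      intro e
      apply hne
      rw [← sup_eq_right.2 (le_iSup N m), ← sup_assoc, e, sup_assoc]
    exact le_iSup N m ((h m).disj _ ((hll hm1).mem P hP) _ ((hll hm2).mem P' hP') e
      ⟨hk m hm3, hk' m hm4⟩)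
  · rintro _ ⟨n, P, hP, rfl⟩ g hg y hy hgy
    obtain ⟨k, hk⟩ := hmem _ _ hy
    obtain ⟨k', hk'⟩ := hmem _ _ hgy
    obtain ⟨m, hm1, hm3, hm4⟩ : ∃ m, n ≤ m ∧ k ≤ m ∧ k' ≤ m :=
      ⟨n + k + k', by omega, by omega, by omega⟩
    exact le_iSup N m ((h m).mal _ ((hll hm1).mem P hP) g (fun hg' => hg (hle P m hg')) y
      (hk m hm3) (hk' m hm4))
  · rintro _ ⟨n, P, hP, rfl⟩ g hg k hk hgk
    obtain ⟨i, hi⟩ := hmem _ _ hg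
    obtain ⟨j, hj⟩ := (mem_iSup_nat hmono).1 hgk
    obtain ⟨m, hm1, hm3, hm4⟩ : ∃ m, n ≤ m ∧ i ≤ m ∧ j ≤ m :=
      ⟨n + i + j, by omega, by omega, by omega⟩
    exact le_iSup N m ((h m).tf _ ((hll hm1).mem P hP) g (hi m hm3) k hk (hmono hm4 hj))
  · refine ⟨0, _, (h 0).base, ?_⟩
    rw [sup_assoc, sup_eq_right.2 (le_iSup N 0)]
  · intro ht
    obtain ⟨k, hk⟩ := hmem _ _ ht
    exact (h k).letter (hk k le_rfl)
  · rintro _ ⟨n, P, hP, rfl⟩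
    rcases (h n).type P hP with ⟨g, hg⟩ | ⟨c, rfl⟩
    · left
      refine ⟨g, fun y => ⟨fun hy => ?_, fun hy => ?_⟩⟩
      · obtain ⟨k, hk⟩ := hmem _ _ hy
        have := (h (n + k)).normal
        obtain ⟨p, hp, z, hz, rfl⟩ := Subgroup.mem_sup_of_normal_right.1 (hk (n + k) (by omega))
        have e : g⁻¹ * (p * z) * g = (g⁻¹ * p * g) * (g⁻¹ * z * g⁻¹⁻¹) := by group
        rw [e]
        refine mul_mem (hle P₀ n ((hg p).1 hp)) (Subgroup.mem_sup_right (le_iSup N (n + k) ?_))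
        exact this.conj_mem z hz g⁻¹
      · obtain ⟨k, hk⟩ := hmem _ _ hy
        have := (h (n + k)).normal
        obtain ⟨p, hp, z, hz, e⟩ := Subgroup.mem_sup_of_normal_right.1 (hk (n + k) (by omega))
        have e' : y = (g * p * g⁻¹) * (g * z * g⁻¹) := by
          have : y = g * (g⁻¹ * y * g) * g⁻¹ := by group
          rw [this, ← e]
          group
        rw [e']
        refine mul_mem (Subgroup.mem_sup_left ((hg _).2 ?_))
          (Subgroup.mem_sup_right (le_iSup N (n + k) (this.conj_mem z hz g)))
        have : g⁻¹ * (g * p * g⁻¹) * g = p := by group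
        rw [this]
        exact Subgroup.mem_sup_left hp
    · right
      exact ⟨c, by rw [sup_assoc, sup_eq_right.2 (le_iSup N n)]⟩
  · rintro P hP y ⟨h1, h2⟩
    obtain ⟨m, hm⟩ := (mem_iSup_nat hmono).1 h2
    exact (hll (Nat.le_add_right n m)).inf P hP ⟨h1, hmono (Nat.le_add_left m n) hm⟩

theorem Realized.exists_limit [Countable F] {P₀ N : Subgroup F} {t : F} {𝓟 : Set (Subgroup F)}
    (h : Realized P₀ t N 𝓟) : ∃ N' 𝓟', Peripheral P₀ t N' 𝓟' ∧ PLink N 𝓟 N' 𝓟' ∧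
      (∀ u, ∃ P ∈ 𝓟', u ∈ P) ∧
      ∀ u v a, (∃ P ∈ 𝓟', u ∈ P ∧ v ∈ P) ∨ a ∈ Subgroup.closure {u, v} ⊔ N' := by
  obtain ⟨e, he⟩ := exists_surjective_nat (F × F × F)
  let St := {S : Subgroup F × Set (Subgroup F) // Realized P₀ t S.1 S.2}
  have hnext : ∀ (S : St) (n : ℕ), ∃ S' : St, PLink S.1.1 S.1.2 S'.1.1 S'.1.2 ∧
      (∃ P ∈ S'.1.2, (e n).1 ∈ P) ∧ ((∃ P ∈ S'.1.2, (e n).1 ∈ P ∧ (e n).2.1 ∈ P) ∨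
        (e n).2.2 ∈ Subgroup.closure {(e n).1, (e n).2.1} ⊔ S'.1.1) := by
    intro S n
    obtain ⟨N', 𝓟', h1, h2⟩ := S.2.exists_next (e n).1 (e n).2.1 (e n).2.2
    exact ⟨⟨(N', 𝓟'), h1⟩, h2⟩
  choose next hn using hnext
  let S : ℕ → St := fun n => Nat.rec ⟨(N, 𝓟), h⟩ (fun n S => next S n) n
  obtain ⟨h1, h2⟩ := Peripheral.limit (N := fun n => (S n).1.1) (𝓟 := fun n => (S n).1.2)
    (fun n => (S n).2.peripheral) (fun n => (hn (S n) n).1)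
  refine ⟨_, _, h1, h2 0, fun u => ?_, fun u v a => ?_⟩
  · obtain ⟨n, hu⟩ := he (u, 1, 1)
    obtain ⟨P, hP, hm⟩ := (hn (S n) n).2.1
    rw [hu] at hm
    exact ⟨_, ⟨n + 1, P, hP, rfl⟩, Subgroup.mem_sup_left hm⟩
  · obtain ⟨n, hu⟩ := he (u, v, a)
    rcases (hn (S n) n).2.2 with ⟨P, hP, hm⟩ | hm
    · rw [hu] at hm
      exact .inl ⟨_, ⟨n + 1, P, hP, rfl⟩, Subgroup.mem_sup_left hm.1, Subgroup.mem_sup_left hm.2⟩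
    · rw [hu] at hm
      exact .inr (sup_le_sup_left (le_iSup (fun n => (S n).1.1) (n + 1)) _ hm)

end

/-- The part of the structure of an extension step which only involves groups. -/
structure Extends {H K : Type} [Group H] [Group K] (φ : H →* K) : Prop where
  inj : Function.Injective φ
  mal : Malnormal φ.range
  dich : ∀ g : K, g ≠ 1 → ∃ P : Subgroup K, g ∈ P ∧ Malnormal P ∧
    (IsCyclic P ∨ ∃ x : K, ∀ y, y ∈ P ↔ x⁻¹ * y * x ∈ φ.range) ∧
    ∀ v ∉ P, Subgroup.closure {g, v} = ⊤

theorem exists_extension (H : Type) [Group H] [Countable H]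
    (htf : ∀ h : H, h ≠ 1 → ¬ IsOfFinOrder h) (f : H → H) :
    ∃ (K : Type) (_ : Group K) (φ : H →* K) (t : K), Countable K ∧
      (∀ g : K, g ≠ 1 → ¬ IsOfFinOrder g) ∧ Extends φ ∧ t ∉ φ.range ∧
      ∀ h : H, h ≠ 1 → bigWord (baseWidth ^ 2) t (φ h) = φ (f h) := by
  obtain ⟨F, _, V, _, Γ, φ, t, x₀, hT, hφ, hx₀, hadj, hcyc, hgen, hword⟩ := exists_base_stage H
    htf f
  have hcF : Countable F := by
    have h1 : (insert t (Set.range φ)).Countable := (Set.countable_range φ).insert t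
    have := h1.to_subtype
    have hfree : Countable (FreeGroup ↥(insert t (Set.range φ))) :=
      inferInstanceAs (Countable (Quot _))
    refine Function.Surjective.countable
      (f := FreeGroup.lift ((↑) : ↥(insert t (Set.range φ)) → F)) ?_
    rw [← MonoidHom.range_eq_top, FreeGroup.range_lift_eq_closure, Subtype.range_coe, hgen]
  have hR : Realized φ.range t ⊥
      (Set.range fun x : V => (MulAction.stabilizer F x).comap (MonoidHom.id F)) := by
    refine ⟨F, _, V, _, Γ, MonoidHom.id F, x₀, hT, Function.surjective_id, ?_, rfl, ?_, hadj, hcyc⟩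
    · exact (MonoidHom.ker_eq_bot_iff _).2 Function.injective_id
    · rw [sup_bot_eq, Subgroup.comap_id]
      ext g
      exact hx₀ g
  obtain ⟨N, 𝓟, hP, hL, hell, hdich⟩ := hR.exists_limit
  have hN := hP.normal
  have hmk : ∀ g : F, (g : F ⧸ N) = 1 ↔ g ∈ N := fun g => QuotientGroup.eq_one_iff g
  have hmem : ∀ P : Subgroup F, ∀ g : F, (g : F ⧸ N) ∈ P.map (QuotientGroup.mk' N) ↔ g ∈ P ⊔ N := by
    intro P g
    have := Subgroup.comap_map_eq (QuotientGroup.mk' N) P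
    rw [QuotientGroup.ker_mk'] at this
    rw [← this]
    rfl
  have hrange : ((QuotientGroup.mk' N).comp φ).range = (φ.range).map (QuotientGroup.mk' N) :=
    MonoidHom.range_comp _ _
  have hmal : ∀ P : Subgroup F, P ⊔ N ∈ 𝓟 → Malnormal (P.map (QuotientGroup.mk' N)) := by
    intro P h𝓟 g hg y hy hgy
    obtain ⟨g, rfl⟩ := QuotientGroup.mk_surjective g
    obtain ⟨y, rfl⟩ := QuotientGroup.mk_surjective y
    rw [hmem] at hg hy
    have hgy : ((g⁻¹ * y * g : F) : F ⧸ N) ∈ P.map (QuotientGroup.mk' N) := hgy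
    rw [hmem] at hgy
    exact (hmk y).2 (hP.mal _ h𝓟 g hg y hy hgy)
  refine ⟨F ⧸ N, inferInstance, (QuotientGroup.mk' N).comp φ, (t : F ⧸ N),
    QuotientGroup.mk_surjective.countable, ?_,
    ⟨?_, ?_, ?_⟩, ?_, ?_⟩
  · intro g hg hfin
    obtain ⟨g, rfl⟩ := QuotientGroup.mk_surjective g
    obtain ⟨n, hn, hgn⟩ := isOfFinOrder_iff_pow_eq_one.1 hfin
    obtain ⟨P, hP', hgP⟩ := hell g
    exact hg ((hmk g).2 (hP.tf P hP' g hgP n hn ((hmk _).1 hgn)))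
  · rw [injective_iff_map_eq_one]
    intro h hh
    have h1 : φ h ∈ N := (hmk _).1 hh
    have h2 := hL.inf _ ⟨x₀, rfl⟩ ⟨(hx₀ _).2 ⟨h, rfl⟩, h1⟩
    exact hφ (h2.trans (map_one φ).symm)
  · rw [hrange]
    exact hmal _ hP.base
  · intro g hg
    obtain ⟨g, rfl⟩ := QuotientGroup.mk_surjective g
    obtain ⟨P, hP', hgP⟩ := hell g
    have hPN : P ⊔ N = P := sup_eq_left.2 (hP.le P hP')
    refine ⟨P.map (QuotientGroup.mk' N), ⟨g, hgP, rfl⟩, hmal P (by rwa [hPN]), ?_, ?_⟩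
    · rcases hP.type P hP' with ⟨x, hx⟩ | ⟨c, hc⟩
      · right
        refine ⟨(x : F ⧸ N), fun y => ?_⟩
        obtain ⟨y, rfl⟩ := QuotientGroup.mk_surjective y
        have e : ((x : F ⧸ N)⁻¹ * y * x) = ((x⁻¹ * y * x : F) : F ⧸ N) := rfl
        rw [hrange, e, hmem, hmem, hPN]
        exact hx y
      · left
        rw [hc, Subgroup.map_sup, MonoidHom.map_zpowers]
        have : N.map (QuotientGroup.mk' N) = ⊥ := by
          rw [Subgroup.map_eq_bot_iff, QuotientGroup.ker_mk']
        rw [this, sup_bot_eq]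
        infer_instance
    · intro v hv
      obtain ⟨v, rfl⟩ := QuotientGroup.mk_surjective v
      rw [hmem, hPN] at hv
      rw [eq_top_iff]
      intro a _
      obtain ⟨a, rfl⟩ := QuotientGroup.mk_surjective a
      rcases hdich g v a with ⟨P', hP'', h1, h2⟩ | h1
      · exfalso
        refine hg ((hmk g).2 (hP.disj P hP' P' hP'' ?_ ⟨hgP, h1⟩))
        rintro rfl
        exact hv h2
      · rw [← hmem, MonoidHom.map_closure, Set.image_pair] at h1
        exact h1
  · rw [hrange, hmem]
    exact hP.letter
  · intro h hh
    have := congrArg (QuotientGroup.mk' N) (hword h hh)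
    rw [map_bigWord] at this
    exact this

section Colouring

variable {Ω : Type*} [LinearOrder Ω]

theorem exists_gt_of_countable (hc : ∀ a : Ω, (Set.Iio a).Countable)
    (hu : ¬ (Set.univ : Set Ω).Countable)
    {S : Set Ω} (hS : S.Countable) : ∃ b, ∀ a ∈ S, a < b := by
  by_contra hcon
  push Not at hcon
  refine hu ((hS.biUnion (t := fun a _ => Set.Iic a) fun a _ => ?_).mono fun b _ => ?_)
  · rw [← Set.Iio_insert]
    exact (hc a).insert a
  · obtain ⟨a, ha, hab⟩ := hcon b
    exact Set.mem_biUnion ha hab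

/-- Stationarity, formulated with closure points of functions. -/
def Stat (S : Set Ω) : Prop := ∀ (F : Ω → Ω) (a : Ω), ∃ δ ∈ S, a < δ ∧ ∀ ξ < δ, F ξ < δ

theorem stat_Ioi [WellFoundedLT Ω] (hc : ∀ a : Ω, (Set.Iio a).Countable)
    (hu : ¬ (Set.univ : Set Ω).Countable) (b : Ω) : Stat (Set.Ioi b) := by
  intro F a
  have hnext : ∀ x : Ω, ∃ y, x < y ∧ ∀ ξ ≤ x, F ξ < y := by
    intro x
    have : (insert x (F '' Set.Iic x)).Countable := by
      refine (Set.Countable.image ?_ F).insert x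
      rw [← Set.Iio_insert]
      exact (hc x).insert x
    obtain ⟨y, hy⟩ := exists_gt_of_countable hc hu this
    exact ⟨y, hy x (.inl rfl), fun ξ hξ => hy _ (.inr ⟨ξ, hξ, rfl⟩)⟩
  choose g hg1 hg2 using hnext
  let s : ℕ → Ω := fun n => Nat.rec (max a b) (fun _ x => g x) n
  obtain ⟨δ, hδ, hmin⟩ : ∃ δ, (∀ n, s n < δ) ∧ ∀ x < δ, ∃ n, x ≤ s n := by
    obtain ⟨y, hy⟩ := exists_gt_of_countable hc hu (Set.countable_range s)
    have hne : {x | ∀ n, s n < x}.Nonempty := ⟨y, fun n => hy _ ⟨n, rfl⟩⟩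
    refine ⟨wellFounded_lt.min _ hne, fun n => wellFounded_lt.min_mem _ hne n, fun x hx => ?_⟩
    by_contra hcon
    push Not at hcon
    exact wellFounded_lt.not_lt_min {x | ∀ n, s n < x} hcon hx
  refine ⟨δ, (le_max_right a b).trans_lt (hδ 0), (le_max_left a b).trans_lt (hδ 0), fun ξ hξ => ?_⟩
  obtain ⟨n, hn⟩ := hmin ξ hξ
  exact (hg2 (s n) ξ hn).trans (hδ (n + 1))

theorem Stat.exists_of_iUnion (hc : ∀ a : Ω, (Set.Iio a).Countable)
    (hu : ¬ (Set.univ : Set Ω).Countable) {S : ℕ → Set Ω} (h : Stat (⋃ n, S n)) : ∃ n, Stat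
      (S n) := by
  by_contra hcon
  unfold Stat at hcon
  push Not at hcon
  choose F a hF using hcon
  have hb : ∀ ξ, ∃ y, ∀ n, F n ξ < y := fun ξ => by
    obtain ⟨y, hy⟩ := exists_gt_of_countable hc hu (Set.countable_range fun n => F n ξ)
    exact ⟨y, fun n => hy _ ⟨n, rfl⟩⟩
  choose G hG using hb
  obtain ⟨b, hb⟩ := exists_gt_of_countable hc hu (Set.countable_range a)
  obtain ⟨δ, hδ, hbδ, hcl⟩ := h G b
  obtain ⟨n, hn⟩ := Set.mem_iUnion.1 hδ
  obtain ⟨ξ, h1, h2⟩ := hF n δ hn ((hb _ ⟨n, rfl⟩).trans hbδ)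
  exact absurd ((hG ξ n).trans (hcl ξ h1)) (not_lt.2 h2)

theorem exists_injOn_Iio (hc : ∀ a : Ω, (Set.Iio a).Countable) :
    ∃ e : Ω → Ω → ℕ, ∀ δ, Set.InjOn (e δ) (Set.Iio δ) := by
  choose e he using fun δ => Set.countable_iff_exists_injOn.1 (hc δ)
  exact ⟨e, he⟩

theorem exists_stat_partition [WellFoundedLT Ω] (hc : ∀ a : Ω, (Set.Iio a).Countable)
    (hu : ¬ (Set.univ : Set Ω).Countable) : ∃ h : Ω → ℕ, ∀ n, Stat {δ | h δ = n} := by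
  classical
  obtain ⟨e, he⟩ := exists_injOn_Iio hc
  have h1 : ∀ ξ, ∃ n, Stat {δ | ξ < δ ∧ e δ ξ = n} := by
    intro ξ
    apply Stat.exists_of_iUnion hc hu
    convert stat_Ioi hc hu ξ
    ext δ
    simp
  choose n hn using h1
  obtain ⟨n₀, hn₀⟩ : ∃ n₀, {ξ | n ξ = n₀}.Infinite := by
    by_contra hcon
    push Not at hcon
    refine hu ((Set.countable_iUnion fun k => (Set.Finite.countable (hcon k))).mono fun ξ _ => ?_)
    exact Set.mem_iUnion.2 ⟨n ξ, rfl⟩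
  let x : ℕ → Ω := fun k => (hn₀.natEmbedding _ k : Ω)
  have hx : ∀ k, n (x k) = n₀ := fun k => (hn₀.natEmbedding _ k).2
  have hxi : Function.Injective x := Subtype.val_injective.comp (hn₀.natEmbedding _).injective
  let h : Ω → ℕ := fun δ => if hk : ∃ k, x k < δ ∧ e δ (x k) = n₀ then hk.choose else 0
  refine ⟨h, fun k F a => ?_⟩
  obtain ⟨δ, ⟨h1, h2⟩, h3⟩ := hn (x k) F a
  rw [hx] at h2
  refine ⟨δ, ?_, h3⟩
  have hk : ∃ k, x k < δ ∧ e δ (x k) = n₀ := ⟨k, h1, h2⟩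
  have : h δ = hk.choose := dif_pos hk
  rw [Set.mem_ofPred_eq, this]
  exact hxi (he δ hk.choose_spec.1 h1 (hk.choose_spec.2.trans h2.symm))

variable (e : Ω → Ω → ℕ)

/-- The records of the enumeration `e β` of the predecessors of `β`: a cofinal subset of `β` with
finite initial segments. -/
def ladder (β : Ω) : Set Ω := {ξ | ξ < β ∧ ∀ η < β, e β η < e β ξ → η < ξ}

variable {e}

theorem ladder_finite (he : ∀ δ, Set.InjOn (e δ) (Set.Iio δ)) {α β : Ω} (h : α < β) :
    (ladder e β ∩ Set.Iio α).Finite := by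
  refine Set.Finite.of_finite_image (f := e β) ((Set.finite_Iic (e β α)).subset ?_) ?_
  · rintro _ ⟨ξ, ⟨h1, h2⟩, rfl⟩
    by_contra hcon
    exact lt_asymm (h1.2 α h (not_le.1 hcon)) h2
  · exact (he β).mono fun ξ hξ => hξ.1.1

theorem ladder_cofinal {α β : Ω} (h : α < β) : ∃ ξ ∈ ladder e β, α ≤ ξ := by
  classical
  have hne : ∃ n, ∃ ξ, α ≤ ξ ∧ ξ < β ∧ e β ξ = n := ⟨_, α, le_rfl, h, rfl⟩
  obtain ⟨ξ, h1, h2, h3⟩ := Nat.find_spec hne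
  refine ⟨ξ, ⟨h2, fun η hη hlt => ?_⟩, h1⟩
  grind [Nat.find_min]

theorem exists_bound_of_finite {δ : Ω} (hne : ∃ a, a < δ) (hδ : ∀ ξ < δ, ∃ η, ξ < η ∧ η < δ)
    {S : Set Ω}
    (hS : S.Finite) (hlt : ∀ s ∈ S, s < δ) : ∃ γ < δ, ∀ s ∈ S, s < γ := by
  induction S, hS using Set.Finite.induction_on with
  | empty => exact hne.imp fun a ha => ⟨ha, fun s hs => hs.elim⟩
  | @insert a S _ _ ih =>
    grind

theorem exists_lt_ncard (he : ∀ δ, Set.InjOn (e δ) (Set.Iio δ)) {δ : Ω} (hne : ∃ a, a < δ)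
    (hδ : ∀ ξ < δ, ∃ η, ξ < η ∧ η < δ) (N : ℕ) :
    ∃ γ < δ, ∀ α, γ ≤ α → α < δ → N < (ladder e δ ∩ Set.Iio α).ncard := by
  have hinf : (ladder e δ).Infinite := by
    intro hfin
    obtain ⟨γ, h1, h2⟩ := exists_bound_of_finite hne hδ hfin fun s hs => hs.1
    obtain ⟨ξ, h3, h4⟩ := ladder_cofinal (e := e) h1
    exact absurd (h2 ξ h3) (not_lt.2 h4)
  obtain ⟨S, hS, hfin, hcard⟩ := hinf.exists_subset_ncard_eq (N + 1)
  obtain ⟨γ, h1, h2⟩ := exists_bound_of_finite hne hδ hfin fun s hs => (hS hs).1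
  grind [Set.ncard_le_ncard, ladder_finite]

variable [WellFoundedLT Ω] (e)

open Classical in
/-- The next point on the walk from `β` to `α`. -/
noncomputable def walkNext (α β : Ω) : Ω :=
  if h : (ladder e β ∩ Set.Ici α).Nonempty then wellFounded_lt.min _ h else β

open Classical in
/-- The first point `β` of the walk to `α` with more than `N` points of its ladder below `α`. -/
noncomputable def bracket (α : Ω) (N : ℕ) (β : Ω) : Ω :=
  if α < β ∧ (ladder e β ∩ Set.Iio α).ncard ≤ N then
    (if _h : walkNext e α β < β then bracket α N (walkNext e α β) else β) else β
termination_by wellFounded_lt.wrap β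
decreasing_by exact _h

variable {e}

theorem walkNext_spec {α β : Ω} (h : α < β) : α ≤ walkNext e α β ∧ walkNext e α β < β := by
  have hne : (ladder e β ∩ Set.Ici α).Nonempty := by
    obtain ⟨ξ, h1, h2⟩ := ladder_cofinal h
    exact ⟨ξ, h1, h2⟩
  rw [walkNext, dif_pos hne]
  have := wellFounded_lt.min_mem _ hne
  exact ⟨this.2, this.1.1⟩

theorem bracket_eq (he : ∀ δ, Set.InjOn (e δ) (Set.Iio δ)) {δ : Ω} (hne : ∃ a, a < δ)
    (hδ : ∀ ξ < δ, ∃ η, ξ < η ∧ η < δ) (β : Ω) (hβ : δ ≤ β) :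
    ∃ γ < δ, ∃ n, ∀ α, γ ≤ α → α < δ → ∀ N, n ≤ N → bracket e α N β = bracket e α N δ := by
  induction β using WellFoundedLT.induction with
  | ind β ih =>
    rcases hβ.eq_or_lt with rfl | hlt
    · grind
    obtain ⟨h1, h2⟩ := walkNext_spec (e := e) hlt
    obtain ⟨γ, hγ, n, h⟩ := ih _ h2 h1
    obtain ⟨γ', hγ', h'⟩ := exists_bound_of_finite hne hδ (ladder_finite he hlt) fun s hs => hs.2
    refine ⟨max γ γ', max_lt hγ hγ', max n (ladder e β ∩ Set.Iio δ).ncard, fun α h3 h4 N hN => ?_⟩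
    have e1 : ladder e β ∩ Set.Iio α = ladder e β ∩ Set.Iio δ := by
      grind
    have e2 : ladder e β ∩ Set.Ici α = ladder e β ∩ Set.Ici δ := by
      ext ξ
      refine ⟨fun hξ => ⟨hξ.1, ?_⟩, fun hξ => ⟨hξ.1, h4.le.trans hξ.2⟩⟩
      by_contra hcon
      have : ξ ∈ ladder e β ∩ Set.Iio δ := ⟨hξ.1, not_le.1 hcon⟩
      grind
    grind [walkNext, bracket]

theorem exists_colouring_nat (hc : ∀ a : Ω, (Set.Iio a).Countable)
    (hu : ¬ (Set.univ : Set Ω).Countable) (r : Ω → ℕ → Bool) (hr : Function.Injective r) :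
    ∃ c : Ω → Ω → ℕ, ∀ A : Set Ω, ¬ A.Countable → ∀ n, ∃ α ∈ A, ∃ β ∈ A, α < β ∧ c α β = n := by
  classical
  obtain ⟨h, hh⟩ := exists_stat_partition hc hu
  obtain ⟨e, he⟩ := exists_injOn_Iio hc
  refine ⟨fun α β => h (bracket e α (PiNat.firstDiff (r α) (r β)) β), fun A hA n => ?_⟩
  let cyl : (Σ k : ℕ, Fin k → Bool) → Set Ω := fun s => {α ∈ A | ∀ i : Fin s.1, r α i = s.2 i}
  have hg : ∀ (s : Σ k : ℕ, Fin k → Bool) (ξ : Ω), ∃ α, ¬ (cyl s).Countable → α ∈ cyl s ∧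
    ξ < α := by
    intro s ξ
    by_contra hcon
    push Not at hcon
    refine (hcon ξ).1 (((hc ξ).insert ξ).mono fun α hα => ?_)
    rw [Set.Iio_insert]
    exact (hcon α).2 hα
  choose g hg using hg
  have hF : ∀ ξ, ∃ y, ξ < y ∧ ∀ s, g s ξ < y := by
    intro ξ
    obtain ⟨y, hy⟩ := exists_gt_of_countable hc hu ((Set.countable_range fun s => g s ξ).insert ξ)
    exact ⟨y, hy _ (.inl rfl), fun s => hy _ (.inr ⟨s, rfl⟩)⟩
  choose F hF1 hF2 using hF
  obtain ⟨a₀⟩ : Nonempty Ω := by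
    by_contra hcon
    rw [not_nonempty_iff] at hcon
    exact hu (Set.countable_univ)
  obtain ⟨δ, hδn, ha₀, hδ⟩ := hh n F a₀
  have hδ' : ∀ ξ < δ, ∃ η, ξ < η ∧ η < δ := fun ξ hξ => ⟨F ξ, hF1 ξ, hδ ξ hξ⟩
  let str : Ω → ℕ → (Σ k : ℕ, Fin k → Bool) := fun β N =>
    ⟨N + 1, fun i => if (i : ℕ) < N then r β i else !(r β N)⟩
  have hmemstr : ∀ α β N, α ∈ cyl (str β N) → (∀ i < N, r α i = r β i) ∧ r α N ≠ r β N := by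
    intro α β N hα
    refine ⟨fun i hi => ?_, ?_⟩
    · have := hα.2 ⟨i, by simp only [str]; omega⟩
      simpa [str, hi] using this
    · have := hα.2 ⟨N, by simp [str]⟩
      grind
  obtain ⟨β, hβA, hβδ, hβ⟩ : ∃ β ∈ A, δ < β ∧ ∀ m, ∃ N, m ≤ N ∧ ¬ (cyl (str β N)).Countable := by
    by_contra hcon
    push Not at hcon
    have hbad : ∀ β ∈ A, δ < β → ∃ s : Σ k : ℕ, Fin k → Bool, β ∈ cyl s ∧ (cyl s).Countable := by
      intro β hβ hlt
      obtain ⟨m, hm⟩ := hcon β hβ hlt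
      refine ⟨⟨m, fun i => r β i⟩, ⟨hβ, fun _ => rfl⟩, ?_⟩
      have : (⋃ N, ⋃ _ : m ≤ N, cyl (str β N)).Countable :=
        Set.countable_iUnion fun N => Set.countable_iUnion fun hN => hm N hN
      refine (this.insert β).mono fun α hα => ?_
      by_cases hαβ : α = β
      · exact .inl hαβ
      right
      have hne : r α ≠ r β := fun h => hαβ (hr h)
      have h1 := PiNat.apply_firstDiff_ne hne
      have h2 : m ≤ PiNat.firstDiff (r α) (r β) := by
        by_contra hlt
        exact h1 (hα.2 ⟨_, not_le.1 hlt⟩)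
      refine Set.mem_iUnion.2 ⟨_, Set.mem_iUnion.2 ⟨h2, hα.1, fun i => ?_⟩⟩
      simp only [str]
      split_ifs with hi
      · exact PiNat.apply_eq_of_lt_firstDiff hi
      · have : (i : ℕ) = PiNat.firstDiff (r α) (r β) := by
          have := i.2
          simp only [str] at this
          omega
        rw [this]
        revert h1
        cases r α (PiNat.firstDiff (r α) (r β)) <;> cases r β (PiNat.firstDiff (r α) (r β)) <;> simp
    refine hA (((hc δ).insert δ).union (Set.countable_iUnion
      (fun s : {s : Σ k : ℕ, Fin k → Bool // (cyl s).Countable} => s.2)) |>.mono fun β hβ => ?_)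
    rcases le_or_gt β δ with h1 | h1
    · left
      rwa [Set.Iio_insert]
    · obtain ⟨s, hs, hs'⟩ := hbad β hβ h1
      exact .inr (Set.mem_iUnion.2 ⟨⟨s, hs'⟩, hs⟩)
  obtain ⟨γ, hγ, m, hm⟩ := bracket_eq he ⟨a₀, ha₀⟩ hδ' β hβδ.le
  obtain ⟨N, hmN, hN⟩ := hβ m
  obtain ⟨γ', hγ', hγN⟩ := exists_lt_ncard he ⟨a₀, ha₀⟩ hδ' N
  obtain ⟨h1, h2⟩ := hg _ (max γ γ') hN
  have h3 : g (str β N) (max γ γ') < δ := (hF2 _ _).trans (hδ _ (max_lt hγ hγ'))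
  generalize g (str β N) (max γ γ') = α at *
  refine ⟨α, h1.1, β, hβA, h3.trans hβδ, ?_⟩
  obtain ⟨h4, h5⟩ := hmemstr α β N h1
  have hne : r α ≠ r β := fun h => h5 (congrFun h N)
  have hdiff : PiNat.firstDiff (r α) (r β) = N := by
    refine le_antisymm ?_ ?_
    · by_contra hlt
      exact h5 (PiNat.apply_eq_of_lt_firstDiff (not_le.1 hlt))
    · by_contra hlt
      exact PiNat.apply_firstDiff_ne hne (h4 _ (not_le.1 hlt))
  have hneg : ¬ (α < δ ∧ (ladder e δ ∩ Set.Iio α).ncard ≤ N) := fun hcon =>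
    absurd (hγN α ((le_max_right _ _).trans h2.le) h3) (not_lt.2 hcon.2)
  beta_reduce
  rw [hdiff, hm α ((le_max_left _ _).trans h2.le) h3 N hmN, bracket, if_neg hneg]
  exact hδn

/-- A colouring of pairs such that every uncountable set realizes all colours. -/
theorem exists_colouring (hc : ∀ a : Ω, (Set.Iio a).Countable)
    (hu : ¬ (Set.univ : Set Ω).Countable) (r : Ω → ℕ → Bool) (hr : Function.Injective r) :
    ∃ c : Ω → Ω → Ω × ℕ, ∀ A : Set Ω, ¬ A.Countable → ∀ z, ∃ α ∈ A, ∃ β ∈ A, α < β ∧ c α β = z := by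
  classical
  obtain ⟨c, hcol⟩ := exists_colouring_nat hc hu r hr
  have hX : ∀ β : Ω, ∃ e : Ω × ℕ → ℕ, Set.InjOn e {x | x.1 < β} := by
    intro β
    apply Set.countable_iff_exists_injOn.1
    convert (hc β).prod (Set.countable_univ (α := ℕ))
    ext x
    simp
  choose e he using hX
  obtain ⟨a₀⟩ : Nonempty Ω := by
    by_contra hcon
    rw [not_nonempty_iff] at hcon
    exact hu (Set.countable_univ)
  refine ⟨fun α β => if h : ∃ z : Ω × ℕ, z.1 < β ∧ e β z = c α β then h.choose else (a₀, 0),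
    fun A hA z => ?_⟩
  obtain ⟨n, hn⟩ : ∃ n, ¬ {β ∈ A | z.1 < β ∧ e β z = n}.Countable := by
    by_contra hcon
    push Not at hcon
    refine hA ((((hc z.1).insert z.1).union (Set.countable_iUnion hcon)).mono fun β hβ => ?_)
    rcases le_or_gt β z.1 with h1 | h1
    · left
      rwa [Set.Iio_insert]
    · exact .inr (Set.mem_iUnion.2 ⟨e β z, hβ, h1, rfl⟩)
  obtain ⟨α, hα, β, hβ, hlt, hcn⟩ := hcol _ hn n
  have h : ∃ z : Ω × ℕ, z.1 < β ∧ e β z = c α β := ⟨z, hβ.2.1, hβ.2.2.trans hcn.symm⟩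
  refine ⟨α, hα.1, β, hβ.1, hlt, ?_⟩
  beta_reduce
  rw [dif_pos h]
  exact he β h.choose_spec.1 hβ.2.1 (h.choose_spec.2.trans (hcn.trans hβ.2.2.symm))

end Colouring

section Tower

variable {Ω : Type} [LinearOrder Ω]

/-- The multiplication `m` makes the elements of rank at most `α` a torsion-free group, which is
cyclic for minimal `α`, and otherwise extends the group of elements of smaller rank. -/
def IsStage (f : Ω → Ω × ℕ → Ω × ℕ) (m : Ω × ℕ → Ω × ℕ → Ω × ℕ) (α : Ω) : Prop :=
  ∃ (K : Type) (_ : Group K) (j : K → Ω × ℕ), Function.Injective j ∧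
    (∀ x, (∃ k, j k = x) ↔ x.1 ≤ α) ∧ (∀ a b, m (j a) (j b) = j (a * b)) ∧
    (∀ g : K, g ≠ 1 → ¬ IsOfFinOrder g) ∧ ((∀ β, α ≤ β) → IsCyclic K) ∧
    ((∃ β, β < α) → ∃ (H : Type) (_ : Group H) (φ : H →* K) (t : K),
      (∀ x, (∃ h, j (φ h) = x) ↔ x.1 < α) ∧ Extends φ ∧ t ∉ φ.range ∧
      ∀ h, h ≠ 1 → j (bigWord (baseWidth ^ 2) t (φ h)) = f α (j (φ h)))

variable {f : Ω → Ω × ℕ → Ω × ℕ} {m m' : Ω × ℕ → Ω × ℕ → Ω × ℕ}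

theorem IsStage.congr {α : Ω} (h : IsStage f m α)
    (hm : ∀ x y : Ω × ℕ, x.1 ≤ α → y.1 ≤ α → m' x y = m x y) : IsStage f m' α := by
  obtain ⟨K, _, j, h1, h2, h3, h4⟩ := h
  refine ⟨K, _, j, h1, h2, fun a b => ?_, h4⟩
  rw [hm _ _ ((h2 _).1 ⟨a, rfl⟩) ((h2 _).1 ⟨b, rfl⟩), h3]

theorem exists_union (I : Set Ω) (hI : I.Nonempty) (h : ∀ β ∈ I, IsStage f m β) :
    ∃ (H : Type) (_ : Group H) (i : H → Ω × ℕ), Function.Injective i ∧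
      (∀ x, (∃ h, i h = x) ↔ ∃ β ∈ I, x.1 ≤ β) ∧ (∀ a b, m (i a) (i b) = i (a * b)) ∧
      ∀ g : H, g ≠ 1 → ¬ IsOfFinOrder g := by
  obtain ⟨β₀, hβ₀⟩ := hI
  obtain ⟨K₀, _, j₀, hj₀, hr₀, hm₀, -⟩ := h β₀ hβ₀
  let e : Ω × ℕ := j₀ 1
  have hee : m e e = e := by rw [hm₀, one_mul]
  have he : e.1 ≤ β₀ := (hr₀ _).1 ⟨1, rfl⟩
  have hone : ∀ (K : Type) (_ : Group K) (j : K → Ω × ℕ), Function.Injective j →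
      (∀ a b, m (j a) (j b) = j (a * b)) → ∀ a, j a = e → a = 1 := by
    intro K _ j hj hm a ha
    have : j (a * a) = j a := by rw [← hm, ha, hee]
    exact mul_eq_left.1 (hj this)
  let S : Set (Ω × ℕ) := {x | ∃ β ∈ I, x.1 ≤ β}
  have hdir : ∀ x y z : S, ∃ β ∈ I, x.1.1 ≤ β ∧ y.1.1 ≤ β ∧ z.1.1 ≤ β ∧ e.1 ≤ β := by
    rintro ⟨x, β, h1, h2⟩ ⟨y, γ, h3, h4⟩ ⟨z, δ, h5, h6⟩
    refine ⟨max (max β γ) (max δ β₀), ?_, ?_, ?_, ?_, ?_⟩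
    · grind
    · simp [h2]
    · simp [h4]
    · simp [h6]
    · simp [he]
  have hst : ∀ x y z : S, ∃ (K : Type) (_ : Group K) (j : K → Ω × ℕ), Function.Injective j ∧
      (∀ a b, m (j a) (j b) = j (a * b)) ∧ (∀ g : K, g ≠ 1 → ¬ IsOfFinOrder g) ∧ j 1 = e ∧
      (∀ k, j k ∈ S) ∧ ∃ a b c, j a = x ∧ j b = y ∧ j c = z := by
    intro x y z
    obtain ⟨β, hβ, h1, h2, h3, h4⟩ := hdir x y z
    obtain ⟨K, _, j, hj, hr, hm, htf, -⟩ := h β hβ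
    obtain ⟨a, ha⟩ := (hr _).2 h1
    obtain ⟨b, hb⟩ := (hr _).2 h2
    obtain ⟨c, hc⟩ := (hr _).2 h3
    obtain ⟨d, hd⟩ := (hr _).2 h4
    refine ⟨K, _, j, hj, hm, htf, ?_, fun k => ⟨β, hβ, (hr _).1 ⟨k, rfl⟩⟩, a, b, c, ha, hb, hc⟩
    rw [← hone K _ j hj hm d hd, hd]
  have hmS : ∀ x y : S, m x y ∈ S := by
    intro x y
    obtain ⟨K, _, j, -, hm, -, -, hS, a, b, -, ha, hb, -⟩ := hst x y x
    rw [← ha, ← hb, hm]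
    exact hS _
  have hinv : ∀ x : S, ∃ y : S, m y x = e := by
    intro x
    obtain ⟨K, _, j, -, hm, -, h1, hS, a, -, -, ha, -⟩ := hst x x x
    refine ⟨⟨j a⁻¹, hS _⟩, ?_⟩
    rw [← ha, hm, inv_mul_cancel, h1]
  choose iv hiv using hinv
  let : Mul S := ⟨fun x y => ⟨m x y, hmS x y⟩⟩
  let : One S := ⟨⟨e, β₀, hβ₀, he⟩⟩
  let : Inv S := ⟨iv⟩
  have hmul : ∀ x y : S, ((x * y : S) : Ω × ℕ) = m x y := fun _ _ => rfl
  have hone' : ((1 : S) : Ω × ℕ) = e := rfl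
  let : Group S := Group.ofLeftAxioms
    (fun x y z => by
      obtain ⟨K, _, j, -, hm, -, -, -, a, b, c, ha, hb, hc⟩ := hst x y z
      apply Subtype.ext
      rw [hmul, hmul, hmul, hmul, ← ha, ← hb, ← hc, hm, hm, hm, hm, mul_assoc])
    (fun x => by
      obtain ⟨K, _, j, -, hm, -, h1, -, a, -, -, ha, -⟩ := hst x x x
      apply Subtype.ext
      rw [hmul, hone', ← ha, ← h1, hm, one_mul])
    (fun x => Subtype.ext (hiv x))
  refine ⟨S, inferInstance, Subtype.val, Subtype.val_injective,
    fun x => ⟨fun ⟨h, hx⟩ => hx ▸ h.2, fun hx => ⟨⟨x, hx⟩, rfl⟩⟩, fun a b => (hmul a b).symm, ?_⟩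
  intro g hg hfin
  obtain ⟨K, _, j, hj, hm, htf, h1, -, a, -, -, ha, -⟩ := hst g g g
  obtain ⟨n, hn, hgn⟩ := isOfFinOrder_iff_pow_eq_one.1 hfin
  have hpow : ∀ n : ℕ, j (a ^ n) = ((g ^ n : S) : Ω × ℕ) := by
    intro n
    induction n with
    | zero => rw [pow_zero, pow_zero, h1, hone']
    | succ n ih => rw [pow_succ, pow_succ, hmul, ← ih, ← ha, hm]
  refine htf a (fun h => hg (Subtype.ext ?_)) (isOfFinOrder_iff_pow_eq_one.2 ⟨n, hn, hj ?_⟩)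
  · rw [hone', ← ha, h, h1]
  · rw [hpow, hgn, hone', h1]

theorem exists_stage (hc : ∀ a : Ω, (Set.Iio a).Countable)
    (hf : ∀ α x, x.1 < α → (f α x).1 < α) (m : Ω × ℕ → Ω × ℕ → Ω × ℕ) (α : Ω)
    (h : ∀ β < α, IsStage f m β) :
    ∃ m', (∀ x y : Ω × ℕ, x.1 < α → y.1 < α → m' x y = m x y) ∧ IsStage f m' α := by
  classical
  by_cases hα : ∃ β, β < α
  · obtain ⟨β₀, hβ₀⟩ := hα
    obtain ⟨H, _, i, hi, hir, him, htf⟩ := exists_union (f := f) (m := m) (Set.Iio α) ⟨β₀, hβ₀⟩ h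
    replace hir : ∀ x, (∃ h, i h = x) ↔ x.1 < α := fun x => (hir x).trans
      ⟨fun ⟨β, h1, h2⟩ => h2.trans_lt h1, fun hx => ⟨x.1, hx, le_rfl⟩⟩
    have : Countable H := by
      have h1 : {x : Ω × ℕ | x.1 < α}.Countable := by
        convert (hc α).prod (Set.countable_univ (α := ℕ))
        ext x
        simp
      have := h1.to_subtype
      exact Function.Injective.countable (f := fun h => (⟨i h, (hir _).1 ⟨h, rfl⟩⟩ :
        {x : Ω × ℕ | x.1 < α})) fun a b hab => hi (congrArg Subtype.val hab)
    have : Infinite H := by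
      choose p hp using fun n : ℕ => (hir (β₀, n)).2 hβ₀
      refine Infinite.of_injective p fun a b hab => ?_
      grind
    choose F hF using fun h : H => (hir (f α (i h))).2 (hf α _ ((hir _).1 ⟨h, rfl⟩))
    obtain ⟨K, _, φ, t, _, hK, hφ, ht, hbig⟩ := exists_extension H htf F
    have : Infinite {k : K // k ∉ φ.range} := by
      refine Infinite.of_injective (fun h => ⟨t * φ h, fun hcon => ht ?_⟩) fun a b hab => ?_
      · exact (Subgroup.mul_mem_cancel_right φ.range (MonoidHom.mem_range.2 ⟨h, rfl⟩)).1 hcon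
      · exact hφ.inj (mul_left_cancel (congrArg Subtype.val hab))
    obtain ⟨e⟩ : Nonempty ({k : K // k ∉ φ.range} ≃ ℕ) := nonempty_equiv_of_countable
    let j : K → Ω × ℕ := fun k => if hk : k ∈ φ.range then i hk.choose else (α, e ⟨k, hk⟩)
    have hj1 : ∀ h, j (φ h) = i h := by
      intro h
      have hk : φ h ∈ φ.range := ⟨h, rfl⟩
      simp only [j, dif_pos hk]
      rw [hφ.inj hk.choose_spec]
    have hj2 : ∀ k (hk : k ∉ φ.range), j k = (α, e ⟨k, hk⟩) := fun k hk => dif_neg hk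
    have hlt : ∀ h, (i h).1 < α := fun h => (hir _).1 ⟨h, rfl⟩
    have hj : Function.Injective j := by
      intro a b hab
      by_cases ha : a ∈ φ.range <;> by_cases hb : b ∈ φ.range
      · obtain ⟨a, rfl⟩ := ha
        obtain ⟨b, rfl⟩ := hb
        rw [hj1, hj1] at hab
        rw [hi hab]
      · obtain ⟨a, rfl⟩ := ha
        rw [hj1, hj2 b hb] at hab
        exact absurd (congrArg Prod.fst hab) (hlt a).ne
      · obtain ⟨b, rfl⟩ := hb
        rw [hj1, hj2 a ha] at hab
        exact absurd (congrArg Prod.fst hab) (hlt b).ne'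
      · rw [hj2 a ha, hj2 b hb] at hab
        exact congrArg Subtype.val (e.injective (congrArg Prod.snd hab))
    refine ⟨fun x y => j (Function.invFun j x * Function.invFun j y), fun x y hx hy => ?_,
      K, _, j, hj, fun x => ?_, fun a b => ?_, hK, fun hmin => absurd hβ₀ (not_lt.2 (hmin β₀)),
      fun _ => ⟨H, _, φ, t, fun x => ?_, hφ, ht, fun h hh => ?_⟩⟩
    · obtain ⟨a, rfl⟩ := (hir x).2 hx
      obtain ⟨b, rfl⟩ := (hir y).2 hy
      beta_reduce
      rw [him, ← hj1, ← hj1 b, Function.leftInverse_invFun hj, Function.leftInverse_invFun hj,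
        ← map_mul, hj1]
    · constructor
      · rintro ⟨k, rfl⟩
        by_cases hk : k ∈ φ.range
        · obtain ⟨k, rfl⟩ := hk
          rw [hj1]
          exact (hlt k).le
        · rw [hj2 k hk]
      · intro hx
        rcases hx.lt_or_eq with hx | hx
        · obtain ⟨a, rfl⟩ := (hir x).2 hx
          exact ⟨φ a, hj1 a⟩
        · refine ⟨e.symm x.2, ?_⟩
          rw [hj2 _ (e.symm x.2).2, ← hx]
          simp
    · simp only [Function.leftInverse_invFun hj _]
    · simp only [hj1]
      exact hir x
    · rw [hbig h hh, hj1, hj1, hF]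
  · push Not at hα
    let j : Multiplicative ℤ → Ω × ℕ := fun k => (α, Equiv.intEquivNat k.toAdd)
    have hj : Function.Injective j := fun a b hab =>
      Multiplicative.toAdd.injective (Equiv.intEquivNat.injective (congrArg Prod.snd hab))
    refine ⟨fun x y => j (Function.invFun j x * Function.invFun j y), fun x y hx hy => ?_,
      Multiplicative ℤ, _, j, hj, fun x => ⟨?_, fun hx => ?_⟩, fun a b => ?_, fun g hg => ?_,
      fun _ => inferInstance, fun ⟨β, hβ⟩ => absurd hβ (not_lt.2 (hα β))⟩
    · exact absurd hx (not_lt.2 (hα _))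
    · rintro ⟨k, rfl⟩
      exact le_rfl
    · refine ⟨Multiplicative.ofAdd (Equiv.intEquivNat.symm x.2), Prod.ext ?_ ?_⟩
      · exact le_antisymm (hα _) hx
      · simp [j]
    · simp only [Function.leftInverse_invFun hj _]
    · rw [isOfFinOrder_iff_pow_eq_one]
      rintro ⟨n, hn, hgn⟩
      exact hg ((pow_eq_one_iff_left hn.ne').1 hgn)

theorem exists_forall_isStage [WellFoundedLT Ω] (hc : ∀ a : Ω, (Set.Iio a).Countable)
    (hf : ∀ α x, x.1 < α → (f α x).1 < α) : ∃ m, ∀ α, IsStage f m α := by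
  classical
  let step : (α : Ω) → (Ω × ℕ → Ω × ℕ → Ω × ℕ) → Ω × ℕ → Ω × ℕ → Ω × ℕ := fun α m =>
    if h : ∃ m', (∀ x y : Ω × ℕ, x.1 < α → y.1 < α → m' x y = m x y) ∧ IsStage f m' α then
      h.choose else m
  let glue : (α : Ω) → ((β : Ω) → β < α → Ω × ℕ → Ω × ℕ → Ω × ℕ) → Ω × ℕ → Ω × ℕ → Ω × ℕ :=
    fun α g x y => if h : max x.1 y.1 < α then g _ h x y else x
  let g : Ω → Ω × ℕ → Ω × ℕ → Ω × ℕ := wellFounded_lt.fix fun α g => step α (glue α g)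
  have hg : ∀ α, g α = step α (glue α fun β _ => g β) := fun α => WellFounded.fix_eq _ _ α
  let m : Ω × ℕ → Ω × ℕ → Ω × ℕ := fun x y => g (max x.1 y.1) x y
  refine ⟨m, fun α => ?_⟩
  induction α using WellFoundedLT.induction with
  | ind α ih =>
    have h0 : ∀ x y : Ω × ℕ, x.1 < α → y.1 < α → (glue α fun β _ => g β) x y = m x y :=
      fun x y hx hy => dif_pos (max_lt hx hy)
    have h1 := exists_stage hc hf (glue α fun β _ => g β) α fun β hβ => (ih β hβ).congr
      fun x y hx hy => h0 x y (hx.trans_lt hβ) (hy.trans_lt hβ)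
    have h2 : g α = h1.choose := (hg α).trans (dif_pos h1)
    obtain ⟨h3, h4⟩ := h1.choose_spec
    rw [← h2] at h3 h4
    refine h4.congr fun x y hx hy => ?_
    rcases (max_le hx hy).lt_or_eq with hlt | heq
    · obtain ⟨hx, hy⟩ := max_lt_iff.1 hlt
      rw [h3 x y hx hy, h0 x y hx hy]
    · simp only [m, heq]

/-- A torsion-free group with a rank function, exhausted by a tower of extensions. -/
theorem exists_tower [WellFoundedLT Ω] [Nonempty Ω] (hc : ∀ a : Ω, (Set.Iio a).Countable)
    (hf : ∀ α x, x.1 < α → (f α x).1 < α) :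
    ∃ (G : Type) (_ : Group G) (i : G → Ω × ℕ), Function.Bijective i ∧
      (∀ g : G, g ≠ 1 → ¬ IsOfFinOrder g) ∧ ∀ α, ∃ (K : Type) (_ : Group K) (ψ : K →* G),
        Function.Injective ψ ∧ (∀ g, g ∈ ψ.range ↔ (i g).1 ≤ α) ∧ ((∀ β, α ≤ β) → IsCyclic K) ∧
        ((∃ β, β < α) → ∃ (H : Type) (_ : Group H) (φ : H →* K) (t : K),
          (∀ g, g ∈ (ψ.comp φ).range ↔ (i g).1 < α) ∧ Extends φ ∧ t ∉ φ.range ∧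
          ∀ h, h ≠ 1 → i (bigWord (baseWidth ^ 2) (ψ t) (ψ (φ h))) = f α (i (ψ (φ h)))) := by
  obtain ⟨m, hm⟩ := exists_forall_isStage hc hf
  obtain ⟨G, _, i, hi, hir, him, htf⟩ := exists_union (f := f) (m := m) Set.univ Set.univ_nonempty
    fun β _ => hm β
  have hs : ∀ x, ∃ g, i g = x := fun x => (hir x).2 ⟨x.1, trivial, le_rfl⟩
  refine ⟨G, _, i, ⟨hi, hs⟩, htf, fun α => ?_⟩
  obtain ⟨K, _, j, hj, hr, hmul, -, hcyc, hext⟩ := hm α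
  choose p hp using fun k => hs (j k)
  let ψ : K →* G := MonoidHom.mk' p fun a b => hi (by rw [hp, ← him, hp, hp, hmul])
  have hψ : ∀ k, i (ψ k) = j k := hp
  have hψi : Function.Injective ψ := fun a b hab => hj (by rw [← hψ, ← hψ, hab])
  refine ⟨K, _, ψ, hψi, fun g => ?_, hcyc, fun hne => ?_⟩
  · rw [← hr]
    exact exists_congr fun k => by rw [← hψ, hi.eq_iff]
  · obtain ⟨H, _, φ, t, h1, h2, h3, h4⟩ := hext hne
    refine ⟨H, _, φ, t, fun g => ?_, h2, h3, fun h hh => ?_⟩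
    · rw [← h1]
      exact exists_congr fun k => by rw [← hψ, hi.eq_iff]; rfl
    · rw [← map_bigWord, hψ, h4 h hh, hψ]

end Tower

section Ranked

variable {G Ω : Type} [Group G] [LinearOrder Ω]

/-- The properties of the rank function of a tower of extensions. -/
structure Ranked (rk : G → Ω) : Prop where
  one_le : ∀ α, rk 1 ≤ α
  mul_le : ∀ g h, rk (g * h) ≤ max (rk g) (rk h)
  inv_le : ∀ g, rk g⁻¹ ≤ rk g
  cyc : ∀ α, (∀ β, α ≤ β) → ∃ C : Subgroup G, IsCyclic C ∧ ∀ g, g ∈ C ↔ rk g ≤ α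
  mal : ∀ g y, rk y < rk g → rk (g⁻¹ * y * g) < rk g → y = 1
  dich : ∀ α, (∃ β, β < α) → ∀ g, rk g ≤ α → g ≠ 1 → ∃ P : Subgroup G, g ∈ P ∧ Malnormal P ∧
    (IsCyclic P ∨ ∃ x, rk x ≤ α ∧ ∀ y ∈ P, rk (x⁻¹ * y * x) < α) ∧
    ∀ v ∉ P, rk v ≤ α → ∀ u, rk u ≤ α → u ∈ Subgroup.closure {g, v}

/-- A subgroup consisting of all elements with rank in a certain initial segment. -/
def RankClosed (rk : G → Ω) (K : Subgroup G) : Prop := ∀ a ∈ K, ∀ b, rk b ≤ rk a → b ∈ K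

variable {rk : G → Ω} {K : Subgroup G}

theorem RankClosed.malnormal (hr : Ranked rk) (hK : RankClosed rk K) : Malnormal K := by
  intro g hg y hy hgy
  have hlt : ∀ a ∈ K, rk a < rk g := fun a ha => not_le.1 fun hle => hg (hK a ha g hle)
  exact hr.mal g y (hlt y hy) (hlt _ hgy)

theorem mem_map_conj {x y : G} :
    y ∈ K.map (MulAut.conj x).toMonoidHom ↔ x⁻¹ * y * x ∈ K := by
  constructor
  · rintro ⟨k, hk, rfl⟩
    simpa [mul_assoc] using hk
  · exact fun h => ⟨_, h, by simp [mul_assoc]⟩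

theorem malnormal_map_conj {x : G} (hK : Malnormal K) :
    Malnormal (K.map (MulAut.conj x).toMonoidHom) := by
  intro g hg y hy hgy
  rw [mem_map_conj] at hg hy hgy
  have := hK _ hg _ hy (by convert hgy using 1; group)
  rwa [mul_assoc, inv_mul_eq_one, eq_comm, mul_eq_right] at this

theorem isCyclic_map {H : Type} [Group H] (φ : G →* H) (h : IsCyclic K) : IsCyclic (K.map φ) :=
  isCyclic_of_surjective _ (φ.subgroupMap_surjective K)

theorem exists_mem_ne_one (hK : ¬ IsCyclic K) : ∃ c ∈ K, c ≠ 1 := by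
  by_contra hcon
  push Not at hcon
  exact hK ((Subgroup.eq_bot_iff_forall K).2 hcon ▸ inferInstance)

theorem commute_of_isCyclic (hK : IsCyclic K) {a b : G} (ha : a ∈ K) (hb : b ∈ K) :
    a⁻¹ * b * a = b := by
  have := IsCyclic.isMulCommutative (α := K)
  have := congrArg Subtype.val (this.is_comm.comm ⟨a, ha⟩ ⟨b, hb⟩)
  grind [Subgroup.coe_mul, mul_assoc, inv_mul_eq_iff_eq_mul]

theorem Ranked.mem_closure (hr : Ranked rk) {h k u : G} (hh : h ≠ 1) (hlt : rk h < rk k)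
    (hu : rk u ≤ rk k) : u ∈ Subgroup.closure {h, k} := by
  obtain ⟨P, hP, -, hdich, hgen⟩ := hr.dich (rk k) ⟨_, hlt⟩ h hlt.le hh
  refine hgen k (fun hk => ?_) le_rfl u hu
  rcases hdich with hcyc | ⟨x, hx, hxP⟩
  · refine hh (hr.mal k h hlt ?_)
    rwa [commute_of_isCyclic hcyc hk hP]
  · rcases hx.lt_or_eq with hx | hx
    · have h1 := hxP k hk
      have h2 : rk (x * (x⁻¹ * k * x) * x⁻¹) < rk k :=
        (hr.mul_le _ _).trans_lt (max_lt ((hr.mul_le _ _).trans_lt (max_lt hx h1))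
          ((hr.inv_le x).trans_lt hx))
      refine h2.ne (congrArg rk ?_)
      group
    · refine hh (hr.mal x h (hx ▸ hlt) (hx ▸ hxP h hP))

theorem Ranked.exists_conj_rankClosed [WellFoundedLT Ω] (hr : Ranked rk) (hK : ¬ IsCyclic K) :
    ∃ x, RankClosed rk (K.map (MulAut.conj x).toMonoidHom) := by
  have hnc : ∀ x, ¬ IsCyclic (K.map (MulAut.conj x).toMonoidHom) := fun x hcon =>
    hK (isCyclic_of_surjective (K.equivMapOfInjective (MulAut.conj x).toMonoidHom
      (MulAut.conj x).injective).symm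
      (MulEquiv.surjective _))
  by_cases hB : ∀ x, ∃ a ∈ K.map (MulAut.conj x).toMonoidHom,
    ∀ b ∈ K.map (MulAut.conj x).toMonoidHom, rk b ≤ rk a
  · let S : Set Ω := {α | ∃ x, ∀ b ∈ K.map (MulAut.conj x).toMonoidHom, rk b ≤ α}
    have hS : S.Nonempty := by
      obtain ⟨a, -, ha⟩ := hB 1
      exact ⟨rk a, 1, ha⟩
    obtain ⟨α, ⟨x, hx⟩, hmin⟩ : ∃ α ∈ S, ∀ β ∈ S, α ≤ β :=
      ⟨_, wellFounded_lt.min_mem S hS, fun β hβ => not_lt.1 (wellFounded_lt.not_lt_min S hβ)⟩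
    refine ⟨x, ?_⟩
    obtain ⟨a, ha, hmax⟩ := hB x
    have haα : rk a = α := le_antisymm (hx a ha) (hmin _ ⟨x, hmax⟩)
    by_cases hne : ∃ β, β < α
    · have ha1 : a ≠ 1 := by
        rintro rfl
        obtain ⟨β, hβ⟩ := hne
        exact absurd (hr.one_le β) (not_le.2 (haα ▸ hβ))
      obtain ⟨P, haP, -, hdich, hgen⟩ := hr.dich α hne a haα.le ha1
      by_cases hle : K.map (MulAut.conj x).toMonoidHom ≤ P
      · exfalso
        rcases hdich with hcyc | ⟨z, -, hz⟩
        · exact hnc x (Subgroup.isCyclic_of_le hle)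
        · obtain ⟨b, hb, hbmax⟩ := hB (z⁻¹ * x)
          refine absurd (hmin _ ⟨z⁻¹ * x, hbmax⟩) (not_le.2 ?_)
          have := hz (z * b * z⁻¹) (hle ?_)
          · convert this using 2
            group
          · rw [mem_map_conj] at hb ⊢
            convert hb using 1
            group
      · obtain ⟨v, hv, hvP⟩ := Set.not_subset.1 hle
        intro c hc b hb
        refine Subgroup.closure_le _ |>.2 ?_ (hgen v hvP (hx v hv) b (hb.trans (hx c hc)))
        rintro _ (rfl | rfl)
        exacts [ha, hv]
    · push Not at hne
      obtain ⟨C, hC, hmem⟩ := hr.cyc α hne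
      exact absurd (Subgroup.isCyclic_of_le fun b hb => (hmem b).2 (hx b hb)) (hnc x)
  · push Not at hB
    obtain ⟨x, hx⟩ := hB
    refine ⟨x, fun a ha b hb => ?_⟩
    obtain ⟨h, hh, hh1⟩ := exists_mem_ne_one (hnc x)
    obtain ⟨k, hk, hlt1, hlt2⟩ : ∃ k ∈ K.map (MulAut.conj x).toMonoidHom, rk a < rk k ∧ rk h < rk
      k := by
      rcases le_total (rk a) (rk h) with h1 | h1
      · obtain ⟨k, hk, h2⟩ := hx h hh
        exact ⟨k, hk, h1.trans_lt h2, h2⟩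
      · obtain ⟨k, hk, h2⟩ := hx a ha
        exact ⟨k, hk, h2, h1.trans_lt h2⟩
    refine Subgroup.closure_le _ |>.2 ?_ (hr.mem_closure hh1 hlt2 (hb.trans hlt1.le))
    rintro _ (rfl | rfl)
    exacts [hh, hk]

theorem Ranked.malnormal [WellFoundedLT Ω] (hr : Ranked rk) (hK : ¬ IsCyclic K) : Malnormal K := by
  obtain ⟨x, hx⟩ := hr.exists_conj_rankClosed hK
  convert malnormal_map_conj (x := x⁻¹) (hx.malnormal hr)
  ext y
  simp [mul_assoc]

theorem Ranked.exists_cyclic [WellFoundedLT Ω] (hr : Ranked rk) {c : G} (hc : c ≠ 1) :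
    ∃ P : Subgroup G, c ∈ P ∧ Malnormal P ∧ IsCyclic P := by
  let S : Set Ω := Set.range fun x => rk (x⁻¹ * c * x)
  have hS : S.Nonempty := ⟨_, 1, rfl⟩
  obtain ⟨_, ⟨x, rfl⟩, hmin⟩ : ∃ α ∈ S, ∀ β ∈ S, α ≤ β :=
    ⟨_, wellFounded_lt.min_mem S hS, fun β hβ => not_lt.1 (wellFounded_lt.not_lt_min S hβ)⟩
  obtain ⟨P, h1, h2, h3⟩ : ∃ P : Subgroup G, x⁻¹ * c * x ∈ P ∧ Malnormal P ∧ IsCyclic P := by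
    by_cases hne : ∃ β, β < rk (x⁻¹ * c * x)
    · obtain ⟨P, h1, h2, h3 | ⟨z, -, hz⟩, -⟩ := hr.dich _ hne (x⁻¹ * c * x) le_rfl fun h1 => hc (by
        rwa [mul_assoc, inv_mul_eq_one, eq_comm, mul_eq_right] at h1)
      · exact ⟨P, h1, h2, h3⟩
      · refine absurd (hmin _ ⟨x * z, rfl⟩) (not_le.2 ?_)
        convert hz _ h1 using 2
        group
    · push Not at hne
      obtain ⟨C, hC, hmem⟩ := hr.cyc _ hne
      refine ⟨C, (hmem _).2 le_rfl, RankClosed.malnormal hr fun a ha b hb => ?_, hC⟩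
      exact (hmem _).2 (hb.trans ((hmem a).1 ha))
  exact ⟨_, mem_map_conj.2 h1, malnormal_map_conj h2, isCyclic_map _ h3⟩

theorem Ranked.exists_malnormal_ge [WellFoundedLT Ω] (hr : Ranked rk) {c : G} (hc : c ≠ 1)
    (hcK : c ∈ K) :
    ∃ P : Subgroup G, K ≤ P ∧ Malnormal P ∧ (IsCyclic P ∨ ¬ IsCyclic K ∧ P = K) := by
  by_cases hK : IsCyclic K
  · obtain ⟨P, h1, h2, h3⟩ := hr.exists_cyclic hc
    refine ⟨P, fun k hk => ?_, h2, .inl h3⟩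
    by_contra hkP
    exact hc (h2 k hkP c h1 (by rwa [commute_of_isCyclic hK hk hcK]))
  · grind [Ranked.malnormal]

theorem Ranked.isSimpleGroup [WellFoundedLT Ω] (hr : Ranked rk) (hK : ¬ IsCyclic K) :
    IsSimpleGroup K := by
  obtain ⟨d, hd, hd1⟩ := exists_mem_ne_one hK
  have : Nontrivial K := ⟨⟨d, hd⟩, 1, fun h => hd1 (congrArg Subtype.val h)⟩
  refine ⟨fun M hM => or_iff_not_imp_left.2 fun hbot => ?_⟩
  obtain ⟨c, hcM, hc⟩ := (Subgroup.ne_bot_iff_exists_ne_one.1 hbot).imp fun c hc =>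
    And.intro c.2 fun h => hc (Subtype.ext h)
  have hc' : ((c : K) : G) ≠ 1 := fun h => hc (Subtype.ext h)
  have hmem : ∀ k : K, k ∈ M → (k : G) ∈ M.map K.subtype := fun k hk => ⟨k, hk, rfl⟩
  obtain ⟨P, hle, hP, hdich⟩ := hr.exists_malnormal_ge (K := M.map K.subtype) hc' (hmem _ hcM)
  have hKP : K ≤ P := by
    intro k hk
    by_contra hkP
    refine hc' (hP k hkP _ (hle (hmem _ hcM)) (hle ?_))
    have := hM.conj_mem c hcM (⟨k, hk⟩⁻¹)
    simpa using hmem _ this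
  rcases hdich with hcyc | ⟨-, rfl⟩
  · exact absurd (Subgroup.isCyclic_of_le hKP) hK
  · rw [eq_top_iff]
    rintro k -
    obtain ⟨m, hm, hmk⟩ := hKP k.2
    rwa [← Subtype.ext (a1 := m) (a2 := k) hmk]

theorem Ranked.malnormal_of_not_lt [WellFoundedLT Ω] (hr : Ranked rk)
    (hK : ¬ ∃ C : Subgroup G, IsCyclic C ∧ K < C) : Malnormal K := by
  by_cases hbot : ∃ c ∈ K, c ≠ 1
  · obtain ⟨c, hc, hc1⟩ := hbot
    obtain ⟨P, hle, hP, hcyc | ⟨-, rfl⟩⟩ := hr.exists_malnormal_ge hc1 hc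
    · rcases hle.eq_or_lt with rfl | hlt
      exacts [hP, absurd ⟨P, hcyc, hlt⟩ hK]
    · exact hP
  · push Not at hbot
    exact fun _ _ y hy _ => hbot y hy

theorem RankClosed.le_of_conj_le (hr : Ranked rk) {K' : Subgroup G} (hK : RankClosed rk K)
    (hK' : RankClosed rk K') {c z : G} (hc : c ∈ K') (hc1 : c ≠ 1)
    (hz : ∀ y ∈ K', z * y * z⁻¹ ∈ K) : K' ≤ K ∧ (K ≤ K' → ∀ y ∈ K, z⁻¹ * y * z ∈ K') := by
  have hle : K' ≤ K := by
    by_contra hcon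
    obtain ⟨b, hb, hbK⟩ := Set.not_subset.1 hcon
    have hle : K ≤ K' := fun a ha => hK' b hb a (not_lt.1 fun h => hbK (hK a ha b h.le))
    have hzK : z⁻¹ ∈ K' := by
      by_contra hzK
      exact hc1 (hK'.malnormal hr _ hzK c hc (by simpa using hle (hz c hc)))
    have := hz (z⁻¹ * b * z) (mul_mem (mul_mem hzK hb) (inv_mem_iff.1 hzK))
    exact hbK (by simpa [mul_assoc] using this)
  refine ⟨hle, fun hle' y hy => ?_⟩
  have hzK : z⁻¹ ∈ K' := by
    by_contra hzK
    exact hc1 (hK'.malnormal hr _ hzK c hc (by simpa using hle' (hz c hc)))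
  exact mul_mem (mul_mem hzK (hle' hy)) (inv_mem_iff.1 hzK)

theorem Ranked.not_strictAnti [WellFoundedLT Ω] (hr : Ranked rk) :
    ¬ ∃ f : ℕ → Subgroup G, StrictAnti f ∧ ∀ n : ℕ, ¬ IsCyclic (f n) := by
  rintro ⟨f, hf, hcyc⟩
  choose x hx using fun n => hr.exists_conj_rankClosed (hcyc n)
  have h1 : ∀ n, ∃ a ∈ (f n).map (MulAut.conj (x n)).toMonoidHom,
      ∀ b ∈ (f (n + 1)).map (MulAut.conj (x (n + 1))).toMonoidHom, rk b < rk a := by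
    intro n
    obtain ⟨c, hc, hc1⟩ := exists_mem_ne_one (hcyc (n + 1))
    have h2 := RankClosed.le_of_conj_le hr (hx n) (hx (n + 1))
      (c := x (n + 1) * c * (x (n + 1))⁻¹) (z := x n * (x (n + 1))⁻¹)
      (by rw [mem_map_conj]; simpa [mul_assoc] using hc) (by rwa [Ne, conj_eq_one_iff]) (by
        intro y hy
        rw [mem_map_conj] at hy ⊢
        convert hf.antitone n.le_succ hy using 1
        simp [mul_assoc])
    have h3 : ¬ (f n).map (MulAut.conj (x n)).toMonoidHom ≤
        (f (n + 1)).map (MulAut.conj (x (n + 1))).toMonoidHom := by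
      intro hle
      refine (hf n.lt_succ_self).not_ge fun y hy => ?_
      have := h2.2 hle (x n * y * (x n)⁻¹) (by rw [mem_map_conj]; simpa [mul_assoc] using hy)
      simpa [mul_assoc] using this
    obtain ⟨a, ha, ha'⟩ := Set.not_subset.1 h3
    exact ⟨a, ha, fun b hb => not_le.1 fun hle => ha' (hx (n + 1) b hb a hle)⟩
  choose a ha ha' using h1
  exact not_strictAnti_of_wellFoundedLT (fun n => rk (a n))
    (strictAnti_nat_of_succ_lt fun n => ha' n _ (ha (n + 1)))

end Ranked

section WordSet

variable {G : Type} [Group G] {Y : Set G}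

theorem mem_wordSet {n : ℕ} {h : G} : h ∈ wordSet Y n ↔
    ∃ l : List G, l.length ≤ n ∧ (∀ g ∈ l, g ∈ Y ∨ g⁻¹ ∈ Y) ∧ h = l.prod := by
  constructor
  · rintro ⟨m, hm, g, hg, rfl⟩
    exact ⟨List.ofFn g, by simpa using hm, List.forall_mem_ofFn_iff.2 hg, rfl⟩
  · rintro ⟨l, hl, hY, rfl⟩
    exact ⟨l.length, hl, l.get, fun i => hY _ (l.get_mem i), by rw [List.ofFn_get]⟩

theorem one_mem_wordSet (n : ℕ) : (1 : G) ∈ wordSet Y n :=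
  mem_wordSet.2 ⟨[], by simp, by simp, by simp⟩

theorem mul_mem_wordSet {m n : ℕ} {a b : G} (ha : a ∈ wordSet Y m) (hb : b ∈ wordSet Y n) :
    a * b ∈ wordSet Y (m + n) := by
  rw [mem_wordSet] at *
  obtain ⟨l, h1, h2, rfl⟩ := ha
  obtain ⟨l', h3, h4, rfl⟩ := hb
  refine ⟨l ++ l', by simp; omega, fun g hg => ?_, by simp⟩
  grind

theorem exists_mem_wordSet {a : G} (ha : a ∈ Subgroup.closure Y) : ∃ n, a ∈ wordSet Y n := by
  rw [← Subgroup.mem_toSubmonoid, Subgroup.closure_toSubmonoid] at ha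
  obtain ⟨l, h1, rfl⟩ := Submonoid.exists_list_of_mem_closure ha
  exact ⟨_, mem_wordSet.2 ⟨l, le_rfl, h1, rfl⟩⟩

theorem bigWord_mem_wordSet {k : ℕ} {t x : G} (ht : t ∈ wordSet Y k) (hx : x ∈ wordSet Y k)
    (n : ℕ) :
    bigWord n t x ∈ wordSet Y (n * (k + k)) := by
  induction n with
  | zero => exact one_mem_wordSet _
  | succ n ih =>
    rw [bigWord_succ, Nat.succ_mul]
    refine mul_mem_wordSet ih (mul_mem_wordSet ?_ ht)
    split_ifs
    exacts [hx, one_mem_wordSet _]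

end WordSet

/-- A ranked torsion-free group whose elements of rank `α` include some `t` for which the values
of the fixed word on `t` and elements of smaller rank are prescribed by `f`. -/
theorem exists_ranked {Ω : Type} [LinearOrder Ω] [WellFoundedLT Ω] [Nonempty Ω]
    (hc : ∀ a : Ω, (Set.Iio a).Countable) {f : Ω → Ω × ℕ → Ω × ℕ}
    (hf : ∀ α x, x.1 < α → (f α x).1 < α) :
    ∃ (G : Type) (_ : Group G) (i : G → Ω × ℕ), Function.Bijective i ∧
      (∀ g : G, g ≠ 1 → ¬ IsOfFinOrder g) ∧ Ranked (fun g => (i g).1) ∧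
      ∀ α, (∃ β, β < α) → ∃ t, (i t).1 = α ∧ ∀ h, h ≠ 1 → (i h).1 < α →
        i (bigWord (baseWidth ^ 2) t h) = f α (i h) := by
  obtain ⟨G, _, i, hi, htf, hG⟩ := exists_tower hc hf
  choose K gK ψ hψ hψr hcyc hext using hG
  have hmal : ∀ g y, (i y).1 < (i g).1 → (i (g⁻¹ * y * g)).1 < (i g).1 → y = 1 := by
    intro g y h1 h2
    obtain ⟨H, _, φ, t, hφr, hφ, -⟩ := hext _ ⟨_, h1⟩
    obtain ⟨k, hk⟩ := (hψr (i g).1 g).2 le_rfl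
    obtain ⟨a, ha⟩ := (hφr y).2 h1
    obtain ⟨b, hb⟩ := (hφr _).2 h2
    have h3 := hφ.mal k (fun ⟨h, hh⟩ => ?_) (φ a) ⟨a, rfl⟩ ⟨b, hψ _ ?_⟩
    · grind [MonoidHom.comp_apply]
    · refine absurd ((hφr g).1 ⟨h, ?_⟩) (lt_irrefl _)
      rw [MonoidHom.comp_apply, hh, hk]
    · rw [map_mul, map_mul, map_inv, hk]
      exact hb.trans (by rw [← ha]; rfl)
  refine ⟨G, _, i, hi, htf, ⟨fun α => ?_, fun g h => ?_, fun g => ?_, fun α hα => ?_, hmal,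
    fun α hα g hg hg1 => ?_⟩, fun α hα => ?_⟩
  · exact (hψr α 1).1 (one_mem _)
  · grind [mul_mem]
  · grind [inv_mem]
  · have := hcyc α hα
    exact ⟨(ψ α).range, isCyclic_of_surjective _ (ψ α).rangeRestrict_surjective, hψr α⟩
  · obtain ⟨H, _, φ, t, hφr, hφ, -⟩ := hext α hα
    obtain ⟨k, rfl⟩ := (hψr α g).2 hg
    obtain ⟨P, hkP, hP, hdich, hgen⟩ := hφ.dich k fun h => hg1 (by rw [h, map_one])
    have hmem : ∀ p, ψ α p ∈ P.map (ψ α) ↔ p ∈ P := fun p =>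
      Subgroup.mem_map_iff_mem (hψ α)
    have hle : ∀ y ∈ P.map (ψ α), (i y).1 ≤ α := by
      rintro _ ⟨p, -, rfl⟩
      exact (hψr α _).1 ⟨p, rfl⟩
    refine ⟨P.map (ψ α), (hmem k).2 hkP, fun g hg y hy hgy => ?_, ?_, fun v hv hvα u hu => ?_⟩
    · rcases le_or_gt (i g).1 α with h | h
      · obtain ⟨g, rfl⟩ := (hψr α g).2 h
        obtain ⟨y, rfl⟩ := (hψr α y).2 (hle y hy)
        rw [← map_inv, ← map_mul, ← map_mul, hmem] at hgy
        rw [hmem] at hg hy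
        rw [hP g hg y hy hgy, map_one]
      · grind
    · refine hdich.imp (isCyclic_map _) ?_
      rintro ⟨x, hx⟩
      refine ⟨ψ α x, (hψr α _).1 ⟨x, rfl⟩, ?_⟩
      rintro _ ⟨p, hp, rfl⟩
      obtain ⟨h, hh⟩ := (hx p).1 hp
      refine (hφr _).1 ⟨h, ?_⟩
      grind [MonoidHom.comp_apply]
    · obtain ⟨v, rfl⟩ := (hψr α v).2 hvα
      obtain ⟨u, rfl⟩ := (hψr α u).2 hu
      have h1 : u ∈ Subgroup.closure {k, v} := hgen v (fun h => hv ((hmem v).2 h)) ▸ trivial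
      have h2 := Subgroup.mem_map_of_mem (ψ α) h1
      rwa [MonoidHom.map_closure, Set.image_pair] at h2
  · obtain ⟨H, _, φ, t, hφr, hφ, ht, hbig⟩ := hext α hα
    refine ⟨ψ α t, le_antisymm ((hψr α _).1 ⟨t, rfl⟩) (not_lt.1 fun hlt => ht ?_), fun h h1 h2 =>
      ?_⟩
    · obtain ⟨h, hh⟩ := (hφr _).2 hlt
      exact ⟨h, hψ α hh⟩
    · obtain ⟨h, rfl⟩ := (hφr _).2 h2
      exact hbig h fun hh => h1 (by rw [hh, map_one])

theorem exists_wordSet_eq_univ {Ω G : Type} [LinearOrder Ω] [Group G] {i : G → Ω × ℕ}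
    (hc : ∀ a : Ω, (Set.Iio a).Countable) (hi : Function.Injective i)
    (hr : Ranked fun g => (i g).1) {c : Ω → Ω → Ω × ℕ}
    (hcol : ∀ A : Set Ω, ¬ A.Countable → ∀ z, ∃ α ∈ A, ∃ β ∈ A, α < β ∧ c α β = z)
    (ht : ∀ α, (∃ β, β < α) → ∃ t, (i t).1 = α ∧ ∀ h, h ≠ 1 → (i h).1 < α → (c (i h).1 α).1 < α →
      i (bigWord (baseWidth ^ 2) t h) = c (i h).1 α)
    (Y : Set G) (hY : ¬ Y.Countable) : ∃ n : ℕ, wordSet Y n = Set.univ := by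
  have hIic : ∀ a : Ω, (Set.Iic a).Countable := fun a => by
    rw [← Set.Iio_insert]
    exact (hc a).insert a
  have hfib : ∀ S : Set Ω, S.Countable → {g | (i g).1 ∈ S}.Countable := by
    intro S hS
    exact ((hS.prod (Set.countable_univ (α := ℕ))).preimage hi).mono
      fun g hg => Set.mem_prod.2 ⟨hg, Set.mem_univ _⟩
  obtain ⟨h₀, hh₀, hne⟩ : ∃ h ∈ Y, h ≠ 1 := by
    by_contra hcon
    push Not at hcon
    exact hY ((Set.countable_singleton 1).mono hcon)
  have hR : ∀ α, (∃ y ∈ Y, (i y).1 = α ∧ (i h₀).1 < α) → ∃ t k, t ∈ wordSet Y k ∧ (i t).1 = α ∧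
      ∀ h, h ≠ 1 → (i h).1 < α → (c (i h).1 α).1 < α →
        i (bigWord (baseWidth ^ 2) t h) = c (i h).1 α := by
    rintro _ ⟨y, hy, rfl, hlt⟩
    obtain ⟨t, h1, h2⟩ := ht _ ⟨_, hlt⟩
    obtain ⟨k, hk⟩ := exists_mem_wordSet (Y := Y) (Subgroup.closure_mono
      (Set.insert_subset hh₀ (Set.singleton_subset_iff.2 hy)) (hr.mem_closure hne hlt h1.le))
    exact ⟨t, k, hk, h1, h2⟩
  choose! t k htk hti htc using hR
  obtain ⟨n, hn⟩ : ∃ n, ¬ {α | (∃ y ∈ Y, (i y).1 = α ∧ (i h₀).1 < α) ∧ k α = n}.Countable := by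
    by_contra hcon
    push Not at hcon
    refine hY ((hfib _ ((hIic (i h₀).1).union (Set.countable_iUnion hcon))).mono fun y hy => ?_)
    rcases le_or_gt (i y).1 (i h₀).1 with h | h
    · exact .inl h
    · exact .inr (Set.mem_iUnion.2 ⟨_, ⟨y, hy, rfl, h⟩, rfl⟩)
  refine ⟨baseWidth ^ 2 * (n + n), Set.eq_univ_of_forall fun z => ?_⟩
  have hA : ¬ ({α | (∃ y ∈ Y, (i y).1 = α ∧ (i h₀).1 < α) ∧ k α = n} \ Set.Iic (i z).1).Countable :=
    fun h => hn ((h.union (hIic (i z).1)).mono (by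
      rw [Set.sdiff_union_self]
      exact Set.subset_union_left))
  obtain ⟨α, ⟨⟨hα, hkα⟩, -⟩, β, ⟨⟨hβ, hkβ⟩, hzβ⟩, hlt, hcz⟩ := hcol _ hA (i z)
  have h1 := htk α hα
  have h2 := htk β hβ
  rw [hkα] at h1
  rw [hkβ] at h2
  have h3 : t α ≠ 1 := by
    intro h
    have := hr.one_le (i h₀).1
    rw [← h, hti α hα] at this
    obtain ⟨y, -, -, hy⟩ := hα
    exact absurd this (not_le.2 hy)
  have h4 := htc β hβ (t α) h3 (by rwa [hti α hα])
    (by rw [hti α hα, hcz]; exact not_le.1 hzβ)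
  rw [hti α hα, hcz] at h4
  rw [← hi h4]
  exact bigWord_mem_wordSet h2 h1 _

end SteepGroup

theorem main_theorem_torsionfree_case :
    ∃ (G : Type) (_ : Group G),
      Cardinal.mk G = Cardinal.aleph 1 ∧
      (∀ Y : Set G, ¬Y.Countable → ∃ n : ℕ, wordSet Y n = Set.univ) ∧
      IsSimpleGroup G ∧
      (∀ K : Subgroup G, IsCyclic K ∨ IsSimpleGroup K) ∧
      (∀ K : Subgroup G, ¬(∃ C : Subgroup G, IsCyclic C ∧ K < C) → Malnormal K) ∧
      (∀ g : G, g ≠ 1 → ¬IsOfFinOrder g) ∧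
      (¬∃ f : ℕ → Subgroup G, StrictAnti f ∧ ∀ n : ℕ, ¬IsCyclic (f n)) := by
  classical
  let Ω : Type := (Cardinal.aleph 1).ord.ToType
  have hΩ : Cardinal.mk Ω = Cardinal.aleph 1 := Cardinal.mk_ord_toType _
  have hc : ∀ a : Ω, (Set.Iio a).Countable := fun a => by
    rw [← Cardinal.le_aleph0_iff_set_countable, ← Cardinal.lt_aleph_one_iff]
    exact (Cardinal.mk_Iio_lt a (by rw [hΩ]; simp [Ω])).trans_eq hΩ
  have hu : ¬ (Set.univ : Set Ω).Countable := by
    rw [← Cardinal.le_aleph0_iff_set_countable, Cardinal.mk_univ, hΩ, not_le]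
    exact Cardinal.aleph0_lt_aleph_one
  have : Nonempty Ω := by
    by_contra hcon
    rw [not_nonempty_iff] at hcon
    exact hu Set.countable_univ
  obtain ⟨r⟩ : Nonempty (Ω ↪ (ℕ → Bool)) := by
    rw [← Cardinal.le_def, hΩ]
    simpa using Cardinal.aleph_one_le_continuum
  obtain ⟨c, hcol⟩ := SteepGroup.exists_colouring hc hu r r.injective
  obtain ⟨G, _, i, hi, htf, hr, ht⟩ := SteepGroup.exists_ranked hc
    (f := fun α x => if (c x.1 α).1 < α then c x.1 α else x) fun α x hx => by
      split_ifs with h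
      exacts [h, hx]
  have hG : Cardinal.mk G = Cardinal.aleph 1 := by
    rw [Cardinal.mk_congr (Equiv.ofBijective i hi), Cardinal.mk_prod, hΩ]
    simp [Cardinal.aleph0_le_aleph]
  have hsimple : ∀ K : Subgroup G, IsCyclic K ∨ IsSimpleGroup K := fun K =>
    or_iff_not_imp_left.2 hr.isSimpleGroup
  have hnc : ¬ IsCyclic (⊤ : Subgroup G) := by
    intro hcyc
    have : IsCyclic G := isCyclic_of_surjective _ Subgroup.topEquiv.surjective
    obtain ⟨g, hg⟩ := IsCyclic.exists_zpow_surjective (G := G)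
    have : Countable G := hg.countable
    have := Cardinal.mk_le_aleph0 (α := G)
    rw [hG] at this
    exact absurd Cardinal.aleph0_lt_aleph_one (not_lt.2 this)
  refine ⟨G, _, hG, ?_, ?_, hsimple, fun K => hr.malnormal_of_not_lt, htf, hr.not_strictAnti⟩
  · refine SteepGroup.exists_wordSet_eq_univ hc hi.injective hr hcol fun α hα => ?_
    obtain ⟨t, h1, h2⟩ := ht α hα
    grind
  · have := (hsimple ⊤).resolve_left hnc
    obtain ⟨g, -, hg⟩ := SteepGroup.exists_mem_ne_one hnc
    have : Nontrivial G := ⟨g, 1, hg⟩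
    exact IsSimpleGroup.isSimpleGroup_of_surjective
      (Subgroup.topEquiv (G := G)).toMonoidHom Subgroup.topEquiv.surjective
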